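/- Let d > 0 be a non-square integer and Γ = SL₂(ℤ[√d]). For γ ∈ Γ let γ̄ denote the matrix obtained by applying the Galois conjugation a + b√d ↦ a − b√d entrywise; both γ and γ̄ are viewed as elements of SL₂(ℝ) via the real embedding with √d > 0. Let Γ act on the upper half-plane ℍ = {z ∈ ℂ : Im z > 0} by fractional linear (Möbius) transformations through this embedding, and set Γ_t = {γ ∈ Γ : log(‖γ‖² + ‖γ̄‖²) ≤ t}, where ‖·‖ is the Frobenius norm on 2×2 real matrices. Let ν be the hyperbolic measure on ℍ with density 1/(Im z)² with respect to Lebesgue measure. Then there exist δ > 0 and c > 0 such that for every compact subset D ⊂ ℍ and every continuously differentiable φ : ℍ → ℝ with support contained in D there is a constant C = C(D,φ) such that for every x ∈ D and all t > 0: | e^{−t} Σ_{γ∈Γ_t} φ(γ · x) − c ∫_ℍ φ dν | ≤ C e^{−δt}. -/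

import Mathlib

open MeasureTheory Filter
open scoped ENNReal

noncomputable section

/-- The image in SL₂(ℝ) of a matrix γ ∈ SL₂(ℤ[√d]) under the real embedding of ℤ[√d]
with √d > 0. -/
def embMat (d : ℤ) (hd : 0 ≤ d) (γ : Matrix.SpecialLinearGroup (Fin 2) (Zsqrtd d)) :
    Matrix (Fin 2) (Fin 2) ℝ :=
  (γ : Matrix (Fin 2) (Fin 2) (Zsqrtd d)).map fun x => Zsqrtd.toReal hd x

/-- The Galois conjugate γ̄ of a matrix γ ∈ SL₂(ℤ[√d]): the Galois conjugation
a + b√d ↦ a − b√d is applied entrywise, followed by the real embedding. -/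
def conjMat (d : ℤ) (hd : 0 ≤ d) (γ : Matrix.SpecialLinearGroup (Fin 2) (Zsqrtd d)) :
    Matrix (Fin 2) (Fin 2) ℝ :=
  (γ : Matrix (Fin 2) (Fin 2) (Zsqrtd d)).map fun x => Zsqrtd.toReal hd (star x)

/-- The squared Frobenius norm ‖A‖² of a 2×2 real matrix. -/
def frobSq (A : Matrix (Fin 2) (Fin 2) ℝ) : ℝ :=
  ∑ i, ∑ j, (A i j) ^ 2

/-- The action of a real 2×2 matrix on the upper half-plane ℍ ⊆ ℂ by fractional linear
(Möbius) transformations. -/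
def moebius (A : Matrix (Fin 2) (Fin 2) ℝ) (z : ℂ) : ℂ :=
  ((A 0 0 : ℝ) * z + (A 0 1 : ℝ)) / ((A 1 0 : ℝ) * z + (A 1 1 : ℝ))

/-- The hyperbolic measure on the upper half-plane ℍ = {z ∈ ℂ : Im z > 0}, with density
1/(Im z)² with respect to Lebesgue measure. -/
def hypMeasure : Measure ℂ :=
  (volume.withDensity fun z : ℂ => ENNReal.ofReal (1 / z.im ^ 2)).restrict
    {z : ℂ | 0 < z.im}

namespace Equi
open scoped BigOperators
noncomputable section

/-! ### Section 1: the two real embeddings and box counting -/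

def e1 {d : ℤ} (a : ℤ√d) : ℝ := (a.re : ℝ) + (a.im : ℝ) * Real.sqrt d
def e2 {d : ℤ} (a : ℤ√d) : ℝ := (a.re : ℝ) - (a.im : ℝ) * Real.sqrt d

section basic
variable {d : ℤ}

@[simp] lemma e1_add (a b : ℤ√d) : e1 (a + b) = e1 a + e1 b := by
  simp only [e1, Zsqrtd.re_add, Zsqrtd.im_add]; push_cast; ring
@[simp] lemma e2_add (a b : ℤ√d) : e2 (a + b) = e2 a + e2 b := by
  simp only [e2, Zsqrtd.re_add, Zsqrtd.im_add]; push_cast; ring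
@[simp] lemma e1_sub (a b : ℤ√d) : e1 (a - b) = e1 a - e1 b := by
  simp only [e1, Zsqrtd.re_sub, Zsqrtd.im_sub]; push_cast; ring
@[simp] lemma e2_sub (a b : ℤ√d) : e2 (a - b) = e2 a - e2 b := by
  simp only [e2, Zsqrtd.re_sub, Zsqrtd.im_sub]; push_cast; ring
@[simp] lemma e1_neg (a : ℤ√d) : e1 (-a) = - e1 a := by
  simp only [e1, Zsqrtd.re_neg, Zsqrtd.im_neg]; push_cast; ring
@[simp] lemma e2_neg (a : ℤ√d) : e2 (-a) = - e2 a := by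
  simp only [e2, Zsqrtd.re_neg, Zsqrtd.im_neg]; push_cast; ring
@[simp] lemma e1_zero : e1 (0 : ℤ√d) = 0 := by simp [e1]
@[simp] lemma e2_zero : e2 (0 : ℤ√d) = 0 := by simp [e2]
@[simp] lemma e1_one : e1 (1 : ℤ√d) = 1 := by simp [e1]
@[simp] lemma e2_one : e2 (1 : ℤ√d) = 1 := by simp [e2]
@[simp] lemma e1_intCast (n : ℤ) : e1 (n : ℤ√d) = n := by simp [e1]
@[simp] lemma e2_intCast (n : ℤ) : e2 (n : ℤ√d) = n := by simp [e2]
@[simp] lemma e1_natCast (n : ℕ) : e1 (n : ℤ√d) = n := by simp [e1]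
@[simp] lemma e2_natCast (n : ℕ) : e2 (n : ℤ√d) = n := by simp [e2]

lemma sqd (hd : 0 < d) : Real.sqrt d * Real.sqrt d = d :=
  Real.mul_self_sqrt (by exact_mod_cast hd.le)

lemma e1_mul (hd : 0 < d) (a b : ℤ√d) : e1 (a * b) = e1 a * e1 b := by
  simp only [e1, Zsqrtd.re_mul, Zsqrtd.im_mul]; push_cast
  linear_combination (-(a.im : ℝ) * b.im) * sqd hd
lemma e2_mul (hd : 0 < d) (a b : ℤ√d) : e2 (a * b) = e2 a * e2 b := by
  simp only [e2, Zsqrtd.re_mul, Zsqrtd.im_mul]; push_cast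
  linear_combination (-(a.im : ℝ) * b.im) * sqd hd

lemma e1_mul_e2 (hd : 0 < d) (a : ℤ√d) : e1 a * e2 a = (a.norm : ℝ) := by
  simp only [e1, e2, Zsqrtd.norm]; push_cast
  linear_combination (-(a.im : ℝ) * a.im) * sqd hd

lemma sqrt_ge_one (hd : 0 < d) : 1 ≤ Real.sqrt d := by
  rw [Real.one_le_sqrt]; exact_mod_cast hd

lemma norm_ne_zero' (hn : ¬ IsSquare d) {a : ℤ√d} (ha : a ≠ 0) : a.norm ≠ 0 := by
  intro h
  apply ha
  exact (Zsqrtd.norm_eq_zero (by intro n hn'; exact hn ⟨n, hn'⟩) a).1 h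

lemma one_le_abs_mul (hd : 0 < d) (hn : ¬ IsSquare d) {a : ℤ√d} (ha : a ≠ 0) :
    1 ≤ |e1 a| * |e2 a| := by
  rw [← abs_mul, e1_mul_e2 hd]
  exact_mod_cast Int.one_le_abs (norm_ne_zero' hn ha)

lemma e1_ne_zero (hd : 0 < d) (hn : ¬ IsSquare d) {a : ℤ√d} (ha : a ≠ 0) : e1 a ≠ 0 := by
  intro h
  have := one_le_abs_mul hd hn ha
  rw [h] at this; simp at this; linarith

lemma e2_ne_zero (hd : 0 < d) (hn : ¬ IsSquare d) {a : ℤ√d} (ha : a ≠ 0) : e2 a ≠ 0 := by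
  intro h
  have := one_le_abs_mul hd hn ha
  rw [h] at this; simp at this; linarith

lemma mul_cancel (hn : ¬ IsSquare d) {a b c : ℤ√d} (hc : c ≠ 0) (h : c * a = c * b) : a = b := by
  have h1 : c * (a - b) = 0 := by rw [mul_sub, h, sub_self]
  have h2 : c.norm * (a - b).norm = 0 := by rw [← Zsqrtd.norm_mul, h1]; simp
  rcases mul_eq_zero.1 h2 with h3 | h3
  · exact absurd h3 (norm_ne_zero' hn hc)
  · by_contra h4
    exact norm_ne_zero' hn (sub_ne_zero.2 h4) h3

/-- units of any size. -/
lemma exists_unit (hd : 0 < d) (hn : ¬ IsSquare d) :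
    ∃ E : ℝ, 1 < E ∧ ∀ l : ℝ, 0 < l → ∃ u v : ℤ√d, u * v = 1 ∧ l ≤ e1 u ∧ e1 u ≤ E * l ∧
      e2 u = 1 / e1 u := by
  obtain ⟨p, hp1, hp2⟩ := Pell.Solution₁.exists_pos_of_not_isSquare hd hn
  set w : ℤ√d := ⟨p.x, p.y⟩ with hw
  set wi : ℤ√d := ⟨p.x, -p.y⟩ with hwi
  have hwwi : w * wi = 1 := by
    ext
    · simp only [hw, hwi, Zsqrtd.re_mul, Zsqrtd.re_one]
      have := p.prop
      linarith
    · simp only [hw, hwi, Zsqrtd.im_mul, Zsqrtd.im_one]; ring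
  have hx : (1 : ℝ) < p.x := by exact_mod_cast hp1
  have hy : (0 : ℝ) < p.y := by exact_mod_cast hp2
  have hE : 1 < e1 w := by
    have := sqrt_ge_one hd
    simp only [e1, hw]; nlinarith
  have hprod : e1 w * e1 wi = 1 := by rw [← e1_mul hd, hwwi, e1_one]
  have h2 : e2 w = e1 wi := by simp [e1, e2, hw, hwi]; ring
  have h2' : e2 wi = e1 w := by simp [e1, e2, hw, hwi]
  refine ⟨e1 w, hE, fun l hl => ?_⟩
  have key : ∀ n : ℕ, e1 (w ^ n) = e1 w ^ n ∧ e1 (wi ^ n) = e1 wi ^ n ∧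
      e2 (w ^ n) = e1 wi ^ n ∧ e2 (wi ^ n) = e1 w ^ n := by
    intro n
    induction n with
    | zero => simp
    | succ k ih =>
      simp only [pow_succ, e1_mul hd, e2_mul hd, ih, h2, h2', and_self]
  obtain ⟨n, hn1, hn2⟩ := exists_mem_Ioc_zpow hl hE
  have hw0 : e1 w ≠ 0 := by positivity
  have hinv : e1 wi = (e1 w)⁻¹ := eq_inv_of_mul_eq_one_right hprod
  have hle : e1 w ^ (n + 1) ≤ e1 w * l := by
    rw [zpow_add_one₀ hw0, mul_comm]; exact mul_le_mul_of_nonneg_left hn1.le (by linarith)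
  obtain ⟨m, hm | hm⟩ := Int.eq_nat_or_neg (n + 1)
  · have e : e1 (w ^ m) = e1 w ^ (n + 1) := by rw [(key m).1, hm]; simp
    refine ⟨w ^ m, wi ^ m, by rw [← mul_pow, hwwi, one_pow], ?_, ?_, ?_⟩
    · rw [e]; exact hn2
    · rw [e]; exact hle
    · rw [(key m).1, (key m).2.2.1, hinv]; simp
  · have e : e1 (wi ^ m) = e1 w ^ (n + 1) := by rw [(key m).2.1, hm, hinv]; simp
    refine ⟨wi ^ m, w ^ m, by rw [← mul_pow, mul_comm wi, hwwi, one_pow], ?_, ?_, ?_⟩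
    · rw [e]; exact hn2
    · rw [e]; exact hle
    · rw [(key m).2.1, (key m).2.2.2, hinv]; simp

lemma card_int_le (S : Finset ℤ) (p h : ℝ) (hh : 0 ≤ h) (hS : ∀ n ∈ S, |(n : ℝ) - p| ≤ h) :
    (S.card : ℝ) ≤ 2 * h + 1 := by
  have hsub : S ⊆ Finset.Icc ⌈p - h⌉ ⌊p + h⌋ := by
    intro n hn
    have := abs_le.1 (hS n hn)
    rw [Finset.mem_Icc, Int.ceil_le, Int.le_floor]
    constructor <;> linarith
  have h1 := Finset.card_le_card hsub
  rw [Int.card_Icc] at h1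
  have h2 : (S.card : ℝ) ≤ ((⌊p + h⌋ + 1 - ⌈p - h⌉).toNat : ℝ) := by exact_mod_cast h1
  refine h2.trans ?_
  rcases le_total 0 (⌊p + h⌋ + 1 - ⌈p - h⌉) with h3 | h3
  · have : (((⌊p + h⌋ + 1 - ⌈p - h⌉).toNat : ℤ) : ℝ) = ((⌊p + h⌋ + 1 - ⌈p - h⌉ : ℤ) : ℝ) := by
      rw [Int.toNat_of_nonneg h3]
    rw [Int.cast_natCast] at this
    rw [this]; push_cast
    linarith [Int.floor_le (p + h), Int.le_ceil (p - h)]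
  · rw [Int.toNat_of_nonpos h3]; simp; linarith

/-- counting lattice points in a strip. -/
lemma strip_count (hd : 0 < d) (hn : ¬ IsSquare d) :
    ∃ C : ℝ, 1 ≤ C ∧ ∀ (S : Finset (ℤ√d)) (p q α β : ℝ), 0 < α → 0 < β →
      (∀ a ∈ S, |e1 a - p| ≤ α ∧ |e2 a - q| ≤ β) → (S.card : ℝ) ≤ C * (1 + α * β) := by
  obtain ⟨E, hE, hu⟩ := exists_unit hd hn
  refine ⟨8 * E ^ 2 + 2, by nlinarith, fun S p q α β hα hβ hS => ?_⟩
  obtain ⟨u, v, huv, hu1, hu2, hu3⟩ := hu (Real.sqrt (β / α)) (Real.sqrt_pos.2 (by positivity))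
  set l := Real.sqrt (β / α) with hl
  have hlpos : 0 < l := Real.sqrt_pos.2 (by positivity)
  set s := Real.sqrt (α * β) with hs
  have hspos : 0 < s := Real.sqrt_pos.2 (by positivity)
  have hss : s * s = α * β := Real.mul_self_sqrt (by positivity)
  have hls : l * α = s := by
    rw [hl, hs, show α * β = (β / α) * (α * α) by field_simp, Real.sqrt_mul (by positivity),
      Real.sqrt_mul_self hα.le]
  have hsl : β = s * l := by
    have : s * l * α = s * s := by rw [mul_assoc, hls]
    have h3 : (s * l - β) * α = 0 := by rw [sub_mul, this, hss]; ring
    rcases mul_eq_zero.1 h3 with h4 | h4 <;> linarith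
  have hb : ∀ a ∈ S, |e1 (u * a) - e1 u * p| ≤ E * s ∧ |e2 (u * a) - e2 u * q| ≤ E * s := by
    intro a ha
    obtain ⟨h1, h2⟩ := hS a ha
    have hu0 : 0 < e1 u := lt_of_lt_of_le hlpos hu1
    constructor
    · rw [e1_mul hd, ← mul_sub, abs_mul, abs_of_pos hu0]
      calc e1 u * |e1 a - p| ≤ (E * l) * α := by gcongr
        _ = E * s := by rw [mul_assoc, hls]
    · rw [e2_mul hd, ← mul_sub, abs_mul, hu3, abs_of_pos (by positivity)]
      calc 1 / e1 u * |e2 a - q| ≤ 1 / l * β := by gcongr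
        _ = s := by rw [hsl]; field_simp
        _ ≤ E * s := by nlinarith
  have hinj : Function.Injective (fun a : ℤ√d => u * a) := by
    intro a b hab
    have : v * (u * a) = v * (u * b) := by simp only at hab; rw [hab]
    rwa [← mul_assoc, ← mul_assoc, mul_comm v u, huv, one_mul, one_mul] at this
  set I1 := S.image (fun a => (u * a).re)
  set I2 := S.image (fun a => (u * a).im)
  have hcard : S.card ≤ I1.card * I2.card := by
    rw [← Finset.card_product]
    refine Finset.card_le_card_of_injOn (fun a => ((u * a).re, (u * a).im)) ?_ ?_
    · intro a ha
      simp only [Finset.mem_coe, Finset.mem_product]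
      exact ⟨Finset.mem_image_of_mem _ ha, Finset.mem_image_of_mem _ ha⟩
    · intro a _ b _ hab
      simp only [Prod.mk.injEq] at hab
      exact hinj (Zsqrtd.ext hab.1 hab.2)
  have hEs : 0 ≤ E * s := by positivity
  have c1 : (I1.card : ℝ) ≤ 2 * (E * s) + 1 := by
    refine card_int_le _ ((e1 u * p + e2 u * q) / 2) _ hEs ?_
    intro n hn
    obtain ⟨a, ha, rfl⟩ := Finset.mem_image.1 hn
    obtain ⟨h1, h2⟩ := hb a ha
    have : ((u * a).re : ℝ) = (e1 (u * a) + e2 (u * a)) / 2 := by simp only [e1, e2]; ring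
    rw [this]
    rw [abs_le] at *
    constructor <;> linarith
  have c2 : (I2.card : ℝ) ≤ 2 * (E * s) + 1 := by
    refine card_int_le _ ((e1 u * p - e2 u * q) / (2 * Real.sqrt d)) _ hEs ?_
    intro n hn
    obtain ⟨a, ha, rfl⟩ := Finset.mem_image.1 hn
    obtain ⟨h1, h2⟩ := hb a ha
    have hsd := sqrt_ge_one hd
    have : ((u * a).im : ℝ) = (e1 (u * a) - e2 (u * a)) / (2 * Real.sqrt d) := by
      simp only [e1, e2]; field_simp; ring
    have h2d : 0 < 2 * Real.sqrt d := by linarith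
    rw [this, ← sub_div, abs_div, abs_of_pos h2d, div_le_iff₀ h2d]
    have h4 : |e1 (u * a) - e2 (u * a) - (e1 u * p - e2 u * q)| ≤ 2 * (E * s) := by
      rw [abs_le] at *
      constructor <;> linarith
    nlinarith
  have : (S.card : ℝ) ≤ (I1.card : ℝ) * I2.card := by exact_mod_cast hcard
  have h5 : (I1.card : ℝ) * I2.card ≤ (2 * (E * s) + 1) * (2 * (E * s) + 1) :=
    mul_le_mul c1 c2 (Nat.cast_nonneg _) (by linarith)
  have h6 : (2 * (E * s) + 1) * (2 * (E * s) + 1) ≤ 8 * E ^ 2 * (s * s) + 2 := by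
    nlinarith [sq_nonneg (2 * (E * s) - 1)]
  rw [hss] at h6
  have : 0 ≤ α * β := by positivity
  nlinarith [sq_nonneg E]

/-- the finite box `|e1 a| ≤ α`, `|e2 a| ≤ β`. -/
def bx (d : ℤ) (α β : ℝ) : Finset (ℤ√d) := by
  classical
  exact (((Finset.Icc (-⌈α + β⌉) ⌈α + β⌉ ×ˢ Finset.Icc (-⌈α + β⌉) ⌈α + β⌉)).image
    (fun p : ℤ × ℤ => (⟨p.1, p.2⟩ : ℤ√d))).filter (fun a => |e1 a| ≤ α ∧ |e2 a| ≤ β)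

lemma mem_bx (hd : 0 < d) {α β : ℝ} {a : ℤ√d} : a ∈ bx d α β ↔ |e1 a| ≤ α ∧ |e2 a| ≤ β := by
  classical
  unfold bx
  rw [Finset.mem_filter, and_iff_right_iff_imp]
  rintro ⟨h1, h2⟩
  rw [Finset.mem_image]
  refine ⟨(a.re, a.im), ?_, rfl⟩
  have hre : (a.re : ℝ) = (e1 a + e2 a) / 2 := by simp only [e1, e2]; ring
  have him : (a.im : ℝ) * Real.sqrt d = (e1 a - e2 a) / 2 := by simp only [e1, e2]; ring
  have hs := sqrt_ge_one hd
  have h3 : |(a.im : ℝ)| ≤ |e1 a - e2 a| / 2 := by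
    have : |(a.im : ℝ) * Real.sqrt d| = |e1 a - e2 a| / 2 := by rw [him, abs_div]; norm_num
    rw [abs_mul, abs_of_pos (a := Real.sqrt d) (by linarith)] at this
    nlinarith [abs_nonneg (a.im : ℝ)]
  have h4 : |e1 a - e2 a| ≤ α + β := (abs_sub _ _).trans (by linarith)
  have h5 := abs_le.1 h1
  have h6 := abs_le.1 h2
  have h7 := abs_le.1 h3
  have hc := Int.le_ceil (α + β)
  have h0 : 0 ≤ α + β := by linarith [abs_nonneg (e1 a), abs_nonneg (e2 a)]
  simp only [Finset.mem_product, Finset.mem_Icc]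
  refine ⟨⟨?_, ?_⟩, ?_, ?_⟩
  all_goals
    have : ∀ x y : ℤ, (x : ℝ) ≤ y → x ≤ y := fun x y h => by exact_mod_cast h
    apply this; push_cast; linarith

lemma bx_card (hd : 0 < d) (hn : ¬ IsSquare d) :
    ∃ C : ℝ, 1 ≤ C ∧ ∀ α β : ℝ, 0 < α → 0 < β → ((bx d α β).card : ℝ) ≤ C * (1 + α * β) := by
  obtain ⟨C, hC, h⟩ := strip_count hd hn
  refine ⟨C, hC, fun α β hα hβ => h _ 0 0 α β hα hβ ?_⟩
  intro a ha
  simpa using (mem_bx hd).1 ha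

end basic
end
end Equi

namespace Equi
open scoped BigOperators ComplexConjugate
noncomputable section
set_option linter.unusedSectionVars false
set_option linter.unusedDecidableInType false
set_option linter.unusedFintypeInType false

/-! ### Section 2: finite Fourier analysis and Kloosterman sums over a finite ring -/

section fourier
variable {G : Type*} [AddCommGroup G] [Fintype G] [DecidableEq G]

/-- exponential sum of a finite family of points. -/
def fhat {I : Type*} [Fintype I] (g : I → G) (χ : AddChar G ℂ) : ℂ := ∑ i, χ (g i)

lemma fhat_norm_le {I : Type*} [Fintype I] (g : I → G) (χ : AddChar G ℂ) :
    ‖fhat g χ‖ ≤ Fintype.card I := by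
  unfold fhat
  refine (norm_sum_le _ _).trans ?_
  simp

lemma fhat_conj {I : Type*} [Fintype I] (g : I → G) (χ : AddChar G ℂ) :
    conj (fhat g χ) = ∑ i, χ (-g i) := by
  unfold fhat
  rw [map_sum]
  refine Finset.sum_congr rfl fun i _ => ?_
  rw [AddChar.map_neg_eq_conj]

lemma second_moment {I : Type*} [Fintype I] [DecidableEq I] (g : I → G) :
    ∑ χ : AddChar G ℂ, ‖fhat g χ‖ ^ 2 =
      (Fintype.card G : ℝ) * ((Finset.univ.filter fun p : I × I => g p.1 = g p.2).card : ℝ) := by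
  have h : ((∑ χ : AddChar G ℂ, ‖fhat g χ‖ ^ 2 : ℝ) : ℂ) =
      ((Fintype.card G : ℝ) *
        ((Finset.univ.filter fun p : I × I => g p.1 = g p.2).card : ℝ) : ℝ) := by
    push_cast
    have h1 : ∀ χ : AddChar G ℂ, ((‖fhat g χ‖ : ℂ)) ^ 2 = ∑ p : I × I, χ (g p.1 - g p.2) := by
      intro χ
      rw [← Complex.mul_conj', fhat_conj, fhat, Finset.sum_mul_sum, Fintype.sum_prod_type]
      refine Finset.sum_congr rfl fun i _ => Finset.sum_congr rfl fun j _ => ?_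
      rw [sub_eq_add_neg, AddChar.map_add_eq_mul]
    rw [Finset.sum_congr rfl fun χ _ => h1 χ, Finset.sum_comm]
    simp_rw [AddChar.sum_apply_eq_ite, sub_eq_zero]
    rw [Finset.sum_ite, Finset.sum_const_zero, add_zero, Finset.sum_const, nsmul_eq_mul, mul_comm]
  exact_mod_cast h

def dl {B : Type*} (b : B → G) (q : B × B × B × B) : G := b q.1 + b q.2.1 - b q.2.2.1 - b q.2.2.2

lemma fhat_dl {B : Type*} [Fintype B] (b : B → G) (χ : AddChar G ℂ) :
    ‖∑ q : B × B × B × B, χ (dl b q)‖ = ‖fhat b χ‖ ^ 4 := by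
  have : ∑ q : B × B × B × B, χ (dl b q)
      = fhat b χ * (fhat b χ * (conj (fhat b χ) * conj (fhat b χ))) := by
    rw [fhat_conj, fhat]
    simp only [Fintype.sum_prod_type, dl, sub_eq_add_neg, AddChar.map_add_eq_mul]
    simp only [← Finset.mul_sum, ← Finset.sum_mul]
    ring
  rw [this]
  simp only [norm_mul, RCLike.norm_conj]
  ring

/-- the number of solutions of `g r = y + δ q`. -/
def nsol {P B : Type*} [Fintype P] [Fintype B] (g : P → G) (b : B → G) (y : G) : ℕ :=
  (Finset.univ.filter fun p : P × (B × B × B × B) => g p.1 = y + dl b p.2).card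

lemma nsol_fourier {P B : Type*} [Fintype P] [Fintype B] (g : P → G) (b : B → G) (y : G) :
    (Fintype.card G : ℂ) * (nsol g b y : ℂ) = ∑ χ : AddChar G ℂ,
      χ y * (∑ q : B × B × B × B, χ (dl b q)) * conj (fhat g χ) := by
  have h1 : ∀ χ : AddChar G ℂ, χ y * (∑ q : B × B × B × B, χ (dl b q)) * conj (fhat g χ) =
      ∑ p : P × (B × B × B × B), χ (y + dl b p.2 - g p.1) := by
    intro χ
    rw [fhat_conj, Fintype.sum_prod_type
      (f := fun p : P × (B × B × B × B) => χ (y + dl b p.2 - g p.1)), Finset.mul_sum]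
    refine Finset.sum_congr rfl fun r _ => ?_
    rw [Finset.mul_sum, Finset.sum_mul]
    refine Finset.sum_congr rfl fun q _ => ?_
    rw [sub_eq_add_neg, AddChar.map_add_eq_mul, AddChar.map_add_eq_mul]
  rw [Finset.sum_congr rfl fun χ _ => h1 χ, Finset.sum_comm]
  simp_rw [AddChar.sum_apply_eq_ite, sub_eq_zero]
  rw [Finset.sum_ite, Finset.sum_const_zero, add_zero, Finset.sum_const, nsmul_eq_mul, mul_comm,
    nsol]
  congr 4
  ext p
  simp [eq_comm]

lemma nsol_bound {P B : Type*} [Fintype P] [Fintype B] [DecidableEq B] (g : P → G) (b : B → G)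
    (hb : Function.Injective b) (y : G) (Sb β : ℝ) (hS : 0 ≤ Sb) (hβ : 0 ≤ β)
    (h : ∀ χ : AddChar G ℂ, χ ≠ 0 → ‖fhat g χ‖ ≤ Sb ∨ ‖fhat b χ‖ ^ 2 ≤ β) :
    |(nsol g b y : ℝ) - (Fintype.card P : ℝ) * (Fintype.card B : ℝ) ^ 4 / Fintype.card G| ≤
      Sb * (Fintype.card B : ℝ) ^ 3 + β * Fintype.card P * Fintype.card B := by
  classical
  have hGpos : (0 : ℝ) < Fintype.card G := by exact_mod_cast Fintype.card_pos
  have hN := nsol_fourier g b y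
  have hpars : ∑ χ : AddChar G ℂ, ‖fhat b χ‖ ^ 2 = (Fintype.card G : ℝ) * Fintype.card B := by
    rw [second_moment]
    congr 2
    have : (Finset.univ.filter fun p : B × B => b p.1 = b p.2) = Finset.univ.image
        (fun x : B => (x, x)) := by
      ext ⟨x, y⟩
      simp only [Finset.mem_filter, Finset.mem_univ, true_and, Finset.mem_image, Prod.mk.injEq,
        exists_eq_left]
      exact ⟨fun h => hb h, fun h => by rw [h]⟩
    rw [this, Finset.card_image_of_injective _ (fun a c hac => (Prod.mk.inj hac).1),
      Finset.card_univ]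
  rw [← Finset.add_sum_erase _ _ (Finset.mem_univ (0 : AddChar G ℂ))] at hN
  have h0 : (0 : AddChar G ℂ) y * (∑ q : B × B × B × B, (0 : AddChar G ℂ) (dl b q)) *
      conj (fhat g 0) = (Fintype.card P : ℂ) * (Fintype.card B : ℂ) ^ 4 := by
    simp [fhat, Fintype.card_prod]; ring
  rw [h0] at hN
  set Rm := ∑ χ ∈ Finset.univ.erase (0 : AddChar G ℂ),
      χ y * (∑ q : B × B × B × B, χ (dl b q)) * conj (fhat g χ) with hRm
  have hR : ‖Rm‖ ≤ Fintype.card G * (Sb * (Fintype.card B : ℝ) ^ 3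
      + β * Fintype.card P * Fintype.card B) := by
    calc ‖Rm‖ ≤ ∑ χ ∈ Finset.univ.erase (0 : AddChar G ℂ),
          ‖fhat b χ‖ ^ 2 * (Sb * (Fintype.card B : ℝ) ^ 2 + β * Fintype.card P) := by
          refine norm_sum_le_of_le _ fun χ hχ => ?_
          rw [norm_mul, norm_mul, fhat_dl, RCLike.norm_conj, AddChar.norm_apply, one_mul]
          have hb1 := fhat_norm_le b χ
          have hg1 := fhat_norm_le g χ
          have hb0 := norm_nonneg (fhat b χ)
          have hg0 := norm_nonneg (fhat g χ)
          have e : ‖fhat b χ‖ ^ 4 * ‖fhat g χ‖ = ‖fhat b χ‖ ^ 2 * (‖fhat g χ‖ * ‖fhat b χ‖ ^ 2) := by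
            ring
          rw [e]
          refine mul_le_mul_of_nonneg_left ?_ (by positivity)
          rcases h χ (Finset.ne_of_mem_erase hχ) with h1 | h1
          · have : ‖fhat g χ‖ * ‖fhat b χ‖ ^ 2 ≤ Sb * (Fintype.card B : ℝ) ^ 2 := by gcongr
            have : 0 ≤ β * Fintype.card P := by positivity
            linarith
          · have : ‖fhat g χ‖ * ‖fhat b χ‖ ^ 2 ≤ (Fintype.card P) * β := by gcongr
            have : 0 ≤ Sb * (Fintype.card B : ℝ) ^ 2 := by positivity
            linarith
      _ ≤ ∑ χ : AddChar G ℂ,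
          ‖fhat b χ‖ ^ 2 * (Sb * (Fintype.card B : ℝ) ^ 2 + β * Fintype.card P) := by
          refine Finset.sum_le_sum_of_subset_of_nonneg (Finset.erase_subset _ _) ?_
          intro χ _ _; positivity
      _ = _ := by rw [← Finset.sum_mul, hpars]; ring
  have hkey : (Fintype.card G : ℝ) * |(nsol g b y : ℝ) -
      (Fintype.card P : ℝ) * (Fintype.card B : ℝ) ^ 4 / Fintype.card G| = ‖Rm‖ := by
    have : Rm = (((Fintype.card G : ℝ) * ((nsol g b y : ℝ) -
      (Fintype.card P : ℝ) * (Fintype.card B : ℝ) ^ 4 / Fintype.card G) : ℝ) : ℂ) := by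
      rw [mul_sub, mul_div_cancel₀ _ hGpos.ne']
      push_cast
      rw [hN]; ring
    rw [this, Complex.norm_real, Real.norm_eq_abs, abs_mul, abs_of_pos hGpos]
  rw [← hkey] at hR
  exact le_of_mul_le_mul_left hR hGpos

end fourier

section kloos
variable {A : Type*} [CommRing A] [Fintype A] [DecidableEq A]

def gk (r : Aˣ) : A × A := ((r : A), ((r⁻¹ : Aˣ) : A))

/-- number of triples with vanishing product -/
def trip (A : Type*) [CommRing A] [Fintype A] [DecidableEq A] : ℕ :=
  (Finset.univ.filter fun p : A × A × A =>
    (p.1 + p.2.1) * ((p.2.2 - p.1) * (p.2.2 - p.2.1)) = 0).card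

lemma fourth_moment : ∑ χ : AddChar (A × A) ℂ, ‖fhat (gk (A := A)) χ‖ ^ 4 ≤
    (Fintype.card A : ℝ) ^ 2 * trip A := by
  have h := second_moment (G := A × A) (fun r : Aˣ × Aˣ => gk r.1 + gk r.2)
  have e : ∀ χ : AddChar (A × A) ℂ,
      fhat (fun r : Aˣ × Aˣ => gk r.1 + gk r.2) χ = (fhat (gk (A := A)) χ) ^ 2 := by
    intro χ
    rw [fhat, fhat, sq, Finset.sum_mul_sum, Fintype.sum_prod_type]
    simp only [AddChar.map_add_eq_mul]
  simp_rw [e, norm_pow, ← pow_mul] at h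
  norm_num at h
  rw [h, sq]
  refine mul_le_mul_of_nonneg_left ?_ (by positivity)
  unfold trip
  norm_cast
  refine Finset.card_le_card_of_injOn
    (fun p : (Aˣ × Aˣ) × (Aˣ × Aˣ) => ((p.1.1 : A), (p.1.2 : A), (p.2.1 : A))) ?_ ?_
  · rintro ⟨⟨r1, r2⟩, ⟨r3, r4⟩⟩ hp
    simp only [gk, Finset.coe_filter, Finset.mem_univ, true_and, Set.mem_ofPred_eq, Prod.mk_add_mk,
      Prod.mk.injEq] at hp
    obtain ⟨h1, h2⟩ := hp
    simp only [Finset.coe_filter, Finset.mem_univ, true_and, Set.mem_ofPred_eq]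
    have i1 := r1.mul_inv
    have i2 := r2.mul_inv
    have i3 := r3.mul_inv
    have i4 := r4.mul_inv
    set a := (r1 : A)
    set b := (r2 : A)
    set c := (r3 : A)
    set d := (r4 : A)
    set a' := ((r1⁻¹ : Aˣ) : A)
    set b' := ((r2⁻¹ : Aˣ) : A)
    set c' := ((r3⁻¹ : Aˣ) : A)
    set d' := ((r4⁻¹ : Aˣ) : A)
    have hd : d = a + b - c := by linear_combination -h1
    have h3 : (a + b) * (c * d) = (c + d) * (a * b) := by
      linear_combination (a * b * c * d) * h2 - b * c * d * i1 - a * c * d * i2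
        + a * b * d * i3 + a * b * c * i4
    rw [hd] at h3
    linear_combination -h3
  · rintro ⟨⟨r1, r2⟩, ⟨r3, r4⟩⟩ hp ⟨⟨s1, s2⟩, ⟨s3, s4⟩⟩ hq heq
    simp only [gk, Finset.coe_filter, Finset.mem_univ, true_and, Set.mem_ofPred_eq, Prod.mk_add_mk,
      Prod.mk.injEq] at hp hq heq
    obtain ⟨q1, q2, q3⟩ := heq
    have q4 : (r4 : A) = s4 := by linear_combination -hp.1 + hq.1 + q1 + q2 - q3
    rw [Units.ext q1, Units.ext q2, Units.ext q3, Units.ext q4]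

def actHom (u : Aˣ) : A × A →+ A × A where
  toFun x := ((u : A) * x.1, ((u⁻¹ : Aˣ) : A) * x.2)
  map_zero' := by simp
  map_add' x y := by simp [mul_add]

def act (u : Aˣ) (χ : AddChar (A × A) ℂ) : AddChar (A × A) ℂ := χ.compAddMonoidHom (actHom u)

lemma act_apply (u : Aˣ) (χ : AddChar (A × A) ℂ) (x : A × A) :
    act u χ x = χ ((u : A) * x.1, ((u⁻¹ : Aˣ) : A) * x.2) := rfl

lemma fhat_act (u : Aˣ) (χ : AddChar (A × A) ℂ) : fhat gk (act u χ) = fhat gk χ := by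
  unfold fhat
  refine Fintype.sum_equiv (Equiv.mulLeft u) _ _ fun r => ?_
  rw [act_apply]
  simp only [gk, Equiv.coe_mulLeft, mul_inv_rev, Units.val_mul]
  rw [mul_comm (((u⁻¹ : Aˣ)) : A)]

def stab (χ : AddChar (A × A) ℂ) : Finset Aˣ := by
  classical exact Finset.univ.filter fun u => act u χ = χ

lemma mem_stab {χ : AddChar (A × A) ℂ} {u : Aˣ} : u ∈ stab χ ↔ act u χ = χ := by
  classical simp [stab]

lemma fhat_stab (χ : AddChar (A × A) ℂ) :
    ‖fhat gk χ‖ ^ 4 * (Fintype.card Aˣ : ℝ) ≤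
      (stab χ).card * ((Fintype.card A : ℝ) ^ 2 * trip A) := by
  classical
  calc ‖fhat gk χ‖ ^ 4 * (Fintype.card Aˣ : ℝ) = ∑ u : Aˣ, ‖fhat gk (act u χ)‖ ^ 4 := by
        simp_rw [fhat_act]; simp [mul_comm]
    _ = ∑ ψ ∈ Finset.univ.image (fun u : Aˣ => act u χ),
          ((Finset.univ.filter fun u : Aˣ => act u χ = ψ).card) • ‖fhat gk ψ‖ ^ 4 :=
        Finset.sum_comp (fun ψ => ‖fhat gk ψ‖ ^ 4) (fun u : Aˣ => act u χ)
    _ ≤ ∑ ψ ∈ Finset.univ.image (fun u : Aˣ => act u χ), (stab χ).card * ‖fhat gk ψ‖ ^ 4 := by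
        refine Finset.sum_le_sum fun ψ hψ => ?_
        rw [nsmul_eq_mul]
        refine mul_le_mul_of_nonneg_right ?_ (by positivity)
        obtain ⟨u0, -, rfl⟩ := Finset.mem_image.1 hψ
        norm_cast
        refine Finset.card_le_card_of_injOn (fun u => u0⁻¹ * u) ?_ ?_
        · intro u hu
          have hu' : act u χ = act u0 χ := by simpa using hu
          rw [Finset.mem_coe, mem_stab]
          ext x
          have h1 := DFunLike.congr_fun hu' (((u0⁻¹ : Aˣ) : A) * x.1, (u0 : A) * x.2)
          rw [act_apply, act_apply] at h1
          rw [act_apply]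
          simp only [Units.mul_inv_cancel_left, Units.inv_mul_cancel_left] at h1
          rw [← h1]
          congr 1
          simp only [Units.val_mul, mul_inv_rev, inv_inv]
          ext <;> simp <;> ring
        · intro a _ b _ hab; simpa using hab
    _ ≤ ∑ ψ : AddChar (A × A) ℂ, (stab χ).card * ‖fhat gk ψ‖ ^ 4 :=
        Finset.sum_le_sum_of_subset_of_nonneg (Finset.subset_univ _) (fun _ _ _ => by positivity)
    _ ≤ _ := by
        rw [← Finset.mul_sum]
        exact mul_le_mul_of_nonneg_left fourth_moment (by positivity)

lemma fhat_fifth (χ : AddChar (A × A) ℂ) (K : ℝ) (hK : ((stab χ).card : ℝ) ≤ K) :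
    ‖fhat gk χ‖ ^ 5 ≤ K * ((Fintype.card A : ℝ) ^ 2 * trip A) := by
  have h1 := fhat_stab χ
  have h2 := fhat_norm_le gk χ
  calc ‖fhat gk χ‖ ^ 5 = ‖fhat gk χ‖ ^ 4 * ‖fhat gk χ‖ := by ring
    _ ≤ ‖fhat gk χ‖ ^ 4 * (Fintype.card Aˣ : ℝ) := by gcongr
    _ ≤ _ := h1
    _ ≤ _ := by gcongr

end kloos
end
end Equi

namespace Equi
open scoped BigOperators ComplexConjugate
noncomputable section
set_option linter.unusedSectionVars false
set_option linter.unusedDecidableInType false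
set_option linter.unusedFintypeInType false

/-! ### Section 3: divisor bound, size of the quotient ring, counting in fibres -/

lemma exists_pow_le_two_pow (k : ℕ) : ∃ D : ℕ, 1 ≤ D ∧ ∀ v : ℕ, (v + 1) ^ k ≤ D * 2 ^ v := by
  have h := (tendsto_pow_const_div_const_pow_of_one_lt k (r := (2 : ℝ)) (by norm_num)).bddAbove_range
  obtain ⟨B, hB⟩ := h
  obtain ⟨D, hD⟩ := exists_nat_ge (2 * B)
  refine ⟨D + 1, by omega, fun v => ?_⟩
  have h1 : ((v + 1 : ℕ) : ℝ) ^ k / 2 ^ (v + 1) ≤ B := hB ⟨v + 1, rfl⟩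
  rw [div_le_iff₀ (by positivity)] at h1
  have h2 : (((v + 1) ^ k : ℕ) : ℝ) ≤ (((D + 1) * 2 ^ v : ℕ) : ℝ) := by
    push_cast at h1 ⊢
    have : (0 : ℝ) < 2 ^ v := by positivity
    rw [pow_succ] at h1
    nlinarith
  exact_mod_cast h2

lemma divisor_bound (k : ℕ) : ∃ C : ℕ, 1 ≤ C ∧ ∀ n : ℕ, 1 ≤ n → (n.divisors.card) ^ k ≤ C * n := by
  obtain ⟨D, hD1, hD⟩ := exists_pow_le_two_pow k
  refine ⟨D ^ (2 ^ k), Nat.one_le_pow _ _ hD1, fun n hn => ?_⟩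
  have hn0 : n ≠ 0 := by omega
  have hfac : n = ∏ p ∈ n.primeFactors, p ^ n.factorization p := by
    conv_lhs => rw [← Nat.prod_factorization_pow_eq_self hn0]
    rfl
  rw [Nat.card_divisors hn0, ← Finset.prod_pow]
  calc ∏ p ∈ n.primeFactors, (n.factorization p + 1) ^ k
      ≤ ∏ p ∈ n.primeFactors, ((if p < 2 ^ k then D else 1) * p ^ n.factorization p) := by
        refine Finset.prod_le_prod' fun p hp => ?_
        have hp2 : 2 ≤ p := (Nat.prime_of_mem_primeFactors hp).two_le
        split_ifs with h
        · exact (hD _).trans (Nat.mul_le_mul_left _ (Nat.pow_le_pow_left hp2 _))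
        · rw [one_mul]
          push Not at h
          calc (n.factorization p + 1) ^ k ≤ (2 ^ n.factorization p) ^ k :=
                Nat.pow_le_pow_left (Nat.lt_two_pow_self) _
            _ = (2 ^ k) ^ n.factorization p := by rw [← pow_mul, ← pow_mul, mul_comm]
            _ ≤ _ := Nat.pow_le_pow_left h _
    _ = (∏ p ∈ n.primeFactors, (if p < 2 ^ k then D else 1)) * n := by
        rw [Finset.prod_mul_distrib, ← hfac]
    _ ≤ _ := by
        refine Nat.mul_le_mul_right _ ?_
        rw [Finset.prod_ite, Finset.prod_const, Finset.prod_const_one, mul_one]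
        refine Nat.pow_le_pow_right hD1 ?_
        calc _ ≤ (Finset.range (2 ^ k)).card := by
              refine Finset.card_le_card fun p hp => ?_
              rw [Finset.mem_filter] at hp
              exact Finset.mem_range.2 hp.2
          _ = _ := Finset.card_range _

/-- real form of the divisor bound -/
lemma divisor_bound_real (k : ℕ) (hk : 1 ≤ k) : ∃ C : ℝ, 1 ≤ C ∧ ∀ n : ℕ, 1 ≤ n →
    (n.divisors.card : ℝ) ≤ C * (n : ℝ) ^ (1 / k : ℝ) := by
  obtain ⟨C, hC, h⟩ := divisor_bound k
  refine ⟨C, by exact_mod_cast hC, fun n hn => ?_⟩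
  have h1 : ((n.divisors.card : ℝ)) ^ k ≤ (C : ℝ) * n := by exact_mod_cast h n hn
  have hk0 : (k : ℝ) ≠ 0 := by positivity
  have hC' : (1 : ℝ) ≤ C := by exact_mod_cast hC
  have h2 : (C : ℝ) * n ≤ ((C : ℝ) * (n : ℝ) ^ (1 / k : ℝ)) ^ k := by
    rw [mul_pow, ← Real.rpow_natCast ((n : ℝ) ^ (1 / k : ℝ)), ← Real.rpow_mul (by positivity),
      one_div_mul_cancel hk0, Real.rpow_one]
    gcongr
    exact le_self_pow₀ hC' (by omega)
  exact le_of_pow_le_pow_left₀ (by omega) (by positivity) (h1.trans h2)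

lemma surj_count {G H : Type*} [AddGroup G] [AddGroup H] [Fintype G] [Fintype H] [DecidableEq H]
    (f : G →+ H) (hf : Function.Surjective f) (P : H → Prop) [DecidablePred P] :
    (Finset.univ.filter fun x : G => P (f x)).card * Fintype.card H =
      Fintype.card G * (Finset.univ.filter fun y : H => P y).card := by
  classical
  set F := (Finset.univ.filter fun x : G => f x = 0).card with hF
  have hfib : ∀ y : H, (Finset.univ.filter fun x : G => f x = y).card = F := by
    intro y
    have := AddMonoidHom.card_fiber_eq_of_mem_range f (x := y) (y := 0) (hf y) (hf 0)
    simpa using this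
  have h1 : (Finset.univ.filter fun x : G => P (f x)).card =
      (Finset.univ.filter fun y : H => P y).card * F := by
    rw [Finset.card_eq_sum_card_fiberwise (f := f) (t := Finset.univ.filter fun y : H => P y)]
    · rw [Finset.sum_congr rfl (g := fun _ => F), Finset.sum_const, smul_eq_mul]
      intro y hy
      rw [← hfib y]
      congr 1
      ext x
      simp only [Finset.mem_filter, Finset.mem_univ, true_and] at hy ⊢
      constructor
      · exact fun h => h.2
      · rintro rfl; exact ⟨hy, rfl⟩
    · intro x hx
      simpa using hx
  have h2 : Fintype.card G = Fintype.card H * F := by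
    rw [← Finset.card_univ, Finset.card_eq_sum_card_fiberwise (f := f) (t := Finset.univ)]
    · simp [hfib]
    · intro x _; simp
  rw [h1, h2]; ring

section quot
variable {d : ℤ}

def zequiv (d : ℤ) : ℤ√d ≃ₗ[ℤ] (Fin 2 → ℤ) where
  toFun a := ![a.re, a.im]
  map_add' a b := by ext i; fin_cases i <;> simp
  map_smul' n a := by ext i; fin_cases i <;> simp
  invFun v := ⟨v 0, v 1⟩
  left_inv a := by simp
  right_inv v := by ext i; fin_cases i <;> simp

def zbasis (d : ℤ) : Module.Basis (Fin 2) ℤ (ℤ√d) := Module.Basis.ofEquivFun (zequiv d)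

abbrev Aq (c : ℤ√d) : Type := ℤ√d ⧸ Ideal.span {c}

lemma card_quot (hn : ¬ IsSquare d) {c : ℤ√d} (hc : c ≠ 0) :
    Nat.card (Aq c) = c.norm.natAbs := by
  have hfree : Module.Free ℤ (ℤ√d) := Module.Free.of_basis (zbasis d)
  have hfin : Module.Finite ℤ (ℤ√d) := Module.Finite.of_basis (zbasis d)
  set I := (Ideal.span {c}).restrictScalars ℤ with hI
  have hmem : ∀ a : ℤ√d, c * a ∈ I := fun a => by
    rw [hI, Submodule.restrictScalars_mem]
    exact Ideal.mem_span_singleton'.2 ⟨a, mul_comm _ _⟩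
  let f : ℤ√d →+ I :=
    { toFun := fun a => ⟨c * a, hmem a⟩
      map_zero' := by ext <;> simp
      map_add' := fun a b => by ext <;> simp [mul_add] }
  have hf : Function.Bijective f := by
    constructor
    · intro a b hab
      exact mul_cancel hn hc (Subtype.ext_iff.1 hab)
    · rintro ⟨x, hx⟩
      rw [hI, Submodule.restrictScalars_mem] at hx
      obtain ⟨a, ha⟩ := Ideal.mem_span_singleton'.1 hx
      exact ⟨a, Subtype.ext ((mul_comm c a).trans ha)⟩
  have h := Submodule.natAbs_det_equiv I (AddEquiv.ofBijective f hf)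
  have h2 : Nat.card (Aq c) = Nat.card (ℤ√d ⧸ I) := rfl
  rw [h2, ← h]
  congr 1
  rw [← LinearMap.det_toMatrix (zbasis d), Matrix.det_fin_two]
  simp only [LinearMap.toMatrix_apply]
  have hb0 : zbasis d 0 = 1 := by
    simp [zbasis, Module.Basis.coe_ofEquivFun, zequiv]; rfl
  have hb1 : zbasis d 1 = ⟨0, 1⟩ := by
    simp [zbasis, Module.Basis.coe_ofEquivFun, zequiv]
  have hr : ∀ x i, (zbasis d).repr x i = ![x.re, x.im] i := by
    intro x i
    rw [zbasis, Module.Basis.ofEquivFun_repr_apply]; rfl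
  simp only [hr, hb0, hb1]
  have e : ∀ a, ((I.subtype ∘ₗ AddMonoidHom.toIntLinearMap
      ((AddEquiv.ofBijective f hf : ℤ√d ≃+ I) : ℤ√d →+ I)) a) = c * a := fun a => rfl
  simp only [e]
  simp [Zsqrtd.norm]

lemma finite_quot (hn : ¬ IsSquare d) {c : ℤ√d} (hc : c ≠ 0) : Finite (Aq c) := by
  apply Nat.finite_of_card_ne_zero
  rw [card_quot hn hc]
  exact Int.natAbs_ne_zero.2 (norm_ne_zero' hn hc)

lemma quot_eq_zero {c a : ℤ√d} : (Ideal.Quotient.mk (Ideal.span {c}) a) = 0 ↔ c ∣ a := by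
  rw [Ideal.Quotient.eq_zero_iff_mem, Ideal.mem_span_singleton]

end quot
end
end Equi

namespace Equi
open scoped BigOperators ComplexConjugate
noncomputable section
set_option linter.unusedSectionVars false
set_option linter.unusedDecidableInType false
set_option linter.unusedFintypeInType false

/-! ### Section 4: the number of triples with zero product -/

lemma trip_surj {A B : Type*} [CommRing A] [Fintype A] [DecidableEq A] [CommRing B] [Fintype B]
    [DecidableEq B] (f : A →+* B) (hf : Function.Surjective f) :
    trip A * Fintype.card B ^ 3 ≤ Fintype.card A ^ 3 * trip B := by
  classical
  let F : A × A × A →+ B × B × B :=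
    (f : A →+ B).prodMap ((f : A →+ B).prodMap (f : A →+ B))
  have hF : Function.Surjective F := by
    rintro ⟨a, b, c⟩
    obtain ⟨a', rfl⟩ := hf a
    obtain ⟨b', rfl⟩ := hf b
    obtain ⟨c', rfl⟩ := hf c
    exact ⟨(a', b', c'), rfl⟩
  have h := surj_count F hF (fun p => (p.1 + p.2.1) * ((p.2.2 - p.1) * (p.2.2 - p.2.1)) = 0)
  have e1 : Fintype.card (B × B × B) = Fintype.card B ^ 3 := by
    simp only [Fintype.card_prod]; ring
  have e2 : Fintype.card (A × A × A) = Fintype.card A ^ 3 := by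
    simp only [Fintype.card_prod]; ring
  rw [e1, e2] at h
  unfold trip
  rw [← h]
  refine Nat.mul_le_mul_right _ (Finset.card_le_card fun p hp => ?_)
  simp only [Finset.mem_filter, Finset.mem_univ, true_and] at hp ⊢
  have : (F p).1 = f p.1 ∧ (F p).2.1 = f p.2.1 ∧ (F p).2.2 = f p.2.2 := ⟨rfl, rfl, rfl⟩
  rw [this.1, this.2.1, this.2.2, ← map_add, ← map_sub, ← map_sub, ← map_mul, ← map_mul, hp,
    map_zero]

def badz (n : ℕ) [NeZero n] : Finset (ZMod n) :=
  Finset.univ.filter fun x : ZMod n => n ≤ (Nat.gcd n x.val) ^ 3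

lemma trip_zmod (n : ℕ) [NeZero n] : trip (ZMod n) ≤ 3 * (n ^ 2 * (badz n).card) := by
  classical
  have hsub : (Finset.univ.filter fun p : ZMod n × ZMod n × ZMod n =>
      (p.1 + p.2.1) * ((p.2.2 - p.1) * (p.2.2 - p.2.1)) = 0) ⊆
      ((badz n ×ˢ (Finset.univ : Finset (ZMod n × ZMod n))).image
        (fun q => (q.1 - q.2.1, q.2.1, q.2.2))) ∪
      (((badz n ×ˢ (Finset.univ : Finset (ZMod n × ZMod n))).image
        (fun q => (q.2.2 - q.1, q.2.1, q.2.2))) ∪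
      ((badz n ×ˢ (Finset.univ : Finset (ZMod n × ZMod n))).image
        (fun q => (q.2.1, q.2.2 - q.1, q.2.2)))) := by
    rintro ⟨a, b, c⟩ hp
    simp only [Finset.mem_filter, Finset.mem_univ, true_and] at hp
    have key : ∀ x y z : ZMod n, x * (y * z) = 0 → x ∈ badz n ∨ y ∈ badz n ∨ z ∈ badz n := by
      intro x y z h
      have h1 : n ∣ x.val * (y.val * z.val) := by
        rw [← ZMod.natCast_eq_zero_iff]
        push_cast
        simpa using h
      have h2 : n ∣ Nat.gcd n x.val * (Nat.gcd n y.val * Nat.gcd n z.val) := by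
        have e : Nat.gcd n (x.val * (y.val * z.val)) = n := Nat.gcd_eq_left h1
        exact e.symm.dvd.trans ((Nat.gcd_mul_right_dvd_mul_gcd n _ _).trans
          (Nat.mul_dvd_mul_left _ (Nat.gcd_mul_right_dvd_mul_gcd n _ _)))
      have hn0 : 0 < n := Nat.pos_of_ne_zero (NeZero.ne n)
      have p1 := Nat.gcd_pos_of_pos_left x.val hn0
      have p2 := Nat.gcd_pos_of_pos_left y.val hn0
      have p3 := Nat.gcd_pos_of_pos_left z.val hn0
      have h3 := Nat.le_of_dvd (by positivity) h2
      simp only [badz, Finset.mem_filter, Finset.mem_univ, true_and]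
      by_contra hcon
      push Not at hcon
      obtain ⟨c1, c2, c3⟩ := hcon
      set X := Nat.gcd n x.val
      set Y := Nat.gcd n y.val
      set Z := Nat.gcd n z.val
      have h4 : n ^ 3 ≤ X ^ 3 * (Y ^ 3 * Z ^ 3) := by
        calc n ^ 3 ≤ (X * (Y * Z)) ^ 3 := Nat.pow_le_pow_left h3 3
          _ = _ := by ring
      have h5 : X ^ 3 * (Y ^ 3 * Z ^ 3) < n * (n * n) :=
        Nat.mul_lt_mul'' c1 (Nat.mul_lt_mul'' c2 c3)
      have : n ^ 3 = n * (n * n) := by ring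
      omega
    simp only [Finset.mem_union, Finset.mem_image, Finset.mem_product, Finset.mem_univ, and_true]
    rcases key _ _ _ hp with h | h | h
    · left; exact ⟨(a + b, b, c), h, by simp⟩
    · right; left; exact ⟨(c - a, b, c), h, by simp⟩
    · right; right; exact ⟨(c - b, a, c), h, by simp⟩
  have hc : (badz n ×ˢ (Finset.univ : Finset (ZMod n × ZMod n))).card = n ^ 2 * (badz n).card := by
    rw [Finset.card_product, Finset.card_univ, Fintype.card_prod, ZMod.card]; ring
  unfold trip
  refine (Finset.card_le_card hsub).trans ?_
  refine (Finset.card_union_le _ _).trans ?_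
  have h1 := Finset.card_union_le ((badz n ×ˢ (Finset.univ : Finset (ZMod n × ZMod n))).image
        (fun q => (q.2.2 - q.1, q.2.1, q.2.2)))
      ((badz n ×ˢ (Finset.univ : Finset (ZMod n × ZMod n))).image
        (fun q => (q.2.1, q.2.2 - q.1, q.2.2)))
  have i1 := Finset.card_image_le (s := badz n ×ˢ (Finset.univ : Finset (ZMod n × ZMod n)))
    (f := fun q => (q.2.2 - q.1, q.2.1, q.2.2))
  have i2 := Finset.card_image_le (s := badz n ×ˢ (Finset.univ : Finset (ZMod n × ZMod n)))
    (f := fun q => (q.2.1, q.2.2 - q.1, q.2.2))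
  have i3 := Finset.card_image_le (s := badz n ×ˢ (Finset.univ : Finset (ZMod n × ZMod n)))
    (f := fun q => (q.1 - q.2.1, q.2.1, q.2.2))
  rw [hc] at i1 i2 i3
  omega

lemma badz_card (n : ℕ) [NeZero n] :
    ((badz n).card : ℝ) ≤ n.divisors.card * (n : ℝ) ^ (2 / 3 : ℝ) := by
  classical
  have hn0 : 0 < n := Nat.pos_of_ne_zero (NeZero.ne n)
  have hsub : badz n ⊆ (n.divisors.filter fun h => n ≤ h ^ 3).biUnion
      (fun h => (Finset.range (n / h)).image (fun i => ((h * i : ℕ) : ZMod n))) := by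
    intro x hx
    simp only [badz, Finset.mem_filter, Finset.mem_univ, true_and] at hx
    simp only [Finset.mem_biUnion, Finset.mem_filter, Nat.mem_divisors, Finset.mem_image,
      Finset.mem_range]
    refine ⟨Nat.gcd n x.val, ⟨⟨Nat.gcd_dvd_left _ _, hn0.ne'⟩, hx⟩, x.val / Nat.gcd n x.val, ?_, ?_⟩
    · exact Nat.div_lt_div_of_lt_of_dvd (Nat.gcd_dvd_left _ _) (ZMod.val_lt x)
    · rw [Nat.mul_div_cancel' (Nat.gcd_dvd_right _ _)]; simp
  have h1 : (badz n).card ≤ ∑ h ∈ n.divisors.filter (fun h => n ≤ h ^ 3), n / h := by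
    refine (Finset.card_le_card hsub).trans (Finset.card_biUnion_le.trans ?_)
    refine Finset.sum_le_sum fun h _ => ?_
    exact Finset.card_image_le.trans (by simp)
  have h2 : ((badz n).card : ℝ) ≤ ∑ h ∈ n.divisors.filter (fun h => n ≤ h ^ 3), (n : ℝ) ^ (2 / 3 : ℝ) := by
    calc ((badz n).card : ℝ) ≤ ((∑ h ∈ n.divisors.filter (fun h => n ≤ h ^ 3), n / h : ℕ) : ℝ) := by
          exact_mod_cast h1
      _ ≤ _ := by
          push_cast
          refine Finset.sum_le_sum fun h hh => ?_
          rw [Finset.mem_filter, Nat.mem_divisors] at hh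
          have hpos : 0 < h := Nat.pos_of_dvd_of_pos hh.1.1 hn0
          refine Nat.cast_div_le.trans ?_
          rw [div_le_iff₀ (by exact_mod_cast hpos)]
          have h3 : (n : ℝ) ^ (1 / 3 : ℝ) ≤ h := by
            have : (n : ℝ) ≤ (h : ℝ) ^ 3 := by exact_mod_cast hh.2
            calc (n : ℝ) ^ (1 / 3 : ℝ) ≤ ((h : ℝ) ^ 3) ^ (1 / 3 : ℝ) := by gcongr
              _ = h := by
                rw [← Real.rpow_natCast, ← Real.rpow_mul (by positivity)]; norm_num
          calc (n : ℝ) = (n : ℝ) ^ (2 / 3 : ℝ) * (n : ℝ) ^ (1 / 3 : ℝ) := by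
                rw [← Real.rpow_add (by exact_mod_cast hn0)]; norm_num
            _ ≤ _ := by gcongr
  refine h2.trans ?_
  rw [Finset.sum_const, nsmul_eq_mul]
  gcongr
  exact Finset.filter_subset _ _

section
variable {d : ℤ}

/-- content of an element -/
def cont (c : ℤ√d) : ℕ := Int.gcd c.re c.im

lemma exists_hom (hn : ¬ IsSquare d) {c : ℤ√d} (hc : c ≠ 0) :
    ∃ n : ℕ, n ≠ 0 ∧ c.norm.natAbs = (cont c) ^ 2 * n ∧
      ∃ f : Aq c →+* ZMod n, Function.Surjective f := by
  have hg : 0 < Int.gcd c.re c.im := by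
    rw [Int.gcd_pos_iff]
    by_contra h
    push Not at h
    exact hc (Zsqrtd.ext h.1 h.2)
  obtain ⟨b, hb, hcop⟩ := Zsqrtd.exists_coprime_of_gcd_pos hg
  have hb0 : b ≠ 0 := by rintro rfl; apply hc; rw [hb]; simp
  have hN : c.norm.natAbs = (cont c) ^ 2 * b.norm.natAbs := by
    rw [hb, Zsqrtd.norm_mul, Zsqrtd.norm_intCast, Int.natAbs_mul, Int.natAbs_mul]
    rw [← hb]
    simp only [cont, Int.natAbs_natCast]
    ring
  refine ⟨b.norm.natAbs, Int.natAbs_ne_zero.2 (norm_ne_zero' hn hb0), hN, ?_⟩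
  set n := b.norm.natAbs with hn'
  have hnorm0 : ((b.norm : ℤ) : ZMod n) = 0 := by
    rw [ZMod.intCast_zmod_eq_zero_iff_dvd, hn', Int.natCast_natAbs, abs_dvd]
  have hcop2 : IsCoprime b.im (n : ℤ) := by
    have h1 : IsCoprime b.im (b.re * b.re) := (hcop.symm).mul_right hcop.symm
    have h2 : IsCoprime b.im (b.re * b.re + b.im * (-d * b.im)) := h1.add_mul_left_right _
    have h3 : b.norm = b.re * b.re + b.im * (-d * b.im) := by rw [Zsqrtd.norm]; ring
    rw [← h3] at h2
    rw [hn', Int.natCast_natAbs]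
    rcases abs_choice b.norm with h4 | h4 <;> rw [h4]
    · exact h2
    · exact h2.neg_right
  obtain ⟨x, y, hxy⟩ := hcop2
  have hinv : (x : ZMod n) * (b.im : ZMod n) = 1 := by
    have := congrArg (fun t : ℤ => (t : ZMod n)) hxy
    push_cast at this
    simpa using this
  have hre : (b.re : ZMod n) * b.re = d * b.im * b.im := by
    have h3 : b.norm = b.re * b.re - d * b.im * b.im := by rw [Zsqrtd.norm]
    rw [h3] at hnorm0
    push_cast at hnorm0
    linear_combination hnorm0
  let r : {r : ZMod n // r * r = (d : ZMod n)} := ⟨-(b.re : ZMod n) * x, by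
    linear_combination (x : ZMod n) * x * hre + (d : ZMod n) * (x * b.im + 1) * hinv⟩
  let θ : ℤ√d →+* ZMod n := Zsqrtd.lift r
  have hθ : ∀ a : ℤ√d, θ a = a.re + a.im * (-(b.re : ZMod n) * x) := fun a => by
    simp only [θ, Zsqrtd.lift_apply_apply, r]
  have hθc : θ c = 0 := by
    have : c = b * (Int.gcd c.re c.im : ℤ) := by rw [mul_comm]; exact hb
    rw [this, map_mul]
    have : θ b = 0 := by
      rw [hθ]; linear_combination (-(b.re : ZMod n)) * hinv
    rw [this, zero_mul]
  refine ⟨Ideal.Quotient.lift (Ideal.span {c}) θ ?_, ?_⟩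
  · intro a ha
    obtain ⟨t, rfl⟩ := Ideal.mem_span_singleton'.1 ha
    rw [map_mul, hθc, mul_zero]
  · apply Ideal.Quotient.lift_surjective_of_surjective
    exact ZMod.ringHom_surjective θ

lemma trip_bound (hn : ¬ IsSquare d) : ∃ C : ℝ, 1 ≤ C ∧ ∀ (c : ℤ√d), c ≠ 0 →
    ∀ [Fintype (Aq c)] [DecidableEq (Aq c)],
      (trip (Aq c) : ℝ) ≤ C * (cont c : ℝ) ^ 6 * (c.norm.natAbs : ℝ) ^ (11 / 4 : ℝ) := by
  obtain ⟨C, hC, hdiv⟩ := divisor_bound_real 12 (by norm_num)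
  refine ⟨3 * C, by linarith, fun c hc _ _ => ?_⟩
  obtain ⟨n, hn0, hN, f, hf⟩ := exists_hom hn hc
  have : NeZero n := ⟨hn0⟩
  have h1 := trip_surj f hf
  rw [ZMod.card, ← Nat.card_eq_fintype_card, card_quot hn hc, hN] at h1
  have hnpos : 0 < n := Nat.pos_of_ne_zero hn0
  have h2 : trip (Aq c) ≤ (cont c) ^ 6 * trip (ZMod n) := by
    have : trip (Aq c) * n ^ 3 ≤ ((cont c) ^ 6 * trip (ZMod n)) * n ^ 3 := by
      calc _ ≤ _ := h1
        _ = _ := by ring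
    exact Nat.le_of_mul_le_mul_right this (by positivity)
  have h3 := trip_zmod n
  have h4 := badz_card n
  have h5 := hdiv n hnpos
  have hN1 : (n : ℝ) ≤ c.norm.natAbs := by
    have : n ≤ c.norm.natAbs := by
      rw [hN]
      refine Nat.le_mul_of_pos_left n ?_
      rcases Nat.eq_zero_or_pos ((cont c) ^ 2) with h | h
      · rw [h, zero_mul] at hN
        exact absurd (Int.natAbs_eq_zero.1 hN) (norm_ne_zero' hn hc)
      · exact h
    exact_mod_cast this
  have hnp : (0 : ℝ) < n := by exact_mod_cast hnpos
  have h6 : (trip (ZMod n) : ℝ) ≤ 3 * C * (n : ℝ) ^ (11 / 4 : ℝ) := by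
    calc (trip (ZMod n) : ℝ) ≤ 3 * ((n : ℝ) ^ 2 * (badz n).card) := by exact_mod_cast h3
      _ ≤ 3 * ((n : ℝ) ^ 2 * ((C * (n : ℝ) ^ (1 / 12 : ℝ)) * (n : ℝ) ^ (2 / 3 : ℝ))) := by
          gcongr
          refine h4.trans ?_
          gcongr
          exact_mod_cast h5
      _ = 3 * C * ((n : ℝ) ^ (2 : ℝ) * (n : ℝ) ^ (1 / 12 : ℝ) * (n : ℝ) ^ (2 / 3 : ℝ)) := by
          rw [Real.rpow_two]; ring
      _ = _ := by rw [← Real.rpow_add hnp, ← Real.rpow_add hnp]; norm_num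
  calc (trip (Aq c) : ℝ) ≤ (cont c : ℝ) ^ 6 * trip (ZMod n) := by exact_mod_cast h2
    _ ≤ (cont c : ℝ) ^ 6 * (3 * C * (c.norm.natAbs : ℝ) ^ (11 / 4 : ℝ)) := by
        gcongr
        refine h6.trans ?_
        gcongr
    _ = _ := by ring

end
end
end Equi

namespace Equi
open scoped BigOperators ComplexConjugate
noncomputable section
set_option linter.unusedSectionVars false
set_option linter.unusedDecidableInType false
set_option linter.unusedFintypeInType false

/-! ### Section 5: equidistribution of modular inverses -/

lemma abs_arg_le (ζ : ℂ) (h : ‖ζ‖ = 1) : 2 / Real.pi * |ζ.arg| ≤ ‖ζ - 1‖ := by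
  have h1 := Complex.mul_angle_le_norm_sub (x := ζ) (y := 1) h (by simp)
  have h0 : ζ ≠ 0 := by rintro rfl; simp at h
  rw [Complex.angle_one_right h0] at h1
  exact h1

lemma geom_norm_le (ζ : ℂ) (h : ‖ζ‖ = 1) (J : ℕ) :
    ‖∑ i : Fin J, ζ ^ (i : ℕ)‖ * ‖ζ - 1‖ ≤ 2 := by
  rw [Fin.sum_univ_eq_sum_range (fun i => ζ ^ i), ← norm_mul, geom_sum_mul]
  refine (norm_sub_le _ _).trans ?_
  rw [norm_pow, h]; norm_num

lemma arg_relation {z1 z2 : ℂ} (h1 : ‖z1‖ = 1) (h2 : ‖z2‖ = 1) (i j : ℤ)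
    (h : z1 ^ i * z2 ^ j = 1) (hlt : |(i : ℝ) * z1.arg + j * z2.arg| < 2 * Real.pi) :
    (i : ℝ) * z1.arg + j * z2.arg = 0 := by
  have e1 : z1 = Complex.exp (z1.arg * Complex.I) := by
    conv_lhs => rw [← Complex.norm_mul_exp_arg_mul_I z1, h1]
    simp
  have e2 : z2 = Complex.exp (z2.arg * Complex.I) := by
    conv_lhs => rw [← Complex.norm_mul_exp_arg_mul_I z2, h2]
    simp
  rw [e1, e2, ← Complex.exp_int_mul, ← Complex.exp_int_mul, ← Complex.exp_add,
    Complex.exp_eq_one_iff] at h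
  obtain ⟨n, hn⟩ := h
  have hn' : (i : ℝ) * z1.arg + j * z2.arg = n * (2 * Real.pi) := by
    have := congrArg Complex.im hn
    simpa using this
  rw [hn'] at hlt ⊢
  rw [abs_mul, abs_of_pos (a := 2 * Real.pi) (by positivity)] at hlt
  have h3 : |(n : ℝ)| < 1 := by
    by_contra hcon
    push Not at hcon
    nlinarith [Real.pi_pos]
  have : n = 0 := by
    rw [← Int.abs_lt_one_iff]
    exact_mod_cast h3
  rw [this]; simp

section
variable {d : ℤ}

def zij (d : ℤ) {J : ℕ} (p : Fin J × Fin J) : ℤ√d := ⟨(p.1 : ℕ), (p.2 : ℕ)⟩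

/-- the small square `u [0,J)^2` reduced mod `c` -/
def bq (c u : ℤ√d) (J : ℕ) (p : Fin J × Fin J) : Aq c :=
  Ideal.Quotient.mk (Ideal.span {c}) (u * zij d p)

lemma chi_lin {c : ℤ√d} (χ : AddChar (Aq c) ℂ) (v : ℤ√d) (i j : ℤ) :
    χ (Ideal.Quotient.mk _ (v * ⟨i, j⟩)) =
      χ (Ideal.Quotient.mk _ v) ^ i * χ (Ideal.Quotient.mk _ (v * ⟨0, 1⟩)) ^ j := by
  have : v * ⟨i, j⟩ = i • v + j • (v * ⟨0, 1⟩) := by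
    ext <;> simp <;> ring
  rw [this, map_add, AddChar.map_add_eq_mul, map_zsmul (Ideal.Quotient.mk (Ideal.span {c})),
    map_zsmul (Ideal.Quotient.mk (Ideal.span {c})), AddChar.map_zsmul_eq_zpow,
    AddChar.map_zsmul_eq_zpow]

lemma chi_triv {c u v : ℤ√d} (huv : u * v = 1) (χ : AddChar (Aq c) ℂ)
    (h1 : χ (Ideal.Quotient.mk _ u) = 1) (h2 : χ (Ideal.Quotient.mk _ (u * ⟨0, 1⟩)) = 1) :
    χ = 0 := by
  ext x
  obtain ⟨a, rfl⟩ := Ideal.Quotient.mk_surjective x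
  have : a = u * ⟨(v * a).re, (v * a).im⟩ := by
    have : (⟨(v * a).re, (v * a).im⟩ : ℤ√d) = v * a := rfl
    rw [this, ← mul_assoc, huv, one_mul]
  rw [this, chi_lin, h1, h2]; simp

/-- the annihilator ideal of a character -/
def annI {A : Type*} [CommRing A] (χ : AddChar A ℂ) : Ideal A where
  carrier := {w | ∀ x, χ (w * x) = 1}
  zero_mem' := by intro x; simp
  add_mem' := by
    intro a b ha hb x
    rw [add_mul, AddChar.map_add_eq_mul, ha x, hb x, one_mul]
  smul_mem' := by
    intro r a ha x
    have := ha (r * x)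
    rw [smul_eq_mul, mul_comm r a, mul_assoc]
    exact this

lemma mem_annI {A : Type*} [CommRing A] (χ : AddChar A ℂ) (w : A) :
    w ∈ annI χ ↔ ∀ x, χ (w * x) = 1 := Iff.rfl

lemma fhat_small (hd : 0 < d) (hn : ¬ IsSquare d) {c u v : ℤ√d} (huv : u * v = 1)
    [Fintype (Aq c)] [DecidableEq (Aq c)]
    (J s : ℕ) (χ : AddChar (Aq c) ℂ) (hχ : χ ≠ 0)
    (hs : Fintype.card (Aq c) < Nat.card (annI χ) * (s + 1) ^ 2) :
    ‖fhat (bq c u J) χ‖ ≤ J * ((1 + d) * s) := by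
  classical
  -- pigeonhole
  have hcard : Fintype.card (Aq c ⧸ annI χ) < Fintype.card (Fin (s + 1) × Fin (s + 1)) := by
    have h1 := AddSubgroup.card_eq_card_quotient_mul_card_addSubgroup (annI χ).toAddSubgroup
    rw [Nat.card_eq_fintype_card (α := Aq c)] at h1
    have h2 : Nat.card (Aq c ⧸ (annI χ).toAddSubgroup) = Fintype.card (Aq c ⧸ annI χ) :=
      Nat.card_eq_fintype_card (α := Aq c ⧸ annI χ)
    have h3 : Nat.card (annI χ).toAddSubgroup = Nat.card (annI χ) := rfl
    rw [h2, h3] at h1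
    rw [h1] at hs
    simp only [Fintype.card_prod, Fintype.card_fin]
    have : Fintype.card (Aq c ⧸ annI χ) * Nat.card (annI χ) < (s + 1) ^ 2 * Nat.card (annI χ) := by
      rw [mul_comm ((s + 1) ^ 2)]; exact hs
    have h4 := lt_of_mul_lt_mul_right this (Nat.zero_le _)
    rw [← sq]; exact h4
  obtain ⟨p, q, hpq, hEq⟩ := Fintype.exists_ne_map_eq_of_card_lt
    (fun p : Fin (s + 1) × Fin (s + 1) => Ideal.Quotient.mk (annI χ)
      (Ideal.Quotient.mk (Ideal.span {c}) (zij d p))) hcard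
  rw [Ideal.Quotient.eq, ← map_sub] at hEq
  set i : ℤ := ((p.1 : ℕ) : ℤ) - (q.1 : ℕ) with hi
  set j : ℤ := ((p.2 : ℕ) : ℤ) - (q.2 : ℕ) with hj
  have hz : zij d p - zij d q = ⟨i, j⟩ := by ext <;> simp [zij, hi, hj]
  rw [hz, mem_annI] at hEq
  have his : |(i : ℝ)| ≤ s := by
    have h1 := p.1.isLt; have h2 := q.1.isLt
    have : |i| ≤ (s : ℤ) := by rw [abs_le]; omega
    exact_mod_cast this
  have hjs : |(j : ℝ)| ≤ s := by
    have h1 := p.2.isLt; have h2 := q.2.isLt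
    have : |j| ≤ (s : ℤ) := by rw [abs_le]; omega
    exact_mod_cast this
  have hz0 : (⟨i, j⟩ : ℤ√d) ≠ 0 := by
    intro h
    have h1 : i = 0 := congrArg Zsqrtd.re h
    have h2 : j = 0 := congrArg Zsqrtd.im h
    apply hpq
    ext <;> omega
  set z1 := χ (Ideal.Quotient.mk _ u) with hz1
  set z2 := χ (Ideal.Quotient.mk _ (u * ⟨0, 1⟩)) with hz2
  have n1 : ‖z1‖ = 1 := AddChar.norm_apply _ _
  have n2 : ‖z2‖ = 1 := AddChar.norm_apply _ _
  have r1 : z1 ^ i * z2 ^ j = 1 := by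
    have := hEq (Ideal.Quotient.mk _ u)
    rwa [← map_mul, mul_comm, chi_lin] at this
  have r2 : z1 ^ (d * j) * z2 ^ i = 1 := by
    have := hEq (Ideal.Quotient.mk _ (u * ⟨0, 1⟩))
    rw [← map_mul] at this
    have e : (⟨i, j⟩ : ℤ√d) * (u * ⟨0, 1⟩) = u * ⟨d * j, i⟩ := by
      ext <;> simp <;> ring
    rwa [e, chi_lin] at this
  have hdr : (1 : ℝ) ≤ d := by exact_mod_cast hd
  -- factorisation
  have hfac : fhat (bq c u J) χ = (∑ i : Fin J, z1 ^ (i : ℕ)) * (∑ j : Fin J, z2 ^ (j : ℕ)) := by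
    unfold fhat
    rw [Finset.sum_mul_sum, Fintype.sum_prod_type]
    refine Finset.sum_congr rfl fun a _ => Finset.sum_congr rfl fun b _ => ?_
    rw [bq, zij, chi_lin, zpow_natCast, zpow_natCast]
  have triv : ∀ z : ℂ, ‖z‖ = 1 → ‖∑ i : Fin J, z ^ (i : ℕ)‖ ≤ J := by
    intro z hz
    refine (norm_sum_le _ _).trans ?_
    simp [hz]
  have good : ∀ z : ℂ, ‖z‖ = 1 → 2 * Real.pi ≤ (1 + d) * s * |z.arg| →
      ‖∑ i : Fin J, z ^ (i : ℕ)‖ ≤ (1 + d) * s := by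
    intro z hz h
    have a1 := abs_arg_le z hz
    have a2 := geom_norm_le z hz J
    set Sg := ‖∑ i : Fin J, z ^ (i : ℕ)‖
    have hS0 : 0 ≤ Sg := norm_nonneg _
    have hpi := Real.pi_pos
    have a3 : Sg * (2 / Real.pi * |z.arg|) ≤ 2 := (mul_le_mul_of_nonneg_left a1 hS0).trans a2
    have a4 : Sg * |z.arg| ≤ Real.pi := by
      have e : Sg * (2 / Real.pi * |z.arg|) = 2 * (Sg * |z.arg|) / Real.pi := by field_simp
      rw [e, div_le_iff₀ hpi] at a3
      linarith
    have hpos : 0 < |z.arg| := by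
      by_contra hcon
      have : |z.arg| = 0 := le_antisymm (not_lt.1 hcon) (abs_nonneg _)
      rw [this] at h; simp at h; linarith
    by_contra hcon
    push Not at hcon
    have := mul_lt_mul_of_pos_right hcon hpos
    linarith
  rw [hfac, norm_mul]
  by_cases ha : 2 * Real.pi ≤ (1 + d) * s * |z1.arg|
  · calc _ ≤ ((1 + d) * s) * (J : ℝ) := mul_le_mul (good z1 n1 ha) (triv z2 n2) (norm_nonneg _)
          (by positivity)
      _ = _ := by ring
  by_cases hb : 2 * Real.pi ≤ (1 + d) * s * |z2.arg|
  · exact mul_le_mul (triv z1 n1) (good z2 n2 hb) (norm_nonneg _) (by positivity)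
  exfalso
  push Not at ha hb
  have hbd : ∀ a b m n : ℝ, |m| ≤ s → |n| ≤ d * s →
      (1 + d) * s * |a| < 2 * Real.pi → (1 + d) * s * |b| < 2 * Real.pi →
      |m * a + n * b| < 2 * Real.pi := by
    intro a b m n hm hn' h1 h2
    have t : |m * a + n * b| ≤ s * |a| + d * s * |b| := by
      refine (abs_add_le _ _).trans ?_
      rw [abs_mul, abs_mul]
      gcongr
    rcases le_total |a| |b| with h3 | h3
    · have : s * |a| ≤ s * |b| := by gcongr
      nlinarith
    · have : d * s * |b| ≤ d * s * |a| := by gcongr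
      nlinarith
  have hsd : (s : ℝ) ≤ d * s := by
    have : (0 : ℝ) ≤ s := by positivity
    nlinarith
  have q1 := arg_relation n1 n2 i j r1 (hbd _ _ _ _ his (hjs.trans hsd) ha hb)
  have q2 := arg_relation n1 n2 (d * j) i r2 (by
    rw [add_comm]
    refine hbd _ _ _ _ his ?_ hb ha
    push_cast
    rw [abs_mul, abs_of_pos (a := (d : ℝ)) (by linarith)]
    gcongr)
  push_cast at q2
  have hnz : ((i : ℝ) * i - d * j * j) ≠ 0 := by
    have := norm_ne_zero' hn hz0
    rw [Zsqrtd.norm] at this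
    simp only at this
    exact_mod_cast this
  have a0 : z1.arg = 0 := by
    have : ((i : ℝ) * i - d * j * j) * z1.arg = 0 := by linear_combination i * q1 - j * q2
    exact (mul_eq_zero.1 this).resolve_left hnz
  have b0 : z2.arg = 0 := by
    have : ((i : ℝ) * i - d * j * j) * z2.arg = 0 := by linear_combination i * q2 - d * j * q1
    exact (mul_eq_zero.1 this).resolve_left hnz
  have one : ∀ z : ℂ, ‖z‖ = 1 → z.arg = 0 → z = 1 := by
    intro z h1 h2
    rw [← Complex.norm_mul_exp_arg_mul_I z, h1, h2]; simp
  exact hχ (chi_triv huv χ (one _ n1 a0) (one _ n2 b0))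

end
end
end Equi

namespace Equi
open scoped BigOperators ComplexConjugate
noncomputable section
set_option linter.unusedSectionVars false
set_option linter.unusedDecidableInType false
set_option linter.unusedFintypeInType false

section
variable {d : ℤ}

/-- pairs of small squares mod `c` -/
def b2 (c u : ℤ√d) (J : ℕ) (p : (Fin J × Fin J) × (Fin J × Fin J)) : Aq c × Aq c :=
  (bq c u J p.1, bq c u J p.2)

def bR (u : ℤ√d) (J : ℕ) (p : (Fin J × Fin J) × (Fin J × Fin J)) : (ℤ√d) × (ℤ√d) :=
  (u * zij d p.1, u * zij d p.2)

lemma fhat_b2 {c u : ℤ√d} [Fintype (Aq c)] [DecidableEq (Aq c)] (J : ℕ)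
    (χ : AddChar (Aq c × Aq c) ℂ) :
    fhat (b2 c u J) χ =
      fhat (bq c u J) (χ.compAddMonoidHom (AddMonoidHom.inl (Aq c) (Aq c))) *
      fhat (bq c u J) (χ.compAddMonoidHom (AddMonoidHom.inr (Aq c) (Aq c))) := by
  unfold fhat
  rw [Finset.sum_mul_sum, Fintype.sum_prod_type]
  refine Finset.sum_congr rfl fun a _ => Finset.sum_congr rfl fun b _ => ?_
  simp only [AddChar.compAddMonoidHom_apply, AddMonoidHom.inl_apply, AddMonoidHom.inr_apply, b2]
  rw [← AddChar.map_add_eq_mul]; simp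

lemma stab_le_ann {A : Type*} [CommRing A] [Fintype A] [DecidableEq A] (χ : AddChar (A × A) ℂ) :
    (stab χ).card ≤ Nat.card (annI (χ.compAddMonoidHom (AddMonoidHom.inl A A))) ∧
    (stab χ).card ≤ Nat.card (annI (χ.compAddMonoidHom (AddMonoidHom.inr A A))) := by
  have key : ∀ I : Ideal A, (∀ u ∈ stab χ, (u : A) - 1 ∈ I) → (stab χ).card ≤ Nat.card I := by
    intro I h
    rw [← Fintype.card_coe, ← Nat.card_eq_fintype_card]
    refine Nat.card_le_card_of_injective
      (fun u : stab χ => (⟨(u.1 : A) - 1, h u.1 u.2⟩ : I)) ?_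
    intro u v huv
    have : (u.1 : A) - 1 = v.1 - 1 := congrArg Subtype.val huv
    exact Subtype.ext (Units.ext (by linear_combination this))
  have h0 : ∀ u ∈ stab χ, ∀ x y : A, χ ((u : A) * x, ((u⁻¹ : Aˣ) : A) * y) = χ (x, y) := by
    intro u hu x y
    rw [mem_stab] at hu
    have := act_apply u χ (x, y)
    rw [hu] at this
    exact this.symm
  constructor
  · refine key _ fun u hu => ?_
    rw [mem_annI]
    intro x
    have h1 := h0 u hu x 0
    rw [mul_zero] at h1
    rw [sub_mul, one_mul, AddChar.map_sub_eq_div]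
    simp only [AddChar.compAddMonoidHom_apply, AddMonoidHom.inl_apply]
    rw [h1, div_self]
    exact fun h => by simpa [h] using AddChar.norm_apply χ (x, 0)
  · refine key _ fun u hu => ?_
    rw [mem_annI]
    intro x
    have h1 := h0 u hu 0 (u * x)
    rw [mul_zero, Units.inv_mul_cancel_left] at h1
    rw [sub_mul, one_mul, AddChar.map_sub_eq_div]
    simp only [AddChar.compAddMonoidHom_apply, AddMonoidHom.inr_apply]
    rw [h1, div_self]
    exact fun h => by simpa [h] using AddChar.norm_apply χ (0, u * x)

lemma fhat_b2_small (hd : 0 < d) (hn : ¬ IsSquare d) {c u v : ℤ√d} (huv : u * v = 1)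
    [Fintype (Aq c)] [DecidableEq (Aq c)]
    (J K0 : ℕ) (hK0 : 1 ≤ K0) (χ : AddChar (Aq c × Aq c) ℂ) (hχ : χ ≠ 0)
    (hs : K0 < (stab χ).card) :
    ‖fhat (b2 c u J) χ‖ ^ 2 ≤ (J : ℝ) ^ 6 * (1 + d) ^ 2 * Fintype.card (Aq c) / K0 := by
  set N := Fintype.card (Aq c) with hN
  set s := Nat.sqrt (N / K0) with hsdef
  have hsq : (s : ℝ) ^ 2 ≤ N / K0 := by
    have h1 : s ^ 2 ≤ N / K0 := Nat.sqrt_le' _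
    calc (s : ℝ) ^ 2 = ((s ^ 2 : ℕ) : ℝ) := by push_cast; rfl
      _ ≤ ((N / K0 : ℕ) : ℝ) := by exact_mod_cast h1
      _ ≤ _ := Nat.cast_div_le
  have hlt : ∀ m : ℕ, K0 < m → N < m * (s + 1) ^ 2 := by
    intro m hm
    have h1 : N / K0 < (s + 1) ^ 2 := Nat.lt_succ_sqrt' _
    have h2 : N < (s + 1) ^ 2 * K0 := (Nat.div_lt_iff_lt_mul hK0).1 h1
    calc N < (s + 1) ^ 2 * K0 := h2
      _ ≤ m * (s + 1) ^ 2 := by rw [mul_comm]; gcongr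
  have hdr : (0 : ℝ) < d := by exact_mod_cast hd
  have key : ‖fhat (b2 c u J) χ‖ ≤ J ^ 2 * (J * ((1 + d) * s)) := by
    rw [fhat_b2, norm_mul]
    set χ1 := χ.compAddMonoidHom (AddMonoidHom.inl (Aq c) (Aq c)) with hχ1
    set χ2 := χ.compAddMonoidHom (AddMonoidHom.inr (Aq c) (Aq c)) with hχ2
    have t : ∀ χ' : AddChar (Aq c) ℂ, ‖fhat (bq c u J) χ'‖ ≤ J ^ 2 := by
      intro χ'
      refine (fhat_norm_le _ _).trans (le_of_eq ?_)
      simp [sq]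
    by_cases h1 : χ1 = 0
    · have h2 : χ2 ≠ 0 := by
        intro h2
        apply hχ
        ext ⟨x, y⟩
        have e1 : χ (x, 0) = 1 := by
          have := DFunLike.congr_fun h1 x
          simpa [hχ1] using this
        have e2 : χ (0, y) = 1 := by
          have := DFunLike.congr_fun h2 y
          simpa [hχ2] using this
        have : (x, y) = (x, 0) + ((0 : Aq c), y) := by simp
        rw [this, AddChar.map_add_eq_mul, e1, e2]; simp
      exact mul_le_mul (t _) (fhat_small hd hn huv J s χ2 h2
        (hlt _ (hs.trans_le (stab_le_ann χ).2))) (norm_nonneg _) (by positivity)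
    · rw [mul_comm]
      exact mul_le_mul (t _) (fhat_small hd hn huv J s χ1 h1
        (hlt _ (hs.trans_le (stab_le_ann χ).1))) (norm_nonneg _) (by positivity)
  calc ‖fhat (b2 c u J) χ‖ ^ 2 ≤ ((J : ℝ) ^ 2 * (J * ((1 + d) * s))) ^ 2 := by
        gcongr
    _ = (J : ℝ) ^ 6 * (1 + d) ^ 2 * (s : ℝ) ^ 2 := by ring
    _ ≤ (J : ℝ) ^ 6 * (1 + d) ^ 2 * (N / K0) := by gcongr
    _ = _ := by ring

lemma zij_inj (hd : 0 < d) (hn : ¬ IsSquare d) {c u v : ℤ√d} (huv : u * v = 1)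
    (J : ℕ) (hJ : (1 + d) * (J : ℤ) ^ 2 ≤ c.norm.natAbs) : Function.Injective (bq c u J) := by
  intro p q h
  rw [bq, bq, Ideal.Quotient.eq, Ideal.mem_span_singleton, ← mul_sub] at h
  set i : ℤ := ((p.1 : ℕ) : ℤ) - (q.1 : ℕ) with hi
  set j : ℤ := ((p.2 : ℕ) : ℤ) - (q.2 : ℕ) with hj
  have hz : zij d p - zij d q = ⟨i, j⟩ := by ext <;> simp [zij, hi, hj]
  have h1 : c ∣ ⟨i, j⟩ := by
    rw [hz] at h
    have := h.mul_left v
    rwa [← mul_assoc, mul_comm v u, huv, one_mul] at this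
  have h2 : c.norm ∣ (⟨i, j⟩ : ℤ√d).norm := by
    obtain ⟨e, he⟩ := h1
    exact ⟨e.norm, by rw [he, Zsqrtd.norm_mul]⟩
  have hp1 := p.1.isLt; have hq1 := q.1.isLt
  have hp2 := p.2.isLt; have hq2 := q.2.isLt
  have hi1 : i ^ 2 < (J : ℤ) ^ 2 := by
    apply sq_lt_sq.2; rw [abs_lt, abs_of_nonneg (by positivity)]; omega
  have hj1 : j ^ 2 < (J : ℤ) ^ 2 := by
    apply sq_lt_sq.2; rw [abs_lt, abs_of_nonneg (by positivity)]; omega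
  have h3 : (⟨i, j⟩ : ℤ√d).norm = 0 := by
    apply Int.eq_zero_of_abs_lt_dvd ((Int.natAbs_dvd).2 h2)
    refine lt_of_lt_of_le ?_ hJ
    rw [Zsqrtd.norm, abs_lt]
    constructor <;> nlinarith [sq_nonneg i, sq_nonneg j]
  have h4 : (⟨i, j⟩ : ℤ√d) = 0 := by
    by_contra hne
    exact norm_ne_zero' hn hne h3
  have h5 : i = 0 := congrArg Zsqrtd.re h4
  have h6 : j = 0 := congrArg Zsqrtd.im h4
  ext <;> omega

/-- Index set of shifts. -/
abbrev QJ (J : ℕ) : Type := ((Fin J × Fin J) × (Fin J × Fin J)) × ((Fin J × Fin J) × (Fin J × Fin J))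
  × ((Fin J × Fin J) × (Fin J × Fin J)) × ((Fin J × Fin J) × (Fin J × Fin J))

lemma dl_b2 (c u : ℤ√d) (J : ℕ) (q : QJ J) :
    dl (b2 c u J) q = (Ideal.Quotient.mk (Ideal.span {c}) (dl (bR u J) q).1,
      Ideal.Quotient.mk (Ideal.span {c}) (dl (bR u J) q).2) := by
  simp [dl, b2, bq, bR]

open Classical in
def cntq (c u : ℤ√d) (J : ℕ) (y1 y2 : ℤ√d) : ℕ :=
  (Finset.univ.filter fun q : QJ J =>
    c ∣ (y1 + (dl (bR u J) q).1) * (y2 + (dl (bR u J) q).2) - 1).card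

lemma nsol_eq {c u : ℤ√d} [Fintype (Aq c)] [DecidableEq (Aq c)] (J : ℕ) (y1 y2 : ℤ√d) :
    nsol (gk (A := Aq c)) (b2 c u J) (Ideal.Quotient.mk _ y1, Ideal.Quotient.mk _ y2) =
      cntq c u J y1 y2 := by
  classical
  unfold nsol cntq
  refine Finset.card_bij' (fun p _ => p.2)
    (fun q hq => (if h : (Ideal.Quotient.mk (Ideal.span {c}) (y1 + (dl (bR u J) q).1)) *
        (Ideal.Quotient.mk (Ideal.span {c}) (y2 + (dl (bR u J) q).2)) = 1 then
        Units.mkOfMulEqOne _ _ h else 1, q)) ?_ ?_ ?_ ?_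
  · intro p hp
    simp only [Finset.mem_filter, Finset.mem_univ, true_and, gk, dl_b2, Prod.mk_add_mk,
      Prod.mk.injEq] at hp ⊢
    rw [← quot_eq_zero, map_sub, map_mul, map_add, map_add, ← hp.1, ← hp.2]
    simp
  · intro q hq
    simp only [Finset.mem_filter, Finset.mem_univ, true_and, gk, dl_b2, Prod.mk_add_mk,
      Prod.mk.injEq] at hq ⊢
    have h : (Ideal.Quotient.mk (Ideal.span {c}) (y1 + (dl (bR u J) q).1)) *
        (Ideal.Quotient.mk (Ideal.span {c}) (y2 + (dl (bR u J) q).2)) = 1 := by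
      rw [← quot_eq_zero, map_sub, map_mul, map_one] at hq
      exact sub_eq_zero.1 hq
    rw [dif_pos h, ← map_add, ← map_add]
    exact ⟨rfl, rfl⟩
  · intro p hp
    simp only [Finset.mem_filter, Finset.mem_univ, true_and, gk, dl_b2, Prod.mk_add_mk,
      Prod.mk.injEq] at hp
    have h : (Ideal.Quotient.mk (Ideal.span {c}) (y1 + (dl (bR u J) p.2).1)) *
        (Ideal.Quotient.mk (Ideal.span {c}) (y2 + (dl (bR u J) p.2).2)) = 1 := by
      rw [map_add, map_add, ← hp.1, ← hp.2]; simp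
    refine Prod.ext ?_ rfl
    simp only
    rw [dif_pos h]
    apply Units.ext
    rw [Units.val_mkOfMulEqOne, map_add, ← hp.1]
  · intro q hq
    rfl

lemma kloost (hd : 0 < d) (hn : ¬ IsSquare d) : ∃ C : ℝ, 1 ≤ C ∧ ∀ (c u v : ℤ√d), c ≠ 0 →
    u * v = 1 → ∀ J K0 : ℕ, 1 ≤ K0 → (1 + d) * (J : ℤ) ^ 2 ≤ c.norm.natAbs → ∀ y1 y2 : ℤ√d,
    |(cntq c u J y1 y2 : ℝ) - (Nat.card (Aq c)ˣ : ℝ) * (J : ℝ) ^ 16 / (c.norm.natAbs : ℝ) ^ 2| ≤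
      (C * K0 * (cont c : ℝ) ^ 6 * (c.norm.natAbs : ℝ) ^ (19 / 4 : ℝ)) ^ (1 / 5 : ℝ) * (J : ℝ) ^ 12
      + (1 + d) ^ 2 * (c.norm.natAbs : ℝ) ^ 2 * (J : ℝ) ^ 10 / K0 := by
  obtain ⟨C, hC, htrip⟩ := trip_bound (d := d) hn
  refine ⟨C, hC, fun c u v hc huv J K0 hK0 hJ y1 y2 => ?_⟩
  classical
  have := finite_quot hn hc
  let _ : Fintype (Aq c) := Fintype.ofFinite _
  set N := c.norm.natAbs with hN
  have hcard : Fintype.card (Aq c) = N := by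
    rw [← Nat.card_eq_fintype_card, card_quot hn hc]
  have hNpos : (0 : ℝ) < N := by
    have := norm_ne_zero' hn hc
    rw [hN]; exact_mod_cast Int.natAbs_pos.2 this
  have hdr : (0 : ℝ) < d := by exact_mod_cast hd
  set Sb : ℝ := (C * K0 * (cont c : ℝ) ^ 6 * (N : ℝ) ^ (19 / 4 : ℝ)) ^ (1 / 5 : ℝ) with hSb
  have hbase : 0 ≤ C * K0 * (cont c : ℝ) ^ 6 * (N : ℝ) ^ (19 / 4 : ℝ) := by positivity
  have hinj : Function.Injective (b2 c u J) := by
    intro p q h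
    have h1 := zij_inj hd hn huv J hJ (congrArg Prod.fst h)
    have h2 := zij_inj hd hn huv J hJ (congrArg Prod.snd h)
    exact Prod.ext h1 h2
  have hb := nsol_bound (gk (A := Aq c)) (b2 c u J) hinj
    (Ideal.Quotient.mk _ y1, Ideal.Quotient.mk _ y2) Sb
    ((J : ℝ) ^ 6 * (1 + d) ^ 2 * N / K0) (by positivity) (by positivity) (by
      intro χ hχ
      by_cases hs : K0 < (stab χ).card
      · right
        rw [← hcard]
        exact fhat_b2_small hd hn huv J K0 hK0 χ hχ hs
      · left
        have h5 := fhat_fifth χ (K0 : ℝ) (by exact_mod_cast not_lt.1 hs)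
        rw [hcard] at h5
        have h6 : ‖fhat gk χ‖ ^ 5 ≤ C * K0 * (cont c : ℝ) ^ 6 * (N : ℝ) ^ (19 / 4 : ℝ) := by
          refine h5.trans ?_
          have h7 := htrip c hc
          calc (K0 : ℝ) * ((N : ℝ) ^ 2 * trip (Aq c)) ≤
              K0 * ((N : ℝ) ^ 2 * (C * (cont c : ℝ) ^ 6 * (N : ℝ) ^ (11 / 4 : ℝ))) := by
                gcongr
            _ = C * K0 * (cont c : ℝ) ^ 6 * ((N : ℝ) ^ 2 * (N : ℝ) ^ (11 / 4 : ℝ)) := by ring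
            _ = _ := by
              rw [← Real.rpow_natCast (N : ℝ) 2, ← Real.rpow_add hNpos]; norm_num
        rw [hSb]
        have h8 : ‖fhat gk χ‖ = (‖fhat gk χ‖ ^ 5) ^ (1 / 5 : ℝ) := by
          rw [← Real.rpow_natCast, ← Real.rpow_mul (norm_nonneg _)]; norm_num
        rw [h8]
        exact Real.rpow_le_rpow (by positivity) h6 (by norm_num))
  rw [nsol_eq] at hb
  have hB : (Fintype.card ((Fin J × Fin J) × (Fin J × Fin J)) : ℝ) = (J : ℝ) ^ 4 := by
    simp; ring
  have hG : (Fintype.card (Aq c × Aq c) : ℝ) = (N : ℝ) ^ 2 := by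
    rw [Fintype.card_prod, hcard]; push_cast; ring
  have hP : (Fintype.card (Aq c)ˣ : ℝ) ≤ N := by
    rw [← hcard]
    exact_mod_cast Fintype.card_le_of_injective _ Units.val_injective
  rw [hB, hG] at hb
  rw [Nat.card_eq_fintype_card]
  refine le_trans (le_of_eq ?_) (hb.trans ?_)
  · congr 2; ring
  · have e1 : ((J : ℝ) ^ 4) ^ 3 = (J : ℝ) ^ 12 := by ring
    rw [e1]
    gcongr
    calc (J : ℝ) ^ 6 * (1 + d) ^ 2 * N / K0 * (Fintype.card (Aq c)ˣ) * (J : ℝ) ^ 4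
        ≤ (J : ℝ) ^ 6 * (1 + d) ^ 2 * N / K0 * N * (J : ℝ) ^ 4 := by gcongr
      _ = _ := by ring

end
end
end Equi

namespace Equi
open scoped BigOperators
noncomputable section
set_option linter.unusedSectionVars false
set_option linter.unusedDecidableInType false
set_option linter.unusedFintypeInType false

/-! ### Section 7: local densities -/

/-- number of vectors mod `n` whose reduction is in `B p` for all `p ∣ n`. -/
def cnt {ι : Type} (B : ∀ p : ℕ, Set (ι → ZMod p)) (n : ℕ) : ℕ :=
  Nat.card {v : ι → ZMod n // ∀ p ∈ n.primeFactors, (fun i => ((v i).cast : ZMod p)) ∈ B p}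

lemma cast_cast_zmod {n m p : ℕ} (h1 : m ∣ n) (h2 : p ∣ m) (x : ZMod n) :
    (((x.cast : ZMod m)).cast : ZMod p) = x.cast := by
  obtain ⟨k, rfl⟩ := ZMod.intCast_surjective x
  rw [ZMod.cast_intCast h1, ZMod.cast_intCast h2, ZMod.cast_intCast (h2.trans h1)]

lemma cnt_mul {ι : Type} (B : ∀ p : ℕ, Set (ι → ZMod p)) {m n : ℕ} (h : m.Coprime n)
    (hm : m ≠ 0) (hn : n ≠ 0) : cnt B (m * n) = cnt B m * cnt B n := by
  unfold cnt
  rw [← Nat.card_prod]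
  refine Nat.card_congr ?_
  refine Equiv.trans (Equiv.subtypeEquiv (((Equiv.refl ι).arrowCongr
    (ZMod.chineseRemainder h).toEquiv).trans (Equiv.arrowProdEquivProdArrow ι _ _))
    (q := fun w => (∀ p ∈ m.primeFactors, (fun i => ((w.1 i).cast : ZMod p)) ∈ B p) ∧
      (∀ p ∈ n.primeFactors, (fun i => ((w.2 i).cast : ZMod p)) ∈ B p)) ?_)
    (Equiv.subtypeProdEquivProd
      (p := fun w : ι → ZMod m => ∀ p ∈ m.primeFactors, (fun i => ((w i).cast : ZMod p)) ∈ B p)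
      (q := fun w : ι → ZMod n => ∀ p ∈ n.primeFactors, (fun i => ((w i).cast : ZMod p)) ∈ B p))
  intro v
  have e1 : ∀ i, ((ZMod.chineseRemainder h) (v i)).1 = (v i).cast := by
    intro i
    obtain ⟨k, hk⟩ := ZMod.intCast_surjective (v i)
    rw [← hk, ZMod.cast_intCast (Dvd.intro _ rfl), map_intCast]; rfl
  have e2 : ∀ i, ((ZMod.chineseRemainder h) (v i)).2 = (v i).cast := by
    intro i
    obtain ⟨k, hk⟩ := ZMod.intCast_surjective (v i)
    rw [← hk, ZMod.cast_intCast (Dvd.intro_left _ rfl), map_intCast]; rfl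
  simp only [Equiv.trans_apply, Equiv.arrowCongr_apply, Equiv.coe_refl, Equiv.refl_symm,
    Equiv.arrowProdEquivProdArrow_apply, Function.comp_def, id,
    RingEquiv.toEquiv_eq_coe, EquivLike.coe_coe, e1, e2]
  rw [Nat.primeFactors_mul hm hn]
  simp only [Finset.mem_union]
  constructor
  · intro H
    refine ⟨fun p hp => ?_, fun p hp => ?_⟩
    · have := H p (Or.inl hp)
      simpa only [cast_cast_zmod (Dvd.intro n rfl) (Nat.dvd_of_mem_primeFactors hp)] using this
    · have := H p (Or.inr hp)
      simpa only [cast_cast_zmod (Dvd.intro_left m rfl) (Nat.dvd_of_mem_primeFactors hp)] using this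
  · rintro ⟨H1, H2⟩ p (hp | hp)
    · have := H1 p hp
      simpa only [cast_cast_zmod (Dvd.intro n rfl) (Nat.dvd_of_mem_primeFactors hp)] using this
    · have := H2 p hp
      simpa only [cast_cast_zmod (Dvd.intro_left m rfl) (Nat.dvd_of_mem_primeFactors hp)] using this

lemma cnt_one {ι : Type} (B : ∀ p : ℕ, Set (ι → ZMod p)) : cnt B 1 = 1 := by
  unfold cnt
  rw [Nat.card_eq_one_iff_unique]
  refine ⟨⟨fun a b => Subtype.ext (Subsingleton.elim (α := ι → ZMod 1) _ _)⟩, ⟨⟨fun _ => 0, ?_⟩⟩⟩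
  simp

lemma cnt_prime {ι : Type} (B : ∀ p : ℕ, Set (ι → ZMod p)) {p : ℕ} (hp : p.Prime) :
    cnt B p = Nat.card (B p) := by
  unfold cnt
  refine Nat.card_congr (Equiv.subtypeEquivRight fun v => ?_)
  simp [hp.primeFactors, ZMod.cast_id]

lemma cnt_le_of_prime {ι : Type} (B : ∀ p : ℕ, Set (ι → ZMod p)) (k : ℕ)
    (hB : ∀ p : ℕ, p.Prime → cnt B p ≤ (2 * p) ^ k) {n : ℕ} (hn : Squarefree n) :
    cnt B n ≤ (n.divisors.card * n) ^ k := by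
  induction n using Nat.recOnPosPrimePosCoprime with
  | zero => simp at hn
  | one => simp [cnt_one]
  | prime_pow p m hp hm =>
    have hm1 : m = 1 := by
      by_contra hne
      have := (Nat.squarefree_pow_iff hp.ne_one hm.ne').1 hn
      exact hne this.2
    subst hm1
    rw [pow_one, hp.divisors, Finset.card_pair hp.one_lt.ne]
    exact hB p hp
  | coprime a b ha hb hab iha ihb =>
    have hs := Nat.squarefree_mul hab |>.1 hn
    rw [cnt_mul B hab (by lia) (by lia), hab.card_divisors_mul]
    refine (Nat.mul_le_mul (iha hs.1) (ihb hs.2)).trans (le_of_eq ?_)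
    rw [← mul_pow]; ring

/-- coprimality of `c0 + c1 √d` and `x0 + x1 √d` over a ring `S` -/
def cop {S : Type*} [CommRing S] (d : ℤ) (c x : Fin 2 → S) : Prop :=
  ∃ r s : Fin 2 → S, r 0 * c 0 + d * r 1 * c 1 + s 0 * x 0 + d * s 1 * x 1 = 1 ∧
    r 0 * c 1 + r 1 * c 0 + s 0 * x 1 + s 1 * x 0 = 0

lemma cop.symm {S : Type*} [CommRing S] {d : ℤ} {c x : Fin 2 → S} (h : cop d c x) :
    cop d x c := by
  obtain ⟨r, s, h1, h2⟩ := h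
  exact ⟨s, r, by linear_combination h1, by linear_combination h2⟩

lemma cop_of_norm {p : ℕ} (hp : p.Prime) {d : ℤ} {c x : Fin 2 → ZMod p}
    (h : c 0 ^ 2 ≠ d * c 1 ^ 2) : cop d c x := by
  have := Fact.mk hp
  have h' : c 0 ^ 2 - d * c 1 ^ 2 ≠ 0 := sub_ne_zero.2 h
  refine ⟨![c 0 / (c 0 ^ 2 - d * c 1 ^ 2), - c 1 / (c 0 ^ 2 - d * c 1 ^ 2)], ![0, 0], ?_, ?_⟩
  · simp
    field_simp
    ring
  · simp
    field_simp
    ring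

lemma card_norm_zero {p : ℕ} (hp : p.Prime) (d : ℤ) :
    Nat.card {x : Fin 2 → ZMod p // x 0 ^ 2 = d * x 1 ^ 2} ≤ 2 * p := by
  classical
  have := Fact.mk hp
  rw [Nat.card_eq_fintype_card, Fintype.card_subtype]
  refine (Finset.card_le_mul_card_image (f := fun x : Fin 2 → ZMod p => x 1) _ 2 ?_).trans ?_
  · intro b hb
    obtain ⟨w, hw, hwb⟩ := Finset.mem_image.1 hb
    rw [Finset.mem_filter] at hw
    refine (Finset.card_le_card (t := {![w 0, b], ![- w 0, b]}) ?_).trans Finset.card_le_two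
    intro y hy
    simp only [Finset.mem_filter, Finset.mem_univ, true_and] at hy
    have h1 : y 0 ^ 2 = w 0 ^ 2 := by rw [hy.1, hw.2, hy.2, hwb]
    rw [Finset.mem_insert, Finset.mem_singleton]
    rcases sq_eq_sq_iff_eq_or_eq_neg.1 h1 with h | h
    · left; ext i; fin_cases i <;> simp [h, hy.2]
    · right; ext i; fin_cases i <;> simp [h, hy.2]
  · refine Nat.mul_le_mul_left _ ((Finset.card_le_univ _).trans ?_)
    rw [ZMod.card]

/-- bad residues -/
def Bc (d : ℤ) (c : ℤ√d) (p : ℕ) : Set (Fin 2 → ZMod p) :=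
  {x | ¬ cop d ![(c.re : ZMod p), (c.im : ZMod p)] x}

def B4 (d : ℤ) (p : ℕ) : Set (Fin 2 ⊕ Fin 2 → ZMod p) :=
  {x | ¬ cop d (fun i => x (Sum.inl i)) (fun i => x (Sum.inr i))}

lemma Bc_prime (d : ℤ) (c : ℤ√d) {p : ℕ} (hp : p.Prime) : cnt (Bc d c) p ≤ (2 * p) ^ 1 := by
  have := Fact.mk hp
  rw [cnt_prime _ hp, pow_one]
  refine le_trans ?_ (card_norm_zero hp d)
  refine Nat.card_le_card_of_injective
    (fun x : Bc d c p => ⟨x.1, by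
      by_contra h
      exact x.2 (cop_of_norm hp h).symm⟩) ?_
  intro a b h
  simp only [Subtype.mk.injEq] at h
  exact Subtype.ext h

lemma Bc_dvd (d : ℤ) (c : ℤ√d) {p : ℕ} (hp : p.Prime) (x : Fin 2 → ZMod p) (hx : x ∈ Bc d c p) :
    p ∣ c.norm.natAbs := by
  by_contra h
  refine hx (cop_of_norm hp ?_)
  intro h2
  apply h
  rw [← Int.natCast_dvd, ← ZMod.intCast_zmod_eq_zero_iff_dvd]
  simp only [Matrix.cons_val_zero, Matrix.cons_val_one] at h2
  rw [Zsqrtd.norm]; push_cast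
  linear_combination h2

lemma B4_prime (d : ℤ) {p : ℕ} (hp : p.Prime) : cnt (B4 d) p ≤ (2 * p) ^ 2 := by
  have := Fact.mk hp
  rw [cnt_prime _ hp, sq]
  refine le_trans ?_ (Nat.mul_le_mul (card_norm_zero hp d) (card_norm_zero hp d))
  rw [← Nat.card_prod]
  refine Nat.card_le_card_of_injective
    (fun x : B4 d p => (⟨fun i => x.1 (Sum.inl i), by
      by_contra h
      exact x.2 (cop_of_norm hp h)⟩, ⟨fun i => x.1 (Sum.inr i), by
      by_contra h
      exact x.2 (cop_of_norm hp h).symm⟩)) ?_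
  intro a b h
  have h1 := congrArg (fun q => q.1.1) h
  have h2 := congrArg (fun q => q.2.1) h
  refine Subtype.ext (funext fun i => ?_)
  rcases i with i | i
  · exact congrFun h1 i
  · exact congrFun h2 i

lemma B4_lt (d : ℤ) {p : ℕ} (hp : p.Prime) : cnt (B4 d) p < p ^ 4 := by
  classical
  have := Fact.mk hp
  rw [cnt_prime _ hp, Nat.card_eq_fintype_card]
  have : Fintype.card (Fin 2 ⊕ Fin 2 → ZMod p) = p ^ 4 := by simp [ZMod.card]
  rw [← this]
  refine Fintype.card_subtype_lt (x := Sum.elim ![1, 0] ![0, 0]) ?_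
  intro h
  exact h ⟨![1, 0], ![0, 0], by simp, by simp⟩

lemma sum_zmod {M : Type*} [AddCommMonoid M] (n : ℕ) [NeZero n] (f : ZMod n → M) :
    ∑ x, f x = ∑ i ∈ Finset.range n, f (i : ZMod n) := by
  refine Finset.sum_nbij' (fun x => x.val) (fun i => (i : ZMod n)) ?_ ?_ ?_ ?_ ?_
  · intro x _; exact Finset.mem_range.2 (ZMod.val_lt x)
  · intro i _; exact Finset.mem_univ _
  · intro x _; simp
  · intro i hi; exact ZMod.val_cast_of_lt (Finset.mem_range.1 hi)
  · intro x _; simp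

open Classical in
lemma cnt_eq_sum {ι : Type} [Fintype ι] [DecidableEq ι] (B : ∀ p : ℕ, Set (ι → ZMod p)) (n : ℕ) [NeZero n] :
    cnt B n = ∑ v : ι → ZMod n,
      if ∀ p ∈ n.primeFactors, (fun i => ((v i).cast : ZMod p)) ∈ B p then 1 else 0 := by
  unfold cnt
  rw [Nat.card_eq_fintype_card, Fintype.card_subtype, Finset.card_filter]

/-- Fubini for the local counts. -/
lemma sum_cnt (d : ℤ) (n : ℕ) [NeZero n] :
    ∑ i ∈ Finset.range n, ∑ j ∈ Finset.range n, cnt (Bc d ⟨i, j⟩) n = cnt (B4 d) n := by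
  classical
  rw [cnt_eq_sum (B4 d) n, ← (Equiv.sumArrowEquivProdArrow (Fin 2) (Fin 2) (ZMod n)).symm.sum_comp,
    Fintype.sum_prod_type, ← (finTwoArrowEquiv (ZMod n)).symm.sum_comp, Fintype.sum_prod_type,
    sum_zmod]
  refine Finset.sum_congr rfl fun i _ => ?_
  rw [sum_zmod]
  refine Finset.sum_congr rfl fun j _ => ?_
  rw [cnt_eq_sum]
  refine Finset.sum_congr rfl fun v _ => ?_
  refine if_congr (forall₂_congr fun p hp => ?_) rfl rfl
  have hpn := Nat.dvd_of_mem_primeFactors hp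
  unfold Bc B4
  rw [Set.mem_ofPred_eq, Set.mem_ofPred_eq]
  have e : (fun k => ((((Equiv.sumArrowEquivProdArrow (Fin 2) (Fin 2) (ZMod n)).symm
      ((finTwoArrowEquiv (ZMod n)).symm ((i : ZMod n), (j : ZMod n)), v)) (Sum.inl k)).cast : ZMod p))
      = ![((i : ℤ) : ZMod p), ((j : ℤ) : ZMod p)] := by
    funext k
    fin_cases k <;> simp [ZMod.cast_natCast hpn]
  rw [e]
  rfl

end
end Equi

namespace Equi
open scoped BigOperators
noncomputable section
set_option linter.unusedSectionVars false
set_option linter.unusedDecidableInType false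
set_option linter.unusedFintypeInType false

/-! ### Section 8: the density of units mod `c` -/
section
variable {d : ℤ}

def rho (c : ℤ√d) : ℝ := (Nat.card (Aq c)ˣ : ℝ) / (c.norm.natAbs : ℝ)

lemma isUnit_mk_iff {c x : ℤ√d} :
    IsUnit (Ideal.Quotient.mk (Ideal.span {c}) x) ↔ ∃ r s : ℤ√d, r * c + s * x = 1 := by
  constructor
  · intro h
    obtain ⟨y, hy⟩ := h.exists_right_inv
    obtain ⟨s, rfl⟩ := Ideal.Quotient.mk_surjective y
    rw [← map_mul, ← map_one (Ideal.Quotient.mk (Ideal.span {c})), Ideal.Quotient.eq,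
      Ideal.mem_span_singleton] at hy
    obtain ⟨r, hr⟩ := hy
    exact ⟨-r, s, by linear_combination hr⟩
  · rintro ⟨r, s, h⟩
    refine IsUnit.of_mul_eq_one (Ideal.Quotient.mk _ s) ?_
    rw [← map_mul, ← map_one (Ideal.Quotient.mk (Ideal.span {c})), Ideal.Quotient.eq,
      Ideal.mem_span_singleton]
    exact ⟨-r, by linear_combination h⟩

lemma isUnit_iff_cop (hn : ¬ IsSquare d) {c : ℤ√d} (hc : c ≠ 0) (x : ℤ√d) :
    IsUnit (Ideal.Quotient.mk (Ideal.span {c}) x) ↔ ∀ p ∈ c.norm.natAbs.primeFactors,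
      cop d ![(c.re : ZMod p), (c.im : ZMod p)] ![(x.re : ZMod p), (x.im : ZMod p)] := by
  rw [isUnit_mk_iff]
  constructor
  · rintro ⟨r, s, h⟩ p hp
    have h1 := congrArg (fun z : ℤ√d => (z.re : ZMod p)) h
    have h2 := congrArg (fun z : ℤ√d => (z.im : ZMod p)) h
    refine ⟨![(r.re : ZMod p), (r.im : ZMod p)], ![(s.re : ZMod p), (s.im : ZMod p)], ?_, ?_⟩
    · simp at h1 ⊢
      linear_combination h1
    · simp at h2 ⊢
      linear_combination h2
  · intro H
    by_contra hcon
    have hne : Ideal.span {c, x} ≠ ⊤ := by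
      intro htop
      apply hcon
      have h1 : (1 : ℤ√d) ∈ Ideal.span {c, x} := by rw [htop]; trivial
      obtain ⟨r, s, h⟩ := Ideal.mem_span_pair.1 h1
      exact ⟨r, s, h⟩
    obtain ⟨M, hM, hle⟩ := Ideal.exists_le_maximal _ hne
    have hcM : c ∈ M := hle (Ideal.subset_span (by simp))
    have hxM : x ∈ M := hle (Ideal.subset_span (by simp))
    have hP : M.IsPrime := hM.isPrime
    have hm0 : c.norm.natAbs ≠ 0 := Int.natAbs_ne_zero.2 (norm_ne_zero' hn hc)
    have hNM : ((c.norm.natAbs : ℕ) : ℤ√d) ∈ M := by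
      have h1 : ((c.norm : ℤ) : ℤ√d) ∈ M := by
        rw [Zsqrtd.norm_eq_mul_conj]; exact M.mul_mem_right _ hcM
      rcases Int.natAbs_eq c.norm with h | h
      · rw [h] at h1; simpa using h1
      · rw [h] at h1; simpa using h1
    have hex : ∃ p ∈ c.norm.natAbs.primeFactors, ((p : ℕ) : ℤ√d) ∈ M := by
      by_contra hno
      push Not at hno
      have : ∀ l : List ℕ, (∀ p ∈ l, ((p : ℕ) : ℤ√d) ∉ M) → ((l.prod : ℕ) : ℤ√d) ∉ M := by
        intro l
        induction l with
        | nil => intro _ h1; exact hP.ne_top ((Ideal.eq_top_iff_one _).2 (by simpa using h1))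
        | cons a l ih =>
          intro hl h1
          rw [List.prod_cons, Nat.cast_mul] at h1
          rcases hP.mem_or_mem h1 with h2 | h2
          · exact hl a (by simp) h2
          · exact ih (fun p hp => hl p (by simp [hp])) h2
      have h2 := this c.norm.natAbs.primeFactorsList (fun p hp => hno p (by
        rw [← Nat.toFinset_factors]; simpa using hp))
      rw [Nat.prod_primeFactorsList hm0] at h2
      exact h2 hNM
    obtain ⟨p, hp, hpM⟩ := hex
    obtain ⟨r, s, h1, h2⟩ := H p hp
    obtain ⟨r0, hr0⟩ := ZMod.intCast_surjective (r 0)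
    obtain ⟨r1, hr1⟩ := ZMod.intCast_surjective (r 1)
    obtain ⟨s0, hs0⟩ := ZMod.intCast_surjective (s 0)
    obtain ⟨s1, hs1⟩ := ZMod.intCast_surjective (s 1)
    simp only [Matrix.cons_val_zero, Matrix.cons_val_one, ← hr0, ← hr1, ← hs0, ← hs1] at h1 h2
    have g1 : ((r0 * c.re + d * r1 * c.im + s0 * x.re + d * s1 * x.im - 1 : ℤ) : ZMod p) = 0 := by
      push_cast; rw [h1]; ring
    have g2 : ((r0 * c.im + r1 * c.re + s0 * x.im + s1 * x.re : ℤ) : ZMod p) = 0 := by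
      push_cast; rw [h2]
    rw [ZMod.intCast_zmod_eq_zero_iff_dvd] at g1 g2
    obtain ⟨t1, ht1⟩ := g1
    obtain ⟨t2, ht2⟩ := g2
    have key : (⟨r0, r1⟩ : ℤ√d) * c + (⟨s0, s1⟩ : ℤ√d) * x - (p : ℤ√d) * ⟨t1, t2⟩ = 1 := by
      ext
      · simp; linear_combination ht1
      · simp; linear_combination ht2
    have : (1 : ℤ√d) ∈ M := by
      rw [← key]
      exact M.sub_mem (M.add_mem (M.mul_mem_left _ hcM) (M.mul_mem_left _ hxM))
        (M.mul_mem_right _ hpM)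
    exact hP.ne_top ((Ideal.eq_top_iff_one _).2 this)

lemma exists_red (c : ℤ√d) : ∃ f : (Fin 2 → ZMod c.norm.natAbs) →+ Aq c,
    Function.Surjective f ∧ ∀ x : ℤ√d,
      f ![(x.re : ZMod c.norm.natAbs), (x.im : ZMod c.norm.natAbs)] = Ideal.Quotient.mk _ x := by
  set m := c.norm.natAbs with hm
  have hz : ∀ y : ℤ√d, Ideal.Quotient.mk (Ideal.span {c}) (((m : ℤ) : ℤ√d) * y) = 0 := by
    intro y
    rw [quot_eq_zero]
    have h1 : c ∣ ((c.norm : ℤ) : ℤ√d) := ⟨star c, Zsqrtd.norm_eq_mul_conj c⟩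
    refine Dvd.dvd.mul_right ?_ _
    rcases Int.natAbs_eq c.norm with h | h
    · rw [h] at h1; exact h1
    · rw [h, Int.cast_neg, dvd_neg] at h1; exact h1
  let g : ℤ√d → (ℤ →+ Aq c) := fun y =>
    ((Ideal.Quotient.mk (Ideal.span {c})).toAddMonoidHom.comp (AddMonoidHom.mulRight y)).comp
      (Int.castAddHom (ℤ√d))
  have hg : ∀ y k, g y k = Ideal.Quotient.mk (Ideal.span {c}) ((k : ℤ√d) * y) := fun y k => rfl
  let L : ℤ√d → (ZMod m →+ Aq c) := fun y => ZMod.lift m ⟨g y, by rw [hg]; exact hz y⟩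
  have hL : ∀ y (k : ℤ), L y (k : ZMod m) = Ideal.Quotient.mk (Ideal.span {c}) ((k : ℤ√d) * y) := by
    intro y k
    simp only [L]
    rw [ZMod.lift_coe]
    exact hg y k
  let f : (Fin 2 → ZMod m) →+ Aq c :=
    (L 1).comp (Pi.evalAddMonoidHom _ 0) + (L ⟨0, 1⟩).comp (Pi.evalAddMonoidHom _ 1)
  have hf : ∀ x : ℤ√d, f ![(x.re : ZMod m), (x.im : ZMod m)] = Ideal.Quotient.mk _ x := by
    intro x
    have : f ![(x.re : ZMod m), (x.im : ZMod m)] = L 1 (x.re : ZMod m) + L ⟨0, 1⟩ (x.im : ZMod m) :=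
      rfl
    rw [this, hL, hL, ← map_add]
    congr 1
    ext <;> simp
  refine ⟨f, ?_, hf⟩
  intro y
  obtain ⟨x, rfl⟩ := Ideal.Quotient.mk_surjective y
  exact ⟨_, hf x⟩

open ArithmeticFunction in
lemma rho_eq (hn : ¬ IsSquare d) {c : ℤ√d} (hc : c ≠ 0) :
    rho c = ∑ n ∈ (∏ p ∈ c.norm.natAbs.primeFactors, p).divisors,
      (ArithmeticFunction.moebius n : ℝ) * ((cnt (Bc d c) n : ℝ) / (n : ℝ) ^ 2) := by
  classical
  set m := c.norm.natAbs with hm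
  obtain ⟨f, hfs, hf⟩ := exists_red c
  change (Fin 2 → ZMod m) →+ Aq c at f
  set r := ∏ p ∈ m.primeFactors, p with hr
  have hm0 : m ≠ 0 := Int.natAbs_ne_zero.2 (norm_ne_zero' hn hc)
  have hm0' : (m : ℝ) ≠ 0 := by exact_mod_cast hm0
  have : NeZero m := ⟨hm0⟩
  have hfin := finite_quot hn hc
  let _ : Fintype (Aq c) := Fintype.ofFinite _
  have hcard : Fintype.card (Aq c) = m := by
    rw [← Nat.card_eq_fintype_card, card_quot hn hc]
  have hcount := surj_count f hfs (fun y => IsUnit y)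
  have hu : (Finset.univ.filter fun y : Aq c => IsUnit y).card = Nat.card (Aq c)ˣ := by
    rw [Nat.card_eq_fintype_card, ← Fintype.card_subtype]
    exact Fintype.card_congr (Equiv.ofBijective (fun u : (Aq c)ˣ => (⟨(u : Aq c), u.isUnit⟩ :
      {y : Aq c // IsUnit y})) ⟨fun a b h => Units.ext (congrArg Subtype.val h),
      fun y => ⟨y.2.unit, Subtype.ext rfl⟩⟩).symm
  rw [hcard, hu] at hcount
  have hcm : Fintype.card (Fin 2 → ZMod m) = m ^ 2 := by simp [ZMod.card]
  rw [hcm] at hcount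
  have hrsq : Squarefree r := by
    refine Finset.squarefree_prod_of_pairwise_isCoprime (fun p hp q hq hpq => ?_) (fun p hp => ?_)
    · exact Nat.coprime_iff_isRelPrime.1 ((Nat.coprime_primes (Nat.prime_of_mem_primeFactors hp)
        (Nat.prime_of_mem_primeFactors hq)).2 hpq)
    · exact (Nat.prime_of_mem_primeFactors hp).prime.squarefree
  have hrp : r.primeFactors = m.primeFactors := Nat.primeFactors_prod_primeFactors m
  have hrm : r ∣ m := Nat.prod_primeFactors_dvd m
  have hstep : ∀ v : Fin 2 → ZMod m, (if IsUnit (f v) then (1 : ℝ) else 0) =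
      ∑ n ∈ r.divisors, (ArithmeticFunction.moebius n : ℝ) *
        (if ∀ p ∈ n.primeFactors, (fun i => ((v i).cast : ZMod p)) ∈ Bc d c p then (1 : ℝ) else 0) := by
    intro v
    let G : ArithmeticFunction ℝ := prodPrimeFactors
      (fun p => if (fun i => ((v i).cast : ZMod p)) ∈ Bc d c p then (1 : ℝ) else 0)
    have hG : ∀ n ∈ r.divisors, G n =
        if ∀ p ∈ n.primeFactors, (fun i => ((v i).cast : ZMod p)) ∈ Bc d c p then (1 : ℝ) else 0 := by
      intro n hnr
      have : G n = _ := prodPrimeFactors_apply (Nat.pos_of_mem_divisors hnr).ne'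
      rw [this, Finset.prod_ite_zero]
      simp
    have h1 := IsMultiplicative.prodPrimeFactors_one_sub_of_squarefree G
      (IsMultiplicative.prodPrimeFactors _) hrsq
    rw [Finset.sum_congr rfl fun n hnr => congrArg (fun t => (ArithmeticFunction.moebius n : ℝ) * t) (hG n hnr).symm,
      ← h1, hrp]
    obtain ⟨a, ha⟩ := ZMod.intCast_surjective (v 0)
    obtain ⟨b, hb⟩ := ZMod.intCast_surjective (v 1)
    have hv : v = ![(((⟨a, b⟩ : ℤ√d).re : ℤ) : ZMod m), (((⟨a, b⟩ : ℤ√d).im : ℤ) : ZMod m)] := by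
      funext i; fin_cases i <;> simp [ha, hb]
    have hvp : ∀ p ∈ m.primeFactors, (fun i => ((v i).cast : ZMod p)) =
        ![((a : ℤ) : ZMod p), ((b : ℤ) : ZMod p)] := by
      intro p hp
      have hpm := Nat.dvd_of_mem_primeFactors hp
      funext i; fin_cases i <;> simp [← ha, ← hb, ZMod.cast_intCast hpm]
    have h2 : ∀ p ∈ m.primeFactors, (1 - G p) =
        if cop d ![(c.re : ZMod p), (c.im : ZMod p)] ![((a : ℤ) : ZMod p), ((b : ℤ) : ZMod p)]
          then (1 : ℝ) else 0 := by
      intro p hp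
      have hpp := Nat.prime_of_mem_primeFactors hp
      rw [hG p (by
        rw [Nat.mem_divisors]
        exact ⟨Finset.dvd_prod_of_mem _ hp, hrsq.ne_zero⟩), hpp.primeFactors]
      simp only [Finset.mem_singleton, forall_eq]
      rw [hvp p hp]
      unfold Bc
      rw [Set.mem_ofPred_eq]
      by_cases hq : cop d ![(c.re : ZMod p), (c.im : ZMod p)]
        ![((a : ℤ) : ZMod p), ((b : ℤ) : ZMod p)]
      · rw [if_pos hq, if_neg (not_not.2 hq), sub_zero]
      · rw [if_neg hq, if_pos hq, sub_self]
    rw [Finset.prod_congr rfl h2, Finset.prod_ite_zero, hv, hf, Finset.prod_const_one]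
    exact if_congr (isUnit_iff_cop hn hc _) rfl rfl
  have hlhs : ((Finset.univ.filter fun v : Fin 2 → ZMod m => IsUnit (f v)).card : ℝ) =
      (m : ℝ) ^ 2 * ∑ n ∈ r.divisors, (ArithmeticFunction.moebius n : ℝ) * ((cnt (Bc d c) n : ℝ) / (n : ℝ) ^ 2) := by
    rw [Finset.card_filter]
    push_cast
    rw [Finset.sum_congr rfl fun v _ => hstep v, Finset.sum_comm, Finset.mul_sum]
    refine Finset.sum_congr rfl fun n hnr => ?_
    rw [← Finset.mul_sum]
    have hn0 := (Nat.pos_of_mem_divisors hnr).ne'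
    have hnm : n ∣ m := (Nat.dvd_of_mem_divisors hnr).trans hrm
    have : NeZero n := ⟨hn0⟩
    have hs := surj_count
      ((AddMonoidHom.compLeft (ZMod.castHom hnm (ZMod n)).toAddMonoidHom (Fin 2)))
      (by
        intro w
        obtain ⟨g, hg⟩ := (ZMod.castHom_surjective hnm).comp_left w
        exact ⟨g, hg⟩)
      (fun w => ∀ p ∈ n.primeFactors, (fun i => ((w i).cast : ZMod p)) ∈ Bc d c p)
    have hcn : Fintype.card (Fin 2 → ZMod n) = n ^ 2 := by simp [ZMod.card]
    rw [hcn, hcm] at hs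
    have hc2 : (Finset.univ.filter fun w : Fin 2 → ZMod n =>
        ∀ p ∈ n.primeFactors, (fun i => ((w i).cast : ZMod p)) ∈ Bc d c p).card
        = cnt (Bc d c) n := by
      rw [cnt_eq_sum, Finset.card_filter]
    rw [hc2] at hs
    have hc3 : (Finset.univ.filter fun v : Fin 2 → ZMod m => ∀ p ∈ n.primeFactors,
        (fun i => (((AddMonoidHom.compLeft (ZMod.castHom hnm (ZMod n)).toAddMonoidHom (Fin 2) v)
          i).cast : ZMod p)) ∈ Bc d c p)
        = (Finset.univ.filter fun v : Fin 2 → ZMod m => ∀ p ∈ n.primeFactors,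
          (fun i => ((v i).cast : ZMod p)) ∈ Bc d c p) := by
      refine Finset.filter_congr fun v _ => forall₂_congr fun p hp => ?_
      have : (fun i => (((AddMonoidHom.compLeft (ZMod.castHom hnm (ZMod n)).toAddMonoidHom (Fin 2) v)
          i).cast : ZMod p)) = fun i => ((v i).cast : ZMod p) := by
        funext i
        exact cast_cast_zmod hnm (Nat.dvd_of_mem_primeFactors hp) (v i)
      rw [this]
    rw [hc3] at hs
    rw [← Finset.natCast_card_filter]
    have hn0' : (n : ℝ) ≠ 0 := by exact_mod_cast hn0
    have hs' := congrArg (fun k : ℕ => (k : ℝ)) hs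
    push_cast at hs'
    field_simp
    linear_combination (ArithmeticFunction.moebius n : ℝ) * hs'
  have hcount' := congrArg (fun k : ℕ => (k : ℝ)) hcount
  push_cast at hcount'
  rw [hlhs] at hcount'
  unfold rho
  rw [div_eq_iff hm0']
  have : (m : ℝ) ^ 2 ≠ 0 := by positivity
  apply mul_left_cancel₀ this
  rw [← hcount']; ring

end
end
end Equi

namespace Equi
open scoped BigOperators
noncomputable section
set_option linter.unusedSectionVars false
set_option linter.unusedDecidableInType false
set_option linter.unusedFintypeInType false

/-! ### Section 9: the mean value of `rho` -/
section
variable {d : ℤ}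

lemma periodic_sum (n : ℕ) [NeZero n] (g : ZMod n → ℝ) (h0 : ∀ x, 0 ≤ g x) (h1 : ∀ x, g x ≤ 1)
    (J : ℕ) : ∀ a : ZMod n, |∑ i ∈ Finset.range J, g (a + (i : ℕ)) - (J : ℝ) / n * ∑ x, g x| ≤ n := by
  have hn0 : (0 : ℝ) < n := by exact_mod_cast Nat.pos_of_ne_zero (NeZero.ne n)
  induction J using Nat.strong_induction_on with
  | _ J ih =>
    intro a
    by_cases hJ : J < n
    · have hJ' : (J : ℝ) ≤ n := by exact_mod_cast hJ.le
      have e1 : 0 ≤ ∑ i ∈ Finset.range J, g (a + (i : ℕ)) := Finset.sum_nonneg fun _ _ => h0 _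
      have e2 : ∑ i ∈ Finset.range J, g (a + (i : ℕ)) ≤ J := by
        refine (Finset.sum_le_sum fun i _ => h1 _).trans ?_; simp
      have e3 : 0 ≤ ∑ x, g x := Finset.sum_nonneg fun _ _ => h0 _
      have e4 : ∑ x, g x ≤ n := by
        refine (Finset.sum_le_sum fun i _ => h1 _).trans ?_; simp [ZMod.card]
      have e5 : (J : ℝ) / n * ∑ x, g x ≤ J := by
        calc (J : ℝ) / n * ∑ x, g x ≤ J / n * n := by gcongr
          _ = J := by field_simp
      have e6 : 0 ≤ (J : ℝ) / n * ∑ x, g x := by positivity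
      rw [abs_le]; constructor <;> linarith
    · obtain ⟨k, rfl⟩ := Nat.exists_eq_add_of_le (not_lt.1 hJ)
      have hk := ih k (by have := NeZero.pos n; omega) a
      have e : ∑ i ∈ Finset.range (n + k), g (a + (i : ℕ)) =
          ∑ x, g x + ∑ i ∈ Finset.range k, g (a + (i : ℕ)) := by
        rw [Finset.sum_range_add]
        congr 1
        · rw [← Equiv.sum_comp (Equiv.addLeft a) g, sum_zmod]; rfl
        · refine Finset.sum_congr rfl fun i _ => ?_
          congr 2; push_cast; simp
      rw [e]
      convert hk using 2
      push_cast
      field_simp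
      ring

lemma cnt_Bc_congr (n : ℕ) (c c' : ℤ√d) (h1 : (c.re : ZMod n) = c'.re)
    (h2 : (c.im : ZMod n) = c'.im) : cnt (Bc d c) n = cnt (Bc d c') n := by
  unfold cnt
  refine Nat.card_congr (Equiv.subtypeEquivRight fun v => forall₂_congr fun p hp => ?_)
  have hpn := Nat.dvd_of_mem_primeFactors hp
  unfold Bc
  rw [Set.mem_ofPred_eq, Set.mem_ofPred_eq]
  have e1 : (c.re : ZMod p) = c'.re := by
    have := congrArg (fun x : ZMod n => (x.cast : ZMod p)) h1
    simpa only [ZMod.cast_intCast hpn] using this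
  have e2 : (c.im : ZMod p) = c'.im := by
    have := congrArg (fun x : ZMod n => (x.cast : ZMod p)) h2
    simpa only [ZMod.cast_intCast hpn] using this
  rw [e1, e2]

lemma cnt_Bc_le (n : ℕ) [NeZero n] (c : ℤ√d) : cnt (Bc d c) n ≤ n ^ 2 := by
  unfold cnt
  refine (Finite.card_subtype_le _).trans (le_of_eq ?_)
  rw [Nat.card_eq_fintype_card]; simp [ZMod.card]

def sn (d : ℤ) (n : ℕ) : ℝ := (cnt (B4 d) n : ℝ) / (n : ℝ) ^ 4

lemma beta_avg (n : ℕ) [NeZero n] (J : ℕ) (a b : ℤ) :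
    |∑ i ∈ Finset.range J, ∑ j ∈ Finset.range J,
      (cnt (Bc d ⟨a + i, b + j⟩) n : ℝ) / (n : ℝ) ^ 2 - (J : ℝ) ^ 2 * sn d n| ≤ 2 * J * n := by
  have hn0 : (0 : ℝ) < n := by exact_mod_cast Nat.pos_of_ne_zero (NeZero.ne n)
  let g : ZMod n → ZMod n → ℝ := fun x y => (cnt (Bc d ⟨x.val, y.val⟩) n : ℝ) / (n : ℝ) ^ 2
  have g0 : ∀ x y, 0 ≤ g x y := fun x y => by positivity
  have g1 : ∀ x y, g x y ≤ 1 := fun x y => by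
    have h := cnt_Bc_le n (⟨x.val, y.val⟩ : ℤ√d)
    rw [div_le_one (by positivity)]
    exact_mod_cast h
  have hg : ∀ x y : ℤ, (cnt (Bc d ⟨x, y⟩) n : ℝ) / (n : ℝ) ^ 2 = g (x : ZMod n) (y : ZMod n) := by
    intro x y
    simp only [g]
    rw [cnt_Bc_congr n ⟨x, y⟩ ⟨((x : ZMod n).val : ℕ), ((y : ZMod n).val : ℕ)⟩ (by simp) (by simp)]
  have hs : (J : ℝ) ^ 2 * sn d n = J / n * ∑ y, (J / n * ∑ x, g x y) := by
    have h1 : ∑ y, ∑ x, g x y = cnt (B4 d) n / (n : ℝ) ^ 2 := by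
      rw [Finset.sum_comm, sum_zmod, ← sum_cnt d n]
      push_cast
      rw [Finset.sum_div]
      refine Finset.sum_congr rfl fun i _ => ?_
      rw [sum_zmod, Finset.sum_div]
      refine Finset.sum_congr rfl fun j _ => ?_
      have := hg i j
      rw [this]; simp
    rw [← Finset.mul_sum, h1, sn]
    field_simp
  rw [hs, Finset.sum_comm]
  have e1 : ∀ j : ℕ, |∑ i ∈ Finset.range J, (cnt (Bc d ⟨a + i, b + j⟩) n : ℝ) / (n : ℝ) ^ 2 -
      (J : ℝ) / n * ∑ x, g x ((b : ZMod n) + (j : ℕ))| ≤ n := by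
    intro j
    have := periodic_sum n (fun x => g x ((b : ZMod n) + (j : ℕ))) (fun x => g0 _ _)
      (fun x => g1 _ _) J (a : ZMod n)
    convert this using 4 with i hi
    rw [hg]; push_cast; rfl
  have e2 := periodic_sum n (fun y => (∑ x, g x y) / n)
    (fun y => div_nonneg (Finset.sum_nonneg fun x _ => g0 _ _) hn0.le)
    (fun y => by
      rw [div_le_one hn0]
      refine (Finset.sum_le_sum fun i _ => g1 _ _).trans ?_; simp [ZMod.card]) J (b : ZMod n)
  have e3 : |∑ j ∈ Finset.range J, (J : ℝ) / n * ∑ x, g x ((b : ZMod n) + (j : ℕ)) -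
      J / n * ∑ y, (J / n * ∑ x, g x y)| ≤ J * n := by
    have : ∑ j ∈ Finset.range J, (J : ℝ) / n * ∑ x, g x ((b : ZMod n) + (j : ℕ)) -
      J / n * ∑ y, (J / n * ∑ x, g x y) = J * (∑ j ∈ Finset.range J,
        (∑ x, g x ((b : ZMod n) + (j : ℕ))) / n - (J : ℝ) / n * ∑ y, (∑ x, g x y) / n) := by
      simp only [← Finset.mul_sum, ← Finset.sum_div]; ring
    rw [this, abs_mul, abs_of_nonneg (by positivity : (0 : ℝ) ≤ J)]
    gcongr
  calc _ ≤ |∑ j ∈ Finset.range J, (∑ i ∈ Finset.range J,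
        (cnt (Bc d ⟨a + i, b + j⟩) n : ℝ) / (n : ℝ) ^ 2 -
          (J : ℝ) / n * ∑ x, g x ((b : ZMod n) + (j : ℕ)))| +
        |∑ j ∈ Finset.range J, (J : ℝ) / n * ∑ x, g x ((b : ZMod n) + (j : ℕ)) -
          J / n * ∑ y, (J / n * ∑ x, g x y)| := by
        rw [Finset.sum_sub_distrib]
        exact abs_sub_le _ _ _
    _ ≤ J * n + J * n := by
        refine add_le_add ((Finset.abs_sum_le_sum_abs _ _).trans
          ((Finset.sum_le_sum fun j _ => e1 j).trans ?_)) e3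
        simp
    _ = _ := by ring

lemma rho_trunc (hn : ¬ IsSquare d) {c : ℤ√d} (hc : c ≠ 0) (D : ℝ)
    (hD : (c.norm.natAbs.divisors.card : ℝ) ≤ D) (Y : ℕ) (hY : 1 ≤ Y) :
    |rho c - ∑ n ∈ Finset.range (Y + 1),
      (ArithmeticFunction.moebius n : ℝ) * ((cnt (Bc d c) n : ℝ) / (n : ℝ) ^ 2)| ≤ D ^ 2 / Y := by
  classical
  rw [rho_eq hn hc]
  set m := c.norm.natAbs with hm
  set r := ∏ p ∈ m.primeFactors, p with hr
  have hm0 : m ≠ 0 := Int.natAbs_ne_zero.2 (norm_ne_zero' hn hc)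
  have hrm : r ∣ m := Nat.prod_primeFactors_dvd m
  have hr0 : r ≠ 0 := fun h => hm0 (Nat.eq_zero_of_zero_dvd (h ▸ hrm))
  have hY0 : (0 : ℝ) < Y := by exact_mod_cast hY
  set a : ℕ → ℝ := fun n =>
    (ArithmeticFunction.moebius n : ℝ) * ((cnt (Bc d c) n : ℝ) / (n : ℝ) ^ 2) with ha
  have hzero : ∀ n, n ∉ r.divisors → a n = 0 := by
    intro n hnr
    by_cases hs : Squarefree n
    · have : ∃ p, p.Prime ∧ p ∣ n ∧ ¬ p ∣ m := by
        by_contra hcon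
        push Not at hcon
        apply hnr
        rw [Nat.mem_divisors]
        refine ⟨?_, hr0⟩
        rw [← Nat.prod_primeFactors_of_squarefree hs, hr]
        apply Finset.prod_dvd_prod_of_subset
        intro p hp
        have hpp := Nat.prime_of_mem_primeFactors hp
        exact Nat.mem_primeFactors.2 ⟨hpp, hcon p hpp (Nat.dvd_of_mem_primeFactors hp), hm0⟩
      obtain ⟨p, hp, hpn, hpm⟩ := this
      have : cnt (Bc d c) n = 0 := by
        unfold cnt
        rw [Nat.card_eq_zero]
        left
        refine ⟨fun v => hpm ?_⟩
        exact Bc_dvd d c hp _ (v.2 p (Nat.mem_primeFactors.2 ⟨hp, hpn, hs.ne_zero⟩))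
      simp [ha, this]
    · simp [ha, ArithmeticFunction.moebius_eq_zero_of_not_squarefree hs]
  have hsplit : ∑ n ∈ r.divisors, a n - ∑ n ∈ Finset.range (Y + 1), a n =
      ∑ n ∈ r.divisors.filter (fun n => Y < n), a n := by
    have h1 : ∑ n ∈ Finset.range (Y + 1), a n = ∑ n ∈ r.divisors.filter (fun n => ¬ Y < n), a n := by
      symm
      apply Finset.sum_subset_zero_on_sdiff
      · intro n hn'
        rw [Finset.mem_filter] at hn'
        rw [Finset.mem_range]; omega
      · intro n hn'
        rw [Finset.mem_sdiff, Finset.mem_filter, Finset.mem_range] at hn'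
        apply hzero
        intro h
        exact hn'.2 ⟨h, by omega⟩
      · intros; rfl
    rw [h1, ← Finset.sum_filter_add_sum_filter_not r.divisors (fun n => Y < n) a]
    ring
  rw [hsplit]
  have hD0 : 0 ≤ D := le_trans (by positivity) hD
  refine (Finset.abs_sum_le_sum_abs _ _).trans ?_
  calc ∑ n ∈ r.divisors.filter (fun n => Y < n), |a n|
      ≤ ∑ n ∈ r.divisors.filter (fun n => Y < n), D / Y := by
        refine Finset.sum_le_sum fun n hn' => ?_
        rw [Finset.mem_filter] at hn'
        have hYn : (Y : ℝ) ≤ n := by exact_mod_cast hn'.2.le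
        by_cases hs : Squarefree n
        · have hcnt := cnt_le_of_prime (Bc d c) 1 (fun p hp => Bc_prime d c hp) hs
          rw [pow_one] at hcnt
          have hmu : |(ArithmeticFunction.moebius n : ℝ)| ≤ 1 := by
            exact_mod_cast ArithmeticFunction.abs_moebius_le_one
          have hdn : (n.divisors.card : ℝ) ≤ D := by
            refine le_trans ?_ hD
            have : n ∣ m := (Nat.dvd_of_mem_divisors hn'.1).trans hrm
            exact_mod_cast Finset.card_le_card (Nat.divisors_subset_of_dvd hm0 this)
          simp only [ha]
          rw [abs_mul, abs_of_nonneg (a := (cnt (Bc d c) n : ℝ) / (n : ℝ) ^ 2) (by positivity)]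
          have hn0 : (0 : ℝ) < n := lt_of_lt_of_le hY0 hYn
          calc |(ArithmeticFunction.moebius n : ℝ)| * ((cnt (Bc d c) n : ℝ) / (n : ℝ) ^ 2)
              ≤ 1 * (((n.divisors.card * n : ℕ) : ℝ) / (n : ℝ) ^ 2) := by gcongr
            _ = (n.divisors.card : ℝ) / n := by push_cast; field_simp
            _ ≤ D / Y := by gcongr
        · simp only [ha]
          rw [ArithmeticFunction.moebius_eq_zero_of_not_squarefree hs]
          simp; positivity
    _ = ((r.divisors.filter (fun n => Y < n)).card : ℝ) * (D / Y) := by simp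
    _ ≤ D * (D / Y) := by
        gcongr
        refine le_trans ?_ hD
        exact_mod_cast (Finset.card_filter_le _ _).trans
          (Finset.card_le_card (Nat.divisors_subset_of_dvd hm0 hrm))
    _ = _ := by ring

def kterm (d : ℤ) (n : ℕ) : ℝ := (ArithmeticFunction.moebius n : ℝ) * sn d n

/-- The density constant. -/
def kap (d : ℤ) : ℝ := ∑' n, kterm d n

lemma kterm_bound (d : ℤ) : ∃ C : ℝ, 1 ≤ C ∧ ∀ n : ℕ, |kterm d n| ≤ C * (n : ℝ) ^ (-(7 / 4) : ℝ) := by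
  obtain ⟨C, hC, h⟩ := divisor_bound_real 8 (by norm_num)
  refine ⟨C ^ 2, one_le_pow₀ hC, fun n => ?_⟩
  by_cases hs : Squarefree n
  · have hn1 : 1 ≤ n := Nat.pos_of_ne_zero hs.ne_zero
    have hn0 : (0 : ℝ) < n := by exact_mod_cast hn1
    have hcnt := cnt_le_of_prime (B4 d) 2 (fun p hp => B4_prime d hp) hs
    have hmu : |(ArithmeticFunction.moebius n : ℝ)| ≤ 1 := by
      exact_mod_cast ArithmeticFunction.abs_moebius_le_one
    unfold kterm sn
    rw [abs_mul, abs_of_nonneg (a := (cnt (B4 d) n : ℝ) / (n : ℝ) ^ 4) (by positivity)]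
    have hd := h n hn1
    calc |(ArithmeticFunction.moebius n : ℝ)| * ((cnt (B4 d) n : ℝ) / (n : ℝ) ^ 4)
        ≤ 1 * ((((n.divisors.card * n) ^ 2 : ℕ) : ℝ) / (n : ℝ) ^ 4) := by gcongr
      _ = (n.divisors.card : ℝ) ^ 2 / (n : ℝ) ^ 2 := by push_cast; field_simp
      _ ≤ (C * (n : ℝ) ^ ((1 : ℝ) / (8 : ℕ))) ^ 2 / (n : ℝ) ^ 2 := by gcongr
      _ = C ^ 2 * (n : ℝ) ^ (-(7 / 4) : ℝ) := by
        rw [mul_pow, ← Real.rpow_natCast ((n : ℝ) ^ ((1 : ℝ) / (8 : ℕ))) 2, ← Real.rpow_mul hn0.le,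
          mul_div_assoc, ← Real.rpow_natCast (n : ℝ) 2, ← Real.rpow_sub hn0]
        norm_num
  · unfold kterm
    rw [ArithmeticFunction.moebius_eq_zero_of_not_squarefree hs]
    simp; positivity

lemma kterm_summable (d : ℤ) : Summable (kterm d) := by
  obtain ⟨C, hC, h⟩ := kterm_bound d
  exact Summable.of_norm_bounded ((Real.summable_nat_rpow.2 (by norm_num)).mul_left C) h

lemma kap_tail (d : ℤ) : ∃ C : ℝ, 1 ≤ C ∧ ∀ Y : ℕ, 1 ≤ Y →
    |∑ n ∈ Finset.range (Y + 1), kterm d n - kap d| ≤ C * (Y : ℝ) ^ (-(1 / 2) : ℝ) := by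
  obtain ⟨C, hC, h⟩ := kterm_bound d
  have hsum : Summable fun n : ℕ => (n : ℝ) ^ (-(5 / 4) : ℝ) := Real.summable_nat_rpow.2 (by norm_num)
  set S := ∑' n : ℕ, (n : ℝ) ^ (-(5 / 4) : ℝ) with hS
  have hS0 : 0 ≤ S := tsum_nonneg fun n => by positivity
  refine ⟨C * (S + 1), by nlinarith, fun Y hY => ?_⟩
  have hY0 : (0 : ℝ) < Y := by exact_mod_cast hY
  have h1 := (kterm_summable d).sum_add_tsum_nat_add (Y + 1)
  have h2 : ∑ n ∈ Finset.range (Y + 1), kterm d n - kap d = - ∑' i, kterm d (i + (Y + 1)) := by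
    unfold kap; rw [← h1]; ring
  rw [h2, abs_neg]
  have hb : ∀ i : ℕ, ‖kterm d (i + (Y + 1))‖ ≤
      C * (Y : ℝ) ^ (-(1 / 2) : ℝ) * ((i + (Y + 1) : ℕ) : ℝ) ^ (-(5 / 4) : ℝ) := by
    intro i
    refine (h _).trans ?_
    have hp : (0 : ℝ) < ((i + (Y + 1) : ℕ) : ℝ) := by positivity
    rw [mul_assoc]
    gcongr
    have : (-(7 / 4) : ℝ) = -(1 / 2) + -(5 / 4) := by norm_num
    rw [this, Real.rpow_add hp]
    gcongr ?_ * _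
    apply Real.rpow_le_rpow_of_nonpos hY0 _ (by norm_num)
    push_cast; linarith [(Nat.cast_nonneg i : (0 : ℝ) ≤ i)]
  have hs2 : Summable fun i : ℕ => ((i + (Y + 1) : ℕ) : ℝ) ^ (-(5 / 4) : ℝ) :=
    (summable_nat_add_iff (Y + 1)).2 hsum
  have h3 := tsum_of_norm_bounded (hs2.mul_left _).hasSum hb
  rw [Real.norm_eq_abs, tsum_mul_left] at h3
  refine h3.trans ?_
  have h4 : ∑' i : ℕ, ((i + (Y + 1) : ℕ) : ℝ) ^ (-(5 / 4) : ℝ) ≤ S := by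
    have := hsum.sum_add_tsum_nat_add (Y + 1)
    rw [hS, ← this]
    have : 0 ≤ ∑ n ∈ Finset.range (Y + 1), (n : ℝ) ^ (-(5 / 4) : ℝ) :=
      Finset.sum_nonneg fun _ _ => by positivity
    linarith
  calc C * (Y : ℝ) ^ (-(1 / 2) : ℝ) * ∑' i : ℕ, ((i + (Y + 1) : ℕ) : ℝ) ^ (-(5 / 4) : ℝ)
      ≤ C * (Y : ℝ) ^ (-(1 / 2) : ℝ) * (S + 1) := by gcongr; linarith
    _ = _ := by ring

lemma rho_avg (hn : ¬ IsSquare d) : ∃ C : ℝ, 1 ≤ C ∧ ∀ (c1 : ℤ√d) (J Y : ℕ) (D : ℝ), 1 ≤ Y → 1 ≤ J →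
    (∀ i j : ℕ, i < J → j < J → (⟨c1.re + i, c1.im + j⟩ : ℤ√d) ≠ 0 ∧
      (((⟨c1.re + i, c1.im + j⟩ : ℤ√d).norm.natAbs.divisors.card : ℝ) ≤ D)) →
    |∑ i ∈ Finset.range J, ∑ j ∈ Finset.range J, rho (⟨c1.re + i, c1.im + j⟩ : ℤ√d)
      - (J : ℝ) ^ 2 * kap d| ≤
      (J : ℝ) ^ 2 * (D ^ 2 / Y + 4 * (Y : ℝ) ^ 2 / J + C * (Y : ℝ) ^ (-(1 / 2) : ℝ)) := by
  obtain ⟨C, hC, hk⟩ := kap_tail d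
  refine ⟨C, hC, fun c1 J Y D hY hJ H => ?_⟩
  have hJ0 : (0 : ℝ) < J := by exact_mod_cast hJ
  have hY0 : (0 : ℝ) < Y := by exact_mod_cast hY
  have hY1 : (1 : ℝ) ≤ Y := by exact_mod_cast hY
  set bt : ℕ → ℕ → ℕ → ℝ := fun n i j =>
    (cnt (Bc d ⟨c1.re + i, c1.im + j⟩) n : ℝ) / (n : ℝ) ^ 2 with hbt
  set T : ℕ → ℕ → ℝ := fun i j => ∑ n ∈ Finset.range (Y + 1),
    (ArithmeticFunction.moebius n : ℝ) * bt n i j with hT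
  have s1 : |∑ i ∈ Finset.range J, ∑ j ∈ Finset.range J, rho (⟨c1.re + i, c1.im + j⟩ : ℤ√d) -
      ∑ i ∈ Finset.range J, ∑ j ∈ Finset.range J, T i j| ≤ (J : ℝ) ^ 2 * (D ^ 2 / Y) := by
    rw [← Finset.sum_sub_distrib]
    refine (Finset.abs_sum_le_sum_abs _ _).trans ?_
    calc _ ≤ ∑ i ∈ Finset.range J, (J : ℝ) * (D ^ 2 / Y) := by
          refine Finset.sum_le_sum fun i hi => ?_
          rw [← Finset.sum_sub_distrib]
          refine (Finset.abs_sum_le_sum_abs _ _).trans ?_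
          calc _ ≤ ∑ j ∈ Finset.range J, (D ^ 2 / Y) := by
                refine Finset.sum_le_sum fun j hj => ?_
                obtain ⟨h1, h2⟩ := H i j (Finset.mem_range.1 hi) (Finset.mem_range.1 hj)
                exact rho_trunc hn h1 D h2 Y hY
            _ = _ := by simp
      _ = _ := by simp; ring
  have e2 : ∑ i ∈ Finset.range J, ∑ j ∈ Finset.range J, T i j =
      ∑ n ∈ Finset.range (Y + 1), (ArithmeticFunction.moebius n : ℝ) *
        ∑ i ∈ Finset.range J, ∑ j ∈ Finset.range J, bt n i j := by
    simp only [hT, Finset.mul_sum]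
    rw [Finset.sum_congr rfl fun i _ => Finset.sum_comm, Finset.sum_comm]
  have s2 : |∑ i ∈ Finset.range J, ∑ j ∈ Finset.range J, T i j -
      (J : ℝ) ^ 2 * ∑ n ∈ Finset.range (Y + 1), kterm d n| ≤ 4 * J * (Y : ℝ) ^ 2 := by
    rw [e2, Finset.mul_sum, ← Finset.sum_sub_distrib]
    refine (Finset.abs_sum_le_sum_abs _ _).trans ?_
    calc _ ≤ ∑ n ∈ Finset.range (Y + 1), 2 * (J : ℝ) * Y := by
          refine Finset.sum_le_sum fun n hn' => ?_
          rcases Nat.eq_zero_or_pos n with rfl | hpos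
          · simp [kterm]; positivity
          · have : NeZero n := ⟨hpos.ne'⟩
            have hnY : (n : ℝ) ≤ Y := by
              exact_mod_cast Nat.lt_succ_iff.1 (Finset.mem_range.1 hn')
            have hmu : |(ArithmeticFunction.moebius n : ℝ)| ≤ 1 := by
              exact_mod_cast ArithmeticFunction.abs_moebius_le_one
            have := beta_avg (d := d) n J c1.re c1.im
            have e : (ArithmeticFunction.moebius n : ℝ) *
                (∑ i ∈ Finset.range J, ∑ j ∈ Finset.range J, bt n i j) - (J : ℝ) ^ 2 * kterm d n =
                (ArithmeticFunction.moebius n : ℝ) *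
                  (∑ i ∈ Finset.range J, ∑ j ∈ Finset.range J, bt n i j - (J : ℝ) ^ 2 * sn d n) := by
              unfold kterm; ring
            rw [e, abs_mul]
            calc _ ≤ 1 * (2 * (J : ℝ) * n) := by gcongr
              _ ≤ _ := by rw [one_mul]; gcongr
      _ = ((Y : ℝ) + 1) * (2 * J * Y) := by simp
      _ ≤ (Y + Y) * (2 * J * Y) := by gcongr
      _ = _ := by ring
  have s3 := hk Y hY
  have s3' : |(J : ℝ) ^ 2 * ∑ n ∈ Finset.range (Y + 1), kterm d n - (J : ℝ) ^ 2 * kap d| ≤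
      (J : ℝ) ^ 2 * (C * (Y : ℝ) ^ (-(1 / 2) : ℝ)) := by
    rw [← mul_sub, abs_mul, abs_of_nonneg (by positivity : (0 : ℝ) ≤ (J : ℝ) ^ 2)]
    gcongr
  have e4 : (J : ℝ) ^ 2 * (4 * (Y : ℝ) ^ 2 / J) = 4 * J * (Y : ℝ) ^ 2 := by field_simp
  rw [mul_add, mul_add, e4]
  have t1 := abs_sub_le (∑ i ∈ Finset.range J, ∑ j ∈ Finset.range J, rho (⟨c1.re + i, c1.im + j⟩ : ℤ√d))
    (∑ i ∈ Finset.range J, ∑ j ∈ Finset.range J, T i j) ((J : ℝ) ^ 2 * kap d)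
  have t2 := abs_sub_le (∑ i ∈ Finset.range J, ∑ j ∈ Finset.range J, T i j)
    ((J : ℝ) ^ 2 * ∑ n ∈ Finset.range (Y + 1), kterm d n) ((J : ℝ) ^ 2 * kap d)
  linarith

lemma kap_pos (d : ℤ) : 0 < kap d := by
  have hs := kterm_summable d
  have h0 : kterm d 0 = 0 := by simp [kterm]
  have h1 : kterm d 1 = 1 := by simp [kterm, sn, cnt_one]
  have hmul : ∀ {m n : ℕ}, m.Coprime n → kterm d (m * n) = kterm d m * kterm d n := by
    intro m n hmn
    rcases Nat.eq_zero_or_pos m with rfl | hm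
    · simp [h0]
    rcases Nat.eq_zero_or_pos n with rfl | hn
    · simp [h0]
    unfold kterm sn
    rw [cnt_mul _ hmn hm.ne' hn.ne', ArithmeticFunction.isMultiplicative_moebius.map_mul_of_coprime hmn]
    push_cast
    have : (m : ℝ) ≠ 0 := by positivity
    have : (n : ℝ) ≠ 0 := by positivity
    field_simp
  have hE := EulerProduct.eulerProduct_hasProd h1 hmul hs.norm h0
  have hterm : ∀ p : Nat.Primes, ∑' e, kterm d ((p : ℕ) ^ e) = 1 + (- sn d p) := by
    intro p
    rw [tsum_eq_sum (s := Finset.range 2)]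
    · rw [Finset.sum_range_succ, Finset.sum_range_one, pow_zero, pow_one, h1]
      simp [kterm, ArithmeticFunction.moebius_apply_prime p.2]
    · intro e he
      rw [Finset.mem_range, not_lt] at he
      unfold kterm
      rw [ArithmeticFunction.moebius_apply_prime_pow p.2 (by omega), if_neg (by omega)]
      simp
  simp only [hterm] at hE
  have hpos : ∀ p : Nat.Primes, 0 < 1 + (- sn d p) := by
    intro p
    have := B4_lt d p.2
    have hp : (0 : ℝ) < (p : ℕ) := by exact_mod_cast p.2.pos
    have : sn d p < 1 := by
      unfold sn
      rw [div_lt_one (by positivity)]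
      exact_mod_cast this
    linarith
  have hsum : Summable fun p : Nat.Primes => - sn d p := by
    have := (hs.comp_injective (i := fun p : Nat.Primes => (p : ℕ)) Subtype.val_injective)
    refine this.congr fun p => ?_
    simp [kterm, ArithmeticFunction.moebius_apply_prime p.2]
  have hlog := Real.summable_log_one_add_of_summable hsum
  have := Real.rexp_tsum_eq_tprod hpos hlog
  rw [hE.tprod_eq] at this
  unfold kap
  rw [← this]
  exact Real.exp_pos _

end
end
end Equi

namespace Equi
open scoped BigOperators
noncomputable section
set_option linter.unusedSectionVars false
set_option linter.unusedDecidableInType false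
set_option linter.unusedFintypeInType false

/-! ### Section 10: averaging over shifts, trivial counts -/
section
variable {d : ℤ}

lemma sum_eq_of_supp {V : Type*} {S T : Finset V} {f : V → ℝ}
    (hS : ∀ v, f v ≠ 0 → v ∈ S) (hT : ∀ v, f v ≠ 0 → v ∈ T) : ∑ v ∈ S, f v = ∑ v ∈ T, f v := by
  classical
  refine (Finset.sum_subset (Finset.subset_union_left (s₁ := S) (s₂ := T)) ?_).trans
    (Finset.sum_subset (Finset.subset_union_right (s₁ := S) (s₂ := T)) ?_).symm
  · intro x _ hx; by_contra h; exact hx (hS x h)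
  · intro x _ hx; by_contra h; exact hx (hT x h)

lemma shift {V Q : Type*} [AddCommGroup V] [DecidableEq V] [Fintype Q] [Nonempty Q] (B : Finset V)
    (h w : V → ℝ) (δ : Q → V) (ω ε m : ℝ)
    (hs : ∀ v, h v ≠ 0 → v ∈ B) (hs' : ∀ v q, h v ≠ 0 → v + δ q ∈ B)
    (hω : ∀ v q, |h v - h (v - δ q)| ≤ ω)
    (hM : ∀ v, h v ≠ 0 → |(∑ q, w (v + δ q)) / Fintype.card Q - m| ≤ ε) :
    |∑ v ∈ B, h v * w v - m * ∑ v ∈ B, h v| ≤ ω * ∑ v ∈ B, |w v| + ε * ∑ v ∈ B, |h v| := by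
  have hQ : (0 : ℝ) < Fintype.card Q := by exact_mod_cast Fintype.card_pos
  have e1 : ∀ q, ∑ v ∈ B, h (v - δ q) * w v = ∑ v ∈ B, h v * w (v + δ q) := by
    intro q
    trans ∑ v ∈ B.map (addRightEmbedding (-δ q)), h v * w (v + δ q)
    · rw [Finset.sum_map]
      refine Finset.sum_congr rfl fun v _ => ?_
      simp [sub_eq_add_neg]
    · refine sum_eq_of_supp ?_ ?_
      · intro v hv
        rw [Finset.mem_map]
        refine ⟨v + δ q, hs' v q (left_ne_zero_of_mul hv), by simp⟩
      · intro v hv; exact hs v (left_ne_zero_of_mul hv)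
  have e2 : ∑ v ∈ B, h v * w v - m * ∑ v ∈ B, h v =
      (∑ q, ∑ v ∈ B, (h v - h (v - δ q)) * w v) / Fintype.card Q +
      ∑ v ∈ B, h v * ((∑ q, w (v + δ q)) / Fintype.card Q - m) := by
    have : ∑ q, ∑ v ∈ B, (h v - h (v - δ q)) * w v =
        Fintype.card Q * ∑ v ∈ B, h v * w v - ∑ v ∈ B, h v * ∑ q, w (v + δ q) := by
      simp only [sub_mul, Finset.sum_sub_distrib, e1]
      congr 1
      · simp [Finset.sum_const]
      · rw [Finset.sum_comm]
        simp only [Finset.mul_sum]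
    rw [this]
    simp only [mul_sub, Finset.sum_sub_distrib, ← Finset.sum_mul, ← mul_div_assoc, ← Finset.sum_div]
    field_simp
    ring
  rw [e2]
  refine (abs_add_le _ _).trans (add_le_add ?_ ?_)
  · rw [abs_div, abs_of_pos hQ, div_le_iff₀ hQ]
    refine (Finset.abs_sum_le_sum_abs _ _).trans ?_
    calc _ ≤ ∑ q : Q, ω * ∑ v ∈ B, |w v| := by
          refine Finset.sum_le_sum fun q _ => (Finset.abs_sum_le_sum_abs _ _).trans ?_
          rw [Finset.mul_sum]
          refine Finset.sum_le_sum fun v _ => ?_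
          rw [abs_mul]
          exact mul_le_mul_of_nonneg_right (hω v q) (abs_nonneg _)
      _ = _ := by simp; ring
  · refine (Finset.abs_sum_le_sum_abs _ _).trans ?_
    rw [Finset.mul_sum]
    refine Finset.sum_le_sum fun v _ => ?_
    rw [abs_mul, mul_comm]
    by_cases hv : h v = 0
    · simp [hv]
    · exact mul_le_mul_of_nonneg_right (hM v hv) (abs_nonneg _)

/-- admissible weight functions -/
structure Adm (z : ℝ) (F : ℝ → ℝ → ℝ → ℝ) : Prop where
  bd : ∀ a e c, |F a e c| ≤ z
  supp : ∀ a e c, F a e c ≠ 0 → |a| ≤ z ∧ |e| ≤ z ∧ |c| ≤ z ∧ 1 / z ≤ |c|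
  lip : ∀ a e c a' e' c', |F a e c - F a' e' c'| ≤ z ^ 4 * (|a - a'| + |e - e'| + |c - c'|)

/-- the big box -/
def Bz (d : ℤ) (z X : ℝ) : Finset (ℤ√d) := bx d (2 * z) (2 * z * X)

lemma mem_Bz (hd : 0 < d) {z X : ℝ} {a : ℤ√d} :
    a ∈ Bz d z X ↔ |e1 a| ≤ 2 * z ∧ |e2 a| ≤ 2 * z * X := mem_bx hd

lemma Bz_card (hd : 0 < d) (hn : ¬ IsSquare d) : ∃ z0 : ℝ, 2 ≤ z0 ∧ ∀ z X : ℝ, z0 ≤ z → 1 ≤ X →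
    ((Bz d z X).card : ℝ) ≤ z ^ 3 * X := by
  obtain ⟨C, hC, h⟩ := bx_card hd hn
  refine ⟨5 * C, by linarith, fun z X hz hX => ?_⟩
  have hz0 : 0 < z := by linarith
  have h1 : 1 ≤ z ^ 2 * X := by
    have : 1 ≤ z := by linarith
    exact one_le_mul_of_one_le_of_one_le (one_le_pow₀ this) hX
  calc _ ≤ C * (1 + 2 * z * (2 * z * X)) := h _ _ (by positivity) (by positivity)
    _ ≤ C * (5 * (z ^ 2 * X)) := by gcongr; nlinarith
    _ = 5 * C * (z ^ 2 * X) := by ring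
    _ ≤ z * (z ^ 2 * X) := by gcongr
    _ = _ := by ring

open Classical in
lemma wcount (hd : 0 < d) (hn : ¬ IsSquare d) : ∃ z0 : ℝ, 2 ≤ z0 ∧ ∀ z X : ℝ, z0 ≤ z → 1 ≤ X →
    ∀ c : ℤ√d, 1 / z ≤ |e1 c| → X / z ≤ |e2 c| →
    ((((Bz d z X) ×ˢ (Bz d z X)).filter fun v => c ∣ v.1 * v.2 - 1).card : ℝ) ≤ z ^ 8 * X := by
  obtain ⟨C, hC, h⟩ := strip_count hd hn
  obtain ⟨z1, hz1, hB⟩ := Bz_card hd hn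
  refine ⟨z1 + 17 * C, by linarith, fun z X hz hX c hc1 hc2 => ?_⟩
  have hz0 : 0 < z := by linarith
  have hz1' : 1 ≤ z := by linarith
  have hX0 : 0 < X := by linarith
  have hc1' : 0 < |e1 c| := lt_of_lt_of_le (by positivity) hc1
  have hc2' : 0 < |e2 c| := lt_of_lt_of_le (by positivity) hc2
  have hc0 : c ≠ 0 := by rintro rfl; simp at hc1'
  have key : ∀ a ∈ Bz d z X, (((Bz d z X).filter fun e => c ∣ a * e - 1).card : ℝ) ≤ z ^ 5 := by
    intro a _
    rcases ((Bz d z X).filter fun e => c ∣ a * e - 1).eq_empty_or_nonempty with h0 | ⟨f, hf⟩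
    · rw [h0]; simp; positivity
    rw [Finset.mem_filter, mem_Bz hd] at hf
    have hdv : ∀ e, c ∣ a * e - 1 → ∃ s, e = f + c * s := by
      intro e he
      obtain ⟨s, hs⟩ : c ∣ e - f := by
        have : e - f = f * (a * e - 1) - e * (a * f - 1) := by ring
        rw [this]
        exact dvd_sub (dvd_mul_of_dvd_right he _) (dvd_mul_of_dvd_right hf.2 _)
      exact ⟨s, by rw [← hs]; ring⟩
    choose! s hs using hdv
    have hcard : ((Bz d z X).filter fun e => c ∣ a * e - 1).card =
        (((Bz d z X).filter fun e => c ∣ a * e - 1).image s).card := by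
      rw [Finset.card_image_of_injOn]
      intro x hx y hy hxy
      rw [Finset.mem_coe, Finset.mem_filter] at hx hy
      rw [hs x hx.2, hs y hy.2, hxy]
    rw [hcard]
    refine (h _ 0 0 (4 * z ^ 2) (4 * z ^ 2) (by positivity) (by positivity) ?_).trans ?_
    · intro b hb
      rw [Finset.mem_image] at hb
      obtain ⟨e, he, rfl⟩ := hb
      rw [Finset.mem_filter, mem_Bz hd] at he
      have e1' : e1 e - e1 f = e1 c * e1 (s e) := by
        conv_lhs => rw [hs e he.2]
        rw [e1_add, e1_mul hd]; ring
      have e2' : e2 e - e2 f = e2 c * e2 (s e) := by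
        conv_lhs => rw [hs e he.2]
        rw [e2_add, e2_mul hd]; ring
      rw [sub_zero, sub_zero]
      have t1 : |e1 c| * |e1 (s e)| ≤ 4 * z := by
        rw [← abs_mul, ← e1']
        exact (abs_sub _ _).trans (by linarith [he.1.1, hf.1.1])
      have t2 : |e2 c| * |e2 (s e)| ≤ 4 * z * X := by
        rw [← abs_mul, ← e2']
        exact (abs_sub _ _).trans (by linarith [he.1.2, hf.1.2])
      constructor
      · have : 1 / z * |e1 (s e)| ≤ 4 * z :=
          (mul_le_mul_of_nonneg_right hc1 (abs_nonneg _)).trans t1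
        rw [div_mul_eq_mul_div, one_mul, div_le_iff₀ hz0] at this
        nlinarith
      · have : X / z * |e2 (s e)| ≤ 4 * z * X :=
          (mul_le_mul_of_nonneg_right hc2 (abs_nonneg _)).trans t2
        rw [div_mul_eq_mul_div, div_le_iff₀ hz0] at this
        have : X * |e2 (s e)| ≤ X * (4 * z ^ 2) := by nlinarith
        exact le_of_mul_le_mul_left this hX0
    · calc C * (1 + 4 * z ^ 2 * (4 * z ^ 2)) ≤ C * (17 * z ^ 4) := by
            have : 1 ≤ z ^ 4 := one_le_pow₀ hz1'
            gcongr; nlinarith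
        _ = 17 * C * z ^ 4 := by ring
        _ ≤ z * z ^ 4 := by gcongr; linarith
        _ = z ^ 5 := by ring
  have hcard : (((Bz d z X) ×ˢ (Bz d z X)).filter fun v => c ∣ v.1 * v.2 - 1).card =
      ∑ a ∈ Bz d z X, ((Bz d z X).filter fun e => c ∣ a * e - 1).card := by
    simp only [Finset.card_filter]
    rw [Finset.sum_product]
  rw [hcard]
  push_cast
  calc _ ≤ ∑ a ∈ Bz d z X, z ^ 5 := Finset.sum_le_sum key
    _ = (Bz d z X).card * z ^ 5 := by simp
    _ ≤ z ^ 3 * X * z ^ 5 := by gcongr; exact hB z X (by linarith) hX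
    _ = _ := by ring

open Classical in
lemma cont_count (hd : 0 < d) (hn : ¬ IsSquare d) : ∃ z0 : ℝ, 2 ≤ z0 ∧ ∀ z X : ℝ, z0 ≤ z → 1 ≤ X →
    (((Bz d z X).filter fun c => c ≠ 0 ∧ z ^ 30 < cont c).card : ℝ) * z ^ 27 ≤ X := by
  obtain ⟨C, hC, h⟩ := strip_count hd hn
  refine ⟨16 * C, by linarith, fun z X hz hX => ?_⟩
  have hz0 : 0 < z := by linarith
  have hX0 : 0 < X := by linarith
  set S := (Bz d z X).filter fun c => c ≠ 0 ∧ z ^ 30 < cont c with hS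
  have hg : ∀ g ∈ S.image cont, (((S.filter fun c => cont c = g).card : ℝ)) ≤
      8 * C * z ^ 2 * X * ((g : ℝ) ^ 2)⁻¹ := by
    intro g hg
    rw [Finset.mem_image] at hg
    obtain ⟨c0, hc0, rfl⟩ := hg
    set g := cont c0 with hgd
    have hc0' := hc0
    rw [hS, Finset.mem_filter, mem_Bz hd] at hc0'
    have hgpos : (0 : ℝ) < g := lt_trans (by positivity) hc0'.2.2
    have hdv : ∀ c : ℤ√d, cont c = g → ∃ b : ℤ√d, c = (g : ℤ√d) * b := by
      intro c hc
      obtain ⟨x, hx⟩ : (g : ℤ) ∣ c.re := hc ▸ Int.gcd_dvd_left ..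
      obtain ⟨y, hy⟩ : (g : ℤ) ∣ c.im := hc ▸ Int.gcd_dvd_right ..
      refine ⟨⟨x, y⟩, ?_⟩
      ext <;> simp [hx, hy]
    choose! b hb using hdv
    have hbd : ∀ c ∈ S.filter fun c => cont c = g, |e1 (b c)| ≤ 2 * z / g ∧
        |e2 (b c)| ≤ 2 * z * X / g := by
      intro c hc
      rw [Finset.mem_filter, hS, Finset.mem_filter, mem_Bz hd] at hc
      have q1 : e1 c = g * e1 (b c) := by
        conv_lhs => rw [hb c hc.2]
        rw [e1_mul hd]; simp
      have q2 : e2 c = g * e2 (b c) := by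
        conv_lhs => rw [hb c hc.2]
        rw [e2_mul hd]; simp
      have r1 := hc.1.1.1
      have r2 := hc.1.1.2
      rw [q1, abs_mul, abs_of_pos hgpos] at r1
      rw [q2, abs_mul, abs_of_pos hgpos] at r2
      rw [le_div_iff₀ hgpos, le_div_iff₀ hgpos]
      constructor <;> linarith
    have hcard : (S.filter fun c => cont c = g).card = ((S.filter fun c => cont c = g).image b).card := by
      rw [Finset.card_image_of_injOn]
      intro x hx y hy hxy
      rw [Finset.mem_coe, Finset.mem_filter] at hx hy
      rw [hb x hx.2, hb y hy.2, hxy]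
    have hone : 1 ≤ 2 * z / g * (2 * z * X / g) := by
      have hm : c0 ∈ S.filter fun c => cont c = g := Finset.mem_filter.2 ⟨hc0, rfl⟩
      have hb0 : b c0 ≠ 0 := by
        intro h0
        apply hc0'.2.1
        rw [hb c0 rfl, h0, mul_zero]
      refine (one_le_abs_mul hd hn hb0).trans ?_
      have := hbd c0 hm
      gcongr
      · exact this.1
      · exact this.2
    rw [hcard]
    refine (h _ 0 0 (2 * z / g) (2 * z * X / g) (by positivity) (by positivity) ?_).trans ?_
    · intro a ha
      rw [Finset.mem_image] at ha
      obtain ⟨c, hc, rfl⟩ := ha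
      simpa using hbd c hc
    · calc C * (1 + 2 * z / g * (2 * z * X / g)) ≤ C * (2 * (2 * z / g * (2 * z * X / g))) := by
            gcongr; linarith
        _ = _ := by field_simp; ring
  have hcardS : (S.card : ℝ) = ∑ g ∈ S.image cont, ((S.filter fun c => cont c = g).card : ℝ) := by
    exact_mod_cast Finset.card_eq_sum_card_image cont S
  have hsub : S.image cont ⊆ Finset.Ioo ⌊z ^ 30⌋₊ ((S.image cont).sup id + 1) := by
    intro g hg
    rw [Finset.mem_Ioo]
    refine ⟨?_, Nat.lt_succ_of_le (Finset.le_sup (f := id) hg)⟩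
    rw [Finset.mem_image] at hg
    obtain ⟨c0, hc0, rfl⟩ := hg
    rw [hS, Finset.mem_filter] at hc0
    exact (Nat.floor_lt (by positivity)).2 hc0.2.2
  have hsum : ∑ g ∈ S.image cont, ((g : ℝ) ^ 2)⁻¹ ≤ 2 / z ^ 30 := by
    calc _ ≤ ∑ g ∈ Finset.Ioo ⌊z ^ 30⌋₊ ((S.image cont).sup id + 1), ((g : ℝ) ^ 2)⁻¹ :=
          Finset.sum_le_sum_of_subset_of_nonneg hsub (fun _ _ _ => by positivity)
      _ ≤ 2 / ((⌊z ^ 30⌋₊ : ℝ) + 1) := sum_Ioo_inv_sq_le _ _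
      _ ≤ 2 / z ^ 30 := by
          gcongr
          exact (Nat.lt_floor_add_one _).le
  have : (S.card : ℝ) ≤ 8 * C * z ^ 2 * X * (2 / z ^ 30) := by
    rw [hcardS]
    refine (Finset.sum_le_sum hg).trans ?_
    rw [← Finset.mul_sum]
    gcongr
  calc (S.card : ℝ) * z ^ 27 ≤ 8 * C * z ^ 2 * X * (2 / z ^ 30) * z ^ 27 := by gcongr
    _ = (16 * C) * X / z := by field_simp; ring
    _ ≤ z * X / z := by gcongr
    _ = X := by field_simp

end
end
end Equi

namespace Equi
open scoped BigOperators
noncomputable section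
set_option linter.unusedSectionVars false
set_option linter.unusedDecidableInType false
set_option linter.unusedFintypeInType false

/-! ### Section 11: the congruence sum for a fixed lower left entry -/
section
variable {d : ℤ}

lemma div_pw {z : ℝ} (hz : 0 < z) (a b : ℕ) : 1 / z ^ (a + b) * z ^ a = 1 / z ^ b := by
  rw [pow_add]; field_simp

lemma div_pw' {z : ℝ} (hz : 0 < z) (a b : ℕ) : z ^ a / z ^ (a + b) = 1 / z ^ b := by
  rw [pow_add]; field_simp

lemma unit_shift (hd : 0 < d) (hn : ¬ IsSquare d) : ∃ z0 : ℝ, 2 ≤ z0 ∧ ∀ z X : ℝ, z0 ≤ z →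
    X = z ^ 6000 → ∃ u v : ℤ√d, u * v = 1 ∧ ∀ J : ℕ, (J : ℝ) ≤ z ^ 2970 → ∀ i j : ℕ, i < J → j < J →
      |e1 (u * ⟨i, j⟩)| ≤ 1 / z ^ 29 / 4 ∧ |e2 (u * ⟨i, j⟩)| ≤ 1 / z ^ 29 / 4 * X := by
  obtain ⟨E, hE, hu⟩ := exists_unit hd hn
  have hs := sqrt_ge_one hd
  refine ⟨4 * E * (1 + Real.sqrt d), by nlinarith, fun z X hz hX => ?_⟩
  have hz0 : 0 < z := by nlinarith
  obtain ⟨u, v, huv, hu1, hu2, hu3⟩ := hu (1 / z ^ 3000) (by positivity)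
  have hupos : 0 < e1 u := lt_of_lt_of_le (by positivity) hu1
  refine ⟨u, v, huv, fun J hJ i j hi hj => ?_⟩
  have hi' : (i : ℝ) ≤ J := by exact_mod_cast hi.le
  have hj' : (j : ℝ) ≤ J := by exact_mod_cast hj.le
  have k1 : |e1 (⟨i, j⟩ : ℤ√d)| ≤ (1 + Real.sqrt d) * z ^ 2970 := by
    unfold e1
    rw [abs_of_nonneg (by push_cast; positivity)]
    push_cast
    nlinarith
  have k2 : |e2 (⟨i, j⟩ : ℤ√d)| ≤ (1 + Real.sqrt d) * z ^ 2970 := by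
    unfold e2
    push_cast
    have : 0 ≤ (j : ℝ) * Real.sqrt d := by positivity
    have : (j : ℝ) * Real.sqrt d ≤ z ^ 2970 * Real.sqrt d := by gcongr; linarith
    have : (0 : ℝ) ≤ i := by positivity
    rw [abs_le]
    constructor <;> nlinarith
  have h30 : E * (1 + Real.sqrt d) * (1 / z ^ 30) ≤ 1 / z ^ 29 / 4 := by
    calc _ ≤ z / 4 * (1 / z ^ 30) := by gcongr; linarith
      _ = 1 / z ^ 29 / 4 := by
        have := div_pw hz0 1 29
        rw [pow_one] at this
        rw [← this]; ring
  have hq : 1 / z ^ 3000 * z ^ 2970 = 1 / z ^ 30 := div_pw hz0 2970 30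
  constructor
  · rw [e1_mul hd, abs_mul, abs_of_pos hupos]
    calc e1 u * |e1 (⟨i, j⟩ : ℤ√d)| ≤ E * (1 / z ^ 3000) * ((1 + Real.sqrt d) * z ^ 2970) := by gcongr
      _ = E * (1 + Real.sqrt d) * (1 / z ^ 3000 * z ^ 2970) := by ring
      _ ≤ _ := by rw [hq]; exact h30
  · rw [e2_mul hd, abs_mul, hu3, abs_of_pos (by positivity)]
    have : 1 / e1 u ≤ z ^ 3000 := by
      rw [div_le_iff₀ hupos]
      rw [div_le_iff₀ (by positivity)] at hu1
      linarith
    have hXs : X * (1 / z ^ 30) = z ^ 3000 * z ^ 2970 := by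
      rw [hX, ← hq]
      have : z ^ 6000 = z ^ 3000 * z ^ 3000 := by ring
      rw [this]; field_simp
    have hX0 : 0 < X := by rw [hX]; positivity
    calc 1 / e1 u * |e2 (⟨i, j⟩ : ℤ√d)| ≤ z ^ 3000 * ((1 + Real.sqrt d) * z ^ 2970) := by gcongr
      _ = (1 + Real.sqrt d) * (1 / z ^ 30) * X := by rw [mul_assoc, mul_comm _ X, hXs]; ring
      _ ≤ E * (1 + Real.sqrt d) * (1 / z ^ 30) * X := by
          gcongr; nlinarith
      _ ≤ _ := by gcongr

/-- the weight on triples -/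
def FF (F1 F2 : ℝ → ℝ → ℝ → ℝ) (X : ℝ) (a e c : ℤ√d) : ℝ :=
  F1 (e1 a) (e1 e) (e1 c) * F2 (e2 a / X) (e2 e / X) (e2 c / X)

lemma FF_lip {z X s : ℝ} (hz : 6 ≤ z) (hX : 0 < X) {F1 F2 : ℝ → ℝ → ℝ → ℝ} (h1 : Adm z F1)
    (h2 : Adm z F2) {a e c a' e' c' : ℤ√d} (ha : |e1 (a - a')| ≤ s ∧ |e2 (a - a')| ≤ s * X)
    (he : |e1 (e - e')| ≤ s ∧ |e2 (e - e')| ≤ s * X)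
    (hc : |e1 (c - c')| ≤ s ∧ |e2 (c - c')| ≤ s * X) :
    |FF F1 F2 X a e c - FF F1 F2 X a' e' c'| ≤ z ^ 6 * s := by
  have hs : 0 ≤ s := (abs_nonneg _).trans ha.1
  simp only [e1_sub, e2_sub] at ha he hc
  have hdiv : ∀ p q : ℝ, |p - q| ≤ s * X → |p / X - q / X| ≤ s := by
    intro p q h
    rw [← sub_div, abs_div, abs_of_pos hX, div_le_iff₀ hX]; exact h
  have k1 := h1.lip (e1 a) (e1 e) (e1 c) (e1 a') (e1 e') (e1 c')
  have k2 := h2.lip (e2 a / X) (e2 e / X) (e2 c / X) (e2 a' / X) (e2 e' / X) (e2 c' / X)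
  have b1 := h1.bd (e1 a) (e1 e) (e1 c)
  have b2 := h2.bd (e2 a' / X) (e2 e' / X) (e2 c' / X)
  have k1' : |F1 (e1 a) (e1 e) (e1 c) - F1 (e1 a') (e1 e') (e1 c')| ≤ z ^ 4 * (3 * s) := by
    refine k1.trans ?_
    gcongr; linarith [ha.1, he.1, hc.1]
  have k2' : |F2 (e2 a / X) (e2 e / X) (e2 c / X) - F2 (e2 a' / X) (e2 e' / X) (e2 c' / X)| ≤
      z ^ 4 * (3 * s) := by
    refine k2.trans ?_
    gcongr; linarith [hdiv _ _ ha.2, hdiv _ _ he.2, hdiv _ _ hc.2]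
  unfold FF
  calc _ = |F1 (e1 a) (e1 e) (e1 c) * (F2 (e2 a / X) (e2 e / X) (e2 c / X) -
          F2 (e2 a' / X) (e2 e' / X) (e2 c' / X)) + (F1 (e1 a) (e1 e) (e1 c) -
          F1 (e1 a') (e1 e') (e1 c')) * F2 (e2 a' / X) (e2 e' / X) (e2 c' / X)| := by congr 1; ring
    _ ≤ z * (z ^ 4 * (3 * s)) + z ^ 4 * (3 * s) * z := by
        refine (abs_add_le _ _).trans ?_
        rw [abs_mul, abs_mul]
        gcongr
    _ = 6 * (z ^ 5 * s) := by ring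
    _ ≤ z * (z ^ 5 * s) := by gcongr
    _ = _ := by ring

lemma FF_bd {z X : ℝ} {F1 F2 : ℝ → ℝ → ℝ → ℝ} (h1 : Adm z F1)
    (h2 : Adm z F2) (a e c : ℤ√d) : |FF F1 F2 X a e c| ≤ z ^ 2 := by
  unfold FF
  rw [abs_mul, sq]
  have := h1.bd (e1 a) (e1 e) (e1 c)
  have := h2.bd (e2 a / X) (e2 e / X) (e2 c / X)
  have h0 : 0 ≤ z := (abs_nonneg _).trans this
  gcongr

lemma FF_supp {z X : ℝ} (hX : 0 < X) {F1 F2 : ℝ → ℝ → ℝ → ℝ} (h1 : Adm z F1)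
    (h2 : Adm z F2) {a e c : ℤ√d} (h : FF F1 F2 X a e c ≠ 0) :
    (|e1 a| ≤ z ∧ |e2 a| ≤ z * X) ∧ (|e1 e| ≤ z ∧ |e2 e| ≤ z * X) ∧
    (|e1 c| ≤ z ∧ |e2 c| ≤ z * X) ∧ 1 / z ≤ |e1 c| ∧ X / z ≤ |e2 c| := by
  have k1 := h1.supp _ _ _ (left_ne_zero_of_mul h)
  have k2 := h2.supp _ _ _ (right_ne_zero_of_mul h)
  simp only [abs_div, abs_of_pos hX, div_le_iff₀ hX, le_div_iff₀ hX] at k2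
  refine ⟨⟨k1.1, k2.1⟩, ⟨k1.2.1, k2.2.1⟩, ⟨k1.2.2.1, k2.2.2.1⟩, k1.2.2.2, ?_⟩
  rw [div_eq_mul_inv, mul_comm, ← one_div]; exact k2.2.2.2

lemma rpow_aux {y : ℝ} (hy : 0 ≤ y) : (y ^ 4) ^ (19 / 4 : ℝ) = y ^ 19 := by
  rw [← Real.rpow_natCast y 4, ← Real.rpow_mul hy, ← Real.rpow_natCast y 19]; norm_num

lemma rpow_aux5 {y : ℝ} (hy : 0 ≤ y) : (y ^ 5) ^ (1 / 5 : ℝ) = y := by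
  rw [← Real.rpow_natCast y 5, ← Real.rpow_mul hy]; norm_num

lemma norm_eq (hd : 0 < d) (c : ℤ√d) : (c.norm.natAbs : ℝ) = |e1 c| * |e2 c| := by
  rw [← abs_mul, e1_mul_e2 hd, Nat.cast_natAbs]; push_cast; rfl

/-- the numerical error estimate -/
lemma err_est {z C d' N g : ℝ} {J K0 : ℕ} (hz : 2 ≤ z) (hC : 1 ≤ C) (hCz : C ≤ z) (hd0 : 0 ≤ d')
    (hdz : (1 + d') ^ 2 ≤ z)
    (hN : 0 ≤ N) (hN2 : N ≤ z ^ 6004) (hg0 : 0 ≤ g) (hg : g ≤ z ^ 30) (hJ : z ^ 2969 ≤ J)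
    (hK1 : z ^ 240 ≤ K0) (hK2 : K0 ≤ z ^ 241) :
    ((C * K0 * g ^ 6 * N ^ (19 / 4 : ℝ)) ^ (1 / 5 : ℝ) * (J : ℝ) ^ 12
      + (1 + d') ^ 2 * N ^ 2 * (J : ℝ) ^ 10 / K0) / (J : ℝ) ^ 16 ≤ 1 / z ^ 6044 := by
  have hz0 : 0 < z := by linarith
  have hJ0 : (0 : ℝ) < J := lt_of_lt_of_le (by positivity) hJ
  have hK0 : (0 : ℝ) < K0 := lt_of_lt_of_le (by positivity) hK1
  have t1 : N ^ (19 / 4 : ℝ) ≤ z ^ 28519 := by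
    calc N ^ (19 / 4 : ℝ) ≤ ((z ^ 1501) ^ 4) ^ (19 / 4 : ℝ) := by
          apply Real.rpow_le_rpow hN _ (by norm_num)
          rw [← pow_mul]; exact hN2
      _ = z ^ 28519 := by rw [rpow_aux (by positivity), ← pow_mul]
  have t2 : (C * K0 * g ^ 6 * N ^ (19 / 4 : ℝ)) ^ (1 / 5 : ℝ) ≤ z ^ 5789 := by
    calc _ ≤ ((z ^ 5789) ^ 5) ^ (1 / 5 : ℝ) := by
          apply Real.rpow_le_rpow (by positivity) _ (by norm_num)
          calc C * K0 * g ^ 6 * N ^ (19 / 4 : ℝ) ≤ z * z ^ 241 * (z ^ 30) ^ 6 * z ^ 28519 := by gcongr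
            _ = z ^ 28941 := by rw [← pow_succ', ← pow_mul, ← pow_add, ← pow_add]
            _ ≤ z ^ 28945 := pow_le_pow_right₀ (by linarith) (by norm_num)
            _ = _ := by rw [← pow_mul]
      _ = _ := rpow_aux5 (by positivity)
  have e : ((C * K0 * g ^ 6 * N ^ (19 / 4 : ℝ)) ^ (1 / 5 : ℝ) * (J : ℝ) ^ 12
      + (1 + d') ^ 2 * N ^ 2 * (J : ℝ) ^ 10 / K0) / (J : ℝ) ^ 16 =
      (C * K0 * g ^ 6 * N ^ (19 / 4 : ℝ)) ^ (1 / 5 : ℝ) / (J : ℝ) ^ 4 +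
      (1 + d') ^ 2 * N ^ 2 / (K0 * (J : ℝ) ^ 6) := by
    field_simp
  rw [e]
  have s1 : (C * K0 * g ^ 6 * N ^ (19 / 4 : ℝ)) ^ (1 / 5 : ℝ) / (J : ℝ) ^ 4 ≤ 1 / z ^ 6045 := by
    calc _ ≤ z ^ 5789 / (z ^ 2969) ^ 4 := by gcongr
      _ = z ^ 5789 / z ^ (5789 + 6087) := by rw [← pow_mul]
      _ = 1 / z ^ 6087 := div_pw' hz0 _ _
      _ ≤ 1 / z ^ 6045 := by
        apply one_div_le_one_div_of_le (by positivity)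
        exact pow_le_pow_right₀ (by linarith) (by norm_num)
  have s2 : (1 + d') ^ 2 * N ^ 2 / (K0 * (J : ℝ) ^ 6) ≤ 1 / z ^ 6045 := by
    calc _ ≤ z * (z ^ 6004) ^ 2 / (z ^ 240 * (z ^ 2969) ^ 6) := by gcongr
      _ = z ^ 12009 / z ^ (12009 + 6045) := by rw [← pow_mul, ← pow_mul, ← pow_succ', ← pow_add]
      _ = 1 / z ^ 6045 := div_pw' hz0 _ _
  calc _ ≤ 1 / z ^ 6045 + 1 / z ^ 6045 := add_le_add s1 s2
    _ = 2 * (1 / z ^ 6045) := by ring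
    _ ≤ z * (1 / z ^ (1 + 6044)) := by gcongr
    _ = 1 / z ^ 6044 := by
      have := div_pw hz0 1 6044
      rw [pow_one] at this
      rw [← this]; ring

lemma floor_est {z : ℝ} (hz : 2 ≤ z) (n : ℕ) : z ^ n ≤ ⌊z ^ (n + 1)⌋₊ ∧
    (⌊z ^ (n + 1)⌋₊ : ℝ) ≤ z ^ (n + 1) := by
  have h1 : 1 ≤ z ^ n := one_le_pow₀ (by linarith)
  refine ⟨?_, Nat.floor_le (by positivity)⟩
  have := Nat.lt_floor_add_one (z ^ (n + 1))
  have : z ^ (n + 1) = z ^ n * z := pow_succ _ _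
  nlinarith

lemma dl_bd {z X : ℝ} {u : ℤ√d} {J : ℕ}
    (hu : ∀ i j : ℕ, i < J → j < J →
      |e1 (u * ⟨i, j⟩)| ≤ 1 / z ^ 29 / 4 ∧ |e2 (u * ⟨i, j⟩)| ≤ 1 / z ^ 29 / 4 * X) (q : QJ J) :
    (|e1 (dl (bR u J) q).1| ≤ 1 / z ^ 29 ∧ |e2 (dl (bR u J) q).1| ≤ 1 / z ^ 29 * X) ∧
    (|e1 (dl (bR u J) q).2| ≤ 1 / z ^ 29 ∧ |e2 (dl (bR u J) q).2| ≤ 1 / z ^ 29 * X) := by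
  have hz : ∀ p : Fin J × Fin J, |e1 (u * zij d p)| ≤ 1 / z ^ 29 / 4 ∧
      |e2 (u * zij d p)| ≤ 1 / z ^ 29 / 4 * X := fun p => hu _ _ p.1.2 p.2.2
  have h4 : ∀ a b c e s : ℝ, |a| ≤ s / 4 → |b| ≤ s / 4 → |c| ≤ s / 4 → |e| ≤ s / 4 →
      |a + b - c - e| ≤ s := by
    intro a b c e s h1 h2 h3 h4
    rw [abs_le] at *
    constructor <;> linarith [h1.1, h1.2, h2.1, h2.2, h3.1, h3.2, h4.1, h4.2]
  have hz2 : ∀ p : Fin J × Fin J, |e2 (u * zij d p)| ≤ 1 / z ^ 29 * X / 4 := fun p =>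
    (hz p).2.trans (by apply le_of_eq; ring)
  simp only [dl, bR, Prod.fst_add, Prod.snd_add, Prod.fst_sub, Prod.snd_sub, e1_add, e1_sub,
    e2_add, e2_sub]
  exact ⟨⟨h4 _ _ _ _ _ (hz _).1 (hz _).1 (hz _).1 (hz _).1, h4 _ _ _ _ _ (hz2 _) (hz2 _) (hz2 _) (hz2 _)⟩,
    ⟨h4 _ _ _ _ _ (hz _).1 (hz _).1 (hz _).1 (hz _).1, h4 _ _ _ _ _ (hz2 _) (hz2 _) (hz2 _) (hz2 _)⟩⟩

lemma in_box (hd : 0 < d) {z X : ℝ} (hz : 1 ≤ z) (hX : 0 < X) {a b : ℤ√d}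
    (ha : |e1 a| ≤ z ∧ |e2 a| ≤ z * X)
    (hb : |e1 b| ≤ 1 / z ^ 29 ∧ |e2 b| ≤ 1 / z ^ 29 * X) : a + b ∈ Bz d z X := by
  have h1 : 1 / z ^ 29 ≤ z := by
    have : 1 ≤ z ^ 29 := one_le_pow₀ hz
    rw [div_le_iff₀ (by positivity)]; nlinarith
  have h2 : 1 / z ^ 29 * X ≤ z * X := by gcongr
  rw [mem_Bz hd, e1_add, e2_add]
  exact ⟨(abs_add_le _ _).trans (by linarith [ha.1, hb.1]),
    (abs_add_le _ _).trans (by linarith [ha.2, hb.2])⟩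

lemma in_box0 (hd : 0 < d) {z X : ℝ} (hz : 1 ≤ z) (hX : 0 < X) {a : ℤ√d}
    (ha : |e1 a| ≤ z ∧ |e2 a| ≤ z * X) : a ∈ Bz d z X := by
  rw [mem_Bz hd]
  have : 0 ≤ z * X := by positivity
  exact ⟨by linarith [ha.1], by linarith [ha.2]⟩

lemma rho_nonneg (c : ℤ√d) : 0 ≤ rho c := by unfold rho; positivity

open Classical in
/-- indicator of the congruence -/
def wc (c : ℤ√d) (v : (ℤ√d) × (ℤ√d)) : ℝ := if c ∣ v.1 * v.2 - 1 then 1 else 0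

lemma perc_good (hd : 0 < d) (hn : ¬ IsSquare d) : ∃ z0 : ℝ, 2 ≤ z0 ∧ ∀ z X : ℝ, z0 ≤ z →
    X = z ^ 6000 → ∀ F1 F2, Adm z F1 → Adm z F2 → ∀ c : ℤ√d, 1 / z ≤ |e1 c| → X / z ≤ |e2 c| →
    |e1 c| ≤ z → |e2 c| ≤ z * X → (cont c : ℝ) ≤ z ^ 30 →
    |∑ v ∈ Bz d z X ×ˢ Bz d z X, FF F1 F2 X v.1 v.2 c * wc c v -
      rho c / (|e1 c| * |e2 c|) * ∑ v ∈ Bz d z X ×ˢ Bz d z X, FF F1 F2 X v.1 v.2 c| ≤ X / z ^ 12 := by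
  classical
  obtain ⟨C, hC, hk⟩ := kloost hd hn
  obtain ⟨z1, hz1, hB⟩ := Bz_card hd hn
  obtain ⟨z2, hz2, hW⟩ := wcount hd hn
  obtain ⟨z3, hz3, hU⟩ := unit_shift hd hn
  have hd' : (1 : ℝ) ≤ d := by exact_mod_cast hd
  refine ⟨z1 + z2 + z3 + C + (1 + d) ^ 2 + 6, by nlinarith, ?_⟩
  intro z X hz hX F1 F2 h1 h2 c hc1 hc2 hc3 hc4 hcont
  have hd2 : 0 ≤ (1 + (d : ℝ)) ^ 2 := by positivity
  have hz6 : 6 ≤ z := by linarith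
  have hz0 : 0 < z := by linarith
  have hzC : C ≤ z := by linarith
  have hzd : (1 + (d : ℝ)) ^ 2 ≤ z := by linarith
  have hzd1 : 1 + (d : ℝ) ≤ z := by nlinarith
  have hd0 : (0 : ℝ) ≤ d := by linarith
  have hz2' : 2 ≤ z := by linarith
  have hX0 : 0 < X := by rw [hX]; positivity
  have hX1 : 1 ≤ X := by rw [hX]; exact one_le_pow₀ (by linarith)
  obtain ⟨u, v, huv, hu⟩ := hU z X (by linarith) hX
  set J := ⌊z ^ (2969 + 1)⌋₊ with hJdef
  obtain ⟨hJ1, hJ2⟩ := floor_est (by linarith : 2 ≤ z) 2969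
  rw [← hJdef] at hJ1 hJ2
  have hu' := hu J hJ2
  set K0 := ⌊z ^ (240 + 1)⌋₊ with hKdef
  obtain ⟨hK1, hK2⟩ := floor_est (by linarith : 2 ≤ z) 240
  rw [← hKdef] at hK1 hK2
  clear_value J K0
  have hJpos : (0 : ℝ) < J := lt_of_lt_of_le (by positivity) hJ1
  have hJpos' : 0 < J := by exact_mod_cast hJpos
  have hKpos : 1 ≤ K0 := by
    have : (0 : ℝ) < K0 := lt_of_lt_of_le (by positivity) hK1
    exact_mod_cast this
  have hc1' : 0 < |e1 c| := lt_of_lt_of_le (by positivity) hc1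
  have hc2' : 0 < |e2 c| := lt_of_lt_of_le (by positivity) hc2
  have hc0 : c ≠ 0 := by rintro rfl; simp at hc1'
  have hN := norm_eq hd c
  have hNup : (c.norm.natAbs : ℝ) ≤ z ^ 6004 := by
    rw [hN]
    calc |e1 c| * |e2 c| ≤ z * (z * X) := by gcongr
      _ = z ^ 6002 := by rw [hX]; ring
      _ ≤ z ^ 6004 := pow_le_pow_right₀ (by linarith) (by norm_num)
  have hNlo : z ^ 5998 ≤ (c.norm.natAbs : ℝ) := by
    rw [hN]
    calc z ^ 5998 = 1 / z * (X / z) := by rw [hX]; field_simp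
      _ ≤ _ := by gcongr
  have hNpos : (0 : ℝ) < c.norm.natAbs := lt_of_lt_of_le (by positivity) hNlo
  have hJN : (1 + d) * (J : ℤ) ^ 2 ≤ c.norm.natAbs := by
    have : (1 + (d : ℝ)) * (J : ℝ) ^ 2 ≤ c.norm.natAbs := by
      refine le_trans ?_ hNlo
      calc (1 + (d : ℝ)) * (J : ℝ) ^ 2 ≤ z * (z ^ (2969 + 1)) ^ 2 := by
            exact mul_le_mul hzd1 (pow_le_pow_left₀ hJpos.le hJ2 2) (by positivity) hz0.le
        _ = z ^ 5941 := by rw [← pow_mul, ← pow_succ']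
        _ ≤ _ := pow_le_pow_right₀ (by linarith) (by norm_num)
    have h' : (((1 + d) * (J : ℤ) ^ 2 : ℤ) : ℝ) ≤ ((c.norm.natAbs : ℤ) : ℝ) := by
      rw [Int.cast_natCast]; push_cast; exact this
    exact Int.cast_le.1 h'
  have hNe : Nonempty (QJ J) := by
    have : Nonempty (Fin J) := ⟨⟨0, hJpos'⟩⟩
    infer_instance
  have hcardQ : (Fintype.card (QJ J) : ℝ) = (J : ℝ) ^ 16 := by
    simp only [QJ, Fintype.card_prod, Fintype.card_fin]; push_cast; ring
  have hsh := shift (V := (ℤ√d) × (ℤ√d)) (Q := QJ J) (Bz d z X ×ˢ Bz d z X)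
    (fun v => FF F1 F2 X v.1 v.2 c) (wc c) (dl (bR u J)) (1 / z ^ 23) (1 / z ^ 6044)
    (rho c / (|e1 c| * |e2 c|)) ?_ ?_ ?_ ?_
  · refine hsh.trans ?_
    have w1 : ∑ v ∈ Bz d z X ×ˢ Bz d z X, |wc c v| ≤ z ^ 8 * X := by
      refine le_trans (le_of_eq ?_) (hW z X (by linarith) hX1 c hc1 hc2)
      rw [Finset.card_filter]; push_cast
      refine Finset.sum_congr rfl fun v _ => ?_
      unfold wc; split_ifs <;> simp
    have w2 : ∑ v ∈ Bz d z X ×ˢ Bz d z X, |FF F1 F2 X v.1 v.2 c| ≤ z ^ 8 * X ^ 2 := by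
      calc _ ≤ ∑ v ∈ Bz d z X ×ˢ Bz d z X, z ^ 2 := Finset.sum_le_sum fun v _ => FF_bd h1 h2 _ _ _
        _ = ((Bz d z X).card : ℝ) * ((Bz d z X).card : ℝ) * z ^ 2 := by
            rw [Finset.sum_const, Finset.card_product]; simp
        _ ≤ (z ^ 3 * X) * (z ^ 3 * X) * z ^ 2 := by
            have := hB z X (by linarith) hX1
            gcongr
        _ = _ := by ring
    calc _ ≤ 1 / z ^ (8 + 15) * (z ^ 8 * X) + 1 / z ^ (6008 + 36) * (z ^ 8 * X ^ 2) := by gcongr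
      _ = 1 / z ^ 15 * X + 1 / z ^ 36 * X := by
          rw [← mul_assoc, div_pw hz0]
          congr 1
          have : z ^ 8 * X ^ 2 = z ^ 6008 * X := by
            rw [sq, ← mul_assoc]; congr 1; rw [hX, ← pow_add]
          rw [this, ← mul_assoc, div_pw hz0]
      _ ≤ 1 / z ^ 13 * X + 1 / z ^ 13 * X := by
          gcongr <;> first | linarith | norm_num
      _ = 2 * (1 / z ^ (1 + 12)) * X := by norm_num; ring
      _ ≤ z ^ 1 * (1 / z ^ (1 + 12)) * X := by gcongr; linarith
      _ = X / z ^ 12 := by rw [mul_comm (z ^ 1), div_pw hz0]; ring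
  · intro v hv
    have := FF_supp hX0 h1 h2 hv
    rw [Finset.mem_product]
    exact ⟨in_box0 hd (by linarith) hX0 this.1, in_box0 hd (by linarith) hX0 this.2.1⟩
  · intro v q hv
    have := FF_supp hX0 h1 h2 hv
    have hq := dl_bd hu' q
    rw [Finset.mem_product]
    exact ⟨in_box hd (by linarith) hX0 this.1 hq.1, in_box hd (by linarith) hX0 this.2.1 hq.2⟩
  · intro v q
    have hq := dl_bd hu' q
    refine (FF_lip (s := 1 / z ^ 29) hz6 hX0 h1 h2 ?_ ?_ ?_).trans ?_
    · rw [Prod.fst_sub, sub_sub_cancel]; exact hq.1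
    · rw [Prod.snd_sub, sub_sub_cancel]; exact hq.2
    · rw [sub_self, e1_zero, e2_zero, abs_zero]; constructor <;> positivity
    · rw [mul_comm]; exact (div_pw hz0 6 23).le
  · intro y _
    have hkk := hk c u v hc0 huv J K0 hKpos hJN y.1 y.2
    have e1' : ∑ q : QJ J, wc c (y + dl (bR u J) q) = (cntq c u J y.1 y.2 : ℝ) := by
      unfold cntq wc
      rw [Finset.card_filter]; push_cast; rfl
    rw [e1', hcardQ]
    have e2' : (cntq c u J y.1 y.2 : ℝ) / (J : ℝ) ^ 16 - rho c / (|e1 c| * |e2 c|) =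
        ((cntq c u J y.1 y.2 : ℝ) - (Nat.card (Aq c)ˣ : ℝ) * (J : ℝ) ^ 16 /
          (c.norm.natAbs : ℝ) ^ 2) / (J : ℝ) ^ 16 := by
      rw [← hN]; unfold rho; field_simp
    rw [e2', abs_div, abs_of_pos (by positivity : (0 : ℝ) < (J : ℝ) ^ 16)]
    refine le_trans (div_le_div_of_nonneg_right hkk (by positivity)) ?_
    exact err_est hz2' hC hzC hd0 hzd (Nat.cast_nonneg _) hNup
      (Nat.cast_nonneg _) hcont hJ1 hK1 hK2

end
end
end Equi

namespace Equi
open scoped BigOperators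
noncomputable section
set_option linter.unusedSectionVars false
set_option linter.unusedDecidableInType false
set_option linter.unusedFintypeInType false

/-! ### Section 12: Theorem A, from the congruence sum to a lattice sum -/
section
variable {d : ℤ}

lemma rho_le_one (hn : ¬ IsSquare d) {c : ℤ√d} (hc : c ≠ 0) : rho c ≤ 1 := by
  unfold rho
  have := finite_quot hn hc
  rw [← card_quot hn hc]
  apply div_le_one_of_le₀ _ (by positivity)
  exact_mod_cast Nat.card_le_card_of_injective _ Units.val_injective

lemma norm_unit {u v : ℤ√d} (huv : u * v = 1) : u.norm.natAbs = 1 := by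
  have : u.norm * v.norm = 1 := by rw [← Zsqrtd.norm_mul, huv]; simp
  exact Int.natAbs_of_isUnit (IsUnit.of_mul_eq_one _ this)

lemma rho_unit {u v : ℤ√d} (huv : u * v = 1) (c : ℤ√d) : rho (u * c) = rho c := by
  have hu : IsUnit u := IsUnit.of_mul_eq_one _ huv
  unfold rho
  have h1 : (u * c).norm.natAbs = c.norm.natAbs := by
    rw [Zsqrtd.norm_mul, Int.natAbs_mul, norm_unit huv, one_mul]
  have h2 : Ideal.span {u * c} = Ideal.span {c} := Ideal.span_singleton_mul_left_unit hu c
  rw [h1]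
  unfold Aq
  rw [h2]

/-- division by the absolute value of the last variable -/
def dvc (F : ℝ → ℝ → ℝ → ℝ) (a e c : ℝ) : ℝ := F a e c / |c|

lemma Adm_dvc {z : ℝ} (hz : 2 ≤ z) {F : ℝ → ℝ → ℝ → ℝ} (h : Adm z F) : Adm (z ^ 2) (dvc F) := by
  have hz0 : 0 < z := by linarith
  have hzz : z ≤ z ^ 2 := by nlinarith
  have hlow : ∀ a e c, F a e c ≠ 0 → 1 / |c| ≤ z ∧ 0 < |c| := by
    intro a e c hne
    have := (h.supp a e c hne).2.2.2
    have hc : 0 < |c| := lt_of_lt_of_le (by positivity) this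
    refine ⟨?_, hc⟩
    rw [div_le_iff₀ hz0] at this
    rw [div_le_iff₀ hc]; linarith
  have key : ∀ a e c a' e' c', F a e c ≠ 0 → |dvc F a e c - dvc F a' e' c'| ≤
      (z ^ 2) ^ 4 * (|a - a'| + |e - e'| + |c - c'|) := by
    intro a e c a' e' c' hne
    obtain ⟨hc, hc0⟩ := hlow _ _ _ hne
    have hl := h.lip a e c a' e' c'
    set s := |a - a'| + |e - e'| + |c - c'| with hs
    have hs0 : 0 ≤ s := by positivity
    have hcs : |c - c'| ≤ s := by rw [hs]; linarith [abs_nonneg (a - a'), abs_nonneg (e - e')]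
    by_cases h' : F a' e' c' = 0
    · unfold dvc
      rw [h', zero_div, sub_zero, abs_div, abs_abs]
      rw [h', sub_zero] at hl
      calc |F a e c| / |c| = |F a e c| * (1 / |c|) := by ring
        _ ≤ z ^ 4 * s * z := by gcongr
        _ = z ^ 5 * s := by ring
        _ ≤ z ^ 8 * s := by gcongr <;> first | linarith | norm_num
        _ = _ := by ring
    · obtain ⟨hc', hc0'⟩ := hlow _ _ _ h'
      have heq : dvc F a e c - dvc F a' e' c' = (F a e c - F a' e' c') * (1 / |c|) +
          F a' e' c' * ((|c'| - |c|) * (1 / |c|) * (1 / |c'|)) := by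
        unfold dvc; field_simp; ring
      rw [heq]
      calc _ ≤ |F a e c - F a' e' c'| * (1 / |c|) +
            |F a' e' c'| * (|(|c'| - |c|)| * (1 / |c|) * (1 / |c'|)) := by
            refine (abs_add_le _ _).trans (le_of_eq ?_)
            simp only [abs_mul, abs_div, abs_one, abs_abs]
        _ ≤ z ^ 4 * s * z + z * (s * z * z) := by
            have h1 : |(|c'| - |c|)| ≤ s := by
              rw [abs_sub_comm]; exact (abs_abs_sub_abs_le _ _).trans hcs
            have := h.bd a' e' c'
            gcongr
        _ = (z ^ 5 + z ^ 3) * s := by ring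
        _ ≤ (z ^ 2) ^ 4 * s := by
            gcongr
            have h3 : z ^ 3 ≤ z ^ 5 := pow_le_pow_right₀ (by linarith) (by norm_num)
            have h6 : 2 * z ^ 5 ≤ z * z ^ 5 := by gcongr
            have h7 : z ^ 6 ≤ z ^ 8 := pow_le_pow_right₀ (by linarith) (by norm_num)
            have : (z ^ 2) ^ 4 = z ^ 8 := by ring
            have : z * z ^ 5 = z ^ 6 := by ring
            linarith
  refine ⟨?_, ?_, ?_⟩
  · intro a e c
    by_cases h0 : F a e c = 0
    · unfold dvc; rw [h0]; simp; positivity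
    · unfold dvc
      rw [abs_div, abs_abs]
      have := h.bd a e c
      obtain ⟨hc, hc0⟩ := hlow _ _ _ h0
      calc |F a e c| / |c| = |F a e c| * (1 / |c|) := by ring
        _ ≤ z * z := by gcongr
        _ = z ^ 2 := by ring
  · intro a e c hne
    have h0 : F a e c ≠ 0 := by
      intro h0; apply hne; unfold dvc; rw [h0, zero_div]
    have := h.supp a e c h0
    refine ⟨by linarith, by linarith, by linarith, ?_⟩
    refine le_trans ?_ this.2.2.2
    gcongr
  · intro a e c a' e' c'
    by_cases h0 : F a e c = 0
    · by_cases h0' : F a' e' c' = 0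
      · unfold dvc; rw [h0, h0']; simp; positivity
      · have := key a' e' c' a e c h0'
        rw [abs_sub_comm, abs_sub_comm a, abs_sub_comm e, abs_sub_comm c]
        exact this
    · exact key _ _ _ _ _ _ h0

lemma FF_dvc {X : ℝ} (hX : 0 < X) (F1 F2 : ℝ → ℝ → ℝ → ℝ) (a e c : ℤ√d) :
    FF (dvc F1) (dvc F2) X a e c = X * (FF F1 F2 X a e c / (|e1 c| * |e2 c|)) := by
  unfold FF dvc
  rw [abs_div, abs_of_pos hX]
  field_simp

/-- the sum over the pair of box variables -/
def HH (d : ℤ) (F1 F2 : ℝ → ℝ → ℝ → ℝ) (z X : ℝ) (c : ℤ√d) : ℝ :=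
  ∑ v ∈ Bz d z X ×ˢ Bz d z X, FF F1 F2 X v.1 v.2 c

lemma rho_err {z C D : ℝ} {J Y : ℕ} (hz : 6 ≤ z) (hC : 1 ≤ C) (hCz : C ≤ z) (hD0 : 0 ≤ D)
    (hD : D ≤ z ^ 189) (hY : z ^ 749 ≤ Y) (hY2 : Y ≤ z ^ 750) (hJ : z ^ 2969 ≤ J) :
    D ^ 2 / Y + 4 * (Y : ℝ) ^ 2 / J + C * (Y : ℝ) ^ (-(1 / 2) : ℝ) ≤ 1 / z ^ 20 := by
  have hz0 : 0 < z := by linarith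
  have h21 : ∀ n, 21 ≤ n → 1 / z ^ n ≤ 1 / z ^ 21 := fun n hn => by
    apply one_div_le_one_div_of_le (by positivity)
    exact pow_le_pow_right₀ (by linarith) hn
  have s1 : D ^ 2 / Y ≤ 1 / z ^ 21 := by
    calc D ^ 2 / Y ≤ (z ^ 189) ^ 2 / z ^ 749 := by gcongr
      _ = z ^ 378 / z ^ (378 + 371) := by rw [← pow_mul]
      _ = 1 / z ^ 371 := div_pw' hz0 _ _
      _ ≤ _ := h21 _ (by norm_num)
  have s2 : 4 * (Y : ℝ) ^ 2 / J ≤ 1 / z ^ 21 := by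
    calc 4 * (Y : ℝ) ^ 2 / J ≤ z * (z ^ 750) ^ 2 / z ^ 2969 := by gcongr; linarith
      _ = z ^ 1501 / z ^ (1501 + 1468) := by rw [← pow_mul, ← pow_succ']
      _ = 1 / z ^ 1468 := div_pw' hz0 _ _
      _ ≤ _ := h21 _ (by norm_num)
  have s3 : C * (Y : ℝ) ^ (-(1 / 2) : ℝ) ≤ 1 / z ^ 21 := by
    calc C * (Y : ℝ) ^ (-(1 / 2) : ℝ) ≤ z * ((z ^ 374) ^ 2) ^ (-(1 / 2) : ℝ) := by
          refine mul_le_mul hCz ?_ (by positivity) hz0.le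
          apply Real.rpow_le_rpow_of_nonpos (by positivity) _ (by norm_num)
          refine le_trans ?_ hY
          rw [← pow_mul]
          exact pow_le_pow_right₀ (by linarith) (by norm_num)
      _ = z * (1 / z ^ 374) := by
          have e : ∀ y : ℝ, 0 < y → (y ^ 2) ^ (-(1 / 2) : ℝ) = 1 / y := by
            intro y hy
            rw [← Real.rpow_natCast y 2, ← Real.rpow_mul hy.le]
            norm_num [Real.rpow_neg_one]
          rw [e _ (by positivity)]
      _ = z ^ 1 / z ^ (1 + 373) := by rw [pow_one]; ring
      _ = 1 / z ^ 373 := div_pw' hz0 _ _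
      _ ≤ _ := h21 _ (by norm_num)
  calc _ ≤ 1 / z ^ 21 + 1 / z ^ 21 + 1 / z ^ 21 := by linarith
    _ = 3 * (1 / z ^ (1 + 20)) := by norm_num; ring
    _ ≤ z ^ 1 * (1 / z ^ (1 + 20)) := by gcongr; linarith
    _ = _ := by rw [mul_comm, div_pw hz0]

lemma rho_local (hd : 0 < d) (hn : ¬ IsSquare d) : ∃ z0 : ℝ, 2 ≤ z0 ∧ ∀ z X : ℝ, z0 ≤ z →
    X = z ^ 6000 → ∀ (J : ℕ) (u v c : ℤ√d), z ^ 2969 ≤ J → u * v = 1 →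
    (∀ q : Fin J × Fin J, c + u * zij d q ≠ 0 ∧ c + u * zij d q ∈ Bz d z X) →
    |(∑ q : Fin J × Fin J, rho (c + u * zij d q)) / Fintype.card (Fin J × Fin J) - kap d| ≤
      1 / z ^ 20 := by
  obtain ⟨C, hC, hr⟩ := rho_avg (d := d) hn
  obtain ⟨C', hC', hdv⟩ := divisor_bound_real 32 (by norm_num)
  refine ⟨C + C' + 6, by linarith, fun z X hz hX J u v c hJ huv H => ?_⟩
  have hz6 : 6 ≤ z := by linarith
  have hz0 : 0 < z := by linarith
  have hzC : C ≤ z := by linarith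
  have hzC' : C' ≤ z := by linarith
  have hz2 : 2 ≤ z := by linarith
  have hX0 : 0 < X := by rw [hX]; positivity
  obtain ⟨hY1, hY2⟩ := floor_est hz2 749
  generalize ⌊z ^ (749 + 1)⌋₊ = Y at hY1 hY2
  have hJpos : (0 : ℝ) < J := lt_of_lt_of_le (by positivity) hJ
  have hYpos : (0 : ℝ) < Y := lt_of_lt_of_le (by positivity) hY1
  have hshift : ∀ q : Fin J × Fin J, (c + u * zij d q) =
      u * (⟨(v * c).re + (q.1 : ℕ), (v * c).im + (q.2 : ℕ)⟩ : ℤ√d) := by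
    intro q
    have : (⟨(v * c).re + (q.1 : ℕ), (v * c).im + (q.2 : ℕ)⟩ : ℤ√d) = v * c + zij d q := by
      ext <;> simp [zij]
    rw [this, mul_add, ← mul_assoc, huv, one_mul]
  have hh := hr (v * c) J Y (z ^ 189) (by exact_mod_cast hYpos) (by exact_mod_cast hJpos) ?_
  · have e1' : ∑ q : Fin J × Fin J, rho (c + u * zij d q) = ∑ i ∈ Finset.range J,
        ∑ j ∈ Finset.range J, rho (⟨(v * c).re + i, (v * c).im + j⟩ : ℤ√d) := by
      rw [Fintype.sum_prod_type, Finset.sum_range]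
      refine Finset.sum_congr rfl fun i _ => ?_
      rw [Finset.sum_range]
      refine Finset.sum_congr rfl fun j _ => ?_
      rw [hshift, rho_unit huv]
    have hcard : (Fintype.card (Fin J × Fin J) : ℝ) = (J : ℝ) ^ 2 := by simp; ring
    have hJ2 : (0 : ℝ) < (J : ℝ) ^ 2 := by positivity
    rw [e1', hcard, div_sub' hJ2.ne', abs_div, abs_of_pos hJ2, div_le_iff₀ hJ2]
    refine hh.trans ?_
    rw [mul_comm]
    gcongr
    exact rho_err hz6 hC hzC (by positivity) le_rfl hY1 hY2 hJ
  · intro i j hi hj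
    obtain ⟨h1, h2⟩ := H (⟨i, hi⟩, ⟨j, hj⟩)
    rw [hshift] at h1 h2
    set w : ℤ√d := ⟨(v * c).re + i, (v * c).im + j⟩ with hw
    change u * w ≠ 0 at h1
    change u * w ∈ _ at h2
    have hw0 : w ≠ 0 := by
      intro h0; apply h1; rw [h0, mul_zero]
    refine ⟨hw0, ?_⟩
    have hnn : w.norm.natAbs = (u * w).norm.natAbs := by
      rw [Zsqrtd.norm_mul, Int.natAbs_mul, norm_unit huv, one_mul]
    have hpos : 1 ≤ w.norm.natAbs := Int.natAbs_pos.2 (norm_ne_zero' hn hw0)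
    have hle : (w.norm.natAbs : ℝ) ≤ (z ^ 188) ^ 32 := by
      rw [hnn, norm_eq hd]
      rw [mem_Bz hd] at h2
      calc |e1 (u * w)| * |e2 (u * w)| ≤ (2 * z) * (2 * z * X) := by
            have := h2.1; have := h2.2
            gcongr
        _ = 4 * z ^ 6002 := by rw [hX]; ring
        _ ≤ z * z ^ 6002 := by gcongr; linarith only [hz6]
        _ = z ^ 6003 := by ring
        _ ≤ z ^ 6016 := pow_le_pow_right₀ (by linarith only [hz6]) (by norm_num)
        _ = _ := by rw [← pow_mul]
    have e32 : ∀ y : ℝ, 0 ≤ y → (y ^ 32) ^ (1 / (32 : ℕ) : ℝ) = y := by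
      intro y hy
      rw [← Real.rpow_natCast y 32, ← Real.rpow_mul hy]; norm_num
    calc (w.norm.natAbs.divisors.card : ℝ) ≤ C' * (w.norm.natAbs : ℝ) ^ (1 / (32 : ℕ) : ℝ) := hdv _ hpos
      _ ≤ z * ((z ^ 188) ^ 32) ^ (1 / (32 : ℕ) : ℝ) := by
          refine mul_le_mul hzC' ?_ (by positivity) hz0.le
          exact Real.rpow_le_rpow (by positivity) hle (by norm_num)
      _ = z * z ^ 188 := by rw [e32 _ (by positivity)]
      _ = z ^ 189 := by ring

end
end
end Equi

namespace Equi
open scoped BigOperators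
noncomputable section
set_option linter.unusedSectionVars false
set_option linter.unusedDecidableInType false
set_option linter.unusedFintypeInType false

/-! ### Section 13: Theorem A, assembly -/
section
variable {d : ℤ}

lemma perc_triv (hd : 0 < d) (hn : ¬ IsSquare d) : ∃ z0 : ℝ, 2 ≤ z0 ∧ ∀ z X : ℝ, z0 ≤ z →
    X = z ^ 6000 → ∀ F1 F2, Adm z F1 → Adm z F2 → ∀ c : ℤ√d, 1 / z ≤ |e1 c| → X / z ≤ |e2 c| →
    |∑ v ∈ Bz d z X ×ˢ Bz d z X, FF F1 F2 X v.1 v.2 c * wc c v -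
      rho c / (|e1 c| * |e2 c|) * ∑ v ∈ Bz d z X ×ˢ Bz d z X, FF F1 F2 X v.1 v.2 c| ≤ z ^ 12 * X := by
  classical
  obtain ⟨z1, hz1, hB⟩ := Bz_card hd hn
  obtain ⟨z2, hz2, hW⟩ := wcount hd hn
  refine ⟨z1 + z2, by linarith, ?_⟩
  intro z X hz hX F1 F2 h1 h2 c hc1 hc2
  have hz2' : 2 ≤ z := by linarith
  have hz0 : 0 < z := by linarith
  have hX0 : 0 < X := by rw [hX]; positivity
  have hX1 : 1 ≤ X := by rw [hX]; exact one_le_pow₀ (by linarith)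
  have hc1' : 0 < |e1 c| := lt_of_lt_of_le (by positivity) hc1
  have hc2' : 0 < |e2 c| := lt_of_lt_of_le (by positivity) hc2
  have hc0 : c ≠ 0 := by rintro rfl; simp at hc1'
  have w1 : ∑ v ∈ Bz d z X ×ˢ Bz d z X, |wc c v| ≤ z ^ 8 * X := by
    refine le_trans (le_of_eq ?_) (hW z X (by linarith) hX1 c hc1 hc2)
    rw [Finset.card_filter]; push_cast
    refine Finset.sum_congr rfl fun v _ => ?_
    unfold wc; split_ifs <;> simp
  have w2 : ∑ v ∈ Bz d z X ×ˢ Bz d z X, |FF F1 F2 X v.1 v.2 c| ≤ z ^ 8 * X ^ 2 := by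
    calc _ ≤ ∑ v ∈ Bz d z X ×ˢ Bz d z X, z ^ 2 := Finset.sum_le_sum fun v _ => FF_bd h1 h2 _ _ _
      _ = ((Bz d z X).card : ℝ) * ((Bz d z X).card : ℝ) * z ^ 2 := by
          rw [Finset.sum_const, Finset.card_product]; simp
      _ ≤ (z ^ 3 * X) * (z ^ 3 * X) * z ^ 2 := by
          have := hB z X (by linarith) hX1
          gcongr
      _ = _ := by ring
  have s1 : |∑ v ∈ Bz d z X ×ˢ Bz d z X, FF F1 F2 X v.1 v.2 c * wc c v| ≤ z ^ 10 * X := by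
    refine (Finset.abs_sum_le_sum_abs _ _).trans ?_
    calc _ ≤ ∑ v ∈ Bz d z X ×ˢ Bz d z X, z ^ 2 * |wc c v| := by
          refine Finset.sum_le_sum fun v _ => ?_
          rw [abs_mul]
          exact mul_le_mul_of_nonneg_right (FF_bd h1 h2 _ _ _) (abs_nonneg _)
      _ ≤ z ^ 2 * (z ^ 8 * X) := by rw [← Finset.mul_sum]; gcongr
      _ = _ := by ring
  have hlow : X / z ^ 2 ≤ |e1 c| * |e2 c| := by
    calc X / z ^ 2 = 1 / z * (X / z) := by field_simp
      _ ≤ _ := by gcongr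
  have s2 : |rho c / (|e1 c| * |e2 c|) * ∑ v ∈ Bz d z X ×ˢ Bz d z X, FF F1 F2 X v.1 v.2 c| ≤
      z ^ 10 * X := by
    rw [abs_mul, abs_div, abs_of_nonneg (rho_nonneg c), abs_of_pos (mul_pos hc1' hc2')]
    calc _ ≤ 1 / (X / z ^ 2) * (z ^ 8 * X ^ 2) := by
          have := rho_le_one hn hc0
          have := (Finset.abs_sum_le_sum_abs (fun v : (ℤ√d) × (ℤ√d) => FF F1 F2 X v.1 v.2 c)
            (Bz d z X ×ˢ Bz d z X)).trans w2
          gcongr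
      _ = z ^ 10 * X := by field_simp
  calc _ ≤ z ^ 10 * X + z ^ 10 * X := (abs_sub _ _).trans (add_le_add s1 s2)
    _ = 2 * z ^ 10 * X := by ring
    _ ≤ (z * z) * z ^ 10 * X := by gcongr; nlinarith
    _ = _ := by ring

lemma stepOne (hd : 0 < d) (hn : ¬ IsSquare d) : ∃ z0 : ℝ, 2 ≤ z0 ∧ ∀ z X : ℝ, z0 ≤ z →
    X = z ^ 6000 → ∀ F1 F2, Adm z F1 → Adm z F2 →
    |∑ c ∈ Bz d z X, ∑ v ∈ Bz d z X ×ˢ Bz d z X, FF F1 F2 X v.1 v.2 c * wc c v -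
      ∑ c ∈ Bz d z X, (HH d (dvc F1) (dvc F2) z X c) / X * rho c| ≤ X ^ 2 / z ^ 8 := by
  classical
  obtain ⟨z1, hz1, hB⟩ := Bz_card hd hn
  obtain ⟨z2, hz2, hT⟩ := perc_triv hd hn
  obtain ⟨z3, hz3, hG⟩ := perc_good hd hn
  obtain ⟨z4, hz4, hC⟩ := cont_count hd hn
  refine ⟨z1 + z2 + z3 + z4, by linarith, ?_⟩
  intro z X hz hX F1 F2 h1 h2
  have hz2' : 2 ≤ z := by linarith
  have hz0 : 0 < z := by linarith
  have hX0 : 0 < X := by rw [hX]; positivity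
  have hX1 : 1 ≤ X := by rw [hX]; exact one_le_pow₀ (by linarith)
  have hB' := hB z X (by linarith) hX1
  have hC' := hC z X (by linarith) hX1
  have hT' := hT z X (by linarith) hX F1 F2 h1 h2
  have hG' := hG z X (by linarith) hX F1 F2 h1 h2
  clear hz hT hG hB hC
  set S := (Bz d z X).filter fun c => c ≠ 0 ∧ z ^ 30 < cont c with hS
  rw [← Finset.sum_sub_distrib]
  refine (Finset.abs_sum_le_sum_abs _ _).trans ?_
  have key : ∀ c ∈ Bz d z X, |∑ v ∈ Bz d z X ×ˢ Bz d z X, FF F1 F2 X v.1 v.2 c * wc c v -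
      (HH d (dvc F1) (dvc F2) z X c) / X * rho c| ≤ X / z ^ 12 + (if c ∈ S then z ^ 12 * X else 0) := by
    intro c hc
    have hH : (HH d (dvc F1) (dvc F2) z X c) / X * rho c =
        rho c / (|e1 c| * |e2 c|) * ∑ v ∈ Bz d z X ×ˢ Bz d z X, FF F1 F2 X v.1 v.2 c := by
      unfold HH
      simp only [FF_dvc hX0]
      rw [← Finset.mul_sum, ← Finset.sum_div]
      field_simp
    rw [hH]
    have hpos1 : 0 ≤ X / z ^ 12 := by positivity
    have hpos2 : 0 ≤ (if c ∈ S then z ^ 12 * X else 0) := by split_ifs <;> positivity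
    by_cases hex : ∃ v : (ℤ√d) × (ℤ√d), FF F1 F2 X v.1 v.2 c ≠ 0
    · obtain ⟨v, hv⟩ := hex
      obtain ⟨_, _, ⟨r1, r2⟩, r3, r4⟩ := FF_supp hX0 h1 h2 hv
      by_cases hcont : (cont c : ℝ) ≤ z ^ 30
      · exact (hG' c r3 r4 r1 r2 hcont).trans (by linarith)
      · have hc0 : c ≠ 0 := by
          rintro rfl
          have : 0 < 1 / z := by positivity
          simp at r3; linarith [r3, inv_pos.2 hz0]
        have hcS : c ∈ S := Finset.mem_filter.2 ⟨hc, hc0, not_le.1 hcont⟩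
        rw [if_pos hcS]
        exact (hT' c r3 r4).trans (by linarith)
    · push Not at hex
      simp only [hex]
      simp only [zero_mul, Finset.sum_const_zero, mul_zero, sub_zero, abs_zero]
      positivity
  calc _ ≤ ∑ c ∈ Bz d z X, (X / z ^ 12 + (if c ∈ S then z ^ 12 * X else 0)) := Finset.sum_le_sum key
    _ = (Bz d z X).card * (X / z ^ 12) + S.card * (z ^ 12 * X) := by
        have hsub : (Bz d z X).filter (fun c => c ∈ S) = S := by
          ext c; rw [Finset.mem_filter, hS, Finset.mem_filter]; tauto
        rw [Finset.sum_add_distrib, ← Finset.sum_filter, hsub]; simp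
    _ ≤ z ^ 3 * X * (X / z ^ 12) + X / z ^ 27 * (z ^ 12 * X) := by
        have : (S.card : ℝ) ≤ X / z ^ 27 := by rw [le_div_iff₀ (by positivity)]; exact hC'
        gcongr
    _ = X ^ 2 * (1 / z ^ 9) + X ^ 2 * (1 / z ^ 15) := by field_simp
    _ ≤ X ^ 2 * (1 / z ^ 9) + X ^ 2 * (1 / z ^ 9) := by
        gcongr <;> first | linarith | norm_num
    _ = 2 * X ^ 2 / z ^ 9 := by ring
    _ ≤ z * X ^ 2 / z ^ 9 := by gcongr
    _ = _ := by field_simp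

lemma stepTwo (hd : 0 < d) (hn : ¬ IsSquare d) : ∃ z0 : ℝ, 2 ≤ z0 ∧ ∀ z X : ℝ, z0 ≤ z →
    X = z ^ 6000 → ∀ F1 F2, Adm z F1 → Adm z F2 →
    |∑ c ∈ Bz d z X, (HH d (dvc F1) (dvc F2) z X c) / X * rho c -
      kap d * ∑ c ∈ Bz d z X, (HH d (dvc F1) (dvc F2) z X c) / X| ≤ X ^ 2 / z ^ 6 := by
  classical
  obtain ⟨z1, hz1, hB⟩ := Bz_card hd hn
  obtain ⟨z2, hz2, hR⟩ := rho_local hd hn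
  obtain ⟨z3, hz3, hU⟩ := unit_shift hd hn
  refine ⟨z1 + z2 + z3 + 6, by linarith, ?_⟩
  intro z X hz hX F1 F2 h1 h2
  have hz6 : 6 ≤ z := by linarith
  have hz2' : 2 ≤ z := by linarith
  have hz1' : 1 ≤ z := by linarith
  have hz0 : 0 < z := by linarith
  have hX0 : 0 < X := by rw [hX]; positivity
  have hX1 : 1 ≤ X := by rw [hX]; exact one_le_pow₀ (by linarith)
  have hB' := hB z X (by linarith) hX1
  have hR' := hR z X (by linarith) hX
  obtain ⟨u, v, huv, hu⟩ := hU z X (by linarith) hX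
  clear hz hB hR hU
  obtain ⟨hJ1, hJ2⟩ := floor_est hz2' 2969
  generalize ⌊z ^ (2969 + 1)⌋₊ = J at hJ1 hJ2
  have hu' := hu J hJ2
  have hJpos : (0 : ℝ) < J := lt_of_lt_of_le (by positivity) hJ1
  have hJpos' : 0 < J := by exact_mod_cast hJpos
  have a1 := Adm_dvc hz2' h1
  have a2 := Adm_dvc hz2' h2
  have hδ : ∀ q : Fin J × Fin J, |e1 (u * zij d q)| ≤ 1 / z ^ 29 ∧
      |e2 (u * zij d q)| ≤ 1 / z ^ 29 * X := by
    intro q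
    have := hu' _ _ q.1.2 q.2.2
    have h0 : 0 ≤ 1 / z ^ 29 := by positivity
    exact ⟨this.1.trans (by linarith), this.2.trans
      (mul_le_mul_of_nonneg_right (by linarith) hX0.le)⟩
  have hHsupp : ∀ c, HH d (dvc F1) (dvc F2) z X c / X ≠ 0 →
      (|e1 c| ≤ z ∧ |e2 c| ≤ z * X) ∧ 1 / z ≤ |e1 c| := by
    intro c hc
    have : ∃ v ∈ Bz d z X ×ˢ Bz d z X, FF (dvc F1) (dvc F2) X v.1 v.2 c ≠ 0 := by
      by_contra hcon
      push Not at hcon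
      apply hc
      unfold HH
      rw [Finset.sum_eq_zero hcon, zero_div]
    obtain ⟨v, _, hv⟩ := this
    rw [FF_dvc hX0] at hv
    have hv' : FF F1 F2 X v.1 v.2 c ≠ 0 := by
      intro h0; apply hv; rw [h0]; simp
    have := FF_supp hX0 h1 h2 hv'
    exact ⟨this.2.2.1, this.2.2.2.1⟩
  have hNe : Nonempty (Fin J × Fin J) := ⟨(⟨0, hJpos'⟩, ⟨0, hJpos'⟩)⟩
  have hsh := shift (V := ℤ√d) (Q := Fin J × Fin J) (Bz d z X)
    (fun c => HH d (dvc F1) (dvc F2) z X c / X) rho (fun q => u * zij d q) (X / z ^ 11) (1 / z ^ 20)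
    (kap d) ?_ ?_ ?_ ?_
  · refine hsh.trans ?_
    have w1 : ∑ c ∈ Bz d z X, |rho c| ≤ z ^ 3 * X + 1 := by
      have : ∀ c ∈ Bz d z X, |rho c| ≤ 1 := by
        intro c _
        rw [abs_of_nonneg (rho_nonneg c)]
        by_cases h0 : c = 0
        · unfold rho; rw [h0]; simp
        · exact rho_le_one hn h0
      refine (Finset.sum_le_sum this).trans ?_
      simp; linarith
    have hHbd : ∀ c, |HH d (dvc F1) (dvc F2) z X c / X| ≤ z ^ 10 * X := by
      intro c
      rw [abs_div, abs_of_pos hX0, div_le_iff₀ hX0]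
      unfold HH
      refine (Finset.abs_sum_le_sum_abs _ _).trans ?_
      calc _ ≤ ∑ v ∈ Bz d z X ×ˢ Bz d z X, (z ^ 2) ^ 2 :=
            Finset.sum_le_sum fun v _ => FF_bd a1 a2 _ _ _
        _ = ((Bz d z X).card : ℝ) * ((Bz d z X).card : ℝ) * (z ^ 2) ^ 2 := by
            rw [Finset.sum_const, Finset.card_product]; simp
        _ ≤ (z ^ 3 * X) * (z ^ 3 * X) * (z ^ 2) ^ 2 := by gcongr
        _ = _ := by ring
    have w2 : ∑ c ∈ Bz d z X, |HH d (dvc F1) (dvc F2) z X c / X| ≤ z ^ 13 * X ^ 2 := by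
      calc _ ≤ ∑ c ∈ Bz d z X, z ^ 10 * X := Finset.sum_le_sum fun c _ => hHbd c
        _ = (Bz d z X).card * (z ^ 10 * X) := by simp
        _ ≤ z ^ 3 * X * (z ^ 10 * X) := by gcongr
        _ = _ := by ring
    have w1' : z ^ 3 * X + 1 ≤ z ^ 4 * X := by
      have : 1 ≤ z ^ 3 * X := one_le_mul_of_one_le_of_one_le (one_le_pow₀ hz1') hX1
      have e : z ^ 4 * X = z * (z ^ 3 * X) := by ring
      nlinarith
    calc _ ≤ X / z ^ 11 * (z ^ 4 * X) + 1 / z ^ 20 * (z ^ 13 * X ^ 2) := by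
          gcongr; exact w1.trans w1'
      _ = 2 * X ^ 2 / z ^ 7 := by field_simp; ring
      _ ≤ z * X ^ 2 / z ^ 7 := by gcongr
      _ = _ := by field_simp
  · intro c hc
    exact in_box0 hd hz1' hX0 (hHsupp c hc).1
  · intro c q hc
    exact in_box hd hz1' hX0 (hHsupp c hc).1 (hδ q)
  · intro c q
    rw [← sub_div, abs_div, abs_of_pos hX0, div_le_iff₀ hX0]
    unfold HH
    rw [← Finset.sum_sub_distrib]
    refine (Finset.abs_sum_le_sum_abs _ _).trans ?_
    calc _ ≤ ∑ v ∈ Bz d z X ×ˢ Bz d z X, (z ^ 2) ^ 6 * (1 / z ^ 29) := by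
          refine Finset.sum_le_sum fun v _ => ?_
          refine FF_lip (s := 1 / z ^ 29) (by nlinarith) hX0 a1 a2 ?_ ?_ ?_
          · rw [sub_self, e1_zero, e2_zero, abs_zero]; constructor <;> positivity
          · rw [sub_self, e1_zero, e2_zero, abs_zero]; constructor <;> positivity
          · rw [sub_sub_cancel]; exact hδ q
      _ = ((Bz d z X).card : ℝ) * ((Bz d z X).card : ℝ) * ((z ^ 2) ^ 6 * (1 / z ^ 29)) := by
          rw [Finset.sum_const, Finset.card_product]; simp
      _ ≤ (z ^ 3 * X) * (z ^ 3 * X) * ((z ^ 2) ^ 6 * (1 / z ^ 29)) := by gcongr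
      _ = X / z ^ 11 * X := by field_simp
  · intro c hc
    have hc' := hHsupp c hc
    refine hR' J u v c hJ1 huv fun q => ⟨?_, in_box hd hz1' hX0 hc'.1 (hδ q)⟩
    intro h0
    have e : e1 c = - e1 (u * zij d q) := by
      have := congrArg e1 h0
      rw [e1_add, e1_zero] at this; linarith
    have k1 := (hδ q).1
    have k2 := hc'.2
    rw [e, abs_neg] at k2
    have : 1 / z ^ 29 < 1 / z := by
      apply one_div_lt_one_div_of_lt hz0
      calc z = z ^ 1 := by ring
        _ < z ^ 29 := pow_lt_pow_right₀ (by linarith only [hz6]) (by norm_num)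
    linarith only [k1, k2, this]

/-- **Theorem A** -/
lemma theoremA (hd : 0 < d) (hn : ¬ IsSquare d) : ∃ z0 : ℝ, 2 ≤ z0 ∧ ∀ z X : ℝ, z0 ≤ z →
    X = z ^ 6000 → ∀ F1 F2, Adm z F1 → Adm z F2 →
    |∑ c ∈ Bz d z X, ∑ v ∈ Bz d z X ×ˢ Bz d z X, FF F1 F2 X v.1 v.2 c * wc c v -
      kap d * ((∑ c ∈ Bz d z X, HH d (dvc F1) (dvc F2) z X c) / X)| ≤ X ^ 2 / z ^ 5 := by
  obtain ⟨z1, hz1, h1⟩ := stepOne hd hn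
  obtain ⟨z2, hz2, h2⟩ := stepTwo hd hn
  refine ⟨z1 + z2, by linarith, ?_⟩
  intro z X hz hX F1 F2 a1 a2
  have hz2' : 2 ≤ z := by linarith
  have hz0 : 0 < z := by linarith
  have k1 := h1 z X (by linarith) hX F1 F2 a1 a2
  have k2 := h2 z X (by linarith) hX F1 F2 a1 a2
  rw [Finset.sum_div]
  refine (abs_sub_le _ _ _).trans ((add_le_add k1 k2).trans ?_)
  have : X ^ 2 / z ^ 8 ≤ X ^ 2 / z ^ 6 := by
    gcongr <;> first | linarith only [hz2'] | norm_num
  calc _ ≤ 2 * X ^ 2 / z ^ 6 := by rw [two_mul, add_div]; gcongr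
    _ ≤ z * X ^ 2 / z ^ 6 := by gcongr
    _ = _ := by field_simp

end
end
end Equi

namespace Equi
open scoped BigOperators
open MeasureTheory
noncomputable section
set_option linter.unusedSectionVars false
set_option linter.unusedDecidableInType false
set_option linter.unusedFintypeInType false
section
variable {d : ℤ}

/-- bounded, compactly supported and Lipschitz. -/
structure Nice (W : ℝ) (f : ℝ → ℝ) : Prop where
  bd : ∀ x, |f x| ≤ W
  supp : ∀ x, f x ≠ 0 → |x| ≤ W
  lip : ∀ x y, |f x - f y| ≤ W * |x - y|

lemma continuous_of_lip {f : ℝ → ℝ} {L : ℝ} (h : ∀ x y, |f x - f y| ≤ L * |x - y|) :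
    Continuous f := by
  have : LipschitzWith (Real.toNNReal L) f := by
    refine LipschitzWith.of_dist_le_mul fun x y => ?_
    rw [Real.dist_eq, Real.dist_eq]
    refine (h x y).trans ?_
    gcongr
    exact Real.le_coe_toNNReal L
  exact this.continuous

lemma compactSupport_of_supp {f : ℝ → ℝ} {W : ℝ} (h : ∀ x, f x ≠ 0 → |x| ≤ W) :
    HasCompactSupport f := by
  refine HasCompactSupport.intro (isCompact_Icc (a := -W) (b := W)) fun x hx => ?_
  by_contra hc
  exact hx (Set.mem_Icc.2 (abs_le.1 (h x hc)))

lemma integrable_of_lip {f : ℝ → ℝ} {L W : ℝ} (h : ∀ x y, |f x - f y| ≤ L * |x - y|)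
    (hs : ∀ x, f x ≠ 0 → |x| ≤ W) : Integrable f :=
  (continuous_of_lip h).integrable_of_hasCompactSupport (compactSupport_of_supp hs)

lemma abs_integral_le_of_supp {f : ℝ → ℝ} {W M : ℝ} (hW : 0 ≤ W) (hb : ∀ x, |f x| ≤ M)
    (hs : ∀ x, f x ≠ 0 → |x| ≤ W) : |∫ x, f x| ≤ 2 * W * M := by
  have h1 : ∫ x, f x = ∫ x in Set.Icc (-W) W, f x := by
    rw [setIntegral_eq_integral_of_forall_compl_eq_zero]
    intro x hx
    by_contra hc
    exact hx (Set.mem_Icc.2 (abs_le.1 (hs x hc)))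
  rw [h1]
  have := norm_setIntegral_le_of_norm_le_const (μ := volume) (s := Set.Icc (-W) W) (f := f) (C := M)
    (by simp) (fun x _ => by simpa using hb x)
  rw [Real.norm_eq_abs] at this
  refine this.trans (le_of_eq ?_)
  rw [measureReal_def, Real.volume_Icc, ENNReal.toReal_ofReal (by linarith)]; ring

/-- one-dimensional Riemann sum. -/
lemma riem1 {f : ℝ → ℝ} {L : ℝ} (k : ℕ) (h : ∀ x y, |f x - f y| ≤ L * |x - y|)
    (hs : ∀ x, f x ≠ 0 → |x| ≤ k) :
    |∑ n ∈ Finset.Icc (-(k:ℤ)) k, f n - ∫ x, f x| ≤ L * (2 * k + 1) := by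
  have hL : 0 ≤ L := by
    have := h 1 0
    simp at this
    exact (abs_nonneg _).trans this
  have hc := continuous_of_lip h
  have h1 : ∫ x, f x = ∫ x in (-(k:ℝ))..(k + 1), f x := by
    rw [intervalIntegral.integral_of_le (by linarith [Nat.cast_nonneg (α := ℝ) k]),
      ← integral_Icc_eq_integral_Ioc, setIntegral_eq_integral_of_forall_compl_eq_zero]
    intro x hx
    by_contra hcx
    have := abs_le.1 (hs x hcx)
    exact hx (Set.mem_Icc.2 ⟨this.1, by linarith⟩)
  have h2 : ∫ x in (-(k:ℝ))..(k + 1), f x =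
      ∑ i ∈ Finset.range (2 * k + 1), ∫ x in ((i:ℝ) - k)..((i:ℝ) - k + 1), f x := by
    have := intervalIntegral.sum_integral_adjacent_intervals (f := f) (μ := volume)
      (a := fun i : ℕ => (i:ℝ) - k) (n := 2 * k + 1)
      (fun i _ => hc.intervalIntegrable _ _)
    rw [show -(k:ℝ) = ((0:ℕ):ℝ) - k by simp,
      show (k:ℝ) + 1 = ((2 * k + 1 : ℕ):ℝ) - k by push_cast; ring, ← this]
    refine Finset.sum_congr rfl fun i _ => ?_
    congr 1
    push_cast; ring
  have h3 : ∑ n ∈ Finset.Icc (-(k:ℤ)) k, f n =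
      ∑ i ∈ Finset.range (2 * k + 1), f ((i:ℝ) - k) := by
    symm
    refine Finset.sum_bij (fun i _ => (i:ℤ) - k) ?_ ?_ ?_ ?_
    · intro i hi; simp at hi ⊢; omega
    · intro i _ j _ hij; simp at hij; exact hij
    · intro b hb
      simp at hb
      refine ⟨(b + k).toNat, ?_, ?_⟩
      · simp; omega
      · omega
    · intro i _; push_cast; rfl
  rw [h1, h2, h3, ← Finset.sum_sub_distrib]
  refine (Finset.abs_sum_le_sum_abs _ _).trans ?_
  calc _ ≤ ∑ i ∈ Finset.range (2 * k + 1), L := by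
        refine Finset.sum_le_sum fun i _ => ?_
        set p : ℝ := (i:ℝ) - k
        have e : f p - ∫ x in p..(p+1), f x = ∫ x in p..(p+1), (f p - f x) := by
          rw [intervalIntegral.integral_sub (by simp) (hc.intervalIntegrable _ _)]
          simp
        rw [e]
        have := intervalIntegral.norm_integral_le_of_norm_le_const (a := p) (b := p + 1)
          (f := fun x => f p - f x) (C := L) (fun x hx => by
            rw [Set.uIoc_of_le (by linarith)] at hx
            rw [Real.norm_eq_abs]
            refine (h p x).trans ?_
            have : |p - x| ≤ 1 := by rw [abs_le]; constructor <;> linarith [hx.1, hx.2]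
            nlinarith)
        simpa using this
    _ = L * (2 * k + 1) := by
        rw [Finset.sum_const, Finset.card_range, nsmul_eq_mul]; push_cast; ring

lemma Nice.nonneg {W : ℝ} {f : ℝ → ℝ} (h : Nice W f) : 0 ≤ W :=
  (abs_nonneg _).trans (h.bd 0)

/-- the planar integral. -/
lemma plane_int {W s p q : ℝ} {g1 g2 : ℝ → ℝ} (h1 : Nice W g1) (h2 : Nice W g2)
    (hs : 0 < s) (hp : 0 < p) (hq : 0 < q) :
    ∫ y, ∫ x, g1 (p * (x + y * s)) * g2 (q * (x - y * s)) =
      1 / (2 * s * p * q) * ((∫ x, g1 x) * ∫ x, g2 x) := by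
  have c1 := continuous_of_lip h1.lip
  have c2 := continuous_of_lip h2.lip
  have e1 : ∀ y, ∫ x, g1 (p * (x + y * s)) * g2 (q * (x - y * s)) =
      ∫ x, g1 (p * x) * g2 (q * (x - 2 * s * y)) := by
    intro y
    rw [← integral_add_right_eq_self (fun x => g1 (p * x) * g2 (q * (x - 2 * s * y))) (y * s)]
    refine integral_congr_ae (Filter.Eventually.of_forall fun x => ?_)
    simp only
    congr 3
    ring
  simp_rw [e1]
  have hIntg : Integrable (Function.uncurry fun (y x : ℝ) => g1 (p * x) * g2 (q * (x - 2 * s * y)))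
      (volume.prod volume) := by
    refine Continuous.integrable_of_hasCompactSupport ?_ ?_
    · refine Continuous.mul ?_ ?_
      · exact c1.comp (by fun_prop)
      · exact c2.comp (by fun_prop)
    · refine HasCompactSupport.intro
        (K := Set.Icc (-((W / p + W / q) / (2 * s))) ((W / p + W / q) / (2 * s)) ×ˢ
          Set.Icc (-(W / p)) (W / p)) (isCompact_Icc.prod isCompact_Icc) ?_
      rintro ⟨y, x⟩ hx
      by_contra hc
      simp only [Function.uncurry] at hc
      have a1 := h1.supp _ (left_ne_zero_of_mul hc)
      have a2 := h2.supp _ (right_ne_zero_of_mul hc)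
      rw [abs_mul, abs_of_pos hp] at a1
      rw [abs_mul, abs_of_pos hq] at a2
      have b1 : |x| ≤ W / p := by rw [le_div_iff₀ hp]; linarith
      have b2 : |x - 2 * s * y| ≤ W / q := by rw [le_div_iff₀ hq]; linarith
      refine hx (Set.mk_mem_prod (Set.mem_Icc.2 (abs_le.1 ?_)) (Set.mem_Icc.2 (abs_le.1 b1)))
      rw [le_div_iff₀ (by positivity)]
      have : |y| * (2 * s) = |2 * s * y| := by
        rw [abs_mul, abs_of_pos (by positivity : 0 < 2 * s)]; ring
      rw [this]
      have := abs_sub x (x - 2 * s * y)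
      rw [show x - (x - 2 * s * y) = 2 * s * y by ring] at this
      linarith
  rw [integral_integral_swap hIntg]
  simp_rw [integral_const_mul]
  have e2 : ∀ x, ∫ y, g2 (q * (x - 2 * s * y)) = 1 / (2 * s * q) * ∫ x, g2 x := by
    intro x
    have : ∀ y, g2 (q * (x - 2 * s * y)) = (fun w => g2 (q * x - w)) ((2 * s * q) * y) := by
      intro y; simp only; congr 1; ring
    simp_rw [this]
    rw [Measure.integral_comp_mul_left (fun w => g2 (q * x - w)),
      integral_sub_left_eq_self (fun w => g2 w), abs_of_pos (by positivity), smul_eq_mul, one_div]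
  simp_rw [e2, integral_mul_const]
  rw [Measure.integral_comp_mul_left (fun x => g1 x), abs_of_pos (by positivity), smul_eq_mul]
  field_simp

set_option maxHeartbeats 1000000 in
/-- lattice sum of a product function versus the integral. -/
lemma riem2 (hd : 0 < d) (hn : ¬ IsSquare d) : ∃ C : ℝ, 1 ≤ C ∧ ∀ (W X : ℝ) (g1 g2 : ℝ → ℝ)
    (S : Finset (ℤ√d)), 1 ≤ W → 1 ≤ X → Nice W g1 → Nice W g2 →
    (∀ a, g1 (e1 a) * g2 (e2 a / X) ≠ 0 → a ∈ S) →
    |∑ a ∈ S, g1 (e1 a) * g2 (e2 a / X)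
      - X / (2 * Real.sqrt d) * ((∫ x, g1 x) * ∫ x, g2 x)| ≤ C * W ^ 4 * Real.sqrt X := by
  obtain ⟨E, hE, hunit⟩ := exists_unit hd hn
  have hs := sqrt_ge_one hd
  set s := Real.sqrt d with hsdef
  have hE0 : 0 < E := by linarith
  refine ⟨80 * s * E ^ 3, ?_, ?_⟩
  · have : 1 ≤ E ^ 3 := one_le_pow₀ hE.le
    nlinarith
  intro W X g1 g2 S hW hX h1 h2 hS
  have hX0 : 0 < X := by linarith
  set Y := Real.sqrt X with hY
  have hY1 : 1 ≤ Y := by rw [hY]; exact Real.one_le_sqrt.2 hX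
  have hYY : Y * Y = X := Real.mul_self_sqrt hX0.le
  have hY0 : 0 < Y := by linarith
  obtain ⟨u, v, huv, hu1, hu2, hu3⟩ := hunit (1 / Y) (by positivity)
  set p := e1 u with hp
  have hp0 : 0 < p := lt_of_lt_of_le (by positivity) hu1
  set q := e2 u / X with hq
  have hqp : q = 1 / (p * X) := by rw [hq, hu3]; field_simp
  have hq0 : 0 < q := by rw [hqp]; positivity
  have hpY : p * Y ≤ E := by
    have := mul_le_mul_of_nonneg_right hu2 hY0.le
    calc _ ≤ _ := this
      _ = E := by field_simp
  have hpY' : 1 ≤ p * Y := by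
    have := mul_le_mul_of_nonneg_right hu1 hY0.le
    rwa [one_div, inv_mul_cancel₀ hY0.ne'] at this
  have hpqX : p * q * X = 1 := by rw [hqp]; field_simp
  have hpq : (p * Y) * (q * Y) = 1 := by rw [← hpqX, ← hYY]; ring
  have hqY : q * Y ≤ 1 := by
    by_contra hc
    push Not at hc
    have : 0 < q * Y := by positivity
    nlinarith
  have hqY' : 1 ≤ E * (q * Y) := by
    rw [← hpq]; gcongr
  -- supports
  have hWp : W / p ≤ W * E * Y := by
    rw [div_le_iff₀ hp0]
    have : 1 ≤ E * (p * Y) := by nlinarith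
    nlinarith
  have hWq : W / q ≤ W * E * Y := by
    rw [div_le_iff₀ hq0]
    nlinarith
  have hWEY : 1 ≤ W * E * Y := by
    have : 1 ≤ W * E := by nlinarith
    nlinarith
  set k : ℕ := ⌈W * E * Y⌉₊ with hk
  have hk1 : W * E * Y ≤ k := Nat.le_ceil _
  have hk2 : (k:ℝ) ≤ 2 * (W * E * Y) := by
    have := Nat.ceil_lt_add_one (by positivity : 0 ≤ W * E * Y)
    linarith
  have key : ∀ x y : ℝ, g1 (p * (x + y * s)) * g2 (q * (x - y * s)) ≠ 0 → |x| ≤ k ∧ |y| ≤ k := by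
    intro x y hxy
    have a1 := h1.supp _ (left_ne_zero_of_mul hxy)
    have a2 := h2.supp _ (right_ne_zero_of_mul hxy)
    rw [abs_mul, abs_of_pos hp0] at a1
    rw [abs_mul, abs_of_pos hq0] at a2
    have b1 : |x + y * s| ≤ W / p := by rw [le_div_iff₀ hp0]; linarith
    have b2 : |x - y * s| ≤ W / q := by rw [le_div_iff₀ hq0]; linarith
    have b1' := abs_le.1 (b1.trans (hWp.trans hk1))
    have b2' := abs_le.1 (b2.trans (hWq.trans hk1))
    have hys : |y * s| ≤ k := by rw [abs_le]; constructor <;> linarith [b1'.1, b1'.2, b2'.1, b2'.2]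
    refine ⟨by rw [abs_le]; constructor <;> linarith [b1'.1, b1'.2, b2'.1, b2'.2], ?_⟩
    rw [abs_mul, abs_of_pos (by linarith : 0 < s)] at hys
    nlinarith [abs_nonneg y]
  clear_value k
  -- transfer of the sum
  have hu_e1 : ∀ m n : ℤ, e1 (u * (⟨m, n⟩ : ℤ√d)) = p * (m + n * s) := by
    intro m n; rw [e1_mul hd]; rfl
  have hu_e2 : ∀ m n : ℤ, e2 (u * (⟨m, n⟩ : ℤ√d)) / X = q * (m - n * s) := by
    intro m n; rw [e2_mul hd, hq]
    have : e2 (⟨m, n⟩ : ℤ√d) = m - n * s := rfl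
    rw [this]; ring
  have hsum : ∑ a ∈ S, g1 (e1 a) * g2 (e2 a / X) =
      ∑ n ∈ Finset.Icc (-(k:ℤ)) k, ∑ m ∈ Finset.Icc (-(k:ℤ)) k,
        g1 (p * ((m:ℝ) + n * s)) * g2 (q * ((m:ℝ) - n * s)) := by
    classical
    set T := ((Finset.Icc (-(k:ℤ)) k) ×ˢ (Finset.Icc (-(k:ℤ)) k)).image
      (fun w : ℤ × ℤ => u * (⟨w.2, w.1⟩ : ℤ√d)) with hT
    have t1 : ∑ a ∈ S, g1 (e1 a) * g2 (e2 a / X) = ∑ a ∈ T, g1 (e1 a) * g2 (e2 a / X) := by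
      refine sum_eq_of_supp hS ?_
      intro a ha
      have hav : a = u * (⟨(v * a).re, (v * a).im⟩ : ℤ√d) := by
        have : (⟨(v * a).re, (v * a).im⟩ : ℤ√d) = v * a := rfl
        rw [this, ← mul_assoc, huv, one_mul]
      rw [hav, hu_e1, hu_e2] at ha
      obtain ⟨k1, k2⟩ := key _ _ ha
      rw [hT, Finset.mem_image]
      refine ⟨((v * a).im, (v * a).re), ?_, hav.symm⟩
      rw [Finset.mem_product, Finset.mem_Icc, Finset.mem_Icc]
      have k1' := abs_le.1 k1
      have k2' := abs_le.1 k2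
      refine ⟨⟨?_, ?_⟩, ?_, ?_⟩
      · exact_mod_cast k2'.1
      · exact_mod_cast k2'.2
      · exact_mod_cast k1'.1
      · exact_mod_cast k1'.2
    rw [t1, hT, Finset.sum_image, Finset.sum_product]
    · refine Finset.sum_congr rfl fun n _ => Finset.sum_congr rfl fun m _ => ?_
      rw [hu_e1, hu_e2]
    · intro w _ w' _ hww
      have : v * (u * (⟨w.2, w.1⟩ : ℤ√d)) = v * (u * (⟨w'.2, w'.1⟩ : ℤ√d)) := by
        simp only at hww; rw [hww]
      rw [← mul_assoc, ← mul_assoc, mul_comm v u, huv, one_mul, one_mul, Zsqrtd.ext_iff] at this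
      exact Prod.ext this.2 this.1
  rw [hsum]
  set h : ℝ → ℝ := fun y => ∫ x, g1 (p * (x + y * s)) * g2 (q * (x - y * s)) with hh
  have hW0 : 0 < W := by linarith
  -- inner sum
  have inner : ∀ n : ℤ, |∑ m ∈ Finset.Icc (-(k:ℤ)) k,
        g1 (p * ((m:ℝ) + n * s)) * g2 (q * ((m:ℝ) - n * s)) - h n| ≤
        (W ^ 2 * (p + q)) * (2 * k + 1) := by
    intro n
    refine riem1 (f := fun x => g1 (p * (x + n * s)) * g2 (q * (x - n * s))) k ?_ ?_
    · intro x y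
      have a1 := h1.lip (p * (x + n * s)) (p * (y + n * s))
      have a2 := h2.lip (q * (x - n * s)) (q * (y - n * s))
      rw [show p * (x + n * s) - p * (y + n * s) = p * (x - y) by ring, abs_mul,
        abs_of_pos hp0] at a1
      rw [show q * (x - n * s) - q * (y - n * s) = q * (x - y) by ring, abs_mul,
        abs_of_pos hq0] at a2
      have b1 := h1.bd (p * (y + n * s))
      have b2 := h2.bd (q * (x - n * s))
      generalize g1 (p * (x + n * s)) = A at *
      generalize g1 (p * (y + n * s)) = A' at *
      generalize g2 (q * (x - n * s)) = B at *
      generalize g2 (q * (y - n * s)) = B' at *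
      calc |A * B - A' * B'| = |(A - A') * B + A' * (B - B')| := by ring_nf
        _ ≤ |A - A'| * |B| + |A'| * |B - B'| := by
            refine (abs_add_le _ _).trans (le_of_eq ?_); rw [abs_mul, abs_mul]
        _ ≤ (W * (p * |x - y|)) * W + W * (W * (q * |x - y|)) := by gcongr
        _ = _ := by ring
    · intro x hx
      exact (key _ _ hx).1
  -- h
  have hh2 : ∀ y, h y = ∫ x, g1 (p * x) * g2 (q * (x - 2 * s * y)) := by
    intro y
    rw [hh, ← integral_add_right_eq_self (fun x => g1 (p * x) * g2 (q * (x - 2 * s * y))) (y * s)]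
    refine integral_congr_ae (Filter.Eventually.of_forall fun x => ?_)
    simp only
    congr 3
    ring
  have c1 := continuous_of_lip h1.lip
  have c2 := continuous_of_lip h2.lip
  have hlip : ∀ y y', |h y - h y'| ≤ (4 * s * W ^ 3 * q / p) * |y - y'| := by
    intro y y'
    have supp1 : ∀ x, g1 (p * x) ≠ 0 → |x| ≤ W / p := by
      intro x hx
      have := h1.supp _ hx
      rw [abs_mul, abs_of_pos hp0] at this
      rw [le_div_iff₀ hp0]; linarith
    have ii : ∀ y, Integrable fun x => g1 (p * x) * g2 (q * (x - 2 * s * y)) := by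
      intro y
      refine Continuous.integrable_of_hasCompactSupport
        ((c1.comp (by fun_prop)).mul (c2.comp (by fun_prop))) (compactSupport_of_supp (W := W / p) ?_)
      intro x hx
      exact supp1 x (left_ne_zero_of_mul hx)
    rw [hh2, hh2, ← integral_sub (ii y) (ii y')]
    refine (abs_integral_le_of_supp (W := W / p) (M := W * (W * (q * (2 * s * |y - y'|))))
      (by positivity) ?_ ?_).trans (le_of_eq ?_)
    · intro x
      have a2 := h2.lip (q * (x - 2 * s * y)) (q * (x - 2 * s * y'))
      rw [show q * (x - 2 * s * y) - q * (x - 2 * s * y') = q * (2 * s * (-(y - y'))) by ring, abs_mul,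
        abs_of_pos hq0, abs_mul, abs_neg, abs_of_pos (by linarith : 0 < 2 * s)] at a2
      rw [← mul_sub, abs_mul]
      have b1 := h1.bd (p * x)
      gcongr
    · intro x hx
      rw [← mul_sub] at hx
      exact supp1 x (left_ne_zero_of_mul hx)
    · field_simp; ring
  have outer : |∑ n ∈ Finset.Icc (-(k:ℤ)) k, h n - ∫ y, h y| ≤ (4 * s * W ^ 3 * q / p) * (2 * k + 1) := by
    refine riem1 k hlip ?_
    intro y hy
    by_contra hc
    apply hy
    rw [hh]
    simp only
    rw [integral_eq_zero_of_ae]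
    refine Filter.Eventually.of_forall fun x => ?_
    by_contra hx
    exact hc (key x y hx).2
  rw [plane_int h1 h2 (by linarith) hp0 hq0] at outer
  have hcoef : 1 / (2 * s * p * q) = X / (2 * s) := by
    rw [div_eq_div_iff (by positivity) (by positivity)]
    linear_combination (-(2 * s)) * hpqX
  rw [hcoef] at outer
  have inner' : |∑ n ∈ Finset.Icc (-(k:ℤ)) k, ∑ m ∈ Finset.Icc (-(k:ℤ)) k,
        g1 (p * ((m:ℝ) + n * s)) * g2 (q * ((m:ℝ) - n * s)) - ∑ n ∈ Finset.Icc (-(k:ℤ)) k, h n|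
      ≤ (2 * k + 1) * ((W ^ 2 * (p + q)) * (2 * k + 1)) := by
    rw [← Finset.sum_sub_distrib]
    refine (Finset.abs_sum_le_sum_abs _ _).trans ?_
    refine (Finset.sum_le_sum fun n _ => inner n).trans (le_of_eq ?_)
    rw [Finset.sum_const, nsmul_eq_mul, Int.card_Icc]
    congr 1
    have : ((k:ℤ) + 1 - -(k:ℤ)).toNat = 2 * k + 1 := by omega
    rw [this]; push_cast; ring
  refine (abs_sub_le _ _ _).trans ((add_le_add inner' outer).trans ?_)
  have hkk : 2 * (k:ℝ) + 1 ≤ 5 * (W * E * Y) := by linarith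
  have hpq' : p + q ≤ 2 * E / Y := by
    rw [le_div_iff₀ hY0, add_mul]; linarith only [hpY, hqY, hE]
  have hqp2 : q / p ≤ 1 := by
    rw [div_le_one hp0]
    by_contra hc
    push Not at hc
    have : p * Y < q * Y := by gcongr
    linarith
  have hk0 : (0:ℝ) ≤ 2 * k + 1 := by positivity
  calc _ ≤ (5 * (W * E * Y)) * ((W ^ 2 * (2 * E / Y)) * (5 * (W * E * Y)))
        + (4 * s * W ^ 3 * (q / p)) * (5 * (W * E * Y)) := by
        rw [mul_div_assoc]; gcongr
    _ ≤ (5 * (W * E * Y)) * ((W ^ 2 * (2 * E / Y)) * (5 * (W * E * Y)))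
        + (4 * s * W ^ 3 * 1) * (5 * (W * E * Y)) := by gcongr
    _ = (50 * E ^ 3 + 20 * s * E) * (W ^ 4 * Y) := by field_simp; ring
    _ ≤ (80 * s * E ^ 3) * (W ^ 4 * Y) := by
        refine mul_le_mul_of_nonneg_right ?_ (by positivity)
        have q1 : 1 ≤ E ^ 2 := one_le_pow₀ hE.le
        have q2 : s * E ≤ s * E ^ 3 := by
          refine mul_le_mul_of_nonneg_left ?_ (by linarith only [hs])
          exact le_self_pow₀ hE.le (by norm_num)
        have q3 : 1 * E ^ 3 ≤ s * E ^ 3 := mul_le_mul_of_nonneg_right hs (by positivity)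
        have q4 : 0 ≤ E ^ 3 := by positivity
        linarith only [q2, q3, q4]
    _ = _ := by ring

end
end
end Equi

namespace Equi
open scoped BigOperators
open MeasureTheory
noncomputable section
set_option linter.unusedSectionVars false
set_option linter.unusedDecidableInType false
set_option linter.unusedFintypeInType false
section
variable {d : ℤ}

/-- two variable version of Nice. -/
structure Nice2 (W : ℝ) (f : ℝ → ℝ → ℝ) : Prop where
  bd : ∀ x y, |f x y| ≤ W
  supp : ∀ x y, f x y ≠ 0 → |x| ≤ W ∧ |y| ≤ W
  lip : ∀ x y x' y', |f x y - f x' y'| ≤ W * (|x - x'| + |y - y'|)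

/-- three variable version of Nice. -/
structure Nice3 (W : ℝ) (f : ℝ → ℝ → ℝ → ℝ) : Prop where
  bd : ∀ x y w, |f x y w| ≤ W
  supp : ∀ x y w, f x y w ≠ 0 → |x| ≤ W ∧ |y| ≤ W ∧ |w| ≤ W
  lip : ∀ x y w x' y' w', |f x y w - f x' y' w'| ≤ W * (|x - x'| + |y - y'| + |w - w'|)

lemma Nice3.sec {W : ℝ} {f : ℝ → ℝ → ℝ → ℝ} (h : Nice3 W f) (e c : ℝ) : Nice W (fun a => f a e c) where
  bd x := h.bd _ _ _
  supp x hx := (h.supp _ _ _ hx).1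
  lip x y := by simpa using h.lip x e c y e c

lemma Nice2.sec {W : ℝ} {f : ℝ → ℝ → ℝ} (h : Nice2 W f) (c : ℝ) : Nice W (fun a => f a c) where
  bd x := h.bd _ _
  supp x hx := (h.supp _ _ hx).1
  lip x y := by simpa using h.lip x c y c

lemma Nice.integrable {W : ℝ} {f : ℝ → ℝ} (h : Nice W f) : Integrable f :=
  integrable_of_lip h.lip h.supp

lemma two_sq_le {W : ℝ} (hW : 2 ≤ W) : 2 * W * W ≤ W ^ 3 ∧ W ≤ W ^ 3 := by
  constructor
  · have : W ^ 3 = W * W * W := by ring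
    rw [this, mul_assoc]
    have := mul_le_mul_of_nonneg_right hW (by positivity : 0 ≤ W * W)
    linarith
  · exact le_self_pow₀ (by linarith) (by norm_num)

lemma exists_of_int_ne {f : ℝ → ℝ} (h : ∫ x, f x ≠ 0) : ∃ x, f x ≠ 0 := by
  by_contra hc
  push Not at hc
  apply h
  rw [integral_eq_zero_of_ae]
  exact Filter.Eventually.of_forall hc

lemma Nice3.int {W : ℝ} {f : ℝ → ℝ → ℝ → ℝ} (hW : 2 ≤ W) (h : Nice3 W f) :
    Nice2 (W ^ 3) (fun e c => ∫ a, f a e c) := by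
  obtain ⟨w1, w2⟩ := two_sq_le hW
  have hW0 : 0 ≤ W := by linarith
  refine ⟨?_, ?_, ?_⟩
  · intro e c
    exact (abs_integral_le_of_supp hW0 (h.sec e c).bd (h.sec e c).supp).trans w1
  · intro e c hec
    obtain ⟨a, ha⟩ := exists_of_int_ne hec
    have := h.supp _ _ _ ha
    exact ⟨this.2.1.trans w2, this.2.2.trans w2⟩
  · intro e c e' c'
    rw [← integral_sub (h.sec e c).integrable (h.sec e' c').integrable]
    refine (abs_integral_le_of_supp (M := W * (|e - e'| + |c - c'|)) hW0 ?_ ?_).trans ?_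
    · intro a
      simpa using h.lip a e c a e' c'
    · intro a ha
      by_cases h0 : f a e c = 0
      · refine (h.supp a e' c' ?_).1
        intro h1; apply ha; rw [h0, h1, sub_zero]
      · exact (h.supp _ _ _ h0).1
    · rw [← mul_assoc]; gcongr

lemma Nice2.int {W : ℝ} {f : ℝ → ℝ → ℝ} (hW : 2 ≤ W) (h : Nice2 W f) :
    Nice (W ^ 3) (fun c => ∫ a, f a c) := by
  obtain ⟨w1, w2⟩ := two_sq_le hW
  have hW0 : 0 ≤ W := by linarith
  refine ⟨?_, ?_, ?_⟩
  · intro c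
    exact (abs_integral_le_of_supp hW0 (h.sec c).bd (h.sec c).supp).trans w1
  · intro c hec
    obtain ⟨a, ha⟩ := exists_of_int_ne hec
    have := h.supp _ _ ha
    exact this.2.trans w2
  · intro c c'
    rw [← integral_sub (h.sec c).integrable (h.sec c').integrable]
    refine (abs_integral_le_of_supp (M := W * (|c - c'|)) hW0 ?_ ?_).trans ?_
    · intro a
      simpa using h.lip a c a c'
    · intro a ha
      by_cases h0 : f a c = 0
      · refine (h.supp a c' ?_).1
        intro h1; apply ha; rw [h0, h1, sub_zero]
      · exact (h.supp _ _ h0).1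
    · rw [← mul_assoc]; gcongr

lemma Nice.mono {W W' : ℝ} {f : ℝ → ℝ} (h : Nice W f) (hW : W ≤ W') : Nice W' f where
  bd x := (h.bd x).trans hW
  supp x hx := (h.supp x hx).trans hW
  lip x y := (h.lip x y).trans (by gcongr)

/-- riem2 over the standard box. -/
lemma riem2' (hd : 0 < d) (hn : ¬ IsSquare d) : ∃ C : ℝ, 1 ≤ C ∧ ∀ (W V X : ℝ) (g1 g2 : ℝ → ℝ),
    1 ≤ W → W ≤ V → 1 ≤ X → Nice W g1 → Nice W g2 →
    |∑ a ∈ Bz d V X, g1 (e1 a) * g2 (e2 a / X)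
      - X / (2 * Real.sqrt d) * ((∫ x, g1 x) * ∫ x, g2 x)| ≤ C * W ^ 4 * Real.sqrt X := by
  obtain ⟨C, hC, h⟩ := riem2 hd hn
  refine ⟨C, hC, fun W V X g1 g2 hW hV hX h1 h2 => h W X g1 g2 _ hW hX h1 h2 fun a ha => ?_⟩
  have hX0 : 0 < X := by linarith
  refine in_box0 hd (hW.trans hV) hX0 ⟨(h1.supp _ (left_ne_zero_of_mul ha)).trans hV, ?_⟩
  have := h2.supp _ (right_ne_zero_of_mul ha)
  rw [abs_div, abs_of_pos hX0, div_le_iff₀ hX0] at this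
  refine this.trans ?_
  gcongr

/-- triple integral -/
def I3 (G : ℝ → ℝ → ℝ → ℝ) : ℝ := ∫ c, ∫ e, ∫ a, G a e c

lemma riem6 (hd : 0 < d) (hn : ¬ IsSquare d) : ∃ z0 : ℝ, 2 ≤ z0 ∧ ∀ (W X : ℝ)
    (G1 G2 : ℝ → ℝ → ℝ → ℝ), z0 ≤ W → 1 ≤ X → Nice3 W G1 → Nice3 W G2 →
    |∑ c ∈ Bz d (W ^ 9) X, ∑ e ∈ Bz d (W ^ 9) X, ∑ a ∈ Bz d (W ^ 9) X, FF G1 G2 X a e c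
      - (X / (2 * Real.sqrt d)) ^ 3 * (I3 G1 * I3 G2)| ≤ W ^ 80 * X ^ 2 * Real.sqrt X := by
  obtain ⟨C, hC, hr⟩ := riem2' hd hn
  obtain ⟨z0, hz0, hB⟩ := Bz_card hd hn
  refine ⟨max z0 (3 * C), le_max_of_le_left hz0, ?_⟩
  intro W X G1 G2 hW hX h1 h2
  have hWz : z0 ≤ W := (le_max_left _ _).trans hW
  have hWC : 3 * C ≤ W := (le_max_right _ _).trans hW
  have hW2 : 2 ≤ W := hz0.trans hWz
  have hW1 : 1 ≤ W := by linarith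
  have hW0 : 0 < W := by linarith
  have hX0 : 0 < X := by linarith
  have w13 : W ≤ W ^ 3 := (two_sq_le hW2).2
  have w39 : W ^ 3 ≤ W ^ 9 := pow_le_pow_right₀ hW1 (by norm_num)
  set B := Bz d (W ^ 9) X with hBdef
  have hBc : (B.card : ℝ) ≤ W ^ 27 * X := by
    have := hB (W ^ 9) X (hWz.trans (w13.trans w39)) hX
    rwa [← pow_mul] at this
  set Q := X / (2 * Real.sqrt d) with hQ
  have hs := sqrt_ge_one hd
  have hQ0 : 0 ≤ Q := by positivity
  have hQX : Q ≤ X := by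
    rw [hQ, div_le_iff₀ (by positivity)]; nlinarith
  set Y := Real.sqrt X with hY
  have hY0 : 0 ≤ Y := Real.sqrt_nonneg _
  have n1 := h1.int hW2
  have n2 := h2.int hW2
  have m1 := n1.int (hW2.trans w13)
  have m2 := n2.int (hW2.trans w13)
  rw [← pow_mul] at m1 m2
  have A1 : ∀ c e : ℤ√d, |∑ a ∈ B, FF G1 G2 X a e c - Q * ((∫ a, G1 a (e1 e) (e1 c)) *
      ∫ a, G2 a (e2 e / X) (e2 c / X))| ≤ C * W ^ 4 * Y := by
    intro c e
    exact hr W (W ^ 9) X (fun a => G1 a (e1 e) (e1 c)) (fun a => G2 a (e2 e / X) (e2 c / X)) hW1 (w13.trans w39) hX (h1.sec _ _) (h2.sec _ _)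
  have A2 : ∀ c : ℤ√d, |∑ e ∈ B, ((∫ a, G1 a (e1 e) (e1 c)) * ∫ a, G2 a (e2 e / X) (e2 c / X))
      - Q * ((∫ e, ∫ a, G1 a e (e1 c)) * ∫ e, ∫ a, G2 a e (e2 c / X))| ≤ C * (W ^ 3) ^ 4 * Y := by
    intro c
    exact hr (W ^ 3) (W ^ 9) X (fun e => ∫ a, G1 a e (e1 c)) (fun e => ∫ a, G2 a e (e2 c / X)) (hW1.trans w13) w39 hX (n1.sec _) (n2.sec _)
  have A3 : |∑ c ∈ B, ((∫ e, ∫ a, G1 a e (e1 c)) * ∫ e, ∫ a, G2 a e (e2 c / X))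
      - Q * (I3 G1 * I3 G2)| ≤ C * (W ^ 9) ^ 4 * Y :=
    hr (W ^ 9) (W ^ 9) X (fun c => ∫ e, ∫ a, G1 a e c) (fun c => ∫ e, ∫ a, G2 a e c) (hW1.trans (w13.trans w39)) le_rfl hX m1 m2
  set P1 : ℤ√d → ℤ√d → ℝ := fun c e => (∫ a, G1 a (e1 e) (e1 c)) * ∫ a, G2 a (e2 e / X) (e2 c / X)
  set P2 : ℤ√d → ℝ := fun c => (∫ e, ∫ a, G1 a e (e1 c)) * ∫ e, ∫ a, G2 a e (e2 c / X)
  set J := I3 G1 * I3 G2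
  have B1 : |∑ c ∈ B, ∑ e ∈ B, ∑ a ∈ B, FF G1 G2 X a e c - Q * ∑ c ∈ B, ∑ e ∈ B, P1 c e| ≤
      (W ^ 27 * X) ^ 2 * (C * W ^ 4 * Y) := by
    rw [Finset.mul_sum, ← Finset.sum_sub_distrib]
    have : ∀ c, |∑ e ∈ B, ∑ a ∈ B, FF G1 G2 X a e c - Q * ∑ e ∈ B, P1 c e| ≤
        (W ^ 27 * X) * (C * W ^ 4 * Y) := by
      intro c
      rw [Finset.mul_sum, ← Finset.sum_sub_distrib]
      refine (Finset.abs_sum_le_sum_abs _ _).trans ?_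
      refine (Finset.sum_le_sum fun e _ => A1 c e).trans ?_
      rw [Finset.sum_const, nsmul_eq_mul]
      exact mul_le_mul_of_nonneg_right hBc (by positivity)
    refine (Finset.abs_sum_le_sum_abs _ _).trans ?_
    refine (Finset.sum_le_sum fun c _ => this c).trans ?_
    rw [Finset.sum_const, nsmul_eq_mul, pow_two, mul_assoc (W ^ 27 * X)]
    exact mul_le_mul_of_nonneg_right hBc (by positivity)
  have B2 : |∑ c ∈ B, ∑ e ∈ B, P1 c e - Q * ∑ c ∈ B, P2 c| ≤
      (W ^ 27 * X) * (C * (W ^ 3) ^ 4 * Y) := by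
    rw [Finset.mul_sum, ← Finset.sum_sub_distrib]
    refine (Finset.abs_sum_le_sum_abs _ _).trans ?_
    refine (Finset.sum_le_sum fun c _ => A2 c).trans ?_
    rw [Finset.sum_const, nsmul_eq_mul]
    exact mul_le_mul_of_nonneg_right hBc (by positivity)
  generalize ∑ c ∈ B, P2 c = T2 at *
  generalize ∑ c ∈ B, ∑ e ∈ B, P1 c e = T1 at *
  generalize ∑ c ∈ B, ∑ e ∈ B, ∑ a ∈ B, FF G1 G2 X a e c = T0 at *
  have e0 : T0 - Q ^ 3 * J = (T0 - Q * T1) + Q * (T1 - Q * T2) + Q ^ 2 * (T2 - Q * J) := by ring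
  rw [e0]
  refine (abs_add_three _ _ _).trans ?_
  rw [abs_mul, abs_mul, abs_of_nonneg hQ0, abs_of_nonneg (by positivity : 0 ≤ Q ^ 2)]
  have hpw : ∀ n : ℕ, n ≤ 79 → W ^ n ≤ W ^ 79 := fun n hn => pow_le_pow_right₀ hW1 hn
  have hC0 : 0 ≤ C := by linarith
  calc _ ≤ (W ^ 27 * X) ^ 2 * (C * W ^ 4 * Y) + X * ((W ^ 27 * X) * (C * (W ^ 3) ^ 4 * Y))
        + X ^ 2 * (C * (W ^ 9) ^ 4 * Y) := by gcongr
    _ = C * (W ^ 58 + W ^ 39 + W ^ 36) * (X ^ 2 * Y) := by ring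
    _ ≤ C * (W ^ 79 + W ^ 79 + W ^ 79) * (X ^ 2 * Y) := by
        have := hpw 58 (by norm_num)
        have := hpw 39 (by norm_num)
        have := hpw 36 (by norm_num)
        gcongr
    _ = (3 * C) * W ^ 79 * (X ^ 2 * Y) := by ring
    _ ≤ W * W ^ 79 * (X ^ 2 * Y) := by gcongr
    _ = _ := by ring

lemma nice_of_adm {z : ℝ} (hz : 2 ≤ z) {F : ℝ → ℝ → ℝ → ℝ} (h : Adm z F) :
    Nice3 (z ^ 8) (dvc F) := by
  have h' := Adm_dvc hz h
  have h28 : z ^ 2 ≤ z ^ 8 := pow_le_pow_right₀ (by linarith) (by norm_num)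
  refine ⟨fun x y w => (h'.bd x y w).trans h28, fun x y w hx => ?_, fun x y w x' y' w' => ?_⟩
  · obtain ⟨a, b, c, _⟩ := h'.supp x y w hx
    exact ⟨a.trans h28, b.trans h28, c.trans h28⟩
  · have := h'.lip x y w x' y' w'
    rwa [← pow_mul] at this

/-- main term of Theorem A through integrals. -/
theorem theoremB (hd : 0 < d) (hn : ¬ IsSquare d) : ∃ z0 : ℝ, 2 ≤ z0 ∧ ∀ (z X : ℝ),
    z0 ≤ z → X = z ^ 6000 → ∀ F1 F2 : ℝ → ℝ → ℝ → ℝ, Adm z F1 → Adm z F2 →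
    |∑ c ∈ Bz d z X, ∑ v ∈ Bz d z X ×ˢ Bz d z X, FF F1 F2 X v.1 v.2 c * wc c v
      - kap d / (2 * Real.sqrt d) ^ 3 * (I3 (dvc F1) * I3 (dvc F2)) * X ^ 2| ≤ X ^ 2 / z ^ 4 := by
  obtain ⟨z1, hz1, hA⟩ := theoremA hd hn
  obtain ⟨z2, hz2, hR⟩ := riem6 hd hn
  have hk := kap_pos d
  refine ⟨max (max z1 z2) (1 + kap d), le_max_of_le_left (le_max_of_le_left hz1), ?_⟩
  intro z X hz hX F1 F2 a1 a2
  have hz_1 : z1 ≤ z := (le_max_left _ _).trans ((le_max_left _ _).trans hz)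
  have hz_2 : z2 ≤ z := (le_max_right _ _).trans ((le_max_left _ _).trans hz)
  have hz_3 : 1 + kap d ≤ z := (le_max_right _ _).trans hz
  have h2 : 2 ≤ z := hz1.trans hz_1
  have h1 : 1 ≤ z := by linarith
  have h0 : 0 < z := by linarith
  have hX1 : 1 ≤ X := by rw [hX]; exact one_le_pow₀ h1
  have hX0 : 0 < X := by linarith
  have hY : Real.sqrt X = z ^ 3000 := by
    rw [hX, show (z:ℝ) ^ 6000 = (z ^ 3000) ^ 2 by rw [← pow_mul], Real.sqrt_sq (by positivity)]
  have hYX : z ^ 3000 * z ^ 3000 = X := by rw [hX, ← pow_add]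
  have TA := hA z X hz_1 hX F1 F2 a1 a2
  have n1 := nice_of_adm h2 a1
  have n2 := nice_of_adm h2 a2
  have TR := hR (z ^ 8) X _ _ (hz_2.trans (le_self_pow₀ h1 (by norm_num))) hX1 n1 n2
  have z89 : z ≤ (z ^ 8) ^ 9 := by rw [← pow_mul]; exact le_self_pow₀ h1 (by norm_num)
  have hsum : ∑ c ∈ Bz d ((z ^ 8) ^ 9) X, ∑ e ∈ Bz d ((z ^ 8) ^ 9) X, ∑ a ∈ Bz d ((z ^ 8) ^ 9) X,
      FF (dvc F1) (dvc F2) X a e c = ∑ c ∈ Bz d z X, HH d (dvc F1) (dvc F2) z X c := by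
    have supp : ∀ a e c : ℤ√d, FF (dvc F1) (dvc F2) X a e c ≠ 0 →
        ∀ w, z ≤ w → a ∈ Bz d w X ∧ e ∈ Bz d w X ∧ c ∈ Bz d w X := by
      intro a e c hh w hw
      have hl : F1 (e1 a) (e1 e) (e1 c) ≠ 0 := by
        intro h; apply hh; simp [FF, dvc, h]
      have hr : F2 (e2 a / X) (e2 e / X) (e2 c / X) ≠ 0 := by
        intro h; apply hh; simp [FF, dvc, h]
      obtain ⟨p1, p2, p3, _⟩ := a1.supp _ _ _ hl
      obtain ⟨q1, q2, q3, _⟩ := a2.supp _ _ _ hr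
      rw [abs_div, abs_of_pos hX0, div_le_iff₀ hX0] at q1 q2 q3
      have hw' : z * X ≤ w * X := by gcongr
      have hw1 := h1.trans hw
      exact ⟨in_box0 hd hw1 hX0 ⟨p1.trans hw, q1.trans hw'⟩,
        in_box0 hd hw1 hX0 ⟨p2.trans hw, q2.trans hw'⟩,
        in_box0 hd hw1 hX0 ⟨p3.trans hw, q3.trans hw'⟩⟩
    generalize (z ^ 8) ^ 9 = w at z89 ⊢
    have t1 : ∀ (e c : ℤ√d), ∑ a ∈ Bz d w X, FF (dvc F1) (dvc F2) X a e c =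
        ∑ a ∈ Bz d z X, FF (dvc F1) (dvc F2) X a e c := fun e c =>
      sum_eq_of_supp (fun a ha => (supp a e c ha w z89).1) (fun a ha => (supp a e c ha z le_rfl).1)
    have t2 : ∀ c : ℤ√d, ∑ e ∈ Bz d w X, ∑ a ∈ Bz d z X, FF (dvc F1) (dvc F2) X a e c =
        ∑ e ∈ Bz d z X, ∑ a ∈ Bz d z X, FF (dvc F1) (dvc F2) X a e c := by
      intro c
      refine sum_eq_of_supp ?_ ?_ <;> intro e he <;>
        obtain ⟨a, _, ha⟩ := Finset.exists_ne_zero_of_sum_ne_zero he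
      · exact (supp a e c ha w z89).2.1
      · exact (supp a e c ha z le_rfl).2.1
    simp_rw [t1, t2]
    have t3 : ∀ c, HH d (dvc F1) (dvc F2) z X c =
        ∑ e ∈ Bz d z X, ∑ a ∈ Bz d z X, FF (dvc F1) (dvc F2) X a e c := by
      intro c
      unfold HH
      rw [Finset.sum_product, Finset.sum_comm]
    simp_rw [t3]
    refine sum_eq_of_supp ?_ ?_ <;> intro c hc <;>
      obtain ⟨e, _, he⟩ := Finset.exists_ne_zero_of_sum_ne_zero hc <;>
      obtain ⟨a, _, ha⟩ := Finset.exists_ne_zero_of_sum_ne_zero he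
    · exact (supp a e c ha w z89).2.2
    · exact (supp a e c ha z le_rfl).2.2
  rw [hsum, hY, ← pow_mul] at TR
  norm_num at TR
  have hX3 : z ^ 640 * X ^ 2 * z ^ 3000 ≤ X ^ 3 / z ^ 6 := by
    rw [le_div_iff₀ (by positivity)]
    calc z ^ 640 * X ^ 2 * z ^ 3000 * z ^ 6 = X ^ 2 * z ^ 3000 * z ^ 646 := by
          rw [show (646:ℕ) = 640 + 6 by norm_num, pow_add]; ring
      _ ≤ X ^ 2 * z ^ 3000 * z ^ 3000 := by
          gcongr; norm_num
      _ = X ^ 3 := by rw [mul_assoc, hYX]; ring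
  set s := Real.sqrt d with hs
  have hs0 : 0 < s := by have := sqrt_ge_one hd; linarith
  generalize ∑ c ∈ Bz d z X, HH d (dvc F1) (dvc F2) z X c = T at *
  generalize ∑ c ∈ Bz d z X, ∑ v ∈ Bz d z X ×ˢ Bz d z X, FF F1 F2 X v.1 v.2 c * wc c v = T0 at *
  generalize I3 (dvc F1) * I3 (dvc F2) = J at *
  clear_value s
  clear hA hR hsum hYX hY z89
  have TR2 := TR.trans hX3
  clear TR hX3 hX
  have e0 : T0 - kap d / (2 * s) ^ 3 * J * X ^ 2 = (T0 - kap d * (T / X)) +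
      kap d / X * (T - (X / (2 * s)) ^ 3 * J) := by field_simp; ring
  rw [e0]
  refine (abs_add_le _ _).trans ?_
  rw [abs_mul, abs_of_pos (by positivity : 0 < kap d / X)]
  calc _ ≤ X ^ 2 / z ^ 5 + kap d / X * (X ^ 3 / z ^ 6) := by gcongr
    _ ≤ X ^ 2 / z ^ 5 + kap d / X * (X ^ 3 / z ^ 5) := by
        gcongr; norm_num
    _ = (1 + kap d) * (X ^ 2 / z ^ 5) := by field_simp
    _ ≤ z * (X ^ 2 / z ^ 5) := by gcongr
    _ = _ := by field_simp

end
end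
end Equi

namespace Equi
open scoped BigOperators
open MeasureTheory
noncomputable section
set_option linter.unusedSectionVars false
set_option linter.unusedDecidableInType false
set_option linter.unusedFintypeInType false
section
variable {d : ℤ}

/-- completions of a given row. -/
lemma row_count (hd : 0 < d) (hn : ¬ IsSquare d) : ∃ C : ℝ, 1 ≤ C ∧ ∀ (K X r : ℝ) (c e : ℤ√d)
    (S : Finset (ℤ√d × ℤ√d)), 1 ≤ K → 1 ≤ X → 0 < r → |e1 c| ≤ K → |e1 e| ≤ K →
    r ≤ max |e2 c| |e2 e| →
    (∀ p ∈ S, p.1 * e - p.2 * c = 1 ∧ |e1 p.1| ≤ K ∧ |e1 p.2| ≤ K ∧ |e2 p.1| ≤ K * X ∧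
      |e2 p.2| ≤ K * X) → (S.card : ℝ) ≤ C * (1 + 8 * K ^ 3 * X / r) := by
  obtain ⟨C, hC, hst⟩ := strip_count hd hn
  refine ⟨C, hC, ?_⟩
  intro K X r c e S hK hX hr hc he hrm hS
  classical
  rcases S.eq_empty_or_nonempty with h0 | ⟨⟨a0, b0⟩, hp0⟩
  · rw [h0]; simp; positivity
  obtain ⟨h1, ha1, hb1, ha2, hb2⟩ := hS _ hp0
  simp only at h1 ha1 hb1 ha2 hb2
  have hK0 : 0 < K := by linarith
  have hX0 : 0 < X := by linarith
  set f : ℤ√d × ℤ√d → ℤ√d := fun p => a0 * p.2 - b0 * p.1 with hf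
  have hfc : ∀ p ∈ S, f p * c = p.1 - a0 := by
    intro p hp
    have := (hS p hp).1
    simp only [hf]
    linear_combination (-a0) * this + p.1 * h1
  have hfe : ∀ p ∈ S, f p * e = p.2 - b0 := by
    intro p hp
    have := (hS p hp).1
    simp only [hf]
    linear_combination (-b0) * this + p.2 * h1
  have hinj : Set.InjOn f S := by
    intro p hp q hq hpq
    have hp' : p ∈ S := hp
    have hq' : q ∈ S := hq
    refine Prod.ext ?_ ?_
    · have i1 := hfc p hp'
      have i2 := hfc q hq'
      rw [hpq, i2] at i1
      linear_combination -i1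
    · have i1 := hfe p hp'
      have i2 := hfe q hq'
      rw [hpq, i2] at i1
      linear_combination -i1
  rw [← Finset.card_image_of_injOn hinj]
  have hmax : 1 / (2 * K) ≤ max |e1 c| |e1 e| := by
    have := congrArg e1 h1
    rw [e1_sub, e1_mul hd, e1_mul hd, e1_one] at this
    rw [div_le_iff₀ (by positivity)]
    have h2 : |e1 a0 * e1 e - e1 b0 * e1 c| ≤ |e1 a0| * |e1 e| + |e1 b0| * |e1 c| := by
      rw [← abs_mul, ← abs_mul]; exact abs_sub _ _
    rw [this, abs_one] at h2
    have q1 : |e1 a0| * |e1 e| ≤ K * max |e1 c| |e1 e| := by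
      gcongr; exact le_max_right _ _
    have q2 : |e1 b0| * |e1 c| ≤ K * max |e1 c| |e1 e| := by
      gcongr; exact le_max_left _ _
    linarith
  have gen : ∀ s A B R M : ℝ, 0 < R → R ≤ max |A| |B| → |s * A| ≤ M → |s * B| ≤ M → |s| ≤ M / R := by
    intro s A B R M hR hRm h1 h2
    rw [le_div_iff₀ hR]
    rw [abs_mul] at h1 h2
    rcases le_total |A| |B| with h | h
    · rw [max_eq_right h] at hRm
      exact (mul_le_mul_of_nonneg_left hRm (abs_nonneg s)).trans h2
    · rw [max_eq_left h] at hRm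
      exact (mul_le_mul_of_nonneg_left hRm (abs_nonneg s)).trans h1
  have := hst (S.image f) 0 0 (2 * K / (1 / (2 * K))) (2 * (K * X) / r) (by positivity) (by positivity) ?_
  · refine this.trans (le_of_eq ?_)
    field_simp; ring
  intro s hs
  rw [Finset.mem_image] at hs
  obtain ⟨p, hp, rfl⟩ := hs
  rw [sub_zero, sub_zero]
  obtain ⟨_, pa1, pb1, pa2, pb2⟩ := hS p hp
  constructor
  · refine gen _ (e1 c) (e1 e) _ _ (by positivity) hmax ?_ ?_
    · rw [← e1_mul hd, hfc p hp, e1_sub]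
      refine (abs_sub _ _).trans (by linarith)
    · rw [← e1_mul hd, hfe p hp, e1_sub]
      refine (abs_sub _ _).trans (by linarith)
  · refine gen _ (e2 c) (e2 e) _ _ hr hrm ?_ ?_
    · rw [← e2_mul hd, hfc p hp, e2_sub]
      refine (abs_sub _ _).trans (by linarith)
    · rw [← e2_mul hd, hfe p hp, e2_sub]
      refine (abs_sub _ _).trans (by linarith)

lemma harm_sum (hd : 0 < d) (hn : ¬ IsSquare d) : ∃ C : ℝ, 1 ≤ C ∧ ∀ (K T : ℝ), 1 ≤ K → 0 ≤ T →
    ∑ e ∈ bx d K T, 1 / (1 + (⌊|e2 e|⌋₊ : ℝ)) ≤ C * (1 + K) * (1 + Real.log (T + 1)) := by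
  obtain ⟨C, hC, hst⟩ := strip_count hd hn
  refine ⟨2 * C, by linarith, ?_⟩
  intro K T hK hT
  classical
  set N := ⌊T⌋₊ + 1 with hN
  have hmap : ∀ e ∈ bx d K T, ⌊|e2 e|⌋₊ ∈ Finset.range N := by
    intro e he
    rw [mem_bx hd] at he
    rw [Finset.mem_range, hN]
    exact Nat.lt_succ_of_le (Nat.floor_le_floor he.2)
  rw [← Finset.sum_fiberwise_of_maps_to hmap]
  have hb : ∀ n ∈ Finset.range N, ∑ e ∈ bx d K T with ⌊|e2 e|⌋₊ = n, 1 / (1 + (⌊|e2 e|⌋₊ : ℝ)) ≤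
      2 * C * (1 + K) * (1 / (n + 1)) := by
    intro n _
    have e0 : ∑ e ∈ bx d K T with ⌊|e2 e|⌋₊ = n, 1 / (1 + (⌊|e2 e|⌋₊ : ℝ)) =
        ∑ e ∈ bx d K T with ⌊|e2 e|⌋₊ = n, 1 / ((n:ℝ) + 1) := by
      refine Finset.sum_congr rfl fun e he => ?_
      rw [(Finset.mem_filter.1 he).2, add_comm]
    rw [e0, Finset.sum_const, nsmul_eq_mul]
    refine mul_le_mul_of_nonneg_right ?_ (by positivity)
    set U := (bx d K T).filter (fun e => ⌊|e2 e|⌋₊ = n) with hU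
    have hUm : ∀ e ∈ U, |e1 e| ≤ K ∧ (n:ℝ) ≤ |e2 e| ∧ |e2 e| ≤ n + 1 := by
      intro e he
      rw [hU, Finset.mem_filter, mem_bx hd] at he
      refine ⟨he.1.1, ?_, ?_⟩
      · rw [← he.2]; exact Nat.floor_le (abs_nonneg _)
      · rw [← he.2]; exact (Nat.lt_floor_add_one _).le
    have hsplit := Finset.card_filter_add_card_filter_not (s := U) (fun e : ℤ√d => 0 ≤ e2 e)
    have hsplit' : (U.card : ℝ) = ((U.filter (fun e : ℤ√d => 0 ≤ e2 e)).card : ℝ) +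
        ((U.filter (fun e : ℤ√d => ¬ 0 ≤ e2 e)).card : ℝ) := by
      rw [← hsplit]; push_cast; rfl
    rw [hsplit']
    have c1 := hst (U.filter (fun e : ℤ√d => 0 ≤ e2 e)) 0 n K 1 (by linarith) one_pos (by
      intro e he
      rw [Finset.mem_filter] at he
      obtain ⟨q1, q2, q3⟩ := hUm e he.1
      rw [abs_of_nonneg he.2] at q2 q3
      rw [sub_zero, abs_le]
      exact ⟨abs_le.1 q1, by rw [abs_le]; constructor <;> linarith⟩)
    have c2 := hst (U.filter (fun e : ℤ√d => ¬ 0 ≤ e2 e)) 0 (-n) K 1 (by linarith) one_pos (by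
      intro e he
      rw [Finset.mem_filter] at he
      obtain ⟨q1, q2, q3⟩ := hUm e he.1
      rw [abs_of_neg (not_le.1 he.2)] at q2 q3
      rw [sub_zero, abs_le]
      exact ⟨abs_le.1 q1, by rw [abs_le]; constructor <;> linarith⟩)
    rw [mul_one] at c1 c2
    linarith
  refine (Finset.sum_le_sum hb).trans ?_
  rw [← Finset.mul_sum]
  refine mul_le_mul_of_nonneg_left ?_ (by positivity)
  have hh := harmonic_le_one_add_log N
  have : ((harmonic N : ℚ) : ℝ) = ∑ i ∈ Finset.range N, 1 / ((i:ℝ) + 1) := by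
    unfold harmonic
    push_cast
    refine Finset.sum_congr rfl fun i _ => ?_
    rw [one_div]
  rw [this] at hh
  refine hh.trans ?_
  have hN1 : (N:ℝ) ≤ T + 1 := by
    rw [hN]; push_cast
    linarith [Nat.floor_le hT]
  have hN0 : (0:ℝ) < N := by rw [hN]; positivity
  have := Real.log_le_log hN0 hN1
  linarith

set_option maxHeartbeats 2000000 in
lemma bad_count (hd : 0 < d) (hn : ¬ IsSquare d) (K : ℝ) (hK : 1 ≤ K) : ∃ C : ℝ, 1 ≤ C ∧
    ∀ (X κ : ℝ) (S : Finset ((ℤ√d × ℤ√d) × (ℤ√d × ℤ√d))), 1 ≤ X → 0 < κ →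
    (∀ p ∈ S, p.2.1 * p.1.2 - p.2.2 * p.1.1 = 1 ∧
      (|e1 p.1.1| ≤ K ∧ |e1 p.1.2| ≤ K ∧ |e1 p.2.1| ≤ K ∧ |e1 p.2.2| ≤ K) ∧
      (|e2 p.1.1| ≤ K * X ∧ |e2 p.1.2| ≤ K * X ∧ |e2 p.2.1| ≤ K * X ∧ |e2 p.2.2| ≤ K * X) ∧
      (|e1 p.1.1| ≤ κ ∨ |e2 p.1.1| ≤ κ * X)) →
    (S.card : ℝ) ≤ C * ((1 + κ * X) * X * (1 + Real.log X)) := by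
  obtain ⟨C1, hC1, hrow⟩ := row_count hd hn
  obtain ⟨C2, hC2, hharm⟩ := harm_sum hd hn
  obtain ⟨C3, hC3, hbx⟩ := bx_card hd hn
  have hK0 : 0 < K := by linarith
  have hl2K : 0 ≤ Real.log (2 * K) := Real.log_nonneg (by linarith)
  set A1 := C1 * (C3 * (1 + K * K)) + C1 * (16 * K ^ 4) * (C2 * (1 + K) * (1 + Real.log (2 * K))) with hA1
  set A0 := C3 * (1 + K * K) * (C1 * (1 + 8 * K ^ 4)) with hA0
  have hA1' : 0 ≤ A1 := by positivity
  have hA0' : 1 ≤ A0 := by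
    have : 1 ≤ C3 * (1 + K * K) := by nlinarith
    have h4 : 0 ≤ K ^ 4 := by positivity
    have : 1 ≤ C1 * (1 + 8 * K ^ 4) := by nlinarith
    rw [hA0]; nlinarith
  refine ⟨A0 + 2 * C3 * K * A1, by
    have : 0 ≤ 2 * C3 * K * A1 := by positivity
    linarith, ?_⟩
  intro X κ S hX hκ hS
  classical
  have hX0 : 0 < X := by linarith
  have hlX : 0 ≤ Real.log X := Real.log_nonneg hX
  -- fibre bound
  have hfib : ∀ (q : ℤ√d × ℤ√d) (r : ℝ), 0 < r → r ≤ max |e2 q.1| |e2 q.2| →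
      ((S.filter (fun p => p.1 = q)).card : ℝ) ≤ C1 * (1 + 8 * K ^ 3 * X / r) := by
    intro q r hr hrm
    rcases (S.filter (fun p => p.1 = q)).eq_empty_or_nonempty with h0 | ⟨p0, hp0⟩
    · rw [h0]; simp; positivity
    rw [Finset.mem_filter] at hp0
    obtain ⟨_, ⟨hc, he, _, _⟩, _⟩ := hS p0 hp0.1
    rw [hp0.2] at hc he
    have hinj : Set.InjOn (Prod.snd : (ℤ√d × ℤ√d) × (ℤ√d × ℤ√d) → _) (S.filter (fun p => p.1 = q)) := by
      intro p hp p' hp' hpp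
      have hp1 : p ∈ S.filter (fun p => p.1 = q) := hp
      have hp2 : p' ∈ S.filter (fun p => p.1 = q) := hp'
      exact Prod.ext ((Finset.mem_filter.1 hp1).2.trans (Finset.mem_filter.1 hp2).2.symm) hpp
    rw [← Finset.card_image_of_injOn hinj]
    refine hrow K X r q.1 q.2 _ hK hX hr hc he hrm ?_
    intro v hv
    rw [Finset.mem_image] at hv
    obtain ⟨p, hp, rfl⟩ := hv
    rw [Finset.mem_filter] at hp
    obtain ⟨g1, ⟨_, _, g2, g3⟩, ⟨_, _, g4, g5⟩, _⟩ := hS p hp.1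
    rw [hp.2] at g1
    exact ⟨g1, g2, g3, g4, g5⟩
  set Bad := ((bx d κ (K * X)) ∪ (bx d K (κ * X))).erase 0 with hBad
  have hcard : (S.card : ℝ) = ((S.filter (fun p => p.1.1 = 0)).card : ℝ) +
      ((S.filter (fun p => ¬ p.1.1 = 0)).card : ℝ) := by
    rw [← Finset.card_filter_add_card_filter_not (s := S) (fun p => p.1.1 = 0)]; push_cast; rfl
  -- c = 0
  have hzero : ((S.filter (fun p => p.1.1 = 0)).card : ℝ) ≤ A0 * X := by
    set P := (bx d K K).image (fun e => ((0 : ℤ√d), e)) with hP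
    have hunit : ∀ p ∈ S, p.1.1 = 0 → |e2 p.1.2| ≤ K ∧ 1 / K ≤ |e2 p.1.2| := by
      intro p hp hp0
      obtain ⟨g, ⟨_, g2, g3, _⟩, _, _⟩ := hS p hp
      rw [hp0, mul_zero, sub_zero] at g
      have hne : p.1.2 ≠ 0 := right_ne_zero_of_mul (g.symm ▸ one_ne_zero)
      have hna : p.2.1 ≠ 0 := left_ne_zero_of_mul (g.symm ▸ one_ne_zero)
      have n1 := one_le_abs_mul hd hn hne
      have n2 := one_le_abs_mul hd hn hna
      have m1 : |e1 p.2.1| * |e1 p.1.2| = 1 := by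
        rw [← abs_mul, ← e1_mul hd, g, e1_one, abs_one]
      have m2 : |e2 p.2.1| * |e2 p.1.2| = 1 := by
        rw [← abs_mul, ← e2_mul hd, g, e2_one, abs_one]
      constructor
      · have : |e2 p.1.2| ≤ |e1 p.2.1| := by
          calc |e2 p.1.2| = 1 * |e2 p.1.2| := by ring
            _ ≤ (|e1 p.2.1| * |e2 p.2.1|) * |e2 p.1.2| := by gcongr
            _ = |e1 p.2.1| * (|e2 p.2.1| * |e2 p.1.2|) := by ring
            _ = _ := by rw [m2, mul_one]
        linarith
      · rw [div_le_iff₀ hK0]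
        nlinarith [abs_nonneg (e2 p.1.2)]
    have hmap : Set.MapsTo Prod.fst (↑(S.filter (fun p => p.1.1 = 0)) : Set ((ℤ√d × ℤ√d) × (ℤ√d × ℤ√d))) (↑P : Set (ℤ√d × ℤ√d)) := by
      intro p hp
      have hp' : p ∈ S.filter (fun p => p.1.1 = 0) := hp
      rw [Finset.mem_filter] at hp'
      obtain ⟨g, ⟨_, g2, g3, _⟩, _, _⟩ := hS p hp'.1
      rw [Finset.mem_coe, hP, Finset.mem_image]
      exact ⟨p.1.2, (mem_bx hd).2 ⟨g2, (hunit p hp'.1 hp'.2).1⟩, Prod.ext hp'.2.symm rfl⟩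
    rw [Finset.card_eq_sum_card_fiberwise hmap]
    push_cast
    have hone : ∀ q ∈ P, (({a ∈ S.filter (fun p => p.1.1 = 0) | a.1 = q} : Finset _).card : ℝ) ≤
        C1 * (1 + 8 * K ^ 4) * X := by
      intro q hq
      rcases ({a ∈ S.filter (fun p => p.1.1 = 0) | a.1 = q} : Finset _).eq_empty_or_nonempty with h0 | ⟨p0, hp0⟩
      · rw [h0]; simp; positivity
      rw [Finset.mem_filter, Finset.mem_filter] at hp0
      have hr := (hunit p0 hp0.1.1 hp0.1.2).2
      rw [hp0.2] at hr
      have := hfib q (1 / K) (by positivity) (hr.trans (le_max_right _ _))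
      have hsub : (({a ∈ S.filter (fun p => p.1.1 = 0) | a.1 = q} : Finset _).card : ℝ) ≤
          ((S.filter (fun p => p.1 = q)).card : ℝ) := by
        norm_cast
        refine Finset.card_le_card fun p hp => ?_
        rw [Finset.mem_filter, Finset.mem_filter] at hp
        rw [Finset.mem_filter]
        exact ⟨hp.1.1, hp.2⟩
      refine hsub.trans (this.trans ?_)
      have e3 : 8 * K ^ 3 * X / (1 / K) = 8 * K ^ 4 * X := by field_simp
      rw [e3, mul_assoc C1]
      refine mul_le_mul_of_nonneg_left ?_ (by linarith)
      rw [add_mul, one_mul]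
      linarith
    refine (Finset.sum_le_sum hone).trans ?_
    rw [Finset.sum_const, nsmul_eq_mul, hA0]
    have hPc : (P.card : ℝ) ≤ C3 * (1 + K * K) :=
      le_trans (by exact_mod_cast Finset.card_image_le) (hbx K K hK0 hK0)
    calc _ ≤ C3 * (1 + K * K) * (C1 * (1 + 8 * K ^ 4) * X) := by gcongr
      _ = _ := by ring
  -- c ≠ 0
  have hBadc : (Bad.card : ℝ) ≤ 2 * C3 * K * (1 + κ * X) := by
    have h1 := hbx κ (K * X) hκ (by positivity)
    have h2 := hbx K (κ * X) hK0 (by positivity)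
    have h3 : (Bad.card : ℝ) ≤ ((bx d κ (K * X)).card : ℝ) + ((bx d K (κ * X)).card : ℝ) := by
      norm_cast
      exact Finset.card_erase_le.trans (Finset.card_union_le _ _)
    have h4 : 1 + κ * (K * X) ≤ K * (1 + κ * X) := by
      have : 0 ≤ κ * X := by positivity
      nlinarith
    have h5 : 1 + K * (κ * X) ≤ K * (1 + κ * X) := by nlinarith
    have h6 := mul_le_mul_of_nonneg_left h4 (by linarith : 0 ≤ C3)
    have h7 := mul_le_mul_of_nonneg_left h5 (by linarith : 0 ≤ C3)
    linarith
  have hnon : ((S.filter (fun p => ¬ p.1.1 = 0)).card : ℝ) ≤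
      2 * C3 * K * (1 + κ * X) * (A1 * (X * (1 + Real.log X))) := by
    have hmap : Set.MapsTo Prod.fst
        (↑(S.filter (fun p => ¬ p.1.1 = 0)) : Set ((ℤ√d × ℤ√d) × (ℤ√d × ℤ√d)))
        (↑(Bad ×ˢ (bx d K (K * X))) : Set (ℤ√d × ℤ√d)) := by
      intro p hp
      have hp' : p ∈ S.filter (fun p => ¬ p.1.1 = 0) := hp
      rw [Finset.mem_filter] at hp'
      obtain ⟨g, ⟨g1, g2, _, _⟩, ⟨g5, g6, _, _⟩, g7⟩ := hS p hp'.1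
      rw [Finset.mem_coe, Finset.mem_product, hBad, Finset.mem_erase, Finset.mem_union, mem_bx hd,
        mem_bx hd, mem_bx hd]
      refine ⟨⟨hp'.2, ?_⟩, g2, g6⟩
      rcases g7 with g | g
      · exact Or.inl ⟨g, g5⟩
      · exact Or.inr ⟨g1, g⟩
    rw [Finset.card_eq_sum_card_fiberwise hmap]
    push_cast
    have hone : ∀ q ∈ Bad ×ˢ (bx d K (K * X)),
        (({a ∈ S.filter (fun p => ¬ p.1.1 = 0) | a.1 = q} : Finset _).card : ℝ) ≤
        C1 + C1 * (16 * K ^ 4) * X * (1 / (1 + (⌊|e2 q.2|⌋₊ : ℝ))) := by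
      intro q hq
      rcases ({a ∈ S.filter (fun p => ¬ p.1.1 = 0) | a.1 = q} : Finset _).eq_empty_or_nonempty with h0 | ⟨p0, hp0⟩
      · rw [h0]; simp; positivity
      rw [Finset.mem_filter, Finset.mem_filter] at hp0
      obtain ⟨g, ⟨g1, g2, _, _⟩, ⟨g5, g6, _, _⟩, g7⟩ := hS p0 hp0.1.1
      have hc0 := one_le_abs_mul hd hn hp0.1.2
      rw [hp0.2] at g1 g2 g5 g6 g7 hc0
      have hc2 : 1 / K ≤ |e2 q.1| := by
        rw [div_le_iff₀ hK0]
        nlinarith [abs_nonneg (e2 q.1)]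
      have hr : (1 + (⌊|e2 q.2|⌋₊ : ℝ)) / (2 * K) ≤ max |e2 q.1| |e2 q.2| := by
        have f1 := Nat.floor_le (abs_nonneg (e2 q.2))
        rcases le_total 1 |e2 q.2| with h | h
        · refine le_trans ?_ (le_max_right _ _)
          rw [div_le_iff₀ (by positivity)]
          have := mul_le_mul_of_nonneg_left hK (abs_nonneg (e2 q.2))
          linarith
        · refine le_trans ?_ (le_max_left _ _)
          refine le_trans ?_ hc2
          rw [div_le_div_iff₀ (by positivity) hK0, one_mul, mul_comm]
          refine (mul_le_mul_of_nonneg_left (by linarith : (1 + (⌊|e2 q.2|⌋₊ : ℝ)) ≤ 2) hK0.le).trans ?_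
          linarith
      have := hfib q _ (by positivity) hr
      have hsub : (({a ∈ S.filter (fun p => ¬ p.1.1 = 0) | a.1 = q} : Finset _).card : ℝ) ≤
          ((S.filter (fun p => p.1 = q)).card : ℝ) := by
        norm_cast
        refine Finset.card_le_card fun p hp => ?_
        rw [Finset.mem_filter, Finset.mem_filter] at hp
        rw [Finset.mem_filter]
        exact ⟨hp.1.1, hp.2⟩
      refine hsub.trans (this.trans (le_of_eq ?_))
      field_simp; ring
    refine (Finset.sum_le_sum hone).trans ?_
    rw [Finset.sum_product]
    simp only []
    rw [Finset.sum_const, nsmul_eq_mul]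
    refine mul_le_mul hBadc ?_ ?_ (by positivity)
    · rw [Finset.sum_add_distrib, Finset.sum_const, nsmul_eq_mul, ← Finset.mul_sum]
      have q1 := hbx K (K * X) hK0 (by positivity)
      have q2 := hharm K (K * X) hK (by positivity)
      have q3 : Real.log (K * X + 1) ≤ Real.log (2 * K) + Real.log X := by
        rw [← Real.log_mul (by positivity) (by positivity)]
        refine Real.log_le_log (by positivity) ?_
        nlinarith
      have q4 : 1 + Real.log (K * X + 1) ≤ (1 + Real.log (2 * K)) * (1 + Real.log X) := by nlinarith
      have q5 : 1 + K * (K * X) ≤ (1 + K * K) * (X * (1 + Real.log X)) := by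
        have : X ≤ X * (1 + Real.log X) := by nlinarith
        have : (1 + K * K) * X ≤ (1 + K * K) * (X * (1 + Real.log X)) := by gcongr
        nlinarith
      calc _ ≤ C3 * ((1 + K * K) * (X * (1 + Real.log X))) * C1 + C1 * (16 * K ^ 4) * X *
            (C2 * (1 + K) * ((1 + Real.log (2 * K)) * (1 + Real.log X))) := by
            refine add_le_add ?_ ?_
            · refine mul_le_mul_of_nonneg_right (q1.trans ?_) (by linarith)
              gcongr
            · refine mul_le_mul_of_nonneg_left (q2.trans ?_) (by positivity)
              gcongr
        _ = _ := by rw [hA1]; ring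
    · exact Finset.sum_nonneg fun e _ => by positivity
  rw [hcard]
  refine (add_le_add hzero hnon).trans ?_
  have hfin : X ≤ (1 + κ * X) * X * (1 + Real.log X) := by
    have : X ≤ (1 + κ * X) * X := by
      have : 0 ≤ κ * X := by positivity
      nlinarith
    nlinarith
  have := mul_le_mul_of_nonneg_left hfin (by linarith : 0 ≤ A0)
  calc _ ≤ A0 * ((1 + κ * X) * X * (1 + Real.log X)) +
      2 * C3 * K * (1 + κ * X) * (A1 * (X * (1 + Real.log X))) := by linarith
    _ = _ := by ring

end
end
end Equi

namespace Equi
open scoped BigOperators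
open MeasureTheory
noncomputable section
set_option linter.unusedSectionVars false
set_option linter.unusedDecidableInType false
set_option linter.unusedFintypeInType false
section
variable {d : ℤ}

/-- clamp to [0,1]. -/
def cl (u : ℝ) : ℝ := max 0 (min 1 u)

lemma cl_nonneg (u : ℝ) : 0 ≤ cl u := le_max_left _ _
lemma cl_le_one (u : ℝ) : cl u ≤ 1 := max_le zero_le_one (min_le_left _ _)
lemma cl_zero {u : ℝ} (h : u ≤ 0) : cl u = 0 := max_eq_left ((min_le_right _ _).trans h)
lemma cl_one {u : ℝ} (h : 1 ≤ u) : cl u = 1 := by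
  unfold cl; rw [min_eq_left h]; exact max_eq_right zero_le_one
lemma cl_pos {u : ℝ} (h : cl u ≠ 0) : 0 < u := by
  by_contra hc; exact h (cl_zero (not_lt.1 hc))
lemma cl_lip (u v : ℝ) : |cl u - cl v| ≤ |u - v| := by
  unfold cl
  refine (abs_max_sub_max_le_max _ _ _ _).trans ?_
  rw [sub_self, abs_zero]
  refine max_le (abs_nonneg _) ?_
  refine (abs_min_sub_min_le_max _ _ _ _).trans ?_
  rw [sub_self, abs_zero]
  exact max_le (abs_nonneg _) le_rfl
lemma cl_cont : Continuous cl := by unfold cl; fun_prop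

/-- cutoff away from `c = 0`. -/
def psi (z c : ℝ) : ℝ := cl (z * |c| - 1)

lemma psi_nonneg (z c : ℝ) : 0 ≤ psi z c := cl_nonneg _
lemma psi_le_one (z c : ℝ) : psi z c ≤ 1 := cl_le_one _
lemma psi_pos {z c : ℝ} (hz : 0 < z) (h : psi z c ≠ 0) : 1 / z ≤ |c| := by
  have := cl_pos h
  rw [div_le_iff₀ hz]; linarith
lemma psi_one {z c : ℝ} (hz : 0 < z) (h : 2 / z ≤ |c|) : psi z c = 1 := by
  rw [div_le_iff₀ hz] at h
  exact cl_one (by linarith)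
lemma psi_lip {z : ℝ} (hz : 0 < z) (c c' : ℝ) : |psi z c - psi z c'| ≤ z * |c - c'| := by
  refine (cl_lip _ _).trans ?_
  rw [show z * |c| - 1 - (z * |c'| - 1) = z * (|c| - |c'|) by ring, abs_mul, abs_of_pos hz]
  exact mul_le_mul_of_nonneg_left (abs_abs_sub_abs_le c c') hz.le
lemma psi_cont (z : ℝ) : Continuous (psi z) := by
  unfold psi; exact cl_cont.comp (by fun_prop)

lemma adm_mk {z : ℝ} (hz : 2 ≤ z) {f : ℝ → ℝ → ℝ → ℝ} (h0 : ∀ a e c, 0 ≤ f a e c)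
    (h1 : ∀ a e c, f a e c ≤ z)
    (hs : ∀ a e c, 1 / z ≤ |c| → f a e c ≠ 0 → |a| ≤ z ∧ |e| ≤ z ∧ |c| ≤ z)
    (hl : ∀ a e c a' e' c', 1 / z ≤ |c| → 1 / z ≤ |c'| → f a e c ≠ 0 →
      |f a e c - f a' e' c'| ≤ z ^ 3 * (|a - a'| + |e - e'| + |c - c'|)) :
    Adm z (fun a e c => f a e c * psi z c) := by
  have hz0 : 0 < z := by linarith
  refine ⟨?_, ?_, ?_⟩
  · intro a e c
    rw [abs_of_nonneg (mul_nonneg (h0 _ _ _) (psi_nonneg _ _))]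
    calc _ ≤ z * 1 := mul_le_mul (h1 _ _ _) (psi_le_one _ _) (psi_nonneg _ _) hz0.le
      _ = z := mul_one z
  · intro a e c h
    have hp := psi_pos hz0 (right_ne_zero_of_mul h)
    obtain ⟨p, q, r⟩ := hs a e c hp (left_ne_zero_of_mul h)
    exact ⟨p, q, r, hp⟩
  · intro a e c a' e' c'
    set N := |a - a'| + |e - e'| + |c - c'| with hN
    have hNc : |c - c'| ≤ N := by
      have := abs_nonneg (a - a'); have := abs_nonneg (e - e'); linarith
    have hN0 : 0 ≤ N := (abs_nonneg _).trans hNc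
    have hpl : |psi z c - psi z c'| ≤ z * N := (psi_lip hz0 c c').trans (by gcongr)
    have hz2 : z * (z * N) ≤ z ^ 4 * N := by
      have : z ^ 2 ≤ z ^ 4 := pow_le_pow_right₀ (by linarith) (by norm_num)
      calc z * (z * N) = z ^ 2 * N := by ring
        _ ≤ _ := by gcongr
    by_cases hp : psi z c = 0
    · rw [hp, mul_zero, zero_sub, abs_neg, abs_mul, abs_of_nonneg (h0 _ _ _)]
      rw [hp, zero_sub, abs_neg] at hpl
      calc _ ≤ z * (z * N) := mul_le_mul (h1 _ _ _) hpl (abs_nonneg _) hz0.le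
        _ ≤ _ := hz2
    by_cases hp' : psi z c' = 0
    · rw [hp', mul_zero, sub_zero, abs_mul, abs_of_nonneg (h0 _ _ _)]
      rw [hp', sub_zero] at hpl
      calc _ ≤ z * (z * N) := mul_le_mul (h1 _ _ _) hpl (abs_nonneg _) hz0.le
        _ ≤ _ := hz2
    have hc := psi_pos hz0 hp
    have hc' := psi_pos hz0 hp'
    have hf : |f a e c - f a' e' c'| ≤ z ^ 3 * N := by
      by_cases hf : f a e c = 0
      · by_cases hf' : f a' e' c' = 0
        · rw [hf, hf', sub_zero, abs_zero]; positivity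
        · have := hl a' e' c' a e c hc' hc hf'
          rw [abs_sub_comm, hN, abs_sub_comm a, abs_sub_comm e, abs_sub_comm c]
          exact this
      · exact hl a e c a' e' c' hc hc' hf
    have e0 : f a e c * psi z c - f a' e' c' * psi z c' =
        (f a e c - f a' e' c') * psi z c + f a' e' c' * (psi z c - psi z c') := by ring
    rw [e0]
    refine (abs_add_le _ _).trans ?_
    rw [abs_mul, abs_mul, abs_of_nonneg (psi_nonneg z c), abs_of_nonneg (h0 a' e' c')]
    calc _ ≤ z ^ 3 * N * 1 + z * (z * N) := by
          refine add_le_add ?_ ?_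
          · exact mul_le_mul hf (psi_le_one _ _) (psi_nonneg _ _) (by positivity)
          · exact mul_le_mul (h1 _ _ _) hpl (abs_nonneg _) hz0.le
      _ = (z ^ 3 + z ^ 2) * N := by ring
      _ ≤ z ^ 4 * N := by
          refine mul_le_mul_of_nonneg_right ?_ hN0
          nlinarith [pow_pos hz0 2, pow_pos hz0 3]

/-- norm form -/
def QQ (a e c : ℝ) : ℝ := (c ^ 2 + e ^ 2) * (1 + (a / c) ^ 2)

/-- the second test function -/
def F2 (T z : ℝ) (a e c : ℝ) : ℝ := cl ((T - QQ a e c) * z) * psi z c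

lemma QQ_eq {a e c : ℝ} (hc : c ≠ 0) : QQ a e c = a ^ 2 + e ^ 2 + c ^ 2 + (a * e / c) ^ 2 := by
  unfold QQ; field_simp; ring

lemma F2_adm {T z : ℝ} (hT : T ≤ 2) (hz : 100 ≤ z) : Adm z (F2 T z) := by
  have hz0 : 0 < z := by linarith
  have key : ∀ a e c : ℝ, 1 / z ≤ |c| → cl ((T - QQ a e c) * z) ≠ 0 →
      c ≠ 0 ∧ |a| ≤ 2 ∧ |e| ≤ 2 ∧ |c| ≤ 2 ∧ |a * e / c| ≤ 2 := by
    intro a e c hc h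
    have hc0 : c ≠ 0 := by
      rw [← abs_pos]; exact lt_of_lt_of_le (by positivity) hc
    have := cl_pos h
    have hQ : QQ a e c < 2 := by
      have := pos_of_mul_pos_left this hz0.le
      linarith
    rw [QQ_eq hc0] at hQ
    refine ⟨hc0, ?_, ?_, ?_, ?_⟩ <;> refine abs_le_of_sq_le_sq ?_ (by norm_num) <;>
      nlinarith [sq_nonneg a, sq_nonneg e, sq_nonneg c, sq_nonneg (a * e / c)]
  refine adm_mk (f := fun a e c => cl ((T - QQ a e c) * z)) (by linarith) (fun _ _ _ => cl_nonneg _)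
    (fun _ _ _ => (cl_le_one _).trans (by linarith)) ?_ ?_
  · intro a e c hc h
    obtain ⟨_, p, q, r, _⟩ := key a e c hc h
    exact ⟨by linarith, by linarith, by linarith⟩
  · intro a e c a' e' c' hc hc' h
    obtain ⟨hc0, ka, ke, kc, kb⟩ := key a e c hc h
    have hc0' : c' ≠ 0 := by
      rw [← abs_pos]; exact lt_of_lt_of_le (by positivity) hc'
    set N := |a - a'| + |e - e'| + |c - c'| with hN
    have hNa : |a - a'| ≤ N := by
      have := abs_nonneg (c - c'); have := abs_nonneg (e - e'); linarith
    have hNe : |e - e'| ≤ N := by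
      have := abs_nonneg (a - a'); have := abs_nonneg (c - c'); linarith
    have hNc : |c - c'| ≤ N := by
      have := abs_nonneg (a - a'); have := abs_nonneg (e - e'); linarith
    have hN0 : 0 ≤ N := (abs_nonneg _).trans hNc
    clear_value N
    have z3 : z * N ≤ z ^ 3 * N := by
      gcongr; exact le_self_pow₀ (by linarith) (by norm_num)
    rcases le_or_gt 1 (z * N) with hbig | hsmall
    · refine le_trans ?_ z3
      refine le_trans ?_ hbig
      rw [abs_le]
      constructor <;> linarith [cl_nonneg ((T - QQ a e c) * z), cl_nonneg ((T - QQ a' e' c') * z),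
        cl_le_one ((T - QQ a e c) * z), cl_le_one ((T - QQ a' e' c') * z)]
    have hN1 : N ≤ 1 := by nlinarith
    refine (cl_lip _ _).trans ?_
    rw [show (T - QQ a e c) * z - (T - QQ a' e' c') * z = (QQ a' e' c' - QQ a e c) * z by ring,
      abs_mul, abs_of_pos hz0, QQ_eq hc0, QQ_eq hc0']
    set b := a * e / c with hb
    set b' := a' * e' / c' with hb'
    have hbd : b - b' = ((a * e - a' * e') + b * (c' - c)) / c' := by
      rw [hb, hb']; field_simp; ring
    have he' : |e'| ≤ 3 := by
      have : |e'| ≤ |e| + |e - e'| := by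
        have := abs_sub e (e - e'); rwa [show e - (e - e') = e' by ring] at this
      linarith
    have hae : |a * e - a' * e'| ≤ 5 * N := by
      rw [show a * e - a' * e' = a * (e - e') + e' * (a - a') by ring]
      refine (abs_add_le _ _).trans ?_
      rw [abs_mul, abs_mul]
      nlinarith [abs_nonneg a, abs_nonneg e', abs_nonneg (e - e'), abs_nonneg (a - a')]
    have hbc : |b * (c' - c)| ≤ 2 * N := by
      rw [abs_mul, abs_sub_comm]
      exact mul_le_mul kb hNc (abs_nonneg _) (by norm_num)
    have hbb : |b - b'| ≤ 7 * (z * N) := by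
      rw [hbd, abs_div, div_le_iff₀ (abs_pos.2 hc0')]
      have h1 : |a * e - a' * e' + b * (c' - c)| ≤ 7 * N := (abs_add_le _ _).trans (by linarith)
      have h2 : 1 ≤ z * |c'| := by
        rw [div_le_iff₀ hz0] at hc'; linarith
      calc _ ≤ 7 * N * 1 := by linarith
        _ ≤ 7 * N * (z * |c'|) := by gcongr
        _ = _ := by ring
    have sqd' : ∀ p p' D : ℝ, |p| ≤ 2 → |p - p'| ≤ D → |p' ^ 2 - p ^ 2| ≤ D * (4 + D) := by
      intro p p' D hp hD
      rw [show p' ^ 2 - p ^ 2 = -((p - p') * (2 * p - (p - p'))) by ring, abs_neg, abs_mul]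
      refine mul_le_mul hD ?_ (abs_nonneg _) ((abs_nonneg _).trans hD)
      refine (abs_sub _ _).trans ?_
      rw [abs_mul, abs_two]; linarith
    have s1 := sqd' a a' N ka hNa
    have s2 := sqd' e e' N ke hNe
    have s3 := sqd' c c' N kc hNc
    have s4 := sqd' b b' _ kb hbb
    clear_value b b'
    have hsum : |a' ^ 2 + e' ^ 2 + c' ^ 2 + b' ^ 2 - (a ^ 2 + e ^ 2 + c ^ 2 + b ^ 2)| ≤
        3 * (N * (4 + N)) + 7 * (z * N) * (4 + 7 * (z * N)) := by
      rw [show a' ^ 2 + e' ^ 2 + c' ^ 2 + b' ^ 2 - (a ^ 2 + e ^ 2 + c ^ 2 + b ^ 2) =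
        (a' ^ 2 - a ^ 2) + (e' ^ 2 - e ^ 2) + (c' ^ 2 - c ^ 2) + (b' ^ 2 - b ^ 2) by ring]
      refine (abs_add_le _ _).trans ?_
      refine (add_le_add_left (abs_add_three _ _ _) _).trans ?_
      linarith
    have hzN : N ≤ z * N := by nlinarith
    have h5 : 3 * (N * (4 + N)) ≤ 15 * (z * N) := by nlinarith
    have h6 : 7 * (z * N) * (4 + 7 * (z * N)) ≤ 77 * (z * N) := by
      have : 0 ≤ z * N := by positivity
      nlinarith
    calc _ ≤ (92 * (z * N)) * z := by
          refine mul_le_mul_of_nonneg_right ?_ hz0.le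
          linarith
      _ ≤ (z * (z * N)) * z := by
          have : 0 ≤ z * N := by positivity
          gcongr; linarith
      _ = _ := by ring

end
end
end Equi

namespace Equi
open scoped BigOperators
open MeasureTheory
noncomputable section
set_option linter.unusedSectionVars false
set_option linter.unusedDecidableInType false
set_option linter.unusedFintypeInType false
section
variable {d : ℤ}

/-- nonnegative Lipschitz test functions supported in a fixed compact set. -/
structure Tst (K : ℝ) (φ : ℂ → ℝ) : Prop where
  nn : ∀ p, 0 ≤ φ p
  bd : ∀ p, φ p ≤ K
  lip : ∀ p q, |φ p - φ q| ≤ K * ‖p - q‖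
  supp : ∀ p, φ p ≠ 0 → 1 / K ≤ p.im ∧ ‖p‖ ≤ K

/-- points in a fixed compact set. -/
structure Pt (K : ℝ) (x : ℂ) : Prop where
  im : 1 / K ≤ x.im
  nm : ‖x‖ ≤ K

lemma im_mob (a b c e : ℝ) (x : ℂ) (h : a * e - b * c = 1) :
    (((a : ℂ) * x + b) / ((c : ℂ) * x + e)).im = x.im / Complex.normSq ((c : ℂ) * x + e) := by
  rw [Complex.div_im]
  simp only [Complex.add_im, Complex.mul_im, Complex.ofReal_re, Complex.ofReal_im, Complex.add_re,
    Complex.mul_re, zero_mul, add_zero, sub_zero]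
  rw [← sub_div]
  congr 1
  linear_combination x.im * h

lemma cw_ne {c e : ℝ} {x : ℂ} (hx : 0 < x.im) (hc : c ≠ 0) : (c : ℂ) * x + e ≠ 0 := by
  intro h
  have := congrArg Complex.im h
  simp at this
  rcases this with h | h
  · exact hc h
  · exact hx.ne' h

lemma mob_form {a e c : ℝ} {x : ℂ} (hx : 0 < x.im) (hc : c ≠ 0) :
    ((a / c : ℝ) : ℂ) - 1 / ((c : ℂ) * ((c : ℂ) * x + e)) =
      ((a : ℂ) * x + ((a * e - 1) / c : ℝ)) / ((c : ℂ) * x + e) := by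
  have h1 := cw_ne (e := e) hx hc
  have h2 : (c : ℂ) ≠ 0 := by exact_mod_cast hc
  push_cast
  field_simp
  ring

lemma mob_bounds {K a b c e : ℝ} {x : ℂ} (hK : 1 ≤ K) (hx : Pt K x) (h : a * e - b * c = 1)
    {p : ℂ} (hp : p = ((a : ℂ) * x + b) / ((c : ℂ) * x + e)) (hp1 : 1 / K ≤ p.im) (hp2 : ‖p‖ ≤ K) :
    1 / K ≤ ‖(c : ℂ) * x + e‖ ∧ ‖(c : ℂ) * x + e‖ ≤ K ∧ |a| ≤ 2 * K ^ 4 ∧ |b| ≤ 2 * K ^ 4 ∧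
      |c| ≤ 2 * K ^ 4 ∧ |e| ≤ 2 * K ^ 4 := by
  have hK0 : 0 < K := by linarith
  have hki : 0 < 1 / K := by positivity
  have hxi : 0 < x.im := hki.trans_le hx.im
  have hpi : 0 < p.im := hki.trans_le hp1
  set w : ℂ := (c : ℂ) * x + e with hw
  have him := im_mob a b c e x h
  rw [← hp, ← hw] at him
  have hw0 : w ≠ 0 := by
    rintro h0; rw [h0] at him; simp at him; linarith
  have hn : 0 < ‖w‖ := norm_pos_iff.2 hw0
  have hn2 : Complex.normSq w = ‖w‖ ^ 2 := Complex.normSq_eq_norm_sq w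
  rw [hn2, eq_div_iff (by positivity)] at him
  have hpk : p.im ≤ K := (Complex.im_le_norm p).trans hp2
  have hxk : x.im ≤ K := (Complex.im_le_norm x).trans hx.nm
  have k1 : 1 ≤ K * p.im := by rwa [div_le_iff₀ hK0, mul_comm] at hp1
  have k2 : 1 ≤ K * x.im := by have := hx.im; rwa [div_le_iff₀ hK0, mul_comm] at this
  have hwK : ‖w‖ ≤ K := by
    have : ‖w‖ ^ 2 ≤ K ^ 2 := by
      calc ‖w‖ ^ 2 = ‖w‖ ^ 2 * 1 := by ring
        _ ≤ ‖w‖ ^ 2 * (K * p.im) := by gcongr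
        _ = K * (p.im * ‖w‖ ^ 2) := by ring
        _ = K * x.im := by rw [him]
        _ ≤ K * K := by gcongr
        _ = K ^ 2 := by ring
    exact le_of_sq_le_sq this hK0.le
  have hwK' : 1 / K ≤ ‖w‖ := by
    rw [div_le_iff₀ hK0]
    have : (1 : ℝ) ^ 2 ≤ (‖w‖ * K) ^ 2 := by
      calc (1 : ℝ) ^ 2 = 1 := by ring
        _ ≤ K * x.im := k2
        _ = K * (p.im * ‖w‖ ^ 2) := by rw [him]
        _ ≤ K * (K * ‖w‖ ^ 2) := by gcongr
        _ = _ := by ring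
    exact le_of_sq_le_sq this (by positivity)
  have hK2 : K ^ 2 ≤ K ^ 4 := pow_le_pow_right₀ hK (by norm_num)
  have hK3 : K ^ 3 ≤ K ^ 4 := pow_le_pow_right₀ hK (by norm_num)
  have hK1 : K ≤ K ^ 4 := by simpa using pow_le_pow_right₀ hK (show 1 ≤ 4 by norm_num)
  have hK4 : 0 ≤ K ^ 4 := by positivity
  have hc : |c| ≤ K ^ 2 := by
    have h1 : |c| * x.im ≤ K := by
      have : w.im = c * x.im := by simp [hw]
      calc |c| * x.im = |w.im| := by rw [this, abs_mul, abs_of_pos hxi]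
        _ ≤ ‖w‖ := Complex.abs_im_le_norm w
        _ ≤ K := hwK
    calc |c| = |c| * 1 := by ring
      _ ≤ |c| * (K * x.im) := by gcongr
      _ = K * (|c| * x.im) := by ring
      _ ≤ K * K := by gcongr
      _ = K ^ 2 := by ring
  have he : |e| ≤ K + K ^ 3 := by
    have : (e : ℂ) = w - c * x := by rw [hw]; ring
    calc |e| = ‖(e : ℂ)‖ := by simp
      _ = ‖w - c * x‖ := by rw [this]
      _ ≤ ‖w‖ + ‖(c : ℂ) * x‖ := norm_sub_le _ _
      _ = ‖w‖ + |c| * ‖x‖ := by simp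
      _ ≤ K + K ^ 2 * K := by gcongr; exact hx.nm
      _ = _ := by ring
  have hpw : (a : ℂ) * x + b = p * w := by rw [hp]; field_simp
  have hpwn : ‖p * w‖ ≤ K ^ 2 := by
    rw [norm_mul]
    calc ‖p‖ * ‖w‖ ≤ K * K := by gcongr
      _ = _ := by ring
  have ha : |a| ≤ K ^ 3 := by
    have h1 : |a| * x.im ≤ K ^ 2 := by
      have : (p * w).im = a * x.im := by rw [← hpw]; simp
      calc |a| * x.im = |(p * w).im| := by rw [this, abs_mul, abs_of_pos hxi]
        _ ≤ ‖p * w‖ := Complex.abs_im_le_norm _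
        _ ≤ K ^ 2 := hpwn
    calc |a| = |a| * 1 := by ring
      _ ≤ |a| * (K * x.im) := by gcongr
      _ = K * (|a| * x.im) := by ring
      _ ≤ K * K ^ 2 := by gcongr
      _ = K ^ 3 := by ring
  have hb : |b| ≤ K ^ 2 + K ^ 4 := by
    have : (b : ℂ) = p * w - a * x := by rw [← hpw]; ring
    calc |b| = ‖(b : ℂ)‖ := by simp
      _ = ‖p * w - a * x‖ := by rw [this]
      _ ≤ ‖p * w‖ + ‖(a : ℂ) * x‖ := norm_sub_le _ _
      _ = ‖p * w‖ + |a| * ‖x‖ := by simp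
      _ ≤ K ^ 2 + K ^ 3 * K := by gcongr; exact hx.nm
      _ = _ := by ring
  refine ⟨hwK', hwK, ?_, ?_, ?_, ?_⟩ <;> linarith

/-- the point γ x in terms of a, e, c. -/
def pp (x : ℂ) (a e c : ℝ) : ℂ := ((a / c : ℝ) : ℂ) - 1 / ((c : ℂ) * ((c : ℂ) * x + e))

def F1 (φ : ℂ → ℝ) (x : ℂ) (z a e c : ℝ) : ℝ := φ (pp x a e c) * psi z c

lemma pp_bounds {K a c e : ℝ} {x : ℂ} {φ : ℂ → ℝ} (hφ : Tst K φ) (hK : 1 ≤ K) (hx : Pt K x) (hc : c ≠ 0)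
    (h : φ (pp x a e c) ≠ 0) :
    1 / K ≤ ‖(c : ℂ) * x + e‖ ∧ ‖(c : ℂ) * x + e‖ ≤ K ∧ |a| ≤ 2 * K ^ 4 ∧ 
      |c| ≤ 2 * K ^ 4 ∧ |e| ≤ 2 * K ^ 4 := by
  have hki : 0 < 1 / K := by positivity
  have hxi : 0 < x.im := hki.trans_le hx.im
  have := mob_bounds (a := a) (b := (a * e - 1) / c) (c := c) (e := e) hK hx (by field_simp; ring)
    (mob_form hxi hc) (hφ.supp _ h).1 (hφ.supp _ h).2
  tauto

lemma inv_sub_le {z c c' : ℝ} (hz : 1 ≤ z) (hc : 1 / z ≤ |c|) (hc' : 1 / z ≤ |c'|) :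
    |1 / c - 1 / c'| ≤ z ^ 2 * |c - c'| := by
  have hz0 : 0 < z := by linarith
  have h0 : 0 < 1 / z := by positivity
  have hc1 : |c|⁻¹ ≤ z := by
    have := inv_anti₀ h0 hc; simpa using this
  have hc1' : |c'|⁻¹ ≤ z := by
    have := inv_anti₀ h0 hc'; simpa using this
  have hc0 : c ≠ 0 := abs_pos.1 (h0.trans_le hc)
  have hc0' : c' ≠ 0 := abs_pos.1 (h0.trans_le hc')
  have : 1 / c - 1 / c' = c⁻¹ * c'⁻¹ * (c' - c) := by field_simp
  rw [this, abs_mul, abs_mul, abs_inv, abs_inv, abs_sub_comm c' c, sq]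
  gcongr

lemma pp_lip {K z a e c a' e' c' : ℝ} {x : ℂ} {φ : ℂ → ℝ} (hφ : Tst K φ) (hK : 1 ≤ K) (hx : Pt K x)
    (hz : 1 ≤ z) (hc : 1 / z ≤ |c|) (hc' : 1 / z ≤ |c'|) (h : φ (pp x a e c) ≠ 0) :
    ‖pp x a e c - pp x a' e' c'‖ ≤ 7 * K ^ 4 * z ^ 2 * (|a - a'| + |e - e'| + |c - c'|) := by
  have hz0 : 0 < z := by linarith
  have hK0 : 0 < K := by linarith
  have h0 : 0 < 1 / z := by positivity
  have hki : 0 < 1 / K := by positivity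
  have hxi : 0 < x.im := hki.trans_le hx.im
  have hc0 : c ≠ 0 := abs_pos.1 (h0.trans_le hc)
  have hc0' : c' ≠ 0 := abs_pos.1 (h0.trans_le hc')
  have hc1' : |c'|⁻¹ ≤ z := by
    have := inv_anti₀ h0 hc'; simpa using this
  obtain ⟨b1, b2, b3, b4, b5⟩ := pp_bounds hφ hK hx hc0 h
  have hw0 := cw_ne (e := e) hxi hc0
  have hw0' := cw_ne (e := e') hxi hc0'
  set w : ℂ := (c : ℂ) * x + e with hw
  set w' : ℂ := (c' : ℂ) * x + e' with hw'
  have i1 : ‖w‖⁻¹ ≤ K := by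
    have := inv_anti₀ hki b1; simpa using this
  have i2 : ‖w'‖⁻¹ ≤ z * K := by
    have h1 : 1 / z * (1 / K) ≤ ‖w'‖ := by
      calc 1 / z * (1 / K) ≤ |c'| * x.im := by gcongr; exact hx.im
        _ = |w'.im| := by simp [hw', abs_mul, abs_of_pos hxi]
        _ ≤ _ := Complex.abs_im_le_norm _
    have := inv_anti₀ (by positivity) h1
    rw [mul_inv] at this
    simpa using this
  have i3 : ‖w - w'‖ ≤ K * |c - c'| + |e - e'| := by
    have : w - w' = ((c - c' : ℝ) : ℂ) * x + ((e - e' : ℝ) : ℂ) := by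
      rw [hw, hw']; push_cast; ring
    rw [this]
    refine (norm_add_le _ _).trans ?_
    rw [norm_mul, Complex.norm_real, Complex.norm_real, Real.norm_eq_abs, Real.norm_eq_abs, mul_comm]
    gcongr
    exact hx.nm
  have hcd := inv_sub_le hz hc hc'
  have key : pp x a e c - pp x a' e' c' = (((a - a') * c'⁻¹ : ℝ) : ℂ) + ((a * (1 / c - 1 / c') : ℝ) : ℂ)
      - w⁻¹ * ((1 / c - 1 / c' : ℝ) : ℂ) - ((c'⁻¹ : ℝ) : ℂ) * (w⁻¹ * w'⁻¹ * (w' - w)) := by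
    unfold pp
    rw [← hw, ← hw']
    have e1 : (c : ℂ) ≠ 0 := by exact_mod_cast hc0
    have e2 : (c' : ℂ) ≠ 0 := by exact_mod_cast hc0'
    push_cast
    field_simp
    ring
  have n1 : ‖(((a - a') * c'⁻¹ : ℝ) : ℂ)‖ ≤ |a - a'| * z := by
    rw [Complex.norm_real, Real.norm_eq_abs, abs_mul, abs_inv]; gcongr
  have n2 : ‖((a * (1 / c - 1 / c') : ℝ) : ℂ)‖ ≤ 2 * K ^ 4 * (z ^ 2 * |c - c'|) := by
    rw [Complex.norm_real, Real.norm_eq_abs, abs_mul]; gcongr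
  have n3 : ‖w⁻¹ * ((1 / c - 1 / c' : ℝ) : ℂ)‖ ≤ K * (z ^ 2 * |c - c'|) := by
    rw [norm_mul, norm_inv, Complex.norm_real, Real.norm_eq_abs]; gcongr
  have n4 : ‖((c'⁻¹ : ℝ) : ℂ) * (w⁻¹ * w'⁻¹ * (w' - w))‖ ≤ z * (K * (z * K) * (K * |c - c'| + |e - e'|)) := by
    rw [norm_mul, norm_mul, norm_mul, norm_inv, norm_inv, Complex.norm_real, Real.norm_eq_abs, abs_inv, norm_sub_rev w' w]
    gcongr
  rw [key]
  refine (norm_sub_le _ _).trans ((add_le_add ((norm_sub_le _ _).trans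
    (add_le_add ((norm_add_le _ _).trans (add_le_add n1 n2)) n3)) n4).trans ?_)
  generalize hA : |a - a'| = A
  generalize hE : |e - e'| = E
  generalize hC : |c - c'| = C
  have hA0 : 0 ≤ A := hA ▸ abs_nonneg _
  have hE0 : 0 ≤ E := hE ▸ abs_nonneg _
  have hC0 : 0 ≤ C := hC ▸ abs_nonneg _
  have hK2 : K ^ 2 ≤ K ^ 4 := pow_le_pow_right₀ hK (by norm_num)
  have hK3 : K ^ 3 ≤ K ^ 4 := pow_le_pow_right₀ hK (by norm_num)
  have hK1 : K ≤ K ^ 4 := by simpa using pow_le_pow_right₀ hK (show 1 ≤ 4 by norm_num)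
  have hK4 : 1 ≤ K ^ 4 := one_le_pow₀ hK
  have hz2 : z ≤ z ^ 2 := by simpa using pow_le_pow_right₀ hz (show 1 ≤ 2 by norm_num)
  have m1 : A * z ≤ K ^ 4 * (z ^ 2 * A) := by
    calc A * z ≤ A * z ^ 2 := by gcongr
      _ = 1 * (z ^ 2 * A) := by ring
      _ ≤ _ := by gcongr
  have m3 : K * (z ^ 2 * C) ≤ K ^ 4 * (z ^ 2 * C) := by gcongr
  have m4 : z * (K * (z * K) * (K * C + E)) ≤ K ^ 4 * (z ^ 2 * C) + K ^ 4 * (z ^ 2 * E) := by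
    calc z * (K * (z * K) * (K * C + E)) = K ^ 3 * (z ^ 2 * C) + K ^ 2 * (z ^ 2 * E) := by ring
      _ ≤ _ := by gcongr
  have p1 : 0 ≤ K ^ 4 * (z ^ 2 * A) := by positivity
  have p2 : 0 ≤ K ^ 4 * (z ^ 2 * C) := by positivity
  have p3 : 0 ≤ K ^ 4 * (z ^ 2 * E) := by positivity
  calc _ ≤ K ^ 4 * (z ^ 2 * A) + 2 * K ^ 4 * (z ^ 2 * C) + K ^ 4 * (z ^ 2 * C) +
        (K ^ 4 * (z ^ 2 * C) + K ^ 4 * (z ^ 2 * E)) := by gcongr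
    _ ≤ _ := by linarith only [p1, p2, p3]

lemma F1_adm {K z : ℝ} {x : ℂ} {φ : ℂ → ℝ} (hφ : Tst K φ) (hK : 1 ≤ K) (hx : Pt K x)
    (hz : 7 * K ^ 5 ≤ z) : Adm z (F1 φ x z) := by
  have hK0 : 0 < K := by linarith
  have hK5 : K ^ 4 ≤ K ^ 5 := pow_le_pow_right₀ hK (by norm_num)
  have hK1 : K ≤ K ^ 4 := by simpa using pow_le_pow_right₀ hK (show 1 ≤ 4 by norm_num)
  have hK4 : 1 ≤ K ^ 4 := one_le_pow₀ hK
  have hz2 : 2 ≤ z := by linarith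
  have hz0 : 0 < z := by linarith
  have h0 : 0 < 1 / z := by positivity
  refine adm_mk (f := fun a e c => φ (pp x a e c)) hz2 (fun _ _ _ => hφ.nn _)
    (fun _ _ _ => (hφ.bd _).trans (by linarith)) ?_ ?_
  · intro a e c hc h
    obtain ⟨b1, b2, b3, b4, b5⟩ := pp_bounds hφ hK hx (abs_pos.1 (h0.trans_le hc)) h
    refine ⟨?_, ?_, ?_⟩ <;> linarith
  · intro a e c a' e' c' hc hc' h
    refine (hφ.lip _ _).trans ?_
    have := pp_lip (a' := a') (e' := e') hφ hK hx (by linarith) hc hc' h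
    calc _ ≤ K * (7 * K ^ 4 * z ^ 2 * (|a - a'| + |e - e'| + |c - c'|)) := by gcongr
      _ = 7 * K ^ 5 * z ^ 2 * (|a - a'| + |e - e'| + |c - c'|) := by ring
      _ ≤ z * z ^ 2 * (|a - a'| + |e - e'| + |c - c'|) := by gcongr
      _ = _ := by ring

end
end
end Equi

namespace Equi
open scoped BigOperators
open MeasureTheory
noncomputable section
set_option linter.unusedSectionVars false
set_option linter.unusedDecidableInType false
set_option linter.unusedFintypeInType false
section

lemma radial (g : ℝ → ℝ) : ∫ p : ℝ × ℝ, g (p.1 ^ 2 + p.2 ^ 2) = Real.pi * ∫ u in Set.Ioi (0:ℝ), g u := by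
  rw [← integral_comp_polarCoord_symm, polarCoord_target]
  have h1 : ∀ p : ℝ × ℝ, p.1 • g ((polarCoord.symm p).1 ^ 2 + (polarCoord.symm p).2 ^ 2) =
      (p.1 * g (p.1 ^ 2)) * (fun _ : ℝ => (1:ℝ)) p.2 := by
    intro p
    rw [polarCoord_symm_apply]
    have : (p.1 * Real.cos p.2) ^ 2 + (p.1 * Real.sin p.2) ^ 2 = p.1 ^ 2 := by
      linear_combination p.1 ^ 2 * Real.sin_sq_add_cos_sq p.2
    simp only [this, smul_eq_mul, mul_one]
  simp_rw [h1]
  rw [Measure.volume_eq_prod, setIntegral_prod_mul (fun r : ℝ => r * g (r ^ 2)) (fun _ : ℝ => (1:ℝ))]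
  have h2 := integral_comp_rpow_Ioi_of_pos (g := g) (p := 2) (by norm_num)
  rw [← h2]
  have h3 : ∀ x : ℝ, ((2:ℝ) * x ^ ((2:ℝ) - 1)) • g (x ^ (2:ℝ)) = 2 * (x * g (x ^ 2)) := by
    intro x
    rw [show (2:ℝ) - 1 = 1 by norm_num, Real.rpow_one, Real.rpow_two, smul_eq_mul]; ring
  simp_rw [h3]
  rw [integral_const_mul]
  simp [Real.pi_pos.le, measureReal_def]
  ring_nf

/-- one-dimensional mass of the smoothed cutoff -/
def JJ (T z : ℝ) : ℝ := ∫ u in Set.Ioi (0:ℝ), cl ((T - u) * z)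

lemma JJ_close {T z : ℝ} (hz : 0 < z) (hT : 1 / z ≤ T) : |JJ T z - T| ≤ 1 / z := by
  have hz1 : 0 < 1 / z := by positivity
  have h1 : JJ T z = ∫ u in Set.Ioc 0 T, cl ((T - u) * z) := by
    refine setIntegral_eq_of_subset_of_forall_sdiff_eq_zero measurableSet_Ioi
      (fun u hu => hu.1) ?_
    intro u hu
    refine cl_zero ?_
    have : T < u := by
      by_contra hc; exact hu.2 ⟨hu.1, not_lt.1 hc⟩
    nlinarith
  have h2 : T = ∫ u in Set.Ioc 0 T, (1:ℝ) := by
    simp; linarith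
  have h3 : JJ T z - T = ∫ u in Set.Ioc 0 T, (cl ((T - u) * z) - 1) := by
    rw [integral_sub, ← h1, ← h2]
    · exact (Continuous.integrableOn_Ioc (cl_cont.comp (by fun_prop)))
    · exact (continuous_const.integrableOn_Ioc)
  have h4 : ∫ u in Set.Ioc 0 T, (cl ((T - u) * z) - 1) = ∫ u in Set.Ioc (T - 1 / z) T, (cl ((T - u) * z) - 1) := by
    refine setIntegral_eq_of_subset_of_forall_sdiff_eq_zero measurableSet_Ioc
      (fun u hu => ⟨by linarith [hu.1], hu.2⟩) ?_
    intro u hu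
    have : u ≤ T - 1 / z := by
      by_contra hc; exact hu.2 ⟨not_le.1 hc, hu.1.2⟩
    rw [cl_one, sub_self]
    have h5 : 1 / z ≤ T - u := by linarith
    rwa [div_le_iff₀ hz] at h5
  rw [h3, h4]
  have := norm_setIntegral_le_of_norm_le_const (f := fun u => cl ((T - u) * z) - 1) (μ := volume)
    (s := Set.Ioc (T - 1 / z) T) (C := 1) (by simp) (by
      intro u _
      rw [Real.norm_eq_abs, abs_le]
      constructor <;> linarith [cl_nonneg ((T - u) * z), cl_le_one ((T - u) * z)])
  simpa [measureReal_def, hz.le] using this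

/-- integrand after the substitution s = a / c -/
def H2 (T z : ℝ) (p : ℝ × ℝ) (s : ℝ) : ℝ := psi z p.1 * cl ((T - (p.1 ^ 2 + p.2 ^ 2) * (1 + s ^ 2)) * z)

lemma H2_supp {T z : ℝ} (hT : T ≤ 2) (hz : 1 ≤ z) {p : ℝ × ℝ} {s : ℝ}
    (h : cl ((T - (p.1 ^ 2 + p.2 ^ 2) * (1 + s ^ 2)) * z) ≠ 0) :
    (p.1 ^ 2 + p.2 ^ 2) * (1 + s ^ 2) < 2 := by
  have h1 := cl_pos h
  have := pos_of_mul_pos_left h1 (by linarith)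
  linarith

lemma H2_cont (T z : ℝ) : Continuous (Function.uncurry (H2 T z)) := by
  unfold H2 Function.uncurry
  exact ((psi_cont z).comp (by fun_prop)).mul (cl_cont.comp (by fun_prop))

lemma H2_cs {T z : ℝ} (hT : T ≤ 2) (hz : 1 ≤ z) : HasCompactSupport (Function.uncurry (H2 T z)) := by
  refine HasCompactSupport.intro (K := ((Set.Icc (-2) 2 ×ˢ Set.Icc (-2) 2) ×ˢ Set.Icc (-(2 * z)) (2 * z)))
    ((isCompact_Icc.prod isCompact_Icc).prod isCompact_Icc) ?_
  rintro ⟨⟨c, e⟩, s⟩ hp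
  by_contra h
  apply hp
  have hz0 : 0 < z := by linarith
  have hh : psi z c * cl ((T - (c ^ 2 + e ^ 2) * (1 + s ^ 2)) * z) ≠ 0 := h
  have h1 := H2_supp (p := (c, e)) hT hz (right_ne_zero_of_mul hh)
  have h2 := psi_pos hz0 (left_ne_zero_of_mul hh)
  simp only at h1
  have hc2 : c ^ 2 ≤ 2 ^ 2 := by nlinarith [sq_nonneg c, sq_nonneg e, sq_nonneg s, mul_nonneg (sq_nonneg c) (sq_nonneg s), mul_nonneg (sq_nonneg e) (sq_nonneg s)]
  have he2 : e ^ 2 ≤ 2 ^ 2 := by nlinarith [sq_nonneg c, sq_nonneg e, sq_nonneg s, mul_nonneg (sq_nonneg c) (sq_nonneg s), mul_nonneg (sq_nonneg e) (sq_nonneg s)]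
  have hcs : c ^ 2 * s ^ 2 ≤ 2 := by nlinarith [sq_nonneg c, sq_nonneg e, sq_nonneg s, mul_nonneg (sq_nonneg c) (sq_nonneg s), mul_nonneg (sq_nonneg e) (sq_nonneg s)]
  have hzc : 1 ≤ z ^ 2 * c ^ 2 := by
    rw [div_le_iff₀ hz0] at h2
    have h3 : 1 ≤ (|c| * z) ^ 2 := one_le_pow₀ h2
    rw [mul_pow, sq_abs] at h3
    linarith
  have hs2 : s ^ 2 ≤ (2 * z) ^ 2 := by
    calc s ^ 2 = 1 * s ^ 2 := by ring
      _ ≤ (z ^ 2 * c ^ 2) * s ^ 2 := by gcongr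
      _ = z ^ 2 * (c ^ 2 * s ^ 2) := by ring
      _ ≤ z ^ 2 * 4 := by gcongr; linarith
      _ = _ := by ring
  have a1 := abs_le_of_sq_le_sq' hc2 (by norm_num)
  have a2 := abs_le_of_sq_le_sq' he2 (by norm_num)
  have a3 := abs_le_of_sq_le_sq' hs2 (by positivity)
  exact ⟨⟨a1, a2⟩, a3⟩

lemma I2_eq {T z : ℝ} (hT : T ≤ 2) (hz : 1 ≤ z) : I3 (dvc (F2 T z)) = ∫ s, ∫ p : ℝ × ℝ, H2 T z p s := by
  have hz0 : 0 < z := by linarith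
  rw [← integral_integral_swap_of_hasCompactSupport (H2_cont T z) (H2_cs hT hz)]
  have hi : Integrable (Function.uncurry (H2 T z)) ((volume : Measure (ℝ × ℝ)).prod volume) :=
    (H2_cont T z).integrable_of_hasCompactSupport (H2_cs hT hz)
  have hi2 := hi.integral_prod_left
  refine Eq.trans ?_ (integral_prod _ hi2).symm
  unfold I3
  refine integral_congr_ae (Filter.Eventually.of_forall fun c => ?_)
  refine integral_congr_ae (Filter.Eventually.of_forall fun e => ?_)
  show ∫ a, dvc (F2 T z) a e c = ∫ s, H2 T z (c, e) s
  by_cases hc : c = 0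
  · subst hc
    have hp : psi z 0 = 0 := by unfold psi; exact cl_zero (by simp)
    simp [dvc, H2, hp]
  · have h1 : ∀ a, dvc (F2 T z) a e c = |c|⁻¹ * H2 T z (c, e) (a / c) := by
      intro a
      unfold dvc F2 H2 QQ
      simp only
      ring
    simp_rw [h1]
    rw [integral_const_mul, Measure.integral_comp_div (fun s => H2 T z (c, e) s), smul_eq_mul,
      ← mul_assoc, inv_mul_cancel₀ (abs_ne_zero.2 hc), one_mul]

lemma int_nocut {T z : ℝ} (s : ℝ) :
    ∫ p : ℝ × ℝ, cl ((T - (p.1 ^ 2 + p.2 ^ 2) * (1 + s ^ 2)) * z) = Real.pi * JJ T z * (1 + s ^ 2)⁻¹ := by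
  rw [radial (fun u => cl ((T - u * (1 + s ^ 2)) * z))]
  have := integral_comp_mul_left_Ioi (fun u => cl ((T - u) * z)) 0 (b := 1 + s ^ 2) (by positivity)
  rw [mul_zero, smul_eq_mul] at this
  simp_rw [mul_comm _ (1 + s ^ 2)]
  rw [this]
  unfold JJ; ring

lemma abs_le_div_of {c σ y : ℝ} (hσ : 0 < σ) (h : c ^ 2 * σ ^ 2 ≤ y ^ 2) (hy : 0 ≤ y) : |c| ≤ y / σ := by
  rw [le_div_iff₀ hσ]
  rw [← mul_pow] at h
  have := abs_le_of_sq_le_sq h hy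
  rwa [abs_mul, abs_of_pos hσ] at this

lemma int2_le {f : ℝ × ℝ → ℝ} {A B M : ℝ} (hA : 0 ≤ A) (hB : 0 ≤ B) (hb : ∀ p, |f p| ≤ M)
    (hs : ∀ p, f p ≠ 0 → |p.1| ≤ A ∧ |p.2| ≤ B) : |∫ p, f p| ≤ M * (2 * A * (2 * B)) := by
  have h1 : ∫ p, f p = ∫ p in Set.Icc (-A) A ×ˢ Set.Icc (-B) B, f p := by
    rw [setIntegral_eq_integral_of_forall_compl_eq_zero]
    intro p hp
    by_contra h
    obtain ⟨u, v⟩ := hs p h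
    exact hp ⟨abs_le.1 u, abs_le.1 v⟩
  rw [h1]
  have hv : (volume : Measure (ℝ × ℝ)) (Set.Icc (-A) A ×ˢ Set.Icc (-B) B) = ENNReal.ofReal (2 * A) * ENNReal.ofReal (2 * B) := by
    rw [Measure.volume_eq_prod, Measure.prod_prod, Real.volume_Icc, Real.volume_Icc]
    ring_nf
  have h2 := norm_setIntegral_le_of_norm_le_const (f := f) (μ := volume)
    (s := Set.Icc (-A) A ×ˢ Set.Icc (-B) B) (C := M) (by
      rw [hv]; exact ENNReal.mul_lt_top ENNReal.ofReal_lt_top ENNReal.ofReal_lt_top) (fun p _ => hb p)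
  rw [measureReal_def, hv, ENNReal.toReal_mul, ENNReal.toReal_ofReal (by positivity),
    ENNReal.toReal_ofReal (by positivity)] at h2
  exact h2

/-- error from cutting off small c, for fixed s -/
lemma int_cut {T z : ℝ} (hT : T ≤ 2) (hz : 1 ≤ z) (s : ℝ) :
    |(∫ p : ℝ × ℝ, H2 T z p s) - Real.pi * JJ T z * (1 + s ^ 2)⁻¹| ≤
      16 * Real.sqrt (1 / z) * (1 + ‖s‖ ^ 2) ^ (-(3/2:ℝ) / 2) := by
  have hz0 : 0 < z := by linarith
  rw [← int_nocut]
  have hσp : 0 < 1 + s ^ 2 := by positivity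
  obtain ⟨σ, hσ, hσ2⟩ : ∃ σ : ℝ, 0 < σ ∧ σ ^ 2 = 1 + s ^ 2 :=
    ⟨Real.sqrt (1 + s ^ 2), Real.sqrt_pos.2 hσp, Real.sq_sqrt hσp.le⟩
  have hsup : ∀ p : ℝ × ℝ, cl ((T - (p.1 ^ 2 + p.2 ^ 2) * (1 + s ^ 2)) * z) ≠ 0 →
      |p.1| ≤ 2 / σ ∧ |p.2| ≤ 2 / σ := by
    intro p hp
    have h1 := H2_supp hT hz hp
    rw [← hσ2, add_mul] at h1
    have := mul_nonneg (sq_nonneg p.1) (sq_nonneg σ)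
    have := mul_nonneg (sq_nonneg p.2) (sq_nonneg σ)
    exact ⟨abs_le_div_of hσ (by linarith) (by norm_num), abs_le_div_of hσ (by linarith) (by norm_num)⟩
  have hc1 : HasCompactSupport (fun p : ℝ × ℝ => cl ((T - (p.1 ^ 2 + p.2 ^ 2) * (1 + s ^ 2)) * z)) := by
    refine HasCompactSupport.intro (K := Set.Icc (-(2/σ)) (2/σ) ×ˢ Set.Icc (-(2/σ)) (2/σ)) (isCompact_Icc.prod isCompact_Icc) ?_
    intro p hp
    by_contra h
    obtain ⟨u, v⟩ := hsup p h
    exact hp ⟨abs_le.1 u, abs_le.1 v⟩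
  have hcont : Continuous (fun p : ℝ × ℝ => cl ((T - (p.1 ^ 2 + p.2 ^ 2) * (1 + s ^ 2)) * z)) :=
    cl_cont.comp (by fun_prop)
  have hIntg := hcont.integrable_of_hasCompactSupport (μ := volume) hc1
  have hint2 : Integrable (fun p : ℝ × ℝ => H2 T z p s) := by
    refine Continuous.integrable_of_hasCompactSupport ?_ ?_
    · exact (H2_cont T z).comp (by fun_prop : Continuous fun p : ℝ × ℝ => (p, s))
    · exact hc1.mul_left
  rw [← integral_sub hint2 hIntg]
  obtain ⟨m, hm0, hm1, hm2, hm⟩ : ∃ m : ℝ, 0 ≤ m ∧ m ≤ 1 / z ∧ m ≤ 1 / σ ∧ (m = 1 / z ∨ m = 1 / σ) := by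
    refine ⟨min (1 / z) (1 / σ), by positivity, min_le_left _ _, min_le_right _ _, ?_⟩
    exact min_choice _ _
  have hb := int2_le (f := fun p : ℝ × ℝ => H2 T z p s - cl ((T - (p.1 ^ 2 + p.2 ^ 2) * (1 + s ^ 2)) * z))
    (A := 2 * m) (B := 2 / σ) (M := 1) (by positivity) (by positivity) ?_ ?_
  · refine hb.trans ?_
    have hmm : m ^ 2 ≤ 1 / z * (1 / σ) := by rw [sq]; gcongr
    set A : ℝ := (1 + ‖s‖ ^ 2) ^ (-(1/2:ℝ) / 2) with hA
    have hns : 1 + ‖s‖ ^ 2 = σ ^ 2 := by rw [hσ2, Real.norm_eq_abs, sq_abs]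
    have hAp : 0 < A := by rw [hA, hns]; positivity
    have hA3 : (1 + ‖s‖ ^ 2) ^ (-(3/2:ℝ) / 2) = A ^ 3 := by
      rw [hA, hns, ← Real.rpow_natCast (_ ^ _), ← Real.rpow_mul (by positivity)]
      norm_num
    have hA2 : 1 / σ = A ^ 2 := by
      rw [hA, hns, ← Real.rpow_natCast (_ ^ _), ← Real.rpow_mul (by positivity), ← Real.rpow_natCast, ← Real.rpow_mul hσ.le]
      norm_num
      rw [Real.rpow_neg_one]
    rw [hA3]
    have hmA : m ≤ Real.sqrt (1 / z) * A := by
      refine le_of_sq_le_sq ?_ (by positivity)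
      rw [mul_pow, Real.sq_sqrt (by positivity), ← hA2]
      exact hmm
    calc 1 * (2 * (2 * m) * (2 * (2 / σ))) = 16 * m * (1 / σ) := by ring
      _ = 16 * m * A ^ 2 := by rw [hA2]
      _ ≤ 16 * (Real.sqrt (1 / z) * A) * A ^ 2 := by gcongr
      _ = _ := by ring
  · intro p
    simp only [H2]
    have h1 := psi_nonneg z p.1
    have h2 := psi_le_one z p.1
    generalize psi z p.1 = P at *
    generalize hq : cl ((T - (p.1 ^ 2 + p.2 ^ 2) * (1 + s ^ 2)) * z) = q
    have h3 : 0 ≤ q := hq ▸ cl_nonneg _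
    have h4 : q ≤ 1 := hq ▸ cl_le_one _
    rw [abs_le]
    constructor <;> nlinarith
  · intro p hp
    simp only [H2] at hp
    have hq : cl ((T - (p.1 ^ 2 + p.2 ^ 2) * (1 + s ^ 2)) * z) ≠ 0 := by
      intro h; rw [h] at hp; simp at hp
    obtain ⟨u, v⟩ := hsup p hq
    refine ⟨?_, v⟩
    rcases hm with h | h
    · rw [h]
      by_contra hc
      push Not at hc
      rw [psi_one hz0 (by rw [← mul_one_div]; exact hc.le)] at hp
      simp at hp
    · rw [h, mul_one_div]; exact u

lemma I2_close : ∃ C : ℝ, 1 ≤ C ∧ ∀ T z : ℝ, 1 ≤ z → 1 / z ≤ T → T ≤ 2 →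
    |I3 (dvc (F2 T z)) - Real.pi ^ 2 * T| ≤ C * Real.sqrt (1 / z) := by
  have hI : Integrable (fun s : ℝ => (1 + ‖s‖ ^ 2) ^ (-(3/2:ℝ) / 2)) :=
    integrable_rpow_neg_one_add_norm_sq (by simp; norm_num)
  set B := ∫ s : ℝ, (1 + ‖s‖ ^ 2) ^ (-(3/2:ℝ) / 2) with hB
  have hB0 : 0 ≤ B := integral_nonneg fun s => by positivity
  refine ⟨16 * B + Real.pi ^ 2 + 1, by nlinarith [sq_nonneg Real.pi], ?_⟩
  intro T z hz hT0 hT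
  have hz0 : 0 < z := by linarith
  have hi : Integrable (Function.uncurry (H2 T z)) ((volume : Measure (ℝ × ℝ)).prod volume) :=
    (H2_cont T z).integrable_of_hasCompactSupport (H2_cs hT hz)
  have hi2 := hi.integral_prod_right
  have hi3 : Integrable (fun s : ℝ => Real.pi * JJ T z * (1 + s ^ 2)⁻¹) :=
    integrable_inv_one_add_sq.const_mul _
  have h1 : |I3 (dvc (F2 T z)) - Real.pi ^ 2 * JJ T z| ≤ 16 * Real.sqrt (1 / z) * B := by
    have : Real.pi ^ 2 * JJ T z = ∫ s : ℝ, Real.pi * JJ T z * (1 + s ^ 2)⁻¹ := by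
      rw [integral_const_mul, integral_univ_inv_one_add_sq]; ring
    rw [I2_eq hT hz, this]
    have h2 := norm_integral_le_of_norm_le (μ := volume)
      (f := fun s : ℝ => (∫ p : ℝ × ℝ, H2 T z p s) - Real.pi * JJ T z * (1 + s ^ 2)⁻¹)
      (g := fun s : ℝ => 16 * Real.sqrt (1 / z) * (1 + ‖s‖ ^ 2) ^ (-(3/2:ℝ) / 2)) (hI.const_mul _)
      (Filter.Eventually.of_forall fun s => int_cut hT hz s)
    rw [integral_const_mul, ← hB] at h2
    have h3 := integral_sub (f := fun s : ℝ => (∫ p : ℝ × ℝ, H2 T z p s)) hi2 hi3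
    rw [h3] at h2
    exact h2
  have h2 := JJ_close hz0 hT0
  have h3 : 1 / z ≤ Real.sqrt (1 / z) := by
    have h0 : 1 / z ≤ 1 := by rw [div_le_one hz0]; exact hz
    refine Real.le_sqrt_of_sq_le ?_
    have : 0 ≤ 1 / z := by positivity
    nlinarith
  have h4 : |Real.pi ^ 2 * JJ T z - Real.pi ^ 2 * T| ≤ Real.pi ^ 2 * Real.sqrt (1 / z) := by
    rw [← mul_sub, abs_mul, abs_of_nonneg (sq_nonneg _)]
    gcongr
    exact h2.trans h3
  have h5 := abs_sub_le (I3 (dvc (F2 T z))) (Real.pi ^ 2 * JJ T z) (Real.pi ^ 2 * T)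
  have h6 := Real.sqrt_nonneg (1 / z)
  linarith

end
end
end Equi

namespace Equi
open scoped BigOperators
open MeasureTheory
noncomputable section
set_option linter.unusedSectionVars false
set_option linter.unusedDecidableInType false
set_option linter.unusedFintypeInType false
section

/-- integral over horizontal lines -/
def Ph (φ : ℂ → ℝ) (v : ℝ) : ℝ := ∫ u : ℝ, φ ⟨u, v⟩

lemma Tst.cont {K : ℝ} {φ : ℂ → ℝ} (hφ : Tst K φ) (hK : 1 ≤ K) : Continuous φ := by
  refine (LipschitzWith.of_dist_le_mul (K := ⟨K, by linarith⟩) ?_).continuous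
  intro p q
  rw [Real.dist_eq, dist_eq_norm]
  exact hφ.lip p q

lemma Tst.re {K : ℝ} {φ : ℂ → ℝ} (hφ : Tst K φ) {u v : ℝ} (h : φ ⟨u, v⟩ ≠ 0) :
    |u| ≤ K ∧ 1 / K ≤ v ∧ v ≤ K := by
  obtain ⟨h1, h2⟩ := hφ.supp _ h
  exact ⟨(Complex.abs_re_le_norm ⟨u, v⟩).trans h2, h1, (Complex.im_le_norm ⟨u, v⟩).trans h2⟩

lemma Tst.abs {K : ℝ} {φ : ℂ → ℝ} (hφ : Tst K φ) (p : ℂ) : |φ p| ≤ K := by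
  rw [abs_of_nonneg (hφ.nn p)]; exact hφ.bd p

lemma mk_cont : Continuous (fun p : ℝ × ℝ => (⟨p.1, p.2⟩ : ℂ)) :=
  Complex.equivRealProdCLM.symm.continuous

lemma line_cont (v : ℝ) : Continuous (fun u : ℝ => (⟨u, v⟩ : ℂ)) :=
  mk_cont.comp (by fun_prop : Continuous fun u : ℝ => (u, v))

lemma Ph_int {K : ℝ} {φ : ℂ → ℝ} (hφ : Tst K φ) (hK : 1 ≤ K) (v : ℝ) :
    Integrable (fun u : ℝ => φ ⟨u, v⟩) := by
  refine Continuous.integrable_of_hasCompactSupport ((hφ.cont hK).comp (line_cont v)) ?_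
  refine HasCompactSupport.intro (K := Set.Icc (-K) K) isCompact_Icc ?_
  intro u hu
  by_contra h
  exact hu (abs_le.1 (hφ.re h).1)

lemma Ph_bd {K : ℝ} {φ : ℂ → ℝ} (hφ : Tst K φ) (hK : 1 ≤ K) (v : ℝ) : |Ph φ v| ≤ 2 * K * K :=
  abs_integral_le_of_supp (by linarith) (fun u => hφ.abs _) (fun u h => (hφ.re h).1)

lemma Ph_supp {K : ℝ} {φ : ℂ → ℝ} (hφ : Tst K φ) {v : ℝ} (h : Ph φ v ≠ 0) : 1 / K ≤ v ∧ v ≤ K := by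
  by_contra hc
  apply h
  unfold Ph
  have : ∀ u : ℝ, φ ⟨u, v⟩ = 0 := by
    intro u; by_contra h'; exact hc (hφ.re h').2
  simp [this]

lemma Ph_cont {K : ℝ} {φ : ℂ → ℝ} (hφ : Tst K φ) (hK : 1 ≤ K) : Continuous (Ph φ) := by
  refine (LipschitzWith.of_dist_le_mul (K := ⟨2 * K * K, by positivity⟩) ?_).continuous
  intro v v'
  rw [Real.dist_eq, Real.dist_eq]
  unfold Ph
  rw [← integral_sub (Ph_int hφ hK v) (Ph_int hφ hK v')]
  refine (abs_integral_le_of_supp (W := K) (M := K * |v - v'|) (by linarith) ?_ ?_).trans (le_of_eq ?_)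
  · intro u
    refine (hφ.lip _ _).trans (le_of_eq ?_)
    congr 1
    have : (⟨u, v⟩ : ℂ) - ⟨u, v'⟩ = ((v - v' : ℝ) : ℂ) * Complex.I := by
      apply Complex.ext <;> simp
    rw [this, norm_mul, Complex.norm_real, Complex.norm_I, mul_one, Real.norm_eq_abs]
  · intro u hu
    by_cases h : φ ⟨u, v⟩ = 0
    · by_cases h' : φ ⟨u, v'⟩ = 0
      · exact absurd (by rw [h, h', sub_self]) hu
      · exact (hφ.re h').1
    · exact (hφ.re h).1
  · show _ = 2 * K * K * |v - v'|
    ring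

lemma pp_eq {x : ℂ} {c e : ℝ} (hx : 0 < x.im) (hc : c ≠ 0) : ∃ r : ℝ, ∀ a : ℝ,
    pp x a e c = ⟨a / c - r, x.im / (c ^ 2 * x.im ^ 2 + (e + c * x.re) ^ 2)⟩ := by
  have hw := cw_ne (e := e) hx hc
  have hw2 : Complex.normSq ((c : ℂ) * x + e) = c ^ 2 * x.im ^ 2 + (e + c * x.re) ^ 2 := by
    rw [Complex.normSq_apply]; simp; ring
  refine ⟨(1 / ((c : ℂ) * ((c : ℂ) * x + e))).re, fun a => ?_⟩
  apply Complex.ext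
  · simp [pp]
  · unfold pp
    rw [mob_form hx hc, im_mob _ _ _ _ _ (by field_simp; ring), hw2]

lemma I1_eq {K z : ℝ} {x : ℂ} {φ : ℂ → ℝ} (hφ : Tst K φ) (hK : 1 ≤ K) (hx : 0 < x.im) :
    I3 (dvc (F1 φ x z)) = ∫ c, psi z c * ∫ e, Ph φ (x.im / ((c * x.im) ^ 2 + e ^ 2)) := by
  unfold I3
  refine integral_congr_ae (Filter.Eventually.of_forall fun c => ?_)
  simp only
  by_cases hc : c = 0
  · subst hc
    have hp : psi z 0 = 0 := by unfold psi; exact cl_zero (by simp)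
    simp [dvc, hp]
  · have h1 : ∀ e, ∫ a, dvc (F1 φ x z) a e c = psi z c * Ph φ (x.im / ((c * x.im) ^ 2 + (e + c * x.re) ^ 2)) := by
      intro e
      obtain ⟨r, hr⟩ := pp_eq (e := e) hx hc
      have h2 : ∀ a, dvc (F1 φ x z) a e c = (psi z c * |c|⁻¹) *
          (fun s : ℝ => φ ⟨s - r, x.im / (c ^ 2 * x.im ^ 2 + (e + c * x.re) ^ 2)⟩) (a / c) := by
        intro a
        unfold dvc F1
        rw [hr]
        ring
      simp_rw [h2]
      rw [integral_const_mul, Measure.integral_comp_div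
        (fun s : ℝ => φ ⟨s - r, x.im / (c ^ 2 * x.im ^ 2 + (e + c * x.re) ^ 2)⟩),
        integral_sub_right_eq_self (fun s : ℝ => φ ⟨s, x.im / (c ^ 2 * x.im ^ 2 + (e + c * x.re) ^ 2)⟩) r,
        smul_eq_mul, mul_pow]
      unfold Ph
      have := abs_ne_zero.2 hc
      field_simp
    simp_rw [h1]
    rw [integral_const_mul, integral_add_right_eq_self (fun e => Ph φ (x.im / ((c * x.im) ^ 2 + e ^ 2)))]

lemma plane_integrable {f : ℝ × ℝ → ℝ} {A M : ℝ} (hm : Measurable f) (hb : ∀ p, |f p| ≤ M)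
    (hs : ∀ p, f p ≠ 0 → |p.1| ≤ A ∧ |p.2| ≤ A) : Integrable f := by
  have hc : IsCompact (Set.Icc (-A) A ×ˢ Set.Icc (-A) A) := isCompact_Icc.prod isCompact_Icc
  have h1 : IntegrableOn f (Set.Icc (-A) A ×ˢ Set.Icc (-A) A) volume := by
    refine Measure.integrableOn_of_bounded (M := M) hc.measure_lt_top.ne hm.aestronglyMeasurable ?_
    exact Filter.Eventually.of_forall hb
  refine h1.integrable_of_forall_notMem_eq_zero ?_
  intro p hp
  by_contra h
  obtain ⟨u, v⟩ := hs p h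
  exact hp ⟨abs_le.1 u, abs_le.1 v⟩

/-- the hyperbolic integral -/
def hypI (φ : ℂ → ℝ) : ℝ := ∫ v in Set.Ioi (0:ℝ), (v ^ 2)⁻¹ * Ph φ v

lemma subst_inv {y : ℝ} (hy : 0 < y) (φ : ℂ → ℝ) :
    ∫ u in Set.Ioi (0:ℝ), Ph φ (y / u) = y * hypI φ := by
  rw [← integral_comp_rpow_Ioi (fun u => Ph φ (y / u)) (p := -1) (by norm_num)]
  have h1 : ∀ u ∈ Set.Ioi (0:ℝ), (|(-1:ℝ)| * u ^ ((-1:ℝ) - 1)) • Ph φ (y / u ^ (-1:ℝ)) =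
      (fun v => y ^ 2 * ((v ^ 2)⁻¹ * Ph φ v)) (y * u) := by
    intro u hu
    have hu0 : 0 < u := hu
    have e1 : u ^ ((-1:ℝ) - 1) = (u ^ 2)⁻¹ := by
      rw [show (-1:ℝ) - 1 = -(2:ℝ) by norm_num, Real.rpow_neg hu0.le, Real.rpow_two]
    rw [e1, Real.rpow_neg_one, div_inv_eq_mul, smul_eq_mul]
    simp only [abs_neg, abs_one, one_mul]
    field_simp
  rw [setIntegral_congr_fun measurableSet_Ioi h1, integral_comp_mul_left_Ioi (fun v => y ^ 2 * ((v ^ 2)⁻¹ * Ph φ v)) _ hy, mul_zero,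
    integral_const_mul, smul_eq_mul]
  unfold hypI
  field_simp

lemma I1_close {K z : ℝ} {x : ℂ} {φ : ℂ → ℝ} (hφ : Tst K φ) (hK : 1 ≤ K) (hx : Pt K x) (hz : 1 ≤ z) :
    |I3 (dvc (F1 φ x z)) - Real.pi * hypI φ| ≤ 16 * K ^ 3 * (1 / z) := by
  have hK0 : 0 < K := by linarith
  have hz0 : 0 < z := by linarith
  have hy : 0 < x.im := lt_of_lt_of_le (by positivity) hx.im
  have hyK : x.im ≤ K := (Complex.im_le_norm x).trans hx.nm
  rw [I1_eq hφ hK hy]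
  generalize x.im = y at hy hyK
  have hsup : ∀ c e : ℝ, Ph φ (y / (c ^ 2 + e ^ 2)) ≠ 0 → |c| ≤ K ∧ |e| ≤ K := by
    intro c e h
    obtain ⟨h1, -⟩ := Ph_supp hφ h
    have hp : 0 < c ^ 2 + e ^ 2 := by
      by_contra hc
      have : c ^ 2 + e ^ 2 = 0 := le_antisymm (not_lt.1 hc) (by positivity)
      rw [this, div_zero] at h1
      have : 0 < 1 / K := by positivity
      linarith
    rw [div_le_div_iff₀ hK0 hp] at h1
    have h2 : c ^ 2 + e ^ 2 ≤ K ^ 2 := by nlinarith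
    exact ⟨abs_le_of_sq_le_sq (by nlinarith [sq_nonneg e]) hK0.le, abs_le_of_sq_le_sq (by nlinarith [sq_nonneg c]) hK0.le⟩
  set G : ℝ × ℝ → ℝ := fun p => Ph φ (y / (p.1 ^ 2 + p.2 ^ 2)) with hG
  have hGm : Measurable G := (Ph_cont hφ hK).measurable.comp (by fun_prop)
  have hGi : Integrable G := plane_integrable hGm (fun p => Ph_bd hφ hK _) (fun p h => hsup _ _ h)
  set R : ℝ → ℝ := fun c => ∫ e, Ph φ (y / (c ^ 2 + e ^ 2)) with hR
  have hRi : Integrable R := hGi.integral_prod_left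
  have hRb : ∀ c, |R c| ≤ 2 * K * (2 * K * K) := fun c =>
    abs_integral_le_of_supp hK0.le (fun e => Ph_bd hφ hK _) (fun e h => (hsup _ _ h).2)
  have hRi2 : Integrable (fun c => R (c * y)) := hRi.comp_mul_right' hy.ne'
  have hRi3 : Integrable (fun c => psi z c * R (c * y)) := by
    refine hRi2.bdd_mul (c := 1) (psi_cont z).aestronglyMeasurable ?_
    refine Filter.Eventually.of_forall fun c => ?_
    rw [Real.norm_eq_abs, abs_of_nonneg (psi_nonneg _ _)]
    exact psi_le_one _ _
  have hmain : ∫ c, R (c * y) = Real.pi * hypI φ := by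
    rw [Measure.integral_comp_mul_right, smul_eq_mul]
    have h1 : ∫ c, R c = ∫ p, G p := (integral_prod G hGi).symm
    rw [h1, hG, radial (fun u => Ph φ (y / u)), subst_inv hy, abs_of_pos (inv_pos.2 hy)]
    field_simp
  rw [← hmain, ← integral_sub hRi3 hRi2]
  refine (abs_integral_le_of_supp (W := 2 / z) (M := 2 * K * (2 * K * K)) (by positivity) ?_ ?_).trans (le_of_eq (by ring))
  · intro c
    have : psi z c * R (c * y) - R (c * y) = (psi z c - 1) * R (c * y) := by ring
    rw [this, abs_mul]
    have h1 : |psi z c - 1| ≤ 1 := by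
      rw [abs_le]; constructor <;> linarith [psi_nonneg z c, psi_le_one z c]
    calc _ ≤ 1 * |R (c * y)| := by gcongr
      _ ≤ _ := by rw [one_mul]; exact hRb _
  · intro c hc
    by_contra h
    push Not at h
    rw [psi_one hz0 h.le] at hc
    simp at hc

lemma hyp_plane_int {K : ℝ} {φ : ℂ → ℝ} (hφ : Tst K φ) (hK : 1 ≤ K) :
    Integrable (fun p : ℝ × ℝ => (1 / p.2 ^ 2) * φ ⟨p.1, p.2⟩) := by
  have hK0 : 0 < K := by linarith
  have hki : 0 < 1 / K := by positivity
  set G : ℝ × ℝ → ℝ := fun p => (1 / p.2 ^ 2) * φ ⟨p.1, p.2⟩ with hG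
  have hGm : Measurable G :=
    (by fun_prop : Measurable fun p : ℝ × ℝ => 1 / p.2 ^ 2).mul ((hφ.cont hK).comp mk_cont).measurable
  refine plane_integrable (A := K) (M := K ^ 2 * K) hGm ?_ ?_
  · intro p
    by_cases h : φ ⟨p.1, p.2⟩ = 0
    · simp only [hG, h]; simp; positivity
    · obtain ⟨h1, h2, h3⟩ := hφ.re h
      simp only [hG]
      rw [abs_mul]
      gcongr
      · have hp : 0 < p.2 := hki.trans_le h2
        rw [abs_of_pos (by positivity), div_le_iff₀ (by positivity), ← mul_pow]
        rw [div_le_iff₀ hK0] at h2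
        exact one_le_pow₀ (by linarith)
      · exact hφ.abs _
  · intro p hp
    have h := right_ne_zero_of_mul hp
    obtain ⟨h1, h2, h3⟩ := hφ.re h
    exact ⟨h1, by rw [abs_of_pos (hki.trans_le h2)]; exact h3⟩

lemma hyp_int {K : ℝ} {φ : ℂ → ℝ} (hφ : Tst K φ) (hK : 1 ≤ K) :
    Integrable (fun w : ℂ => (1 / w.im ^ 2) * φ w) := by
  rw [← Complex.volume_preserving_equiv_real_prod.symm.integrable_comp_emb (MeasurableEquiv.measurableEmbedding _)]
  exact hyp_plane_int hφ hK

lemma hypI_eq {K : ℝ} {φ : ℂ → ℝ} (hφ : Tst K φ) (hK : 1 ≤ K) :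
    ∫ w in {w : ℂ | 0 < w.im}, (1 / w.im ^ 2) * φ w = hypI φ := by
  have hK0 : 0 < K := by linarith
  have hki : 0 < 1 / K := by positivity
  rw [setIntegral_eq_integral_of_forall_compl_eq_zero]
  · rw [← Complex.volume_preserving_equiv_real_prod.symm.integral_comp' ]
    set G : ℝ × ℝ → ℝ := fun p => (1 / p.2 ^ 2) * φ ⟨p.1, p.2⟩ with hG
    have hGi : Integrable G := hyp_plane_int hφ hK
    have h1 := integral_prod_symm G hGi
    refine Eq.trans h1 ?_
    unfold hypI
    rw [setIntegral_eq_integral_of_forall_compl_eq_zero]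
    · refine integral_congr_ae (Filter.Eventually.of_forall fun v => ?_)
      simp only [hG]
      rw [integral_const_mul, one_div]
      rfl
    · intro v hv
      have : Ph φ v = 0 := by
        by_contra h
        exact hv (hki.trans_le (Ph_supp hφ h).1)
      rw [this, mul_zero]
  · intro w hw
    have : φ w = 0 := by
      by_contra h
      exact hw (hki.trans_le (hφ.supp _ h).1)
    rw [this, mul_zero]

end
end
end Equi

namespace Equi
open scoped BigOperators
open MeasureTheory
noncomputable section
set_option linter.unusedSectionVars false
set_option linter.unusedDecidableInType false
set_option linter.unusedFintypeInType false
section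
variable {d : ℤ}

/-- quadruples ((c,e),(a,b)) -/
abbrev Qd (d : ℤ) := (ℤ√d × ℤ√d) × (ℤ√d × ℤ√d)

def dt (q : Qd d) : ℤ√d := q.2.1 * q.1.2 - q.2.2 * q.1.1
def n1 (q : Qd d) : ℝ := e1 q.2.1 ^ 2 + e1 q.2.2 ^ 2 + e1 q.1.1 ^ 2 + e1 q.1.2 ^ 2
def n2 (q : Qd d) : ℝ := e2 q.2.1 ^ 2 + e2 q.2.2 ^ 2 + e2 q.1.1 ^ 2 + e2 q.1.2 ^ 2
def mq (x : ℂ) (q : Qd d) : ℂ :=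
  ((e1 q.2.1 : ℂ) * x + (e1 q.2.2 : ℝ)) / ((e1 q.1.1 : ℂ) * x + (e1 q.1.2 : ℝ))

open Classical in
def GX (d : ℤ) (X : ℝ) : Finset (Qd d) :=
  ((bx d X X ×ˢ bx d X X) ×ˢ (bx d X X ×ˢ bx d X X)).filter (fun q => dt q = 1 ∧ n1 q + n2 q ≤ X ^ 2)

lemma n1_nonneg (q : Qd d) : 0 ≤ n1 q := by unfold n1; positivity
lemma n2_nonneg (q : Qd d) : 0 ≤ n2 q := by unfold n2; positivity

lemma n1_bds {X : ℝ} (hX : 0 ≤ X) {q : Qd d} (h : n1 q ≤ X ^ 2) :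
    |e1 q.1.1| ≤ X ∧ |e1 q.1.2| ≤ X ∧ |e1 q.2.1| ≤ X ∧ |e1 q.2.2| ≤ X := by
  unfold n1 at h
  have h1 := sq_nonneg (e1 q.1.1)
  have h2 := sq_nonneg (e1 q.1.2)
  have h3 := sq_nonneg (e1 q.2.1)
  have h4 := sq_nonneg (e1 q.2.2)
  refine ⟨?_, ?_, ?_, ?_⟩ <;> exact abs_le_of_sq_le_sq (by linarith) hX

lemma n2_bds {X : ℝ} (hX : 0 ≤ X) {q : Qd d} (h : n2 q ≤ X ^ 2) :
    |e2 q.1.1| ≤ X ∧ |e2 q.1.2| ≤ X ∧ |e2 q.2.1| ≤ X ∧ |e2 q.2.2| ≤ X := by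
  unfold n2 at h
  have h1 := sq_nonneg (e2 q.1.1)
  have h2 := sq_nonneg (e2 q.1.2)
  have h3 := sq_nonneg (e2 q.2.1)
  have h4 := sq_nonneg (e2 q.2.2)
  refine ⟨?_, ?_, ?_, ?_⟩ <;> exact abs_le_of_sq_le_sq (by linarith) hX

lemma mem_GX (hd : 0 < d) {X : ℝ} (hX : 0 ≤ X) {q : Qd d} :
    q ∈ GX d X ↔ dt q = 1 ∧ n1 q + n2 q ≤ X ^ 2 := by
  unfold GX
  rw [Finset.mem_filter]
  constructor
  · exact fun h => h.2
  · intro h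
    refine ⟨?_, h⟩
    have := n1_bds (q := q) hX (by linarith [n2_nonneg q])
    have := n2_bds (q := q) hX (by linarith [n1_nonneg q])
    simp only [Finset.mem_product, mem_bx hd]
    tauto

lemma det1 (hd : 0 < d) {q : Qd d} (h : dt q = 1) : e1 q.2.1 * e1 q.1.2 - e1 q.2.2 * e1 q.1.1 = 1 := by
  have := congrArg e1 h
  unfold dt at this
  rwa [e1_sub, e1_mul hd, e1_mul hd, e1_one] at this

lemma det2 (hd : 0 < d) {q : Qd d} (h : dt q = 1) : e2 q.2.1 * e2 q.1.2 - e2 q.2.2 * e2 q.1.1 = 1 := by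
  have := congrArg e2 h
  unfold dt at this
  rwa [e2_sub, e2_mul hd, e2_mul hd, e2_one] at this

lemma pp_mq (hd : 0 < d) {q : Qd d} (h : dt q = 1) {x : ℂ} (hx : 0 < x.im) (hc : e1 q.1.1 ≠ 0) :
    pp x (e1 q.2.1) (e1 q.1.2) (e1 q.1.1) = mq x q := by
  unfold pp mq
  rw [mob_form hx hc]
  have : (e1 q.2.1 * e1 q.1.2 - 1) / e1 q.1.1 = e1 q.2.2 := by
    rw [div_eq_iff hc]; linarith [det1 hd h]
  rw [this]

lemma mq_bounds (hd : 0 < d) {K : ℝ} {x : ℂ} {φ : ℂ → ℝ} (hφ : Tst K φ) (hK : 1 ≤ K) (hx : Pt K x)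
    {q : Qd d} (h : dt q = 1) (hq : φ (mq x q) ≠ 0) :
    |e1 q.1.1| ≤ 2 * K ^ 4 ∧ |e1 q.1.2| ≤ 2 * K ^ 4 ∧ |e1 q.2.1| ≤ 2 * K ^ 4 ∧ |e1 q.2.2| ≤ 2 * K ^ 4 := by
  have := mob_bounds hK hx (det1 hd h) (p := mq x q) rfl (hφ.supp _ hq).1 (hφ.supp _ hq).2
  tauto

/-- the real inequality comparing b with ae/c. -/
lemma b_cmp {b t X z : ℝ} (hX : 1 ≤ X) (hz : 1 ≤ z) (hzX : z ≤ X) (hb : |b| ≤ X) (ht : |t| ≤ z / X) :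
    (b + t) ^ 2 ≤ b ^ 2 + 3 * z := by
  have hX0 : 0 < X := by linarith
  have h1 : |b| * |t| ≤ z := by
    calc |b| * |t| ≤ X * (z / X) := by gcongr
      _ = z := by field_simp
  have h2 : |t| ≤ 1 := ht.trans ((div_le_one hX0).2 hzX)
  have h3 : t ^ 2 ≤ 1 := by
    rw [← sq_abs]; exact pow_le_one₀ (abs_nonneg _) h2
  have h4 : b * t ≤ z := (le_abs_self _).trans (by rw [abs_mul]; exact h1)
  linarith [show (b + t) ^ 2 = b ^ 2 + 2 * (b * t) + t ^ 2 by ring]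

lemma QQ_scale {a e c X : ℝ} (hX : 0 < X) (hc : c ≠ 0) :
    QQ (a / X) (e / X) (c / X) = (a ^ 2 + e ^ 2 + c ^ 2 + (a * e / c) ^ 2) / X ^ 2 := by
  rw [QQ_eq (by positivity)]
  field_simp

/-- the triple sum. -/
def TS (d : ℤ) (F1 F2 : ℝ → ℝ → ℝ → ℝ) (z X : ℝ) : ℝ :=
  ∑ c ∈ Bz d z X, ∑ v ∈ Bz d z X ×ˢ Bz d z X, FF F1 F2 X v.1 v.2 c * wc c v

lemma TS_eq (F1 F2 : ℝ → ℝ → ℝ → ℝ) (z X : ℝ) :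
    TS d F1 F2 z X = ∑ t ∈ Bz d z X ×ˢ (Bz d z X ×ˢ Bz d z X), FF F1 F2 X t.2.1 t.2.2 t.1 * wc t.1 t.2 := by
  unfold TS; rw [Finset.sum_product]

open Classical in
def badS (d : ℤ) (φ : ℂ → ℝ) (x : ℂ) (z X : ℝ) : Finset (Qd d) :=
  (GX d X).filter (fun q => φ (mq x q) ≠ 0 ∧ (|e1 q.1.1| ≤ 2 / z ∨ |e2 q.1.1| ≤ 2 / z * X))

open Classical in
def goodS (d : ℤ) (φ : ℂ → ℝ) (x : ℂ) (z X : ℝ) : Finset (Qd d) :=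
  (GX d X).filter (fun q => φ (mq x q) ≠ 0 ∧ ¬ (|e1 q.1.1| ≤ 2 / z ∨ |e2 q.1.1| ≤ 2 / z * X))

lemma sum_split (φ : ℂ → ℝ) (x : ℂ) (z X : ℝ) :
    ∑ q ∈ GX d X, φ (mq x q) = ∑ q ∈ goodS d φ x z X, φ (mq x q) + ∑ q ∈ badS d φ x z X, φ (mq x q) := by
  classical
  rw [← Finset.sum_filter_ne_zero, ← Finset.sum_filter_not_add_sum_filter _ (fun q => |e1 q.1.1| ≤ 2 / z ∨ |e2 q.1.1| ≤ 2 / z * X)]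
  unfold goodS badS
  rw [Finset.filter_filter, Finset.filter_filter]


lemma FF_nonneg {F1 F2 : ℝ → ℝ → ℝ → ℝ} (h1 : ∀ a e c, 0 ≤ F1 a e c) (h2 : ∀ a e c, 0 ≤ F2 a e c)
    {X : ℝ} (a e c : ℤ√d) : 0 ≤ FF F1 F2 X a e c := mul_nonneg (h1 _ _ _) (h2 _ _ _)
lemma wc_nonneg (c : ℤ√d) (v : ℤ√d × ℤ√d) : 0 ≤ wc c v := by unfold wc; split_ifs <;> norm_num
lemma F1_nonneg {K : ℝ} {φ : ℂ → ℝ} (hφ : Tst K φ) (x : ℂ) (z a e c : ℝ) : 0 ≤ F1 φ x z a e c :=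
  mul_nonneg (hφ.nn _) (psi_nonneg _ _)
lemma F2_nonneg (T z a e c : ℝ) : 0 ≤ F2 T z a e c := mul_nonneg (cl_nonneg _) (psi_nonneg _ _)

lemma det_c {c a b e b' : ℤ√d} (hn : ¬ IsSquare d) (hc : c ≠ 0) (h : a * e - b * c = 1)
    (h' : a * e - b' * c = 1) : b = b' := by
  have : c * b = c * b' := by linear_combination h' - h
  exact mul_cancel hn hc this

lemma good_le (hd : 0 < d) (hn : ¬ IsSquare d) {K z X : ℝ} {x : ℂ} {φ : ℂ → ℝ} (hφ : Tst K φ) (hK : 1 ≤ K)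
    (hx : Pt K x) (hz : 7 * K ^ 5 ≤ z) (hX : 3 * z ^ 2 ≤ X ^ 2) (hzX : z ≤ X) :
    ∑ q ∈ goodS d φ x z X, φ (mq x q) ≤ TS d (F1 φ x z) (F2 (1 + 2 / z) z) z X := by
  classical
  have hK5 : 1 ≤ K ^ 5 := one_le_pow₀ hK
  have hK4 : K ^ 4 ≤ K ^ 5 := pow_le_pow_right₀ hK (by norm_num)
  have hz1 : 1 ≤ z := by linarith
  have hz0 : 0 < z := by linarith
  have hX1 : 1 ≤ X := by linarith
  have hX0 : 0 < X := by linarith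
  have hxi : 0 < x.im := lt_of_lt_of_le (by positivity) hx.im
  rw [TS_eq]
  set f : ℤ√d × (ℤ√d × ℤ√d) → ℝ := fun t => FF (F1 φ x z) (F2 (1 + 2 / z) z) X t.2.1 t.2.2 t.1 * wc t.1 t.2 with hf
  set π : Qd d → ℤ√d × (ℤ√d × ℤ√d) := fun q => (q.1.1, (q.2.1, q.1.2)) with hπ
  have h0 : ∀ t, 0 ≤ f t := fun t => mul_nonneg (FF_nonneg (F1_nonneg hφ x z) (F2_nonneg _ z) _ _ _) (wc_nonneg _ _)
  have hfact : ∀ q ∈ goodS d φ x z X, dt q = 1 ∧ n1 q + n2 q ≤ X ^ 2 ∧ φ (mq x q) ≠ 0 ∧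
      2 / z < |e1 q.1.1| ∧ 2 / z * X < |e2 q.1.1| := by
    intro q hq
    unfold goodS at hq
    rw [Finset.mem_filter, mem_GX hd hX0.le] at hq
    push Not at hq
    tauto
  have hz2 : 0 < 2 / z := by positivity
  have hc0 : ∀ q ∈ goodS d φ x z X, q.1.1 ≠ 0 := by
    intro q hq h
    have := (hfact q hq).2.2.2.1
    rw [h] at this
    simp at this
    linarith
  have hinj : Set.InjOn π (goodS d φ x z X : Set (Qd d)) := by
    rintro ⟨⟨c, e⟩, ⟨a, b⟩⟩ hq ⟨⟨c', e'⟩, ⟨a', b'⟩⟩ hq' h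
    simp only [hπ, Prod.mk.injEq] at h
    obtain ⟨rfl, rfl, rfl⟩ := h
    have := det_c hn (hc0 _ hq) (hfact _ hq).1 (hfact _ hq').1
    simp only [Prod.mk.injEq, true_and]
    exact this
  have hle : ∀ q ∈ goodS d φ x z X, φ (mq x q) ≤ f (π q) := by
    intro q hq
    obtain ⟨h1, h2, h3, h4, h5⟩ := hfact q hq
    have hc1 : e1 q.1.1 ≠ 0 := abs_pos.1 (hz2.trans h4)
    have hc2 : e2 q.1.1 ≠ 0 := abs_pos.1 (lt_trans (by positivity) h5)
    have hw : wc q.1.1 (q.2.1, q.1.2) = 1 := by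
      unfold wc
      rw [if_pos]
      exact ⟨q.2.2, by unfold dt at h1; linear_combination h1⟩
    have hF1 : F1 φ x z (e1 q.2.1) (e1 q.1.2) (e1 q.1.1) = φ (mq x q) := by
      unfold F1
      rw [psi_one hz0 h4.le, mul_one, pp_mq hd h1 hxi hc1]
    have hF2 : F2 (1 + 2 / z) z (e2 q.2.1 / X) (e2 q.1.2 / X) (e2 q.1.1 / X) = 1 := by
      unfold F2
      rw [psi_one hz0 (by rw [abs_div, abs_of_pos hX0, le_div_iff₀ hX0]; exact h5.le), mul_one]
      apply cl_one
      have hq2 : n2 q ≤ X ^ 2 := by linarith [n1_nonneg q]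
      have hb := (n2_bds hX0.le hq2).2.2.2
      have hdt := det2 hd h1
      have hbt : e2 q.2.1 * e2 q.1.2 / e2 q.1.1 = e2 q.2.2 + (e2 q.1.1)⁻¹ := by
        field_simp; linarith
      have ht : |(e2 q.1.1)⁻¹| ≤ z / X := by
        rw [abs_inv]
        have h6 : X / z ≤ |e2 q.1.1| := by
          refine le_trans ?_ h5.le
          rw [div_mul_eq_mul_div]
          gcongr; linarith
        have := inv_anti₀ (by positivity) h6
        rwa [inv_div] at this
      have hcmp := b_cmp hX1 hz1 hzX hb ht
      rw [← hbt] at hcmp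
      have hQ : QQ (e2 q.2.1 / X) (e2 q.1.2 / X) (e2 q.1.1 / X) ≤ 1 + 1 / z := by
        rw [QQ_scale hX0 hc2, div_le_iff₀ (by positivity)]
        have : 3 * z ≤ 1 / z * X ^ 2 := by
          rw [div_mul_eq_mul_div, le_div_iff₀ hz0]; linarith
        unfold n2 at hq2
        linarith
      calc 1 = (1 / z) * z := by field_simp
        _ ≤ _ := by
          gcongr
          have : 2 / z = 1 / z + 1 / z := by ring
          linarith
    simp only [hf, hπ, FF]
    rw [hw, hF1, hF2, mul_one, mul_one]
  calc ∑ q ∈ goodS d φ x z X, φ (mq x q) ≤ ∑ q ∈ goodS d φ x z X, f (π q) := Finset.sum_le_sum hle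
    _ = ∑ t ∈ (goodS d φ x z X).image π, f t := (Finset.sum_image hinj).symm
    _ ≤ _ := by
      refine Finset.sum_le_sum_of_subset_of_nonneg ?_ (fun t _ _ => h0 t)
      intro t ht
      rw [Finset.mem_image] at ht
      obtain ⟨q, hq, rfl⟩ := ht
      obtain ⟨h1, h2, h3, h4, h5⟩ := hfact q hq
      obtain ⟨u1, u2, u3, u4⟩ := mq_bounds hd hφ hK hx h1 h3
      obtain ⟨v1, v2, v3, v4⟩ := n2_bds (q := q) hX0.le (by linarith [n1_nonneg q])
      have hzz : X ≤ z * X := by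
        calc X = 1 * X := by ring
          _ ≤ _ := by gcongr
      simp only [hπ, Finset.mem_product]
      refine ⟨in_box0 hd hz1 hX0 ⟨?_, ?_⟩, in_box0 hd hz1 hX0 ⟨?_, ?_⟩, in_box0 hd hz1 hX0 ⟨?_, ?_⟩⟩ <;> linarith

lemma lower (hd : 0 < d) {K z X : ℝ} {x : ℂ} {φ : ℂ → ℝ} (hφ : Tst K φ) (hK : 1 ≤ K)
    (hx : Pt K x) (hz : 16 * K ^ 8 ≤ z) (hX : 3 * z ^ 2 ≤ X ^ 2) (hzX : z ≤ X) :
    TS d (F1 φ x z) (F2 (1 - 2 / z) z) z X ≤ ∑ q ∈ GX d X, φ (mq x q) := by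
  classical
  have hK8 : 1 ≤ K ^ 8 := one_le_pow₀ hK
  have hz1 : 1 ≤ z := by linarith
  have hz0 : 0 < z := by linarith
  have hX1 : 1 ≤ X := by linarith
  have hX0 : 0 < X := by linarith
  have hxi : 0 < x.im := lt_of_lt_of_le (by positivity) hx.im
  rw [TS_eq]
  set f : ℤ√d × (ℤ√d × ℤ√d) → ℝ := fun t => FF (F1 φ x z) (F2 (1 - 2 / z) z) X t.2.1 t.2.2 t.1 * wc t.1 t.2 with hf
  rw [← Finset.sum_filter_ne_zero]
  set P := (Bz d z X ×ˢ (Bz d z X ×ˢ Bz d z X)).filter (fun t => f t ≠ 0) with hP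
  have hb : ∀ t : ℤ√d × (ℤ√d × ℤ√d), ∃ b : ℤ√d, wc t.1 t.2 ≠ 0 → t.2.1 * t.2.2 - b * t.1 = 1 := by
    intro t
    by_cases h : t.1 ∣ t.2.1 * t.2.2 - 1
    · obtain ⟨b, hb⟩ := h
      exact ⟨b, fun _ => by linear_combination hb⟩
    · refine ⟨0, fun h' => absurd ?_ h'⟩
      unfold wc; rw [if_neg h]
  choose b hb using hb
  set ι : ℤ√d × (ℤ√d × ℤ√d) → Qd d := fun t => ((t.1, t.2.2), (t.2.1, b t)) with hι
  have hinj : Set.InjOn ι (P : Set (ℤ√d × (ℤ√d × ℤ√d))) := by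
    rintro ⟨c, a, e⟩ _ ⟨c', a', e'⟩ _ h
    simp only [hι, Prod.mk.injEq] at h
    simp only [Prod.mk.injEq]
    tauto
  have hfact : ∀ t ∈ P, f t ≤ φ (mq x (ι t)) ∧ ι t ∈ GX d X := by
    intro t ht
    have hft : f t ≠ 0 := (Finset.mem_filter.1 ht).2
    have hw0 : wc t.1 t.2 ≠ 0 := right_ne_zero_of_mul hft
    have hFF := left_ne_zero_of_mul hft
    have hdet : dt (ι t) = 1 := hb t hw0
    have hw1 : wc t.1 t.2 = 1 := by
      unfold wc at hw0 ⊢; split_ifs at hw0 ⊢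
      · rfl
      · exact absurd rfl hw0
    have hF1 : F1 φ x z (e1 t.2.1) (e1 t.2.2) (e1 t.1) ≠ 0 := left_ne_zero_of_mul hFF
    have hF2 : F2 (1 - 2 / z) z (e2 t.2.1 / X) (e2 t.2.2 / X) (e2 t.1 / X) ≠ 0 := right_ne_zero_of_mul hFF
    have hc1 := psi_pos hz0 (right_ne_zero_of_mul hF1)
    have hc2 := psi_pos hz0 (right_ne_zero_of_mul hF2)
    have hzi : 0 < 1 / z := by positivity
    have hc10 : e1 t.1 ≠ 0 := abs_pos.1 (hzi.trans_le hc1)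
    have hppm : pp x (e1 t.2.1) (e1 t.2.2) (e1 t.1) = mq x (ι t) := pp_mq hd hdet hxi hc10
    have hφ0 : φ (mq x (ι t)) ≠ 0 := by rw [← hppm]; exact left_ne_zero_of_mul hF1
    constructor
    · simp only [hf, hw1, mul_one, FF, F1]
      rw [hppm]
      have hF2le : F2 (1 - 2 / z) z (e2 t.2.1 / X) (e2 t.2.2 / X) (e2 t.1 / X) ≤ 1 := by
        unfold F2
        exact mul_le_one₀ (cl_le_one _) (psi_nonneg _ _) (psi_le_one _ _)
      have h1 := hφ.nn (mq x (ι t))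
      have h2 := psi_le_one z (e1 t.1)
      have h3 := psi_nonneg z (e1 t.1)
      calc _ ≤ φ (mq x (ι t)) * 1 * 1 := by
            gcongr
            exact F2_nonneg _ _ _ _ _
        _ = _ := by ring
    · rw [mem_GX hd hX0.le]
      refine ⟨hdet, ?_⟩
      obtain ⟨u1, u2, u3, u4⟩ := mq_bounds hd hφ hK hx hdet hφ0
      have hn1 : n1 (ι t) ≤ z := by
        have sqb : ∀ r : ℝ, |r| ≤ 2 * K ^ 4 → r ^ 2 ≤ 4 * K ^ 8 := by
          intro r hr
          calc r ^ 2 = |r| ^ 2 := (sq_abs r).symm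
            _ ≤ (2 * K ^ 4) ^ 2 := by gcongr
            _ = _ := by ring
        have := sqb _ u1
        have := sqb _ u2
        have := sqb _ u3
        have := sqb _ u4
        unfold n1; linarith
      rw [abs_div, abs_of_pos hX0, le_div_iff₀ hX0] at hc2
      have hc20 : e2 t.1 ≠ 0 := abs_pos.1 (lt_of_lt_of_le (by positivity) hc2)
      have hQ := pos_of_mul_pos_left (cl_pos (left_ne_zero_of_mul hF2)) hz0.le
      rw [sub_pos, QQ_scale hX0 hc20, div_lt_iff₀ (by positivity)] at hQ
      have hdt : e2 t.2.1 * e2 t.2.2 - e2 (b t) * e2 t.1 = 1 := det2 hd hdet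
      set B := e2 t.2.1 * e2 t.2.2 / e2 t.1 with hB
      have hbt : e2 (b t) = B + (-(e2 t.1)⁻¹) := by
        rw [hB]; field_simp; linarith
      have ht : |(-(e2 t.1)⁻¹)| ≤ z / X := by
        rw [abs_neg, abs_inv]
        have h6 : X / z ≤ |e2 t.1| := by
          refine le_trans (le_of_eq ?_) hc2
          ring
        have := inv_anti₀ (by positivity) h6
        rwa [inv_div] at this
      have q1 := sq_nonneg (e2 t.2.1)
      have q2 := sq_nonneg (e2 t.2.2)
      have q3 := sq_nonneg (e2 t.1)
      have hXz : 0 ≤ 2 / z * X ^ 2 := by positivity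
      have hBX : |B| ≤ X := abs_le_of_sq_le_sq (by linarith) hX0.le
      have hcmp := b_cmp hX1 hz1 hzX hBX ht
      rw [← hbt] at hcmp
      have hn2 : n2 (ι t) = e2 t.2.1 ^ 2 + e2 (b t) ^ 2 + e2 t.1 ^ 2 + e2 t.2.2 ^ 2 := rfl
      have : 6 * z ≤ 2 / z * X ^ 2 := by
        rw [div_mul_eq_mul_div, le_div_iff₀ hz0]; linarith
      linarith
  calc ∑ t ∈ P, f t ≤ ∑ t ∈ P, φ (mq x (ι t)) := Finset.sum_le_sum fun t ht => (hfact t ht).1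
    _ = ∑ q ∈ P.image ι, φ (mq x q) := (Finset.sum_image (f := fun q => φ (mq x q)) hinj).symm
    _ ≤ _ := by
      refine Finset.sum_le_sum_of_subset_of_nonneg ?_ (fun q _ _ => hφ.nn _)
      intro q hq
      obtain ⟨t, ht, rfl⟩ := Finset.mem_image.1 hq
      exact (hfact t ht).2

lemma bad_le (hd : 0 < d) (hn : ¬ IsSquare d) {K : ℝ} (hK : 1 ≤ K) : ∃ C : ℝ, 1 ≤ C ∧ ∀ (z X : ℝ) (x : ℂ) (φ : ℂ → ℝ),
    Tst K φ → Pt K x → 1 ≤ z → 1 ≤ X →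
    ∑ q ∈ badS d φ x z X, φ (mq x q) ≤ C * ((1 + 2 / z * X) * X * (1 + Real.log X)) := by
  have hK0 : 0 < K := by linarith
  have hK4 : 1 ≤ K ^ 4 := one_le_pow₀ hK
  obtain ⟨C, hC, h⟩ := bad_count hd hn (2 * K ^ 4) (by linarith)
  refine ⟨K * C, by nlinarith, ?_⟩
  intro z X x φ hφ hx hz hX
  have hX0 : 0 < X := by linarith
  have hcard := h X (2 / z) (badS d φ x z X) hX (by positivity) ?_
  · calc ∑ q ∈ badS d φ x z X, φ (mq x q) ≤ ∑ q ∈ badS d φ x z X, K := Finset.sum_le_sum fun q _ => hφ.bd _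
      _ = (badS d φ x z X).card * K := by rw [Finset.sum_const, nsmul_eq_mul]
      _ ≤ (C * ((1 + 2 / z * X) * X * (1 + Real.log X))) * K := by gcongr
      _ = _ := by ring
  · intro q hq
    unfold badS at hq
    rw [Finset.mem_filter, mem_GX hd hX0.le] at hq
    obtain ⟨⟨h1, h2⟩, h3, h4⟩ := hq
    have hzz : X ≤ 2 * K ^ 4 * X := by
      calc X = 1 * X := by ring
        _ ≤ _ := by gcongr; linarith
    obtain ⟨v1, v2, v3, v4⟩ := n2_bds (q := q) hX0.le (by linarith [n1_nonneg q])
    exact ⟨h1, mq_bounds hd hφ hK hx h1 h3, ⟨v1.trans hzz, v2.trans hzz, v3.trans hzz, v4.trans hzz⟩, h4⟩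

end
end
end Equi

namespace Equi
open scoped BigOperators
open MeasureTheory
noncomputable section
set_option linter.unusedSectionVars false
set_option linter.unusedDecidableInType false
set_option linter.unusedFintypeInType false
section
variable {d : ℤ}

lemma hypI_bd {K : ℝ} {φ : ℂ → ℝ} (hφ : Tst K φ) (hK : 1 ≤ K) : |hypI φ| ≤ 4 * K ^ 5 := by
  have hK0 : 0 < K := by linarith
  have hki : 0 < 1 / K := by positivity
  unfold hypI
  rw [setIntegral_eq_integral_of_forall_compl_eq_zero]
  · refine (abs_integral_le_of_supp (W := K) (M := K ^ 2 * (2 * K * K)) hK0.le ?_ ?_).trans (le_of_eq (by ring))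
    · intro v
      by_cases h : Ph φ v = 0
      · rw [h, mul_zero, abs_zero]; positivity
      · have h1 := (Ph_supp hφ h).1
        have hv : 0 < v := hki.trans_le h1
        rw [abs_mul]
        gcongr
        · rw [abs_of_pos (by positivity), ← inv_pow]
          gcongr
          have := inv_anti₀ hki h1
          simpa using this
        · exact Ph_bd hφ hK v
    · intro v hv
      obtain ⟨h1, h2⟩ := Ph_supp hφ (right_ne_zero_of_mul hv)
      rw [abs_of_pos (hki.trans_le h1)]; exact h2
  · intro v hv
    have : Ph φ v = 0 := by
      by_contra h
      exact hv (hki.trans_le (Ph_supp hφ h).1)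
    rw [this, mul_zero]

def c0 (d : ℤ) : ℝ := kap d / (2 * Real.sqrt d) ^ 3 * Real.pi ^ 3

lemma c0_pos (hd : 0 < d) : 0 < c0 d := by
  have h1 := kap_pos d
  have h2 := sqrt_ge_one hd
  have h3 := Real.pi_pos
  unfold c0; positivity

lemma prod_close {a a0 b b0 A B ea eb ζ : ℝ} (hA : |a0| ≤ A) (hB : |b0| ≤ B) (h0 : 0 ≤ ζ) (h1 : ζ ≤ 1)
    (ha : |a - a0| ≤ ea * ζ) (hb : |b - b0| ≤ eb * ζ) (hea : 0 ≤ ea) (heb : 0 ≤ eb) :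
    |a * b - a0 * b0| ≤ (ea * (B + eb) + A * eb) * ζ := by
  have hb' : |b| ≤ B + eb := by
    have : b = (b - b0) + b0 := by ring
    rw [this]
    refine (abs_add_le _ _).trans ?_
    have : eb * ζ ≤ eb * 1 := by gcongr
    linarith
  have : a * b - a0 * b0 = (a - a0) * b + a0 * (b - b0) := by ring
  rw [this]
  refine (abs_add_le _ _).trans ?_
  rw [abs_mul, abs_mul]
  calc |a - a0| * |b| + |a0| * |b - b0| ≤ (ea * ζ) * (B + eb) + A * (eb * ζ) := by
        gcongr
        exact (abs_nonneg _).trans hA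
    _ = _ := by ring

lemma TS_close (hd : 0 < d) (hn : ¬ IsSquare d) {K : ℝ} (hK : 1 ≤ K) : ∃ C z0 : ℝ, 1 ≤ C ∧ 100 ≤ z0 ∧
    ∀ (T z X : ℝ) (x : ℂ) (φ : ℂ → ℝ), Tst K φ → Pt K x → z0 ≤ z → X = z ^ 6000 →
    |T - 1| ≤ 2 / z →
    |TS d (F1 φ x z) (F2 T z) z X - c0 d * hypI φ * X ^ 2| ≤ C * Real.sqrt (1 / z) * X ^ 2 := by
  obtain ⟨z1, hz1, hB⟩ := theoremB hd hn
  obtain ⟨C2, hC2, hI2⟩ := I2_close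
  have hk := kap_pos d
  have hsd := sqrt_ge_one hd
  have hpi := Real.pi_pos
  have hK0 : 0 < K := by linarith
  set k := kap d / (2 * Real.sqrt d) ^ 3 with hkdef
  have hk0 : 0 < k := by rw [hkdef]; positivity
  set E := 16 * K ^ 3 * (Real.pi ^ 2 + (C2 + 2 * Real.pi ^ 2)) + Real.pi * (4 * K ^ 5) * (C2 + 2 * Real.pi ^ 2) with hE
  have hE0 : 0 ≤ E := by positivity
  refine ⟨1 + k * E, max (max z1 (7 * K ^ 5)) 100, by nlinarith, le_max_right _ _, ?_⟩
  intro T z X x φ hφ hx hz hX hT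
  have hza : z1 ≤ z := (le_max_left _ _).trans ((le_max_left _ _).trans hz)
  have hzb : 7 * K ^ 5 ≤ z := (le_max_right _ _).trans ((le_max_left _ _).trans hz)
  have hzc : 100 ≤ z := (le_max_right _ _).trans hz
  have hz0 : 0 < z := by linarith
  have h1z : 1 ≤ z := by linarith
  have hiz : 1 / z ≤ 1 / 100 := by gcongr
  have h2z : 2 / z = 2 * (1 / z) := by ring
  have hiz0 : 0 < 1 / z := by positivity
  set ζ := Real.sqrt (1 / z) with hζ
  have hζ0 : 0 ≤ ζ := Real.sqrt_nonneg _
  have hζ2 : ζ ^ 2 = 1 / z := Real.sq_sqrt hiz0.le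
  have hζ1 : ζ ≤ 1 := by
    refine le_of_sq_le_sq ?_ zero_le_one
    rw [hζ2]; linarith
  have hzζ : 1 / z ≤ ζ := by rw [← hζ2]; nlinarith
  have hT2 := abs_le.1 hT
  have hT3 : T ≤ 2 := by linarith [hT2.2]
  have hT4 : 1 / z ≤ T := by linarith [hT2.1]
  have hmain := hB z X hza hX _ _ (F1_adm hφ hK hx hzb) (F2_adm hT3 hzc)
  have h1 : |I3 (dvc (F1 φ x z)) - Real.pi * hypI φ| ≤ 16 * K ^ 3 * ζ :=
    (I1_close hφ hK hx h1z).trans (by gcongr)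
  have h2 : |I3 (dvc (F2 T z)) - Real.pi ^ 2| ≤ (C2 + 2 * Real.pi ^ 2) * ζ := by
    have h3 := hI2 T z h1z hT4 hT3
    have h4 : |Real.pi ^ 2 * T - Real.pi ^ 2| ≤ 2 * Real.pi ^ 2 * ζ := by
      rw [← mul_sub_one, abs_mul, abs_of_nonneg (sq_nonneg _)]
      calc Real.pi ^ 2 * |T - 1| ≤ Real.pi ^ 2 * (2 * ζ) := by gcongr; linarith
        _ = _ := by ring
    have := abs_sub_le (I3 (dvc (F2 T z))) (Real.pi ^ 2 * T) (Real.pi ^ 2)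
    linarith
  have h3 : |Real.pi * hypI φ| ≤ Real.pi * (4 * K ^ 5) := by
    rw [abs_mul, abs_of_pos hpi]; gcongr; exact hypI_bd hφ hK
  have h4 := prod_close h3 (le_of_eq (abs_of_nonneg (sq_nonneg Real.pi))) hζ0 hζ1 h1 h2 (by positivity) (by positivity)
  rw [← hE] at h4
  generalize I3 (dvc (F1 φ x z)) = J1 at *
  generalize I3 (dvc (F2 T z)) = J2 at *
  have h5 : |k * (J1 * J2) * X ^ 2 - c0 d * hypI φ * X ^ 2| ≤ k * E * ζ * X ^ 2 := by
    have : k * (J1 * J2) * X ^ 2 - c0 d * hypI φ * X ^ 2 = k * (J1 * J2 - Real.pi * hypI φ * Real.pi ^ 2) * X ^ 2 := by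
      unfold c0; rw [← hkdef]; ring
    rw [this, abs_mul, abs_mul, abs_of_pos hk0, abs_of_nonneg (sq_nonneg X)]
    calc k * |J1 * J2 - Real.pi * hypI φ * Real.pi ^ 2| * X ^ 2 ≤ k * (E * ζ) * X ^ 2 := by gcongr
      _ = _ := by ring
  have h6 : X ^ 2 / z ^ 4 ≤ ζ * X ^ 2 := by
    rw [div_eq_mul_one_div, mul_comm]
    gcongr
    refine le_trans ?_ hzζ
    gcongr
    exact le_self_pow₀ h1z (by norm_num)
  have h7 := abs_sub_le (TS d (F1 φ x z) (F2 T z) z X) (k * (J1 * J2) * X ^ 2) (c0 d * hypI φ * X ^ 2)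
  have h8 : |TS d (F1 φ x z) (F2 T z) z X - k * (J1 * J2) * X ^ 2| ≤ X ^ 2 / z ^ 4 := hmain
  calc _ ≤ X ^ 2 / z ^ 4 + k * E * ζ * X ^ 2 := h7.trans (add_le_add h8 h5)
    _ ≤ ζ * X ^ 2 + k * E * ζ * X ^ 2 := by gcongr
    _ = _ := by ring

lemma core (hd : 0 < d) (hn : ¬ IsSquare d) {K : ℝ} (hK : 1 ≤ K) : ∃ C z0 : ℝ, 1 ≤ C ∧ 100 ≤ z0 ∧
    ∀ (z X : ℝ) (x : ℂ) (φ : ℂ → ℝ), Tst K φ → Pt K x → z0 ≤ z → X = z ^ 6000 →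
    |∑ q ∈ GX d X, φ (mq x q) - c0 d * hypI φ * X ^ 2| ≤ C * Real.sqrt (1 / z) * X ^ 2 := by
  obtain ⟨C1, z1, hC1, hz1, hT⟩ := TS_close hd hn hK
  obtain ⟨C2, hC2, hbad⟩ := bad_le hd hn hK
  have hK8 : 1 ≤ K ^ 8 := one_le_pow₀ hK
  have hK58 : K ^ 5 ≤ K ^ 8 := pow_le_pow_right₀ hK (by norm_num)
  refine ⟨C1 + C2 * 36003, max z1 (16 * K ^ 8), by linarith, hz1.trans (le_max_left _ _), ?_⟩
  intro z X x φ hφ hx hz hX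
  have hza : z1 ≤ z := (le_max_left _ _).trans hz
  have hzb : 16 * K ^ 8 ≤ z := (le_max_right _ _).trans hz
  have hz100 : 100 ≤ z := hz1.trans hza
  have hz0 : 0 < z := by linarith
  have h1z : 1 ≤ z := by linarith
  have hzX2 : z ^ 2 ≤ X := by rw [hX]; exact pow_le_pow_right₀ h1z (by norm_num)
  have hzX : z ≤ X := (le_self_pow₀ h1z (by norm_num)).trans hzX2
  have hX1 : 1 ≤ X := h1z.trans hzX
  have hX0 : 0 < X := by linarith
  have hXX : 3 * z ^ 2 ≤ X ^ 2 := by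
    calc 3 * z ^ 2 ≤ X * X := by gcongr; linarith
      _ = _ := by ring
  have hup := good_le hd hn hφ hK hx (by linarith) hXX hzX
  have hlo := lower hd hφ hK hx hzb hXX hzX
  have hb := hbad z X x φ hφ hx h1z hX1
  have hs := sum_split (d := d) φ x z X
  have ht1 := abs_le.1 (hT (1 + 2 / z) z X x φ hφ hx hza hX (by
    rw [add_sub_cancel_left, abs_of_pos (by positivity)]))
  have ht2 := abs_le.1 (hT (1 - 2 / z) z X x φ hφ hx hza hX (by
    rw [sub_sub_cancel_left, abs_neg, abs_of_pos (by positivity)]))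
  have hsz : 0 < Real.sqrt z := Real.sqrt_pos.2 hz0
  have hszs : Real.sqrt z ^ 2 = z := Real.sq_sqrt hz0.le
  have hζe : Real.sqrt (1 / z) = 1 / Real.sqrt z := by
    rw [Real.sqrt_div zero_le_one, Real.sqrt_one]
  have hs1 : 1 ≤ Real.sqrt z := by
    rw [Real.one_le_sqrt]; exact h1z
  have hlog : 1 + Real.log X ≤ 12001 * Real.sqrt z := by
    rw [hX, Real.log_pow]
    have h1 : Real.log z = 2 * Real.log (Real.sqrt z) := by
      rw [Real.log_sqrt hz0.le]; ring
    have h2 := Real.log_le_sub_one_of_pos hsz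
    rw [h1]; push_cast; linarith
  have hbb : C2 * ((1 + 2 / z * X) * X * (1 + Real.log X)) ≤ C2 * 36003 * Real.sqrt (1 / z) * X ^ 2 := by
    have h1 : 1 + 2 / z * X ≤ 3 * (X / z) := by
      have : 1 ≤ X / z := by rw [one_le_div hz0]; exact hzX
      have : 2 / z * X = 2 * (X / z) := by ring
      linarith
    calc C2 * ((1 + 2 / z * X) * X * (1 + Real.log X)) ≤ C2 * ((3 * (X / z)) * X * (12001 * Real.sqrt z)) := by
          have := Real.log_nonneg hX1
          gcongr
      _ = C2 * ((3 * (X / Real.sqrt z ^ 2)) * X * (12001 * Real.sqrt z)) := by rw [hszs]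
      _ = _ := by rw [hζe]; field_simp; ring
  rw [abs_le]
  have e1 : (C1 + C2 * 36003) * Real.sqrt (1 / z) * X ^ 2 = C1 * Real.sqrt (1 / z) * X ^ 2 + C2 * 36003 * Real.sqrt (1 / z) * X ^ 2 := by ring
  have e2 : 0 ≤ C2 * 36003 * Real.sqrt (1 / z) * X ^ 2 := by positivity
  rw [e1]
  constructor
  · linarith [ht2.1]
  · linarith [ht1.2]

end
end
end Equi

namespace Equi
open scoped BigOperators
open MeasureTheory
noncomputable section
set_option linter.unusedSectionVars false
section
variable {d : ℤ}

lemma GX_mono (hd : 0 < d) {X Y : ℝ} (hX : 0 ≤ X) (h : X ≤ Y) : GX d X ⊆ GX d Y := by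
  intro q hq
  rw [mem_GX hd hX] at hq
  rw [mem_GX hd (hX.trans h)]
  exact ⟨hq.1, hq.2.trans (by gcongr)⟩

lemma core_all (hd : 0 < d) (hn : ¬ IsSquare d) {K : ℝ} (hK : 1 ≤ K) :
    ∃ C : ℝ, ∀ (φ : ℂ → ℝ) (x : ℂ) (t : ℝ), Tst K φ → Pt K x → 0 < t →
      |Real.exp (-t) * ∑ q ∈ GX d (Real.exp (t / 2)), φ (mq x q) - c0 d * hypI φ| ≤
        C * Real.exp (-(1 / 24000) * t) := by
  obtain ⟨C, z0, hC, hz0, h⟩ := core hd hn hK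
  have hc0 := c0_pos (d := d) hd
  set N : ℝ := ((GX d (z0 ^ 6000)).card : ℝ) with hN
  have hN0 : 0 ≤ N := Nat.cast_nonneg _
  set B : ℝ := (N * K + c0 d * (4 * K ^ 5)) * Real.sqrt z0 with hB
  have hB0 : 0 ≤ B := by positivity
  refine ⟨C + B, ?_⟩
  intro φ x t hφ hx ht
  obtain ⟨z, hz⟩ : ∃ z, z = Real.exp (t / 12000) := ⟨_, rfl⟩
  have hzp : 0 < z := by rw [hz]; exact Real.exp_pos _
  have hX : Real.exp (t / 2) = z ^ 6000 := by
    rw [hz, ← Real.exp_nat_mul]; congr 1; push_cast; ring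
  have hX2 : Real.exp (t / 2) ^ 2 = Real.exp t := by
    rw [← Real.exp_nat_mul]; congr 1; push_cast; ring
  have hs : Real.sqrt (1 / z) = Real.exp (-(1 / 24000) * t) := by
    rw [Real.sqrt_eq_iff_eq_sq (by positivity) (Real.exp_pos _).le, hz, ← Real.exp_nat_mul, one_div, ← Real.exp_neg]
    congr 1; push_cast; ring
  have hep := Real.exp_pos (-(1 / 24000) * t)
  have hee : Real.exp (-t) * Real.exp t = 1 := by rw [← Real.exp_add]; simp
  rcases le_or_gt z0 z with hzz | hzz
  · have h1 := h z _ x φ hφ hx hzz hX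
    rw [hs, hX2] at h1
    have h2 : Real.exp (-t) * ∑ q ∈ GX d (Real.exp (t / 2)), φ (mq x q) - c0 d * hypI φ =
        Real.exp (-t) * (∑ q ∈ GX d (Real.exp (t / 2)), φ (mq x q) - c0 d * hypI φ * Real.exp t) := by
      linear_combination (c0 d * hypI φ) * hee
    rw [h2, abs_mul, abs_of_pos (Real.exp_pos _)]
    calc _ ≤ Real.exp (-t) * (C * Real.exp (-(1 / 24000) * t) * Real.exp t) := by gcongr
      _ = C * Real.exp (-(1 / 24000) * t) * (Real.exp (-t) * Real.exp t) := by ring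
      _ = C * Real.exp (-(1 / 24000) * t) := by rw [hee, mul_one]
      _ ≤ _ := by gcongr; linarith
  · have hsum0 : 0 ≤ ∑ q ∈ GX d (Real.exp (t / 2)), φ (mq x q) := Finset.sum_nonneg fun q _ => hφ.nn _
    have hsum : ∑ q ∈ GX d (Real.exp (t / 2)), φ (mq x q) ≤ N * K := by
      calc _ ≤ ∑ q ∈ GX d (z0 ^ 6000), φ (mq x q) := by
            apply Finset.sum_le_sum_of_subset_of_nonneg
            · apply GX_mono hd (Real.exp_pos _).le
              rw [hX]
              exact pow_le_pow_left₀ hzp.le hzz.le _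
            · intro q _ _; exact hφ.nn _
        _ ≤ ∑ q ∈ GX d (z0 ^ 6000), K := Finset.sum_le_sum fun q _ => hφ.bd _
        _ = N * K := by rw [Finset.sum_const, nsmul_eq_mul]
    have he1 : Real.exp (-t) ≤ 1 := by rw [Real.exp_le_one_iff]; linarith
    have h1 : |Real.exp (-t) * ∑ q ∈ GX d (Real.exp (t / 2)), φ (mq x q)| ≤ N * K := by
      rw [abs_of_nonneg (mul_nonneg (Real.exp_pos _).le hsum0)]
      calc _ ≤ 1 * (N * K) := by gcongr
        _ = _ := one_mul _
    have h2 : |c0 d * hypI φ| ≤ c0 d * (4 * K ^ 5) := by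
      rw [abs_mul, abs_of_pos hc0]
      have := hypI_bd hφ hK
      gcongr
    have h3 : 1 ≤ Real.sqrt z0 * Real.exp (-(1 / 24000) * t) := by
      rw [← hs, ← Real.sqrt_mul (by linarith), Real.one_le_sqrt, mul_one_div, one_le_div hzp]
      exact hzz.le
    have h4 : 0 ≤ N * K + c0 d * (4 * K ^ 5) := by positivity
    calc _ ≤ N * K + c0 d * (4 * K ^ 5) := (abs_sub _ _).trans (add_le_add h1 h2)
      _ ≤ (N * K + c0 d * (4 * K ^ 5)) * (Real.sqrt z0 * Real.exp (-(1 / 24000) * t)) := le_mul_of_one_le_right h4 h3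
      _ = B * Real.exp (-(1 / 24000) * t) := by rw [hB]; ring
      _ ≤ _ := by gcongr; linarith

lemma toReal_e1 (hd : 0 ≤ d) (a : ℤ√d) : Zsqrtd.toReal hd a = e1 a := by
  unfold e1; simp [Zsqrtd.toReal]

lemma toReal_e2 (hd : 0 ≤ d) (a : ℤ√d) : Zsqrtd.toReal hd (star a) = e2 a := by
  unfold e2; simp [Zsqrtd.toReal]; ring

def qg (γ : Matrix.SpecialLinearGroup (Fin 2) (Zsqrtd d)) : Qd d :=
  ((γ 1 0, γ 1 1), (γ 0 0, γ 0 1))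

lemma frob_emb (hd : 0 ≤ d) (γ : Matrix.SpecialLinearGroup (Fin 2) (Zsqrtd d)) :
    frobSq (embMat d hd γ) = n1 (qg γ) := by
  unfold frobSq embMat n1 qg
  simp only [Fin.sum_univ_two, Matrix.map_apply, toReal_e1]
  ring

lemma frob_conj (hd : 0 ≤ d) (γ : Matrix.SpecialLinearGroup (Fin 2) (Zsqrtd d)) :
    frobSq (conjMat d hd γ) = n2 (qg γ) := by
  unfold frobSq conjMat n2 qg
  simp only [Fin.sum_univ_two, Matrix.map_apply, toReal_e2]
  ring

lemma moeb_emb (hd : 0 ≤ d) (γ : Matrix.SpecialLinearGroup (Fin 2) (Zsqrtd d)) (x : ℂ) :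
    moebius (embMat d hd γ) x = mq x (qg γ) := by
  unfold moebius embMat mq qg
  simp only [Matrix.map_apply, toReal_e1]

lemma dt_qg (γ : Matrix.SpecialLinearGroup (Fin 2) (Zsqrtd d)) : dt (qg γ) = 1 := by
  have := γ.2
  rw [Matrix.det_fin_two] at this
  unfold dt qg
  exact this

lemma qg_inj : Function.Injective (qg (d := d)) := by
  intro a b h
  unfold qg at h
  simp only [Prod.mk.injEq] at h
  apply Matrix.SpecialLinearGroup.ext
  intro i j
  fin_cases i <;> fin_cases j <;> tauto

lemma qg_surj (q : Qd d) (h : dt q = 1) : ∃ γ, qg γ = q := by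
  refine ⟨⟨!![q.2.1, q.2.2; q.1.1, q.1.2], ?_⟩, ?_⟩
  · rw [Matrix.det_fin_two_of]; exact h
  · unfold qg; rfl

lemma log_iff (hd : 0 < d) (γ : Matrix.SpecialLinearGroup (Fin 2) (Zsqrtd d)) (t : ℝ) :
    Real.log (frobSq (embMat d hd.le γ) + frobSq (conjMat d hd.le γ)) ≤ t ↔
      qg γ ∈ GX d (Real.exp (t / 2)) := by
  have hp : 0 < n1 (qg γ) := by
    have := det1 hd (dt_qg γ)
    unfold n1
    by_contra! hh
    nlinarith [sq_nonneg (e1 (qg γ).2.1 - e1 (qg γ).1.2), sq_nonneg (e1 (qg γ).2.2 + e1 (qg γ).1.1)]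
  rw [frob_emb, frob_conj, mem_GX hd (Real.exp_pos _).le, Real.log_le_iff_le_exp (by linarith [n2_nonneg (qg γ)])]
  have hX2 : Real.exp (t / 2) ^ 2 = Real.exp t := by
    rw [← Real.exp_nat_mul]; congr 1; push_cast; ring
  rw [hX2]
  exact ⟨fun h => ⟨dt_qg γ, h⟩, fun h => h.2⟩

lemma tsum_conv (hd : 0 < d) (φ : ℂ → ℝ) (x : ℂ) (t : ℝ) :
    (∑' γ : {γ : Matrix.SpecialLinearGroup (Fin 2) (Zsqrtd d) //
        Real.log (frobSq (embMat d hd.le γ) + frobSq (conjMat d hd.le γ)) ≤ t},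
      φ (moebius (embMat d hd.le (γ : Matrix.SpecialLinearGroup (Fin 2) (Zsqrtd d))) x)) =
    ∑ q ∈ GX d (Real.exp (t / 2)), φ (mq x q) := by
  let F : {γ : Matrix.SpecialLinearGroup (Fin 2) (Zsqrtd d) //
        Real.log (frobSq (embMat d hd.le γ) + frobSq (conjMat d hd.le γ)) ≤ t} →
      {q // q ∈ GX d (Real.exp (t / 2))} := fun γ => ⟨qg γ.1, (log_iff hd γ.1 t).1 γ.2⟩
  have hF : Function.Bijective F := by
    constructor
    · intro a b h
      exact Subtype.ext (qg_inj (congrArg Subtype.val h))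
    · rintro ⟨q, hq⟩
      obtain ⟨γ, hγ⟩ := qg_surj q ((mem_GX hd (Real.exp_pos _).le).1 hq).1
      exact ⟨⟨γ, (log_iff hd γ t).2 (hγ ▸ hq)⟩, Subtype.ext hγ⟩
  rw [← Finset.tsum_subtype (GX d (Real.exp (t / 2))) (fun q => φ (mq x q)), ← (Equiv.ofBijective F hF).tsum_eq]
  apply tsum_congr
  intro γ
  rw [moeb_emb]
  rfl

lemma int_conv (φ : ℂ → ℝ) :
    ∫ z, φ z ∂hypMeasure = ∫ w in {w : ℂ | 0 < w.im}, (1 / w.im ^ 2) * φ w := by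
  unfold hypMeasure
  have hS : MeasurableSet {z : ℂ | 0 < z.im} := measurableSet_lt measurable_const Complex.measurable_im
  rw [restrict_withDensity hS, integral_withDensity_eq_integral_toReal_smul]
  · apply integral_congr_ae
    filter_upwards with w
    rw [ENNReal.toReal_ofReal (by positivity), smul_eq_mul]
  · exact ENNReal.measurable_ofReal.comp (by
      have := Complex.measurable_im
      fun_prop)
  · filter_upwards with w
    exact ENNReal.ofReal_lt_top

lemma int_diff {K : ℝ} (hK : 1 ≤ K) {φ f g : ℂ → ℝ} (hf : Tst K f) (hg : Tst K g) (h : ∀ p, φ p = f p - g p) :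
    ∫ z, φ z ∂hypMeasure = hypI f - hypI g := by
  rw [int_conv, ← hypI_eq hf hK, ← hypI_eq hg hK, ← integral_sub (hyp_int hf hK).integrableOn (hyp_int hg hK).integrableOn]
  congr 1
  ext w
  rw [h]; ring

lemma tst_of {K : ℝ} {φ : ℂ → ℝ} (hK : 1 ≤ K) (bd : ∀ p, |φ p| ≤ K) (lip : ∀ p q, |φ p - φ q| ≤ K * ‖p - q‖)
    (supp : ∀ p, φ p ≠ 0 → 1 / K ≤ p.im ∧ ‖p‖ ≤ K) : Tst K (fun p => max (φ p) 0) where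
  nn p := le_max_right _ _
  bd p := max_le ((le_abs_self _).trans (bd p)) (by linarith)
  lip p q := (abs_max_sub_max_le_abs _ _ _).trans (lip p q)
  supp p h := supp p (fun h0 => h (by simp [h0]))

lemma exists_K {D : Set ℂ} (hD : D ⊆ {z : ℂ | 0 < z.im}) (hc : IsCompact D) {φ : ℂ → ℝ}
    (hφ : ContDiff ℝ 1 φ) (hs : tsupport φ ⊆ D) :
    ∃ K : ℝ, 1 ≤ K ∧ (∀ p, |φ p| ≤ K) ∧ (∀ p q, |φ p - φ q| ≤ K * ‖p - q‖) ∧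
      (∀ p ∈ D, 1 / K ≤ p.im ∧ ‖p‖ ≤ K) := by
  have hcs : HasCompactSupport φ := hc.of_isClosed_subset (isClosed_tsupport φ) hs
  obtain ⟨L, hL⟩ := hφ.lipschitzWith_of_hasCompactSupport hcs (by simp)
  obtain ⟨M, hM⟩ := hφ.continuous.bounded_above_of_compact_support hcs
  obtain ⟨R, hR⟩ := hc.isBounded.exists_norm_le
  obtain ⟨m, hm, hmD⟩ : ∃ m : ℝ, 0 < m ∧ ∀ p ∈ D, m ≤ p.im := by
    rcases D.eq_empty_or_nonempty with h | h
    · exact ⟨1, one_pos, by simp [h]⟩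
    · obtain ⟨p, hp, hpm⟩ := hc.exists_isMinOn h Complex.continuous_im.continuousOn
      exact ⟨p.im, hD hp, fun q hq => hpm hq⟩
  have hL0 : (0 : ℝ) ≤ L := L.2
  refine ⟨1 + |R| + |M| + L + 1 / m, ?_, ?_, ?_, ?_⟩
  · have : 0 < 1 / m := by positivity
    linarith [abs_nonneg R, abs_nonneg M]
  · intro p
    have : 0 < 1 / m := by positivity
    have h1 := hM p
    rw [Real.norm_eq_abs] at h1
    linarith [abs_nonneg R, le_abs_self M]
  · intro p q
    have h1 := hL.dist_le_mul p q
    rw [Real.dist_eq, dist_eq_norm] at h1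
    refine h1.trans ?_
    have : 0 < 1 / m := by positivity
    gcongr
    linarith [abs_nonneg R, abs_nonneg M]
  · intro p hp
    have : 0 < 1 / m := by positivity
    constructor
    · refine le_trans ?_ (hmD p hp)
      rw [one_div_le (by linarith [abs_nonneg R, abs_nonneg M]) hm]
      linarith [abs_nonneg R, abs_nonneg M]
    · linarith [hR p hp, le_abs_self R, abs_nonneg M]

end
end
end Equi

/-- **Quantitative equidistribution of every orbit of SL₂(ℤ[√d]) on the hyperbolic
plane.**  Let d > 0 be a non-square integer and Γ = SL₂(ℤ[√d]), acting on
ℍ = {z ∈ ℂ : Im z > 0} by Möbius transformations through the real embedding, with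
Γ_t = {γ ∈ Γ : log(‖γ‖² + ‖γ̄‖²) ≤ t}.  Then there are δ > 0 and c > 0 such that for
every compact D ⊂ ℍ and every C¹ function φ with support in D there is a constant
C = C(D,φ) with, for every x ∈ D and all t > 0:
| e^{−t} Σ_{γ∈Γ_t} φ(γ·x) − c ∫_ℍ φ dν | ≤ C e^{−δt} ,
where ν is the hyperbolic measure dν = (Im z)^{−2} dz. -/
theorem equidistribution_SL2_Zsqrtd
    (d : ℤ) (hd : 0 < d) (hnsq : ¬ IsSquare d) :
    ∃ δ : ℝ, 0 < δ ∧ ∃ c : ℝ, 0 < c ∧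
      ∀ D : Set ℂ, D ⊆ {z : ℂ | 0 < z.im} → IsCompact D →
        ∀ φ : ℂ → ℝ, ContDiff ℝ 1 φ → tsupport φ ⊆ D →
          ∃ C : ℝ, ∀ x ∈ D, ∀ t : ℝ, 0 < t →
            |Real.exp (-t) *
                (∑' γ : {γ : Matrix.SpecialLinearGroup (Fin 2) (Zsqrtd d) //
                    Real.log (frobSq (embMat d hd.le γ) + frobSq (conjMat d hd.le γ)) ≤ t},
                  φ (moebius (embMat d hd.le (γ : Matrix.SpecialLinearGroup (Fin 2) (Zsqrtd d))) x))
              - c * ∫ z, φ z ∂hypMeasure|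
            ≤ C * Real.exp (-δ * t) := by
  refine ⟨1 / 24000, by norm_num, Equi.c0 d, Equi.c0_pos hd, ?_⟩
  intro D hD hc φ hφ hs
  obtain ⟨K, hK, hbd, hlip, hKD⟩ := Equi.exists_K hD hc hφ hs
  obtain ⟨C, hC⟩ := Equi.core_all hd hnsq hK
  have hsupp : ∀ p, φ p ≠ 0 → 1 / K ≤ p.im ∧ ‖p‖ ≤ K := fun p hp => hKD p (hs (subset_tsupport φ hp))
  have hf : Equi.Tst K (fun p => max (φ p) 0) := Equi.tst_of hK hbd hlip hsupp
  have hg : Equi.Tst K (fun p => max (-φ p) 0) := Equi.tst_of (φ := fun p => -φ p) hK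
    (fun p => by rw [abs_neg]; exact hbd p)
    (fun p q => by rw [neg_sub_neg, abs_sub_comm]; exact hlip p q)
    (fun p hp => hsupp p (fun h => hp (by simp [h])))
  have hfg : ∀ p, φ p = max (φ p) 0 - max (-φ p) 0 := fun p => by
    rcases le_total 0 (φ p) with h | h
    · rw [max_eq_left h, max_eq_right (by linarith)]; ring
    · rw [max_eq_right h, max_eq_left (by linarith)]; ring
  refine ⟨2 * C, ?_⟩
  intro x hx t ht
  have hPt : Equi.Pt K x := ⟨(hKD x hx).1, (hKD x hx).2⟩
  have h1 := abs_le.1 (hC _ x t hf hPt ht)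
  have h2 := abs_le.1 (hC _ x t hg hPt ht)
  have hsum : ∑ q ∈ Equi.GX d (Real.exp (t / 2)), φ (Equi.mq x q) =
      ∑ q ∈ Equi.GX d (Real.exp (t / 2)), max (φ (Equi.mq x q)) 0 -
        ∑ q ∈ Equi.GX d (Real.exp (t / 2)), max (-φ (Equi.mq x q)) 0 := by
    rw [← Finset.sum_sub_distrib]
    exact Finset.sum_congr rfl fun q _ => hfg _
  rw [Equi.tsum_conv hd, Equi.int_diff hK hf hg hfg, hsum, mul_sub, mul_sub, abs_le]
  constructor <;> linarith [h1.1, h1.2, h2.1, h2.2]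

end
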